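/- Let n ≥ 1 be an integer, p := 2/(1−m) − n > 2, and let Λ ∈ [−(p/2+1)², −2p] satisfy −4p < Λ. Suppose ρ is a solution of the fast diffusion equation, B > 0 is such that lim_{τ→∞} sup_{y∈ℝⁿ} |ρ(τ,y)/ρ_B(τ,y) − 1| = 0, and y ↦ |y|·ρ(0,y) is integrable with ∫_{ℝⁿ} y·ρ(0,y) dy = 0. Then for each pair (ℓ,k) ∈ ℕ² with Λ < λ_{ℓk} < 0 (and ℓ ≤ 1 if n = 1) there exists a polynomial u_{ℓk} : ℝⁿ → ℝ, either identically zero or of degree ℓ+2k, such that the function x ↦ u_{ℓk}(x)/(B+|x|²) satisfies L(u_{ℓk}/(B+|·|²)) = λ_{ℓk} · u_{ℓk}/(B+|·|²) pointwise on ℝⁿ, and such that limsup_{τ→∞} sup_{y∈ℝⁿ} | [ (ρ_B(τ,0)/ρ_B(τ,y))^{2/(p+n)} · (ρ(τ,y)/ρ_B(τ,y) − 1) − Σ_{(ℓ,k): Λ < λ_{ℓk} < 0} u_{ℓk}((1+2pτ)^{−β} y) · (1+2pτ)^{λ_{ℓk}/(2p)} / B ] / [ (ρ_B(τ,0)/ρ_B(τ,y))^{(p+2−√((p+2)²+4Λ))/(2p+2n)}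 · τ^{Λ/(2p)} ] | < ∞. -/

import Mathlib

open MeasureTheory Filter
open scoped BigOperators ENNReal Topology

noncomputable section

/-- The `i`-th standard basis vector of `ℝⁿ`. -/
def stdBasis (n : ℕ) (i : Fin n) : EuclideanSpace ℝ (Fin n) :=
  EuclideanSpace.single i 1

/-- The Laplacian (sum of second partial derivatives) of `f : ℝⁿ → ℝ`. -/
def lap (n : ℕ) (f : EuclideanSpace ℝ (Fin n) → ℝ) (x : EuclideanSpace ℝ (Fin n)) : ℝ :=
  ∑ i : Fin n, fderiv ℝ (fun y => fderiv ℝ f y (stdBasis n i)) x (stdBasis n i)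

/-- `x · ∇f x`. -/
def gradDot (n : ℕ) (f : EuclideanSpace ℝ (Fin n) → ℝ) (x : EuclideanSpace ℝ (Fin n)) : ℝ :=
  ∑ i : Fin n, x i * fderiv ℝ f x (stdBasis n i)

/-- The moment parameter `p = 2/(1-m) - n`. -/
def pPar (n : ℕ) (m : ℝ) : ℝ := 2 / (1 - m) - n

/-- The scaling exponent `β = (1 + n/p)/2`. -/
def betaPar (n : ℕ) (m : ℝ) : ℝ := (1 + n / pPar n m) / 2

/-- The Barenblatt profile `u_B(x) = (B + |x|²)^{-1/(1-m)}`. -/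
def uB (n : ℕ) (m B : ℝ) (x : EuclideanSpace ℝ (Fin n)) : ℝ :=
  (B + ‖x‖ ^ 2) ^ (-(1 / (1 - m)))

/-- The Barenblatt solution `ρ_B(τ,y) = (1+2pτ)^{-nβ} u_B((1+2pτ)^{-β} y)`. -/
def rhoB (n : ℕ) (m B : ℝ) (τ : ℝ) (y : EuclideanSpace ℝ (Fin n)) : ℝ :=
  (1 + 2 * pPar n m * τ) ^ (-(n : ℝ) * betaPar n m) *
    uB n m B ((1 + 2 * pPar n m * τ) ^ (-betaPar n m) • y)

/-- A (positive, continuous up to time 0, smooth for positive times) solution of the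
fast diffusion equation `∂_τ ρ = (1/m) Δ (ρ^m)` on `[0,∞) × ℝⁿ`. -/
def IsFDESol (n : ℕ) (m : ℝ) (ρ : ℝ → EuclideanSpace ℝ (Fin n) → ℝ) : Prop :=
  (∀ τ ∈ Set.Ici (0 : ℝ), ∀ y, 0 < ρ τ y) ∧
  ContinuousOn (fun q : ℝ × EuclideanSpace ℝ (Fin n) => ρ q.1 q.2)
    (Set.Ici 0 ×ˢ Set.univ) ∧
  ContDiffOn ℝ (⊤ : ℕ∞) (fun q : ℝ × EuclideanSpace ℝ (Fin n) => ρ q.1 q.2)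
    (Set.Ioi 0 ×ˢ Set.univ) ∧
  ∀ τ ∈ Set.Ioi (0 : ℝ), ∀ y,
    deriv (fun s => ρ s y) τ = (1 / m) * lap n (fun x => ρ τ x ^ m) y

/-- The eigenvalues `λ_{ℓk} = -((ℓ+2k)p + nℓ + 4k(1-ℓ-k))`. -/
def lamEig (n : ℕ) (p : ℝ) (ℓ k : ℕ) : ℝ :=
  -(((ℓ : ℝ) + 2 * (k : ℝ)) * p + (n : ℝ) * (ℓ : ℝ) + 4 * (k : ℝ) * (1 - (ℓ : ℝ) - (k : ℝ)))

/-- The linearized operator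
`(Lv)(x) = (B+|x|²)Δv + (2(1-2m)/(1-m)) x·∇v + 2(n - (2/(1-m))|x|²/(B+|x|²)) v`. -/
def Lop (n : ℕ) (m B : ℝ) (v : EuclideanSpace ℝ (Fin n) → ℝ)
    (x : EuclideanSpace ℝ (Fin n)) : ℝ :=
  (B + ‖x‖ ^ 2) * lap n v x + (2 * (1 - 2 * m) / (1 - m)) * gradDot n v x +
    2 * ((n : ℝ) - (2 / (1 - m)) * ‖x‖ ^ 2 / (B + ‖x‖ ^ 2)) * v x

/-- Evaluation of a multivariate polynomial as a function on `ℝⁿ`. -/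
def evalPoly (n : ℕ) (P : MvPolynomial (Fin n) ℝ) (x : EuclideanSpace ℝ (Fin n)) : ℝ :=
  MvPolynomial.eval (fun i => x i) P

namespace FastDiffusion

/-- The space `ℝⁿ` with its Euclidean norm. -/
abbrev Eu (n : ℕ) := EuclideanSpace ℝ (Fin n)

/-- The algebra of smooth real functions on space-time `ℝ × ℝⁿ`. -/
def SF (n : ℕ) : Subalgebra ℝ (ℝ × Eu n → ℝ) where
  carrier := {f | ContDiff ℝ (⊤ : ℕ∞) f}
  mul_mem' := fun {f g} (hf : ContDiff ℝ _ f) (hg : ContDiff ℝ _ g) => show ContDiff ℝ (⊤ : ℕ∞) (f * g) from hf.mul hg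
  add_mem' := fun {f g} (hf : ContDiff ℝ _ f) (hg : ContDiff ℝ _ g) => show ContDiff ℝ (⊤ : ℕ∞) (f + g) from hf.add hg
  algebraMap_mem' := fun c => (contDiff_const : ContDiff ℝ (⊤ : ℕ∞) fun _ => c)

variable {n : ℕ}

/-- Evaluation of an element of `SF n`. -/
def evSF (f : SF n) (t : ℝ) (x : Eu n) : ℝ := f.1 (t, x)

instance : CoeFun (SF n) (fun _ => ℝ → Eu n → ℝ) := ⟨evSF⟩

lemma contDiffSF (f : SF n) : ContDiff ℝ (⊤ : ℕ∞) f.1 := f.2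

lemma differentiableSF (f : SF n) : Differentiable ℝ f.1 := (contDiffSF f).differentiable (by simp)

lemma continuousSF (f : SF n) : Continuous f.1 := (contDiffSF f).continuous

lemma continuous_evSF (f : SF n) : Continuous (fun z : ℝ × Eu n => f z.1 z.2) := continuousSF f

@[simp] lemma add_ev (f g : SF n) (t : ℝ) (x : Eu n) : (f + g) t x = f t x + g t x := rfl
@[simp] lemma sub_ev (f g : SF n) (t : ℝ) (x : Eu n) : (f - g) t x = f t x - g t x := rfl
@[simp] lemma neg_ev (f : SF n) (t : ℝ) (x : Eu n) : (-f) t x = -f t x := rfl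
@[simp] lemma mul_ev (f g : SF n) (t : ℝ) (x : Eu n) : (f * g) t x = f t x * g t x := rfl
@[simp] lemma pow_ev (f : SF n) (k : ℕ) (t : ℝ) (x : Eu n) : (f ^ k) t x = f t x ^ k := rfl
@[simp] lemma smul_ev (c : ℝ) (f : SF n) (t : ℝ) (x : Eu n) : (c • f) t x = c * f t x := rfl
@[simp] lemma zero_ev (t : ℝ) (x : Eu n) : (0 : SF n) t x = 0 := rfl
@[simp] lemma one_ev (t : ℝ) (x : Eu n) : (1 : SF n) t x = 1 := rfl
@[simp] lemma algebraMap_ev (c : ℝ) (t : ℝ) (x : Eu n) : (algebraMap ℝ (SF n) c) t x = c := rfl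
@[simp] lemma natCast_ev (k : ℕ) (t : ℝ) (x : Eu n) : ((k : ℕ) : SF n) t x = k := rfl
@[simp] lemma two_ev (t : ℝ) (x : Eu n) : (2 : SF n) t x = 2 := rfl
@[simp] lemma sum_ev {ι : Type*} (s : Finset ι) (f : ι → SF n) (t : ℝ) (x : Eu n) :
    (∑ i ∈ s, f i) t x = ∑ i ∈ s, f i t x := by
  classical
  induction s using Finset.induction_on with
  | empty => simp
  | insert a s ha ih => simp [Finset.sum_insert ha, ih]

lemma SF_ext {f g : SF n} (h : ∀ t x, f t x = g t x) : f = g :=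
  Subtype.ext (funext fun z => h z.1 z.2)

/-- The derivation of `SF n` in a fixed direction. -/
def pd (v : ℝ × Eu n) : Derivation ℝ (SF n) (SF n) :=
  Derivation.mk'
    { toFun := fun f => ⟨fun z => fderiv ℝ f.1 z v,
        ((contDiffSF f).fderiv_right (m := (⊤ : ℕ∞)) (by simp)).clm_apply contDiff_const⟩
      map_add' := fun f g => by
        refine SF_ext fun t x => ?_
        change fderiv ℝ (f.1 + g.1) (t, x) v = _
        rw [fderiv_add (differentiableSF f _) (differentiableSF g _)]; rfl
      map_smul' := fun c f => by
        refine SF_ext fun t x => ?_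
        change fderiv ℝ (c • f.1) (t, x) v = _
        rw [fderiv_const_smul (differentiableSF f _)]; rfl }
    (fun f g => by
        refine SF_ext fun t x => ?_
        change fderiv ℝ (f.1 * g.1) (t, x) v = _
        rw [fderiv_mul (differentiableSF f _) (differentiableSF g _)]
        rfl)

lemma pd_ev (v : ℝ × Eu n) (f : SF n) (t : ℝ) (x : Eu n) : pd v f t x = fderiv ℝ f.1 (t, x) v := rfl

lemma pd_comm (v w : ℝ × Eu n) (f : SF n) : pd v (pd w f) = pd w (pd v f) := by
  refine SF_ext fun t x => ?_
  have h2 : ContDiff ℝ 1 (fderiv ℝ f.1) := (contDiffSF f).fderiv_right (m := 1) (by norm_cast)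
  have hd : DifferentiableAt ℝ (fderiv ℝ f.1) (t, x) := h2.differentiable (by simp) _
  have key : ∀ u u' : ℝ × Eu n, pd u (pd u' f) t x = fderiv ℝ (fderiv ℝ f.1) (t, x) u u' := by
    intro u u'
    change fderiv ℝ (fun z => fderiv ℝ f.1 z u') (t, x) u = _
    rw [fderiv_clm_apply hd (differentiableAt_const _)]
    simp
  rw [key, key]
  have := ((contDiffSF f).contDiffAt (x := (t, x))).isSymmSndFDerivAt
    (by simp only [minSmoothness_of_isRCLikeNormedField]; norm_cast)
  exact this v w

/-- The time derivative. -/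
def dt : Derivation ℝ (SF n) (SF n) := pd (1, 0)

/-- The spatial partial derivatives. -/
def dx (a : Fin n) : Derivation ℝ (SF n) (SF n) := pd (0, stdBasis n a)

lemma dx_comm (a b : Fin n) (f : SF n) : dx a (dx b f) = dx b (dx a f) := pd_comm _ _ _
lemma dt_dx (a : Fin n) (f : SF n) : dt (dx a f) = dx a (dt f) := pd_comm _ _ _

/-- The spatial Laplacian. -/
def lapl : SF n →ₗ[ℝ] SF n := ∑ a : Fin n, (dx a).toLinearMap ∘ₗ (dx a).toLinearMap

lemma lapl_eq (f : SF n) : lapl f = ∑ a, dx a (dx a f) := by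
  simp [lapl, LinearMap.sum_apply]

lemma dx_lapl (a : Fin n) (f : SF n) : dx a (lapl f) = lapl (dx a f) := by
  simp only [lapl_eq, map_sum]
  exact Finset.sum_congr rfl fun b _ => by rw [dx_comm a b, dx_comm a b]

lemma dt_lapl (f : SF n) : dt (lapl f) = lapl (dt f) := by
  simp only [lapl_eq, map_sum]
  exact Finset.sum_congr rfl fun b _ => by rw [dt_dx, dt_dx]

/-- Iterated spatial derivatives along a list of directions. -/
def D (J : List (Fin n)) : SF n →ₗ[ℝ] SF n :=
  J.foldr (fun a T => (dx a).toLinearMap ∘ₗ T) LinearMap.id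

@[simp] lemma D_nil (f : SF n) : D [] f = f := rfl
@[simp] lemma D_cons (a : Fin n) (J : List (Fin n)) (f : SF n) : D (a :: J) f = dx a (D J f) := rfl

lemma D_dx (a : Fin n) (J : List (Fin n)) (f : SF n) : D J (dx a f) = dx a (D J f) := by
  induction J with
  | nil => rfl
  | cons b J ih => rw [D_cons, D_cons, ih, dx_comm]

lemma D_dt (J : List (Fin n)) (f : SF n) : D J (dt f) = dt (D J f) := by
  induction J with
  | nil => rfl
  | cons b J ih => rw [D_cons, D_cons, ih, dt_dx]

lemma D_append (I J : List (Fin n)) (f : SF n) : D (I ++ J) f = D I (D J f) := by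
  induction I with
  | nil => rfl
  | cons b I ih => rw [List.cons_append, D_cons, D_cons, ih]

lemma D_lapl (J : List (Fin n)) (f : SF n) : D J (lapl f) = lapl (D J f) := by
  induction J with
  | nil => rfl
  | cons b J ih => rw [D_cons, D_cons, ih, dx_lapl]

/-- Smooth functions of space only. -/
def ofSpace (g : Eu n → ℝ) (hg : ContDiff ℝ (⊤ : ℕ∞) g) : SF n :=
  ⟨fun z => g z.2, hg.comp contDiff_snd⟩

/-- Smooth functions of time only. -/
def ofTime (g : ℝ → ℝ) (hg : ContDiff ℝ (⊤ : ℕ∞) g) : SF n :=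
  ⟨fun z => g z.1, hg.comp contDiff_fst⟩

@[simp] lemma ofSpace_ev (g : Eu n → ℝ) (hg) (t : ℝ) (x : Eu n) : ofSpace g hg t x = g x := rfl
@[simp] lemma ofTime_ev (g : ℝ → ℝ) (hg) (t : ℝ) (x : Eu n) : ofTime g hg t x = g t := rfl

lemma hasFDerivAt_pair (f : SF n) (t : ℝ) (x : Eu n) :
    HasFDerivAt f.1 (fderiv ℝ f.1 (t, x)) (t, x) := (differentiableSF f _).hasFDerivAt

lemma hasDerivAt_dt (f : SF n) (t : ℝ) (x : Eu n) :
    HasDerivAt (fun s => f s x) (dt f t x) t := by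
  have h1 : HasDerivAt (fun s : ℝ => (s, x)) ((1 : ℝ), (0 : Eu n)) t :=
    (hasDerivAt_id t).prodMk (hasDerivAt_const t x)
  exact (hasFDerivAt_pair f t x).comp_hasDerivAt t h1

lemma hasFDerivAt_space (f : SF n) (t : ℝ) (x : Eu n) :
    HasFDerivAt (fun y => f t y)
      ((fderiv ℝ f.1 (t, x)).comp (ContinuousLinearMap.inr ℝ ℝ (Eu n))) x := by
  have h1 : HasFDerivAt (fun y : Eu n => (t, y)) (ContinuousLinearMap.inr ℝ ℝ (Eu n)) x :=
    hasFDerivAt_prodMk_right t x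
  exact (hasFDerivAt_pair f t x).comp x h1

lemma fderiv_space (f : SF n) (t : ℝ) (x : Eu n) (a : Fin n) :
    fderiv ℝ (fun y => f t y) x (stdBasis n a) = dx a f t x := by
  rw [(hasFDerivAt_space f t x).fderiv]
  simp [dx, pd_ev]

lemma eu_sum (v : Eu n) : v = ∑ a, v a • stdBasis n a := by
  ext i
  simp [stdBasis, Finset.sum_apply, Pi.single_apply]

lemma fderiv_space_apply (f : SF n) (t : ℝ) (x v : Eu n) :
    fderiv ℝ (fun y => f t y) x v = ∑ a, v a * dx a f t x := by
  conv_lhs => rw [eu_sum v]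
  simp only [map_sum, map_smul, fderiv_space, smul_eq_mul]

lemma differentiable_space (f : SF n) (t : ℝ) : Differentiable ℝ (fun y => f t y) :=
  fun x => (hasFDerivAt_space f t x).differentiableAt

lemma contDiff_space (f : SF n) (t : ℝ) : ContDiff ℝ (⊤ : ℕ∞) (fun y => f t y) :=
  (contDiffSF f).comp (contDiff_const.prodMk contDiff_id)

lemma continuous_space (f : SF n) (t : ℝ) : Continuous (fun y => f t y) :=
  (contDiff_space f t).continuous

lemma hasDerivAt_line (f : SF n) (t : ℝ) (x v : Eu n) (s : ℝ) :
    HasDerivAt (fun s : ℝ => f t (x + s • v)) (∑ a, v a * dx a f t (x + s • v)) s := by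
  have h1 : HasDerivAt (fun s : ℝ => x + s • v) v s := by
    simpa using ((hasDerivAt_id s).smul_const v).const_add x
  rw [← fderiv_space_apply]
  exact (differentiable_space f t _).hasFDerivAt.comp_hasDerivAt s h1

lemma hasDerivAt_dx (f : SF n) (t : ℝ) (x : Eu n) (a : Fin n) (s : ℝ) :
    HasDerivAt (fun s : ℝ => f t (x + s • stdBasis n a)) (dx a f t (x + s • stdBasis n a)) s := by
  convert hasDerivAt_line f t x (stdBasis n a) s using 1
  simp [stdBasis]

@[simp] lemma dx_ofTime (g : ℝ → ℝ) (hg) (a : Fin n) : dx a (ofTime g hg) = 0 := by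
  refine SF_ext fun t x => ?_
  have := hasDerivAt_dx (ofTime g hg) t x a 0
  simp only [ofTime_ev] at this
  simpa using (this.unique (hasDerivAt_const _ _))

@[simp] lemma dt_ofSpace (g : Eu n → ℝ) (hg) : dt (ofSpace g hg) = 0 := by
  refine SF_ext fun t x => ?_
  have := hasDerivAt_dt (ofSpace g hg) t x
  simp only [ofSpace_ev] at this
  simpa using (this.unique (hasDerivAt_const _ _))

/-- The coordinate functions. -/
def X (a : Fin n) : SF n := ofSpace (fun x => x a) (by fun_prop)

@[simp] lemma X_ev (a : Fin n) (t : ℝ) (x : Eu n) : X a t x = x a := rfl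

@[simp] lemma dt_X (a : Fin n) : dt (X a) = 0 := dt_ofSpace _ _

lemma dx_X (a b : Fin n) : dx a (X b) = if a = b then 1 else 0 := by
  refine SF_ext fun t x => ?_
  have h := hasDerivAt_dx (X b) t x a 0
  have h2 : HasDerivAt (fun s : ℝ => x b + s * (if a = b then (1 : ℝ) else 0))
      (if a = b then (1 : ℝ) else 0) 0 := by
    simpa using ((hasDerivAt_id (0 : ℝ)).mul_const (if a = b then (1 : ℝ) else 0)).const_add (x b)
  have e : (fun s : ℝ => (X b) t (x + s • stdBasis n a)) =
      fun s : ℝ => x b + s * (if a = b then (1 : ℝ) else 0) := by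
    funext s
    simp [stdBasis, eq_comm]
  rw [e] at h
  have := h.unique h2
  simp only [zero_smul, add_zero] at this
  rw [this]; split_ifs <;> simp

/-- The exponential `e^{μ t}`. -/
def expT (μ : ℝ) : SF n := ofTime (fun t => Real.exp (μ * t)) (by fun_prop)

@[simp] lemma expT_ev (μ : ℝ) (t : ℝ) (x : Eu n) : (expT μ : SF n) t x = Real.exp (μ * t) := rfl
@[simp] lemma dx_expT (μ : ℝ) (a : Fin n) : dx a (expT μ) = 0 := dx_ofTime _ _ _
lemma dt_expT (μ : ℝ) : dt (expT μ : SF n) = μ • expT μ := by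
  refine SF_ext fun t x => ?_
  have h := hasDerivAt_dt (expT μ : SF n) t x
  have h2 : HasDerivAt (fun s : ℝ => Real.exp (μ * s)) (Real.exp (μ * t) * (μ * 1)) t :=
    ((hasDerivAt_id t).const_mul μ).exp
  simpa [mul_comm] using h.unique h2

/-- The weight `B + |x|²`. -/
def om (n : ℕ) (B : ℝ) : SF n := algebraMap ℝ (SF n) B + ∑ a, X a ^ 2

lemma om_ev (B t : ℝ) (x : Eu n) : om n B t x = B + ‖x‖ ^ 2 := by
  simp [om, EuclideanSpace.norm_sq_eq]

@[simp] lemma dt_om (B : ℝ) : dt (om n B) = 0 := by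
  simp [om, Derivation.leibniz_pow]

lemma dx_om (B : ℝ) (a : Fin n) : dx a (om n B) = (2 : ℝ) • X a := by
  simp [om, Derivation.leibniz_pow, dx_X, two_smul]

/-- Real powers of the weight. -/
def omPow (n : ℕ) {B : ℝ} (hB : 0 < B) (s : ℝ) : SF n :=
  ofSpace (fun x => (B + ‖x‖ ^ 2) ^ s) (by
    have h : ∀ x : Eu n, B + ‖x‖ ^ 2 ≠ 0 := fun x => by positivity
    exact (contDiff_const.add (contDiff_norm_sq ℝ)).rpow_const_of_ne h)

@[simp] lemma omPow_ev {B : ℝ} (hB : 0 < B) (s t : ℝ) (x : Eu n) :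
    omPow n hB s t x = (B + ‖x‖ ^ 2) ^ s := rfl

@[simp] lemma dt_omPow {B : ℝ} (hB : 0 < B) (s : ℝ) : dt (omPow n hB s) = 0 := dt_ofSpace _ _

lemma dx_omPow {B : ℝ} (hB : 0 < B) (s : ℝ) (a : Fin n) :
    dx a (omPow n hB s) = (2 * s) • (X a * omPow n hB (s - 1)) := by
  refine SF_ext fun t x => ?_
  have h := hasDerivAt_dx (omPow n hB s) t x a 0
  have h1 := hasDerivAt_dx (om n B) t x a 0
  have hpos : om n B t (x + (0 : ℝ) • stdBasis n a) ≠ 0 := by rw [om_ev]; positivity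
  have h2 := h1.rpow_const (p := s) (Or.inl hpos)
  simp only [om_ev, omPow_ev] at h h2
  have := h.unique h2
  simp only [zero_smul, add_zero, dx_om] at this
  rw [this]
  simp
  ring

lemma om_mul_omPow {B : ℝ} (hB : 0 < B) (s : ℝ) : om n B * omPow n hB s = omPow n hB (s + 1) := by
  refine SF_ext fun t x => ?_
  have hpos : 0 < B + ‖x‖ ^ 2 := by positivity
  rw [mul_ev, om_ev, omPow_ev, omPow_ev, Real.rpow_add_one hpos.ne']
  ring

/-- The operator `f ↦ ω Δf - c x·∇f + l f`. -/
def Op (n : ℕ) (B c l : ℝ) (f : SF n) : SF n :=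
  om n B * lapl f - c • ∑ a, X a * dx a f + l • f

lemma dx_Op (B c l : ℝ) (f : SF n) (a : Fin n) :
    dx a (Op n B c l f) = Op n B c (l - c) (dx a f) + (2 : ℝ) • (X a * lapl f) := by
  simp only [Op, map_add, map_sub, Derivation.leibniz, dx_om, Derivation.map_smul, map_sum, dx_X,
    dx_lapl, smul_eq_mul]
  have : ∀ b, X b * dx a (dx b f) = X b * dx b (dx a f) := fun b => by rw [dx_comm]
  simp only [this, Finset.sum_add_distrib, mul_ite, mul_one, mul_zero, Finset.sum_ite_eq,
    Finset.mem_univ, if_true, smul_add, sub_smul, two_smul]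
  ring

lemma lapl_mul (f g : SF n) :
    lapl (f * g) = f * lapl g + (2 : ℝ) • ∑ a, dx a f * dx a g + g * lapl f := by
  simp only [lapl_eq, map_add, Derivation.leibniz, smul_eq_mul, Finset.sum_add_distrib,
    Finset.mul_sum, two_smul]
  have : ∀ a, dx a g * dx a f = dx a f * dx a g := fun a => mul_comm _ _
  simp only [this]
  abel

lemma second_deriv_nonpos_of_isLocalMax {g g' : ℝ → ℝ} {c : ℝ}
    (hg : ∀ s, HasDerivAt g (g' s) s) (hg' : HasDerivAt g' c 0) (hmax : IsLocalMax g 0) :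
    c ≤ 0 := by
  by_contra! hc
  have h0 : g' 0 = 0 := hmax.hasDerivAt_eq_zero (hg 0)
  have hs := hg'.tendsto_slope
  have h1 : ∀ᶠ s in 𝓝[≠] (0 : ℝ), 0 < slope g' 0 s := hs.eventually (lt_mem_nhds hc)
  have h2 : ∀ᶠ s in 𝓝[>] (0 : ℝ), 0 < g' s := by
    have h3 : 𝓝[>] (0 : ℝ) ≤ 𝓝[≠] 0 := nhdsWithin_mono _ fun s hs => ne_of_gt hs
    filter_upwards [h3 h1, self_mem_nhdsWithin] with s hs hs0
    have hs0 : (0 : ℝ) < s := hs0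
    rw [slope_def_field, h0, sub_zero, sub_zero] at hs
    exact (div_pos_iff_of_pos_right hs0).1 hs
  obtain ⟨δ, hδ, hδ'⟩ := mem_nhdsGT_iff_exists_Ioo_subset.1 h2
  have hδ : (0 : ℝ) < δ := hδ
  have h4 : ∀ᶠ s in 𝓝[>] (0 : ℝ), g s ≤ g 0 := nhdsWithin_le_nhds hmax
  have h5 : ∀ᶠ s in 𝓝[>] (0 : ℝ), s ∈ Set.Ioo 0 δ := Ioo_mem_nhdsGT hδ
  obtain ⟨s, hs1, hs2⟩ := (h4.and h5).exists
  have hmono : StrictMonoOn g (Set.Icc 0 s) := by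
    refine strictMonoOn_of_deriv_pos (convex_Icc _ _)
      (fun u _ => (hg u).continuousAt.continuousWithinAt) fun u hu => ?_
    rw [interior_Icc] at hu
    rw [(hg u).deriv]
    exact hδ' ⟨hu.1, hu.2.trans hs2.2⟩
  exact absurd (hmono ⟨le_rfl, hs2.1.le⟩ ⟨hs2.1.le, le_rfl⟩ hs2.1) (not_lt.2 hs1)

/-- At a first contact with the level `θ` from below, the space derivatives vanish, the Laplacian
is nonpositive and the time derivative nonnegative; if this never happens, the level is never
reached. -/
lemma first_touch (Z : SF n) {S U : Set (Eu n)} (hS : IsCompact S) (hU : IsOpen U) (hUS : U ⊆ S)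
    {θ t₁ T : ℝ} (h0 : ∀ x ∈ S, Z t₁ x < θ)
    (hb : ∀ t ∈ Set.Icc t₁ T, ∀ x ∈ S, x ∉ U → Z t x < θ)
    (hZ : ∀ t ∈ Set.Ioc t₁ T, ∀ x ∈ U, Z t x = θ → (∀ a, dx a Z t x = 0) → lapl Z t x ≤ 0 →
      dt Z t x < 0) :
    ∀ t ∈ Set.Icc t₁ T, ∀ x ∈ S, Z t x < θ := by
  by_contra! hcon
  obtain ⟨t', ht', x', hx', hZ'⟩ := hcon
  set A : Set (ℝ × Eu n) := (Set.Icc t₁ T ×ˢ S) ∩ {z | θ ≤ Z z.1 z.2} with hA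
  have hAc : IsCompact A := (isCompact_Icc.prod hS).inter_right
    (isClosed_le continuous_const (continuous_evSF Z))
  obtain ⟨z, hz, hmin⟩ := hAc.exists_isMinOn ⟨(t', x'), ⟨ht', hx'⟩, hZ'⟩ continuous_fst.continuousOn
  obtain ⟨⟨hzt, hzx⟩, hzθ⟩ := hz
  have hzθ : θ ≤ Z z.1 z.2 := hzθ
  have ht1 : t₁ < z.1 := by
    rcases eq_or_lt_of_le hzt.1 with h | h
    · have := h0 z.2 hzx
      rw [h] at this
      exact absurd hzθ (not_le.2 this)
    · exact h
  have hbefore : ∀ t ∈ Set.Ico t₁ z.1, ∀ x ∈ S, Z t x < θ := by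
    intro t ht x hx
    by_contra! hc
    have := hmin (show (t, x) ∈ A from ⟨⟨⟨ht.1, ht.2.le.trans hzt.2⟩, hx⟩, hc⟩)
    exact absurd ht.2 (not_lt.2 this)
  have hle : ∀ x ∈ S, Z z.1 x ≤ θ := by
    intro x hx
    have hcont : Tendsto (fun t => Z t x) (𝓝[<] z.1) (𝓝 (Z z.1 x)) :=
      (hasDerivAt_dt Z z.1 x).continuousAt.tendsto.mono_left nhdsWithin_le_nhds
    refine le_of_tendsto hcont ?_
    filter_upwards [Ico_mem_nhdsLT ht1] with t ht using (hbefore t ht x hx).le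
  have hxU : z.2 ∈ U := by
    by_contra hxU
    exact absurd hzθ (not_le.2 (hb z.1 hzt z.2 hzx hxU))
  have heq : Z z.1 z.2 = θ := le_antisymm (hle _ hzx) hzθ
  have hline : ∀ a, IsLocalMax (fun s : ℝ => Z z.1 (z.2 + s • stdBasis n a)) 0 := by
    intro a
    have hc : ContinuousAt (fun s : ℝ => z.2 + s • stdBasis n a) 0 := by fun_prop
    have := hc.preimage_mem_nhds (t := U) (by simpa using hU.mem_nhds hxU)
    filter_upwards [this] with s hs
    have := hle _ (hUS hs)
    simpa [heq] using this
  have hgrad : ∀ a, dx a Z z.1 z.2 = 0 := by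
    intro a
    have := (hline a).hasDerivAt_eq_zero (hasDerivAt_dx Z z.1 z.2 a 0)
    simpa using this
  have hlap : lapl Z z.1 z.2 ≤ 0 := by
    rw [lapl_eq, sum_ev]
    refine Finset.sum_nonpos fun a _ => ?_
    have h1 := hasDerivAt_dx (dx a Z) z.1 z.2 a 0
    have := second_deriv_nonpos_of_isLocalMax (fun s => hasDerivAt_dx Z z.1 z.2 a s) h1 (hline a)
    simpa using this
  have hneg := hZ z.1 ⟨ht1, hzt.2⟩ z.2 hxU heq hgrad hlap
  have hs := (hasDerivAt_dt Z z.1 z.2).tendsto_slope.mono_left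
    (nhdsWithin_mono z.1 (fun s (hs : s ∈ Set.Iio z.1) => ne_of_lt hs))
  have : 0 ≤ dt Z z.1 z.2 := by
    refine ge_of_tendsto hs ?_
    filter_upwards [Ico_mem_nhdsLT ht1] with s hs'
    rw [slope_def_field]
    refine div_nonneg_of_nonpos ?_ (by linarith [hs'.2])
    have := hbefore s hs' z.2 hzx
    linarith
  linarith

lemma om_pos {B : ℝ} (hB : 0 < B) (t : ℝ) (x : Eu n) : 0 < om n B t x := by
  rw [om_ev]; positivity

lemma le_om {B : ℝ} (t : ℝ) (x : Eu n) : B ≤ om n B t x := by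
  rw [om_ev]; nlinarith [sq_nonneg ‖x‖]

/-- The scalar product of a vector with the gradient. -/
def vgrad (b : Eu n) (f : SF n) (t : ℝ) (x : Eu n) : ℝ := ∑ a, b a * dx a f t x

lemma dx_om_pow (B : ℝ) (L : ℕ) (a : Fin n) :
    dx a (om n B ^ (L + 1)) = (2 * ((L : ℝ) + 1)) • (X a * om n B ^ L) := by
  refine SF_ext fun t x => ?_
  simp [Derivation.leibniz_pow, dx_om]
  ring

lemma lapl_om_pow_le (B : ℝ) (L : ℕ) (hB : 0 < B) (t : ℝ) (x : Eu n) :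
    0 ≤ lapl (om n B ^ (L + 1)) t x ∧
    lapl (om n B ^ (L + 1)) t x ≤ 2 * (L + 1) * (n + 2 * L) * om n B t x ^ L := by
  have hω := om_pos hB t x
  rw [lapl_eq]
  cases L with
  | zero =>
    have : ∀ a, dx a (dx a (om n B ^ (0 + 1))) = (2 : ℝ) • (1 : SF n) := by
      intro a; simp [dx_om, dx_X]
    simp only [this]
    constructor
    · simp
    · simp
  | succ k =>
    have : ∀ a, dx a (dx a (om n B ^ (k + 1 + 1))) t x =
        (2 * ((k : ℝ) + 2)) * (om n B t x ^ (k + 1) + 2 * (k + 1) * om n B t x ^ k * x a ^ 2) := by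
      intro a
      rw [dx_om_pow]
      simp only [Derivation.map_smul, Derivation.leibniz, dx_X, dx_om_pow]
      simp
      ring
    simp only [sum_ev, this, ← Finset.mul_sum, Finset.sum_add_distrib, ← EuclideanSpace.real_norm_sq_eq]
    have h2 : ‖x‖ ^ 2 ≤ om n B t x := by rw [om_ev]; linarith
    have h3 : om n B t x ^ k * ‖x‖ ^ 2 ≤ om n B t x ^ (k + 1) := by
      rw [pow_succ _ k]; exact mul_le_mul_of_nonneg_left h2 (by positivity)
    constructor
    · simp; positivity
    · push_cast
      simp only [Finset.sum_const, Finset.card_univ, Fintype.card_fin, nsmul_eq_mul]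
      have h4 : (2 * ((k : ℝ) + 1)) * (om n B t x ^ k * ‖x‖ ^ 2) ≤
        (2 * ((k : ℝ) + 1)) * om n B t x ^ (k + 1) := by gcongr
      have : (0 : ℝ) ≤ 2 * (k + 2) := by positivity
      nlinarith [mul_le_mul_of_nonneg_left h4 this]

/-- The maximum principle for parabolic inequalities with coefficients of quadratic growth, in the
exterior of a ball (or in the whole space, if `r₀ < 0`). -/
theorem max_principle {B : ℝ} (hB : 0 < B) (z : SF n) {t₁ T r₀ K K' : ℝ} (hK : 0 ≤ K) (L : ℕ)
    (hgrow : ∀ t ∈ Set.Icc t₁ T, ∀ x, r₀ ≤ ‖x‖ → z t x ≤ K' * om n B t x ^ L)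
    (h0 : ∀ x, r₀ ≤ ‖x‖ → z t₁ x ≤ 0)
    (hb : ∀ t ∈ Set.Icc t₁ T, ∀ x, ‖x‖ = r₀ → z t x ≤ 0)
    (hpde : ∀ t ∈ Set.Ioc t₁ T, ∀ x, r₀ < ‖x‖ → 0 < z t x → ∃ (a : ℝ) (b : Eu n) (c : ℝ),
      0 ≤ a ∧ a ≤ K * om n B t x ∧ |∑ i, b i * x i| ≤ K * om n B t x ∧ c ≤ K ∧
      dt z t x ≤ a * lapl z t x + vgrad b z t x + c * z t x) :
    ∀ t ∈ Set.Icc t₁ T, ∀ x, r₀ ≤ ‖x‖ → z t x ≤ 0 := by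
  set K2 : ℝ := K * (2 * (L + 1) * (n + 2 * L)) + 2 * (L + 1) * K + K + 1 with hK2
  have hlt : ∀ ε > 0, ∀ t ∈ Set.Icc t₁ T, ∀ x, r₀ ≤ ‖x‖ →
      z t x < ε * (Real.exp (K2 * (t - t₁)) * om n B t x ^ (L + 1)) := by
    intro ε hε t ht x hx
    have hK2pos : 0 ≤ K2 := by positivity
    set H : SF n := (ε * Real.exp (-K2 * t₁)) • (expT K2 * om n B ^ (L + 1)) with hH
    have hHev : ∀ t x, H t x = ε * (Real.exp (K2 * (t - t₁)) * om n B t x ^ (L + 1)) := by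
      intro t x
      simp only [hH, smul_ev, mul_ev, expT_ev, pow_ev]
      rw [show K2 * (t - t₁) = -K2 * t₁ + K2 * t by ring, Real.exp_add]
      ring
    have hHlow : ∀ t ∈ Set.Icc t₁ T, ∀ x, ε * om n B t x ^ (L + 1) ≤ H t x := by
      intro t ht x
      rw [hHev]
      have : 1 ≤ Real.exp (K2 * (t - t₁)) :=
        Real.one_le_exp (mul_nonneg hK2pos (by linarith [ht.1]))
      have h2 : 0 ≤ om n B t x ^ (L + 1) := (pow_pos (om_pos hB t x) _).le
      have := mul_le_mul_of_nonneg_right this h2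
      rw [one_mul] at this
      gcongr
    have hHpos : ∀ t ∈ Set.Icc t₁ T, ∀ x, 0 < H t x := fun t ht x =>
      lt_of_lt_of_le (mul_pos hε (pow_pos (om_pos hB t x) _)) (hHlow t ht x)
    set R : ℝ := max ‖x‖ (|K'| / ε) + 1 + |r₀| with hR
    have hRbig : ∀ y : Eu n, R ≤ ‖y‖ → |K'| < ε * om n B t y := by
      intro y hy
      rw [om_ev]
      have h1 : |K'| / ε ≤ ‖y‖ - 1 := by
        have := le_max_right ‖x‖ (|K'| / ε)
        have := abs_nonneg r₀
        linarith
      have h2 : ‖y‖ - 1 < B + ‖y‖ ^ 2 := by nlinarith [sq_nonneg (‖y‖ - 1)]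
      have := lt_of_le_of_lt h1 h2
      rw [div_lt_iff₀ hε] at this
      linarith
    set S : Set (Eu n) := Metric.closedBall 0 R ∩ {y | r₀ ≤ ‖y‖} with hS
    set U : Set (Eu n) := Metric.ball 0 R ∩ {y | r₀ < ‖y‖} with hU
    have hSc : IsCompact S := (isCompact_closedBall _ _).inter_right
      (isClosed_le continuous_const continuous_norm)
    have hUo : IsOpen U := Metric.isOpen_ball.inter (isOpen_lt continuous_const continuous_norm)
    have hUS : U ⊆ S := fun y hy => ⟨Metric.ball_subset_closedBall hy.1, (show r₀ < ‖y‖ from hy.2).le⟩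
    have hmain := first_touch (z - H) hSc hUo hUS (θ := 0) (t₁ := t₁) (T := T) ?_ ?_ ?_ t ht x ?_
    · rw [sub_ev, hHev] at hmain
      linarith
    · intro y hy
      have := hHpos t₁ ⟨le_rfl, ht.1.trans ht.2⟩ y
      have := h0 y hy.2
      rw [sub_ev]; linarith
    · intro s hs y hy hyU
      rw [sub_ev]
      by_cases hyR : ‖y‖ = r₀
      · have := hHpos s hs y
        have := hb s hs y hyR
        linarith
      · have hyR' : r₀ < ‖y‖ := lt_of_le_of_ne hy.2 (Ne.symm hyR)
        have hyR2 : R ≤ ‖y‖ := by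
          by_contra! hc
          exact hyU ⟨by simpa using hc, hyR'⟩
        have h1 := hgrow s hs y hy.2
        have h2 := hRbig y hyR2
        have h3 := hHlow s hs y
        have hp : 0 < om n B s y ^ L := pow_pos (om_pos hB s y) _
        have h4 : om n B t y = om n B s y := by rw [om_ev, om_ev]
        rw [h4] at h2
        have h5 : K' * om n B s y ^ L < ε * om n B s y ^ (L + 1) := by
          calc K' * om n B s y ^ L ≤ |K'| * om n B s y ^ L := by gcongr; exact le_abs_self _
            _ < (ε * om n B s y) * om n B s y ^ L := by gcongr
            _ = _ := by ring
        linarith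
    · intro s hs y hy heq hgrad hlap
      have hs' : s ∈ Set.Icc t₁ T := ⟨hs.1.le, hs.2⟩
      have hHp := hHpos s hs' y
      have hzH : z s y = H s y := by rw [sub_ev] at heq; linarith
      obtain ⟨a, b, c, ha0, ha, hbb, hc, hineq⟩ := hpde s hs y hy.2 (by rw [hzH]; exact hHp)
      have hω := om_pos hB s y
      have hdx : ∀ i, dx i H = (ε * Real.exp (-K2 * t₁)) • (expT K2 *
          ((2 * ((L : ℝ) + 1)) • (X i * om n B ^ L))) := by
        intro i
        rw [hH, Derivation.map_smul, Derivation.leibniz, dx_om_pow, dx_expT]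
        simp
      have hlapH : lapl H = (ε * Real.exp (-K2 * t₁)) • (expT K2 * lapl (om n B ^ (L + 1))) := by
        rw [hH, map_smul, lapl_mul]
        simp [lapl_eq (expT K2)]
      have hdtH : dt H = K2 • H := by
        refine SF_ext fun t x => ?_
        rw [hH, Derivation.map_smul, Derivation.leibniz, Derivation.leibniz_pow, dt_om, dt_expT]
        simp
        ring
      set P : ℝ := ε * Real.exp (-K2 * t₁) * Real.exp (K2 * s) with hP
      have hPpos : 0 < P := by positivity
      have hHP : H s y = P * om n B s y ^ (L + 1) := by
        simp only [hH, smul_ev, mul_ev, expT_ev, pow_ev, hP]; ring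
      have hz1 : vgrad b z s y = vgrad b H s y := by
        unfold vgrad
        refine Finset.sum_congr rfl fun i _ => ?_
        have := hgrad i
        rw [map_sub, sub_ev] at this
        rw [sub_eq_zero.1 this]
      have hz2 : lapl z s y ≤ lapl H s y := by
        rw [map_sub, sub_ev] at hlap; linarith
      have hz3 : vgrad b H s y ≤ P * (2 * (L + 1) * K * om n B s y ^ (L + 1)) := by
        have : vgrad b H s y = P * (2 * (L + 1) * om n B s y ^ L * ∑ i, b i * y i) := by
          unfold vgrad
          simp only [hdx, smul_ev, mul_ev, expT_ev, pow_ev, X_ev, Finset.mul_sum, hP]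
          refine Finset.sum_congr rfl fun i _ => ?_
          ring
        rw [this]
        have h6 : ∑ i, b i * y i ≤ K * om n B s y := (le_abs_self _).trans hbb
        have h7 : 0 ≤ 2 * ((L : ℝ) + 1) * om n B s y ^ L := by positivity
        refine mul_le_mul_of_nonneg_left ((mul_le_mul_of_nonneg_left h6 h7).trans_eq ?_) hPpos.le
        ring
      have hz4 : a * lapl z s y ≤
          P * (K * (2 * (L + 1) * (n + 2 * L)) * om n B s y ^ (L + 1)) := by
        have e : lapl H s y = P * lapl (om n B ^ (L + 1)) s y := by
          rw [hlapH]; simp only [smul_ev, mul_ev, expT_ev, hP]; ring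
        obtain ⟨h8, h9⟩ := lapl_om_pow_le B L hB s y
        calc a * lapl z s y ≤ a * (P * lapl (om n B ^ (L + 1)) s y) := by rw [← e]; gcongr
          _ ≤ (K * om n B s y) * (P * (2 * (L + 1) * (n + 2 * L) * om n B s y ^ L)) := by gcongr
          _ = _ := by ring
      have hz5 : c * z s y ≤ P * (K * om n B s y ^ (L + 1)) := by
        rw [hzH, hHP]
        calc c * (P * om n B s y ^ (L + 1)) ≤ K * (P * om n B s y ^ (L + 1)) := by gcongr
          _ = _ := by ring
      have hz6 : dt H s y = P * (K2 * om n B s y ^ (L + 1)) := by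
        rw [hdtH, smul_ev, hHP]; ring
      rw [map_sub, sub_ev, hz6]
      have hpos : 0 < P * om n B s y ^ (L + 1) := by positivity
      rw [hz1] at hineq
      rw [hK2]
      linarith
    · refine ⟨?_, hx⟩
      have := le_max_left ‖x‖ (|K'| / ε)
      have := abs_nonneg r₀
      simp only [Metric.mem_closedBall, dist_zero_right]
      linarith
  intro t ht x hx
  refine le_of_forall_pos_lt_add fun ε hε => ?_
  have hQ : 0 < Real.exp (K2 * (t - t₁)) * om n B t x ^ (L + 1) :=
    mul_pos (Real.exp_pos _) (pow_pos (om_pos hB t x) _)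
  have := hlt (ε / (Real.exp (K2 * (t - t₁)) * om n B t x ^ (L + 1))) (div_pos hε hQ) t ht x hx
  rwa [div_mul_cancel₀ _ hQ.ne', ← zero_add ε] at this

lemma dx_sq (f : SF n) (a : Fin n) : dx a (f ^ 2) = (2 : ℝ) • (f * dx a f) := by
  refine SF_ext fun t x => ?_
  simp [Derivation.leibniz_pow]

lemma dt_sq (f : SF n) : dt (f ^ 2) = (2 : ℝ) • (f * dt f) := by
  refine SF_ext fun t x => ?_
  simp [Derivation.leibniz_pow]

lemma lapl_sq (f : SF n) :
    lapl (f ^ 2) = (2 : ℝ) • (f * lapl f) + (2 : ℝ) • ∑ a, dx a f ^ 2 := by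
  rw [pow_two, lapl_mul, two_smul ℝ (f * lapl f)]
  simp only [pow_two]
  abel

/-- The squared distance to a point. -/
def distSq (x₀ : Eu n) : SF n := ∑ a, (X a - algebraMap ℝ (SF n) (x₀ a)) ^ 2

lemma distSq_ev (x₀ : Eu n) (t : ℝ) (x : Eu n) : distSq x₀ t x = ‖x - x₀‖ ^ 2 := by
  simp [distSq, EuclideanSpace.norm_sq_eq]

lemma dx_distSq (x₀ : Eu n) (a : Fin n) :
    dx a (distSq x₀) = (2 : ℝ) • (X a - algebraMap ℝ (SF n) (x₀ a)) := by
  simp [distSq, Derivation.leibniz_pow, dx_X, two_smul]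

lemma dt_distSq (x₀ : Eu n) : dt (distSq x₀) = 0 := by
  simp [distSq, Derivation.leibniz_pow]

lemma lapl_distSq (x₀ : Eu n) : lapl (distSq x₀) = algebraMap ℝ (SF n) (2 * n) := by
  refine SF_ext fun t x => ?_
  rw [lapl_eq]
  simp [dx_distSq, dx_X, mul_comm]

set_option maxHeartbeats 1000000 in
/-- An interior gradient estimate of Bernstein type, for a finite family of functions
satisfying a system of parabolic differential inequalities. -/
theorem bernstein {ι : Type*} [Fintype ι] (F : ι → SF n) (a : SF n) {t₀ : ℝ} {x₀ : Eu n}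
    {R c₀ C₀ C₁ δ K L : ℝ} (hR : 0 < R) (hc₀ : 0 < c₀) (hC₀ : 0 ≤ C₀) (hC₁ : 0 ≤ C₁) (hδ : 0 < δ)
    (hK : K = (2 + 2 * C₁ + 256 * C₀ ^ 2 / c₀ + 16 * n * C₀) / c₀) (hL : L = C₁ + K * C₁ + 1)
    (hsmall : (2 * K + L) * δ ^ 2 ≤ 1)
    (hX : ∀ t ∈ Set.Icc (t₀ - 1) t₀, ∀ x, ‖x - x₀‖ ≤ R / 2 → ∑ i, F i t x ^ 2 ≤ δ ^ 2)
    (ha : ∀ t ∈ Set.Icc (t₀ - 1) t₀, ∀ x, ‖x - x₀‖ ≤ R / 2 →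
      c₀ * R ^ 2 ≤ a t x ∧ a t x ≤ C₀ * R ^ 2)
    (h1 : ∀ t ∈ Set.Icc (t₀ - 1) t₀, ∀ x, ‖x - x₀‖ ≤ R / 2 →
      2 * ∑ i, F i t x * (dt (F i) t x - a t x * lapl (F i) t x) ≤
        c₀ * R ^ 2 * (∑ i, ∑ b, dx b (F i) t x ^ 2) + C₁ * δ ^ 2)
    (h2 : ∀ t ∈ Set.Icc (t₀ - 1) t₀, ∀ x, ‖x - x₀‖ ≤ R / 2 →
      2 * R ^ 2 * ∑ i, ∑ b, dx b (F i) t x * (dt (dx b (F i)) t x - a t x * lapl (dx b (F i)) t x) ≤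
        c₀ * R ^ 4 * (∑ i, ∑ b, ∑ c, dx c (dx b (F i)) t x ^ 2) +
        C₁ * (R ^ 2 * (∑ i, ∑ b, dx b (F i) t x ^ 2) +
          (R ^ 2 * (∑ i, ∑ b, dx b (F i) t x ^ 2)) ^ 2) + C₁ * δ ^ 2) :
    R ^ 2 * (∑ i, ∑ b, dx b (F i) t₀ x₀ ^ 2) ≤ (2 * K + L) * δ ^ 2 := by
  have hKpos : 0 < K := by rw [hK]; positivity
  have hLpos : 0 < L := by rw [hL]; positivity
  set XX : SF n := ∑ i, F i ^ 2 with hXX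
  set Y : SF n := ∑ i, ∑ b, dx b (F i) ^ 2 with hY
  set η : SF n := 1 - (4 / R ^ 2) • distSq x₀ with hη
  set s : SF n := ofTime (fun t => t - (t₀ - 1)) (by fun_prop) with hs
  set Z : SF n := R ^ 2 • (s * (η ^ 2 * Y)) + K • XX - (L * δ ^ 2) • s with hZ
  have hs_t : dt s = 1 := by
    refine SF_ext fun t x => ?_
    have := hasDerivAt_dt s t x
    simp only [hs, ofTime_ev] at this
    exact this.unique ((hasDerivAt_id t).sub_const _)
  have hs_x : ∀ b, dx b s = 0 := fun b => dx_ofTime _ _ _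
  have hη_t : dt η = 0 := by simp [hη, dt_distSq]
  have hη_x : ∀ b, dx b η = -((8 / R ^ 2) • (X b - algebraMap ℝ (SF n) (x₀ b))) := by
    intro b
    refine SF_ext fun t x => ?_
    simp [hη, dx_distSq]
    ring
  have hη_l : lapl η = -algebraMap ℝ (SF n) (8 * n / R ^ 2) := by
    have : lapl (1 : SF n) = 0 := by simp [lapl_eq]
    refine SF_ext fun t x => ?_
    simp [hη, lapl_distSq, this]
    ring
  have hXev : ∀ t x, XX t x = ∑ i, F i t x ^ 2 := fun t x => by simp [hXX]
  have hYev : ∀ t x, Y t x = ∑ i, ∑ b, dx b (F i) t x ^ 2 := fun t x => by simp [hY]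
  have hX_t : ∀ t x, dt XX t x - a t x * lapl XX t x =
      2 * ∑ i, F i t x * (dt (F i) t x - a t x * lapl (F i) t x) - 2 * a t x * Y t x := by
    intro t x
    simp only [hXX, hY, map_sum, dt_sq, lapl_sq, sum_ev, add_ev, smul_ev, mul_ev, pow_ev,
      Finset.mul_sum, ← Finset.sum_sub_distrib]
    refine Finset.sum_congr rfl fun i _ => ?_
    rw [mul_add, Finset.mul_sum]
    simp only [← Finset.mul_sum]
    ring
  have hY_t : ∀ t x, dt Y t x - a t x * lapl Y t x =
      2 * ∑ i, ∑ b, dx b (F i) t x * (dt (dx b (F i)) t x - a t x * lapl (dx b (F i)) t x) -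
        2 * a t x * (∑ i, ∑ b, ∑ c, dx c (dx b (F i)) t x ^ 2) := by
    intro t x
    simp only [hY, map_sum, dt_sq, lapl_sq, sum_ev, add_ev, smul_ev, mul_ev, pow_ev,
      Finset.mul_sum, ← Finset.sum_sub_distrib]
    refine Finset.sum_congr rfl fun i _ => Finset.sum_congr rfl fun b _ => ?_
    rw [mul_add, Finset.mul_sum]
    simp only [← Finset.mul_sum]
    ring
  set Q : Set (Eu n) := Metric.closedBall x₀ (R / 2)
  have hηev : ∀ t x, η t x = 1 - 4 / R ^ 2 * ‖x - x₀‖ ^ 2 := fun t x => by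
    simp [hη, distSq_ev]
  have key := first_touch Z (isCompact_closedBall x₀ (R / 2)) Metric.isOpen_ball
    (Metric.ball_subset_closedBall (x := x₀) (ε := R / 2)) (θ := 2 * K * δ ^ 2) (t₁ := t₀ - 1)
    (T := t₀) ?_ ?_ ?_ t₀ ⟨by linarith, le_rfl⟩ x₀ (Metric.mem_closedBall_self (by positivity))
  · have e1 : Z t₀ x₀ = R ^ 2 * Y t₀ x₀ + K * XX t₀ x₀ - L * δ ^ 2 := by
      simp only [hZ, sub_ev, add_ev, smul_ev, mul_ev, pow_ev, hηev, hs, ofTime_ev]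
      simp
    rw [e1, hYev, hXev] at key
    have : 0 ≤ K * ∑ i, F i t₀ x₀ ^ 2 := mul_nonneg hKpos.le (Finset.sum_nonneg fun i _ => sq_nonneg _)
    linarith
  · intro x hx
    have e1 : Z (t₀ - 1) x = K * XX (t₀ - 1) x := by
      simp only [hZ, sub_ev, add_ev, smul_ev, mul_ev, pow_ev, hηev, hs, ofTime_ev]
      simp
    have h3 := hX (t₀ - 1) ⟨le_rfl, by linarith⟩ x (by simpa [dist_eq_norm] using hx)
    rw [e1, hXev]
    have := mul_le_mul_of_nonneg_left h3 hKpos.le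
    have : 0 < K * δ ^ 2 := by positivity
    linarith
  · intro t ht x hx hxU
    have hn : ‖x - x₀‖ = R / 2 := by
      have h3 : ‖x - x₀‖ ≤ R / 2 := by simpa [dist_eq_norm] using hx
      have h4 : ¬ ‖x - x₀‖ < R / 2 := by simpa [dist_eq_norm] using hxU
      linarith
    have hη0 : η t x = 0 := by rw [hηev, hn]; field_simp; ring
    have e1 : Z t x = K * XX t x - L * δ ^ 2 * (t - (t₀ - 1)) := by
      simp only [hZ, sub_ev, add_ev, smul_ev, mul_ev, pow_ev, hη0, hs, ofTime_ev]
      simp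
    have h3 := hX t ht x hn.le
    rw [e1, hXev]
    have := mul_le_mul_of_nonneg_left h3 hKpos.le
    have : 0 < K * δ ^ 2 := by positivity
    have : 0 ≤ L * δ ^ 2 * (t - (t₀ - 1)) := mul_nonneg (by positivity) (by linarith [ht.1])
    linarith
  · intro t ht x hx hθ _ hlap
    have ht' : t ∈ Set.Icc (t₀ - 1) t₀ := ⟨ht.1.le, ht.2⟩
    have hxn : ‖x - x₀‖ < R / 2 := by simpa [dist_eq_norm] using hx
    have hxR : ‖x - x₀‖ ^ 2 ≤ R ^ 2 / 4 := by nlinarith [norm_nonneg (x - x₀)]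
    obtain ⟨ha1, ha2⟩ := ha t ht' x hxn.le
    have h1' := h1 t ht' x hxn.le
    have h2' := h2 t ht' x hxn.le
    rw [← hYev] at h1' h2'
    have hXt := hX_t t x
    have hYt := hY_t t x
    have hY0 : 0 ≤ Y t x := by
      rw [hYev]; exact Finset.sum_nonneg fun i _ => Finset.sum_nonneg fun b _ => sq_nonneg _
    have hX0 : 0 ≤ XX t x := by
      rw [hXev]; exact Finset.sum_nonneg fun i _ => sq_nonneg _
    set SS : ℝ := ∑ i, ∑ b, ∑ c, dx c (dx b (F i)) t x ^ 2 with hSS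
    have hS0 : 0 ≤ SS := Finset.sum_nonneg fun i _ => Finset.sum_nonneg fun b _ =>
      Finset.sum_nonneg fun c _ => sq_nonneg _
    set σ : ℝ := s t x with hσ
    have hσ1 : 0 < σ ∧ σ ≤ 1 := by
      simp only [hσ, hs, ofTime_ev]
      exact ⟨by linarith [ht.1], by linarith [ht.2]⟩
    set e : ℝ := η t x with he
    have he1 : 0 ≤ e ∧ e ≤ 1 := by
      rw [he, hηev]
      refine ⟨?_, ?_⟩
      · have : 4 / R ^ 2 * ‖x - x₀‖ ^ 2 ≤ 4 / R ^ 2 * (R ^ 2 / 4) := by gcongr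
        have h5 : 4 / R ^ 2 * (R ^ 2 / 4) = 1 := by field_simp
        linarith
      · have : 0 ≤ 4 / R ^ 2 * ‖x - x₀‖ ^ 2 := by positivity
        linarith
    set A : ℝ := a t x with hA
    have hApos : 0 < A := lt_of_lt_of_le (by positivity) ha1
    -- the time derivative
    have hZt : dt Z t x = R ^ 2 * (e ^ 2 * Y t x + σ * (e ^ 2 * dt Y t x)) + K * dt XX t x
        - L * δ ^ 2 := by
      simp only [hZ, map_add, map_sub, Derivation.map_smul, Derivation.leibniz, hs_t,
        Derivation.leibniz_pow, hη_t]
      simp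
      ring
    have hZl : lapl Z t x = R ^ 2 * (σ * (e ^ 2 * lapl Y t x +
        2 * ∑ b, 2 * e * dx b η t x * dx b Y t x +
        Y t x * (2 * (e * lapl η t x) + 2 * ∑ b, dx b η t x ^ 2))) + K * lapl XX t x := by
      have hls : lapl s = 0 := by simp [lapl_eq, hs_x]
      simp only [hZ, map_add, map_sub, map_smul, lapl_mul s, hls, hs_x, lapl_mul (η ^ 2), lapl_sq,
        dx_sq]
      simp [mul_assoc, ← hσ, ← he]
    have hgradη : ∑ b, dx b η t x ^ 2 ≤ 16 / R ^ 2 := by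
      have : ∑ b, dx b η t x ^ 2 = (8 / R ^ 2) ^ 2 * ‖x - x₀‖ ^ 2 := by
        simp [hη_x, EuclideanSpace.norm_sq_eq, mul_pow, Finset.mul_sum]
      rw [this]
      calc (8 / R ^ 2) ^ 2 * ‖x - x₀‖ ^ 2 ≤ (8 / R ^ 2) ^ 2 * (R ^ 2 / 4) := by gcongr
        _ = _ := by field_simp; norm_num
    have hcross : -(A * (R ^ 2 * (2 * ∑ b, 2 * e * dx b η t x * dx b Y t x))) ≤
        c₀ * R ^ 4 * e ^ 2 * SS + 256 * C₀ ^ 2 / c₀ * (R ^ 2 * Y t x) := by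
      have hdY : ∀ c, dx c Y t x = ∑ i, ∑ b, 2 * (dx b (F i) t x * dx c (dx b (F i)) t x) := by
        intro c; simp [hY]
      have e1 : -(A * (R ^ 2 * (2 * ∑ c, 2 * e * dx c η t x * dx c Y t x))) =
          ∑ i, ∑ b, ∑ c, -(8 * A * e * R ^ 2 *
            (dx c η t x * dx b (F i) t x * dx c (dx b (F i)) t x)) := by
        simp only [hdY, Finset.mul_sum, ← Finset.sum_neg_distrib]
        rw [Finset.sum_comm]
        refine Finset.sum_congr rfl fun i _ => ?_
        rw [Finset.sum_comm]
        refine Finset.sum_congr rfl fun b _ => Finset.sum_congr rfl fun c _ => ?_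
        ring
      have e2 : ∀ u v w : ℝ, -(8 * A * e * R ^ 2 * (u * v * w)) ≤
          c₀ * R ^ 4 * e ^ 2 * w ^ 2 + 16 * A ^ 2 / c₀ * (u ^ 2 * v ^ 2) := by
        intro u v w
        have : 0 ≤ (c₀ * R ^ 2 * e * w + 4 * A * u * v) ^ 2 / c₀ := by positivity
        have e3 : (c₀ * R ^ 2 * e * w + 4 * A * u * v) ^ 2 / c₀ =
          c₀ * R ^ 4 * e ^ 2 * w ^ 2 + 16 * A ^ 2 / c₀ * (u ^ 2 * v ^ 2) +
            8 * A * e * R ^ 2 * (u * v * w) := by field_simp; ring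
        linarith
      rw [e1]
      calc _ ≤ ∑ i, ∑ b, ∑ c, (c₀ * R ^ 4 * e ^ 2 * dx c (dx b (F i)) t x ^ 2 +
            16 * A ^ 2 / c₀ * (dx c η t x ^ 2 * dx b (F i) t x ^ 2)) :=
            Finset.sum_le_sum fun i _ => Finset.sum_le_sum fun b _ =>
              Finset.sum_le_sum fun c _ => e2 _ _ _
        _ = c₀ * R ^ 4 * e ^ 2 * SS + 16 * A ^ 2 / c₀ * ((∑ c, dx c η t x ^ 2) * Y t x) := by
            simp only [Finset.sum_add_distrib, ← Finset.mul_sum, hSS, hYev, ← Finset.sum_mul]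
        _ ≤ c₀ * R ^ 4 * e ^ 2 * SS + 16 * (C₀ * R ^ 2) ^ 2 / c₀ * ((16 / R ^ 2) * Y t x) := by
            gcongr
        _ = _ := by field_simp; ring
    have hlapη : -(A * (R ^ 2 * (Y t x * (2 * (e * lapl η t x) + 2 * ∑ b, dx b η t x ^ 2)))) ≤
        16 * n * C₀ * (R ^ 2 * Y t x) := by
      have h5 : lapl η t x = -(8 * n / R ^ 2) := by rw [hη_l]; simp
      have h6 : 0 ≤ ∑ b, dx b η t x ^ 2 := Finset.sum_nonneg fun b _ => sq_nonneg _
      have h7 : 0 ≤ A * (R ^ 2 * (Y t x * (2 * ∑ b, dx b η t x ^ 2))) := by positivity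
      have h8 : A * e ≤ C₀ * R ^ 2 * 1 := by
        gcongr
        · exact he1.1
        · exact he1.2
      have h9 : A * (R ^ 2 * (Y t x * (2 * (e * (8 * n / R ^ 2))))) ≤
          16 * n * C₀ * (R ^ 2 * Y t x) := by
        calc A * (R ^ 2 * (Y t x * (2 * (e * (8 * n / R ^ 2))))) = (A * e) * (16 * n * Y t x) := by
              field_simp; ring
          _ ≤ (C₀ * R ^ 2 * 1) * (16 * n * Y t x) := by gcongr
          _ = _ := by ring
      rw [h5]
      have h10 : -(A * (R ^ 2 * (Y t x * (2 * (e * -(8 * n / R ^ 2)) + 2 * ∑ b, dx b η t x ^ 2)))) =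
        A * (R ^ 2 * (Y t x * (2 * (e * (8 * n / R ^ 2))))) -
          A * (R ^ 2 * (Y t x * (2 * ∑ b, dx b η t x ^ 2))) := by ring
      linarith
    have hy2 : σ * e ^ 2 * (R ^ 2 * Y t x) ≤ 1 := by
      have e1 : Z t x = R ^ 2 * (σ * (e ^ 2 * Y t x)) + K * XX t x - L * δ ^ 2 * σ := by
        simp only [hZ, sub_ev, add_ev, smul_ev, mul_ev, pow_ev, ← hσ, ← he]
      rw [e1] at hθ
      have : 0 ≤ K * XX t x := by positivity
      have h5 : L * δ ^ 2 * σ ≤ L * δ ^ 2 := mul_le_of_le_one_right (by positivity) hσ1.2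
      linarith only [this, h5, hθ, hsmall]
    set y : ℝ := R ^ 2 * Y t x with hy
    have hy0 : 0 ≤ y := by positivity
    have hse : 0 ≤ σ * e ^ 2 := mul_nonneg hσ1.1.le (sq_nonneg _)
    have he2 : e ^ 2 ≤ 1 := pow_le_one₀ he1.1 he1.2
    have hse1 : σ * e ^ 2 ≤ 1 := mul_le_one₀ hσ1.2 (sq_nonneg _) he2
    -- contributions of `Y`
    have hB1 : σ * e ^ 2 * (R ^ 2 * (dt Y t x - A * lapl Y t x)) ≤
        σ * (-(c₀ * R ^ 4 * e ^ 2 * SS)) + 2 * C₁ * y + C₁ * δ ^ 2 := by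
      have h5 : R ^ 2 * (dt Y t x - A * lapl Y t x) ≤
          -(c₀ * R ^ 4 * SS) + C₁ * (y + y ^ 2) + C₁ * δ ^ 2 := by
        rw [hYt]
        have h6 : c₀ * R ^ 2 * (R ^ 2 * SS) ≤ A * (R ^ 2 * SS) := by gcongr
        rw [mul_sub]
        linarith
      have h7 := mul_le_mul_of_nonneg_left h5 hse
      have h8 : σ * e ^ 2 * (C₁ * y) ≤ C₁ * y := mul_le_of_le_one_left (by positivity) hse1
      have h9 : σ * e ^ 2 * (C₁ * δ ^ 2) ≤ C₁ * δ ^ 2 := mul_le_of_le_one_left (by positivity) hse1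
      have h10 : (σ * e ^ 2 * y) * (C₁ * y) ≤ C₁ * y := mul_le_of_le_one_left (by positivity) hy2
      linarith
    have hB2 : K * (dt XX t x - A * lapl XX t x) ≤ -(K * c₀ * y) + K * C₁ * δ ^ 2 := by
      have h5 : dt XX t x - A * lapl XX t x ≤ -(c₀ * y) + C₁ * δ ^ 2 := by
        rw [hXt]
        have h6 : c₀ * R ^ 2 * Y t x ≤ A * Y t x := by gcongr
        rw [hy]
        linarith
      have := mul_le_mul_of_nonneg_left h5 hKpos.le
      linarith
    have hKc : K * c₀ = 2 + 2 * C₁ + 256 * C₀ ^ 2 / c₀ + 16 * n * C₀ := by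
      rw [hK]; field_simp
    have hAl : A * lapl Z t x ≤ 0 := mul_nonpos_of_nonneg_of_nonpos hApos.le hlap
    have hB3 := mul_le_mul_of_nonneg_left hcross hσ1.1.le
    have hB4 := mul_le_mul_of_nonneg_left hlapη hσ1.1.le
    have hB5 : σ * (256 * C₀ ^ 2 / c₀ * y) ≤ 256 * C₀ ^ 2 / c₀ * y :=
      mul_le_of_le_one_left (by positivity) hσ1.2
    have hB6 : σ * (16 * n * C₀ * y) ≤ 16 * n * C₀ * y :=
      mul_le_of_le_one_left (by positivity) hσ1.2
    have hB7 : e ^ 2 * y ≤ y := mul_le_of_le_one_left hy0 he2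
    have hδ2 : 0 < δ ^ 2 := by positivity
    have hKcy : K * c₀ * y = (2 + 2 * C₁ + 256 * C₀ ^ 2 / c₀ + 16 * n * C₀) * y := by rw [hKc]
    have hfin : dt Z t x = (R ^ 2 * (e ^ 2 * Y t x)) + σ * e ^ 2 * (R ^ 2 * (dt Y t x - A * lapl Y t x))
        + K * (dt XX t x - A * lapl XX t x) +
        σ * (-(A * (R ^ 2 * (2 * ∑ b, 2 * e * dx b η t x * dx b Y t x)))) +
        σ * (-(A * (R ^ 2 * (Y t x * (2 * (e * lapl η t x) + 2 * ∑ b, dx b η t x ^ 2))))) +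
        A * lapl Z t x - L * δ ^ 2 := by
      rw [hZt, hZl]; ring
    have hB8 : R ^ 2 * (e ^ 2 * Y t x) = e ^ 2 * y := by rw [hy]; ring
    have hLδ : L * δ ^ 2 = C₁ * δ ^ 2 + K * C₁ * δ ^ 2 + δ ^ 2 := by rw [hL]; ring
    rw [hfin, hB8, hLδ]
    linarith

/-- The terms of lower order in the equation for the derivatives of order `k` of a solution `f` of
`∂ₜ f = ω Δf - c x·∇f + l f + G + ϑ (f Δf - κ |∇f|²)`. -/
def lowerTerms (f G : SF n) (ϑ : ℝ) (k : ℕ) : Submodule ℝ (SF n) :=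
  Submodule.span ℝ
    ({g | ∃ (a : Fin n) (J : List (Fin n)), J.length = k + 1 ∧ g = X a * D J f} ∪
     {g | ∃ J : List (Fin n), J.length = k ∧ g = D J f} ∪
     {g | ∃ I J : List (Fin n), 1 ≤ I.length ∧ 1 ≤ J.length ∧ I.length + J.length = k + 2 ∧
        g = ϑ • (D I f * D J f)} ∪
     {g | ∃ J : List (Fin n), J.length = k ∧ g = D J G})

lemma X_mul_mem_lowerTerms (f G : SF n) (ϑ : ℝ) {k : ℕ} (a : Fin n) {J : List (Fin n)}
    (hJ : J.length = k + 1) : X a * D J f ∈ lowerTerms f G ϑ k :=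
  Submodule.subset_span (Or.inl (Or.inl (Or.inl ⟨a, J, hJ, rfl⟩)))

lemma D_mem_lowerTerms (f G : SF n) (ϑ : ℝ) {k : ℕ} {J : List (Fin n)}
    (hJ : J.length = k) : D J f ∈ lowerTerms f G ϑ k :=
  Submodule.subset_span (Or.inl (Or.inl (Or.inr ⟨J, hJ, rfl⟩)))

lemma mul_mem_lowerTerms (f G : SF n) (ϑ : ℝ) {k : ℕ} {I J : List (Fin n)}
    (hI : 1 ≤ I.length) (hJ : 1 ≤ J.length) (h : I.length + J.length = k + 2) :
    ϑ • (D I f * D J f) ∈ lowerTerms f G ϑ k :=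
  Submodule.subset_span (Or.inl (Or.inr ⟨I, J, hI, hJ, h, rfl⟩))

lemma DG_mem_lowerTerms (f G : SF n) (ϑ : ℝ) {k : ℕ} {J : List (Fin n)}
    (hJ : J.length = k) : D J G ∈ lowerTerms f G ϑ k :=
  Submodule.subset_span (Or.inr ⟨J, hJ, rfl⟩)

lemma dx_lowerTerms (f G : SF n) (ϑ : ℝ) {k : ℕ} (b : Fin n) {g : SF n}
    (hg : g ∈ lowerTerms f G ϑ k) : dx b g ∈ lowerTerms f G ϑ (k + 1) := by
  induction hg using Submodule.span_induction with
  | mem g hg =>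
    rcases hg with ((⟨a, J, hJ, rfl⟩ | ⟨J, hJ, rfl⟩) | ⟨I, J, hI, hJ, h, rfl⟩) | ⟨J, hJ, rfl⟩
    · rw [Derivation.leibniz, smul_eq_mul, smul_eq_mul, dx_X]
      refine add_mem ?_ ?_
      · exact X_mul_mem_lowerTerms f G ϑ a (J := b :: J) (by simp [hJ])
      · split_ifs
        · rw [mul_one]; exact D_mem_lowerTerms f G ϑ hJ
        · rw [mul_zero]; exact zero_mem _
    · exact D_mem_lowerTerms f G ϑ (J := b :: J) (by simp [hJ])
    · rw [Derivation.map_smul, Derivation.leibniz, smul_eq_mul, smul_eq_mul, smul_add]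
      refine add_mem ?_ ?_
      · exact mul_mem_lowerTerms f G ϑ (I := I) (J := b :: J) hI (by simp) (by simp; omega)
      · exact mul_mem_lowerTerms f G ϑ (I := J) (J := b :: I) hJ (by simp) (by simp; omega)
    · exact DG_mem_lowerTerms f G ϑ (J := b :: J) (by simp [hJ])
  | zero => rw [map_zero]; exact zero_mem _
  | add g h _ _ ihg ihh => rw [map_add]; exact add_mem ihg ihh
  | smul c g _ ih => rw [Derivation.map_smul]; exact Submodule.smul_mem _ _ ih

/-- The quasilinear equation with coefficient `ω + ϑ f`. -/
def IsQSol (B c l κ ϑ : ℝ) (f G : SF n) : Prop :=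
  dt f = Op n B c l f + G + ϑ • (f * lapl f - κ • ∑ a, dx a f ^ 2)

lemma equation_mem_lowerTerms {B c l κ ϑ : ℝ} {f G : SF n} (hf : IsQSol B c l κ ϑ f G)
    (J : List (Fin n)) :
    dt (D J f) - (om n B + ϑ • f) * lapl (D J f) ∈ lowerTerms f G ϑ J.length := by
  induction J with
  | nil =>
    have h : dt f - (om n B + ϑ • f) * lapl f =
        (-c) • (∑ a, X a * D [a] f) + l • D [] f + D [] G +
        (-κ) • ∑ a, ϑ • (D [a] f * D [a] f) := by
      rw [hf]
      refine SF_ext fun t x => ?_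
      simp [Op, Finset.mul_sum]
      have : ∀ a, ϑ * (κ * (dx a f t x) ^ 2) = κ * (ϑ * (dx a f t x * dx a f t x)) :=
        fun a => by ring
      simp only [mul_sub, Finset.mul_sum, this]
      ring
    rw [D_nil, h]
    refine add_mem (add_mem (add_mem (Submodule.smul_mem _ _ ?_) (Submodule.smul_mem _ _ ?_)) ?_)
      (Submodule.smul_mem _ _ ?_)
    · exact sum_mem fun a _ => X_mul_mem_lowerTerms f G ϑ a (J := [a]) rfl
    · exact D_mem_lowerTerms f G ϑ (J := []) rfl
    · exact DG_mem_lowerTerms f G ϑ (J := []) rfl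
    · exact sum_mem fun a _ => mul_mem_lowerTerms f G ϑ (I := [a]) (J := [a]) (by simp) (by simp)
        (by simp)
  | cons b J ih =>
    have h : dt (D (b :: J) f) - (om n B + ϑ • f) * lapl (D (b :: J) f) =
        dx b (dt (D J f) - (om n B + ϑ • f) * lapl (D J f)) +
        ((2 : ℝ) • ∑ a, X b * D (a :: a :: J) f + ∑ a, ϑ • (D [b] f * D (a :: a :: J) f)) := by
      simp only [D_cons, D_nil, ← Finset.mul_sum, ← Finset.smul_sum, ← lapl_eq]
      rw [map_sub, Derivation.leibniz, map_add, Derivation.map_smul, dx_om, dt_dx, dx_lapl]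
      refine SF_ext fun t x => ?_
      simp
      ring
    rw [h]
    refine add_mem (dx_lowerTerms f G ϑ b ih) (add_mem (Submodule.smul_mem _ _ ?_) ?_)
    · exact sum_mem fun a _ => X_mul_mem_lowerTerms f G ϑ b (J := a :: a :: J) (by simp)
    · exact sum_mem fun a _ => mul_mem_lowerTerms f G ϑ (I := [b]) (J := a :: a :: J) (by simp)
        (by simp) (by simp; omega)

lemma abs_coord_le (x : Eu n) (a : Fin n) : |x a| ≤ ‖x‖ := by
  simpa using PiLp.norm_apply_le x a

/-- Pointwise bounds for the lower order terms from bounds on the derivatives. -/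
lemma bound_lowerTerms (f G : SF n) {ϑ s : ℝ} (hs : ϑ = 0 ∨ s = 2) {k : ℕ} {g : SF n}
    (hg : g ∈ lowerTerms f G ϑ k) :
    ∃ C : ℝ, 0 ≤ C ∧ ∀ (t : ℝ) (x : Eu n) (R M δ : ℝ) (μ : ℕ → ℝ), 0 < R → ‖x‖ ≤ 2 * R → 0 ≤ δ →
      (∀ j, 0 ≤ μ j) → (∀ J : List (Fin n), J.length ≤ k + 1 →
        |D J f t x| ≤ μ J.length * R ^ (s - J.length)) →
      (∀ J : List (Fin n), J.length = k → |D J G t x| ≤ δ * R ^ (s - J.length)) →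
      μ (k + 1) + μ k + δ ≤ M →
      (∀ i j, 1 ≤ i → 1 ≤ j → i + j = k + 2 → μ i * μ j ≤ M) →
      |g t x| ≤ C * (M * R ^ (s - k)) := by
  induction hg using Submodule.span_induction with
  | mem g hg =>
    rcases hg with ((⟨a, J, hJ, rfl⟩ | ⟨J, hJ, rfl⟩) | ⟨I, J, hI, hJ, h, rfl⟩) | ⟨J, hJ, rfl⟩
    · refine ⟨2, by norm_num, fun t x R M δ μ hR hx hδ hμ hf hG hM hM2 => ?_⟩
      have h1 := hf J hJ.le
      rw [hJ] at h1
      have h2 : R ^ (s - k) = R * R ^ (s - ((k + 1 : ℕ) : ℝ)) := by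
        rw [show s - k = (s - ((k + 1 : ℕ) : ℝ)) + 1 by push_cast; ring, Real.rpow_add_one hR.ne']
        ring
      have h3 : 0 ≤ R ^ (s - ((k + 1 : ℕ) : ℝ)) := (Real.rpow_pos_of_pos hR _).le
      have h4 : μ (k + 1) ≤ M := by linarith [hμ k]
      rw [mul_ev, abs_mul, X_ev, h2]
      calc |x a| * |D J f t x| ≤ (2 * R) * (M * R ^ (s - ((k + 1 : ℕ) : ℝ))) := by
            gcongr
            · exact (abs_coord_le x a).trans hx
            · exact h1.trans (by gcongr)
        _ = _ := by ring
    · refine ⟨1, by norm_num, fun t x R M δ μ hR hx hδ hμ hf hG hM hM2 => ?_⟩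
      have h1 := hf J (by omega)
      rw [hJ] at h1
      have h3 : 0 ≤ R ^ (s - (k : ℝ)) := (Real.rpow_pos_of_pos hR _).le
      rw [one_mul]
      refine h1.trans ?_
      gcongr
      linarith [hμ (k + 1)]
    · refine ⟨|ϑ|, abs_nonneg _, fun t x R M δ μ hR hx hδ hμ hf hG hM hM2 => ?_⟩
      rcases hs with hs | hs
      · simp [hs]
      have h1 := hf I (by omega)
      have h2 := hf J (by omega)
      rw [smul_ev, mul_ev, abs_mul, abs_mul]
      have h3 : R ^ (s - k) = R ^ (s - I.length) * R ^ (s - J.length) := by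
        rw [← Real.rpow_add hR]
        congr 1
        have : (I.length : ℝ) + J.length = k + 2 := by exact_mod_cast h
        linarith
      have h4 := hM2 _ _ hI hJ h
      have h5 : 0 ≤ R ^ (s - (k : ℝ)) := (Real.rpow_pos_of_pos hR _).le
      refine mul_le_mul_of_nonneg_left ?_ (abs_nonneg _)
      calc |D I f t x| * |D J f t x| ≤
            (μ I.length * R ^ (s - I.length)) * (μ J.length * R ^ (s - J.length)) :=
            mul_le_mul h1 h2 (abs_nonneg _) ((abs_nonneg _).trans h1)
        _ = (μ I.length * μ J.length) * R ^ (s - k) := by rw [h3]; ring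
        _ ≤ M * R ^ (s - k) := by gcongr
    · refine ⟨1, by norm_num, fun t x R M δ μ hR hx hδ hμ hf hG hM hM2 => ?_⟩
      have h1 := hG J hJ
      rw [hJ] at h1
      have h3 : 0 ≤ R ^ (s - (k : ℝ)) := (Real.rpow_pos_of_pos hR _).le
      rw [one_mul]
      refine h1.trans ?_
      gcongr
      linarith [hμ (k + 1), hμ k]
  | zero => exact ⟨0, le_rfl, by intros; simp⟩
  | add g h _ _ ihg ihh =>
    obtain ⟨C1, hC1, h1⟩ := ihg
    obtain ⟨C2, hC2, h2⟩ := ihh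
    refine ⟨C1 + C2, by positivity, fun t x R M δ μ hR hx hδ hμ hf hG hM hM2 => ?_⟩
    rw [add_ev, add_mul]
    exact (abs_add_le _ _).trans (add_le_add (h1 t x R M δ μ hR hx hδ hμ hf hG hM hM2)
      (h2 t x R M δ μ hR hx hδ hμ hf hG hM hM2))
  | smul c g _ ih =>
    obtain ⟨C1, hC1, h1⟩ := ih
    refine ⟨|c| * C1, by positivity, fun t x R M δ μ hR hx hδ hμ hf hG hM hM2 => ?_⟩
    rw [smul_ev, abs_mul, mul_assoc]
    gcongr
    exact h1 t x R M δ μ hR hx hδ hμ hf hG hM hM2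

/-- The weight `√(B + |x|²)`. -/
def wt (B : ℝ) (x : Eu n) : ℝ := √(B + ‖x‖ ^ 2)

lemma wt_pos {B : ℝ} (hB : 0 < B) (x : Eu n) : 0 < wt B x := Real.sqrt_pos.2 (by positivity)

lemma wt_sq {B : ℝ} (hB : 0 < B) (x : Eu n) : wt B x ^ 2 = B + ‖x‖ ^ 2 :=
  Real.sq_sqrt (by positivity)

lemma om_eq_wt_sq {B : ℝ} (hB : 0 < B) (t : ℝ) (x : Eu n) : om n B t x = wt B x ^ 2 := by
  rw [om_ev, wt_sq hB]

lemma norm_le_wt {B : ℝ} (hB : 0 < B) (x : Eu n) : ‖x‖ ≤ wt B x :=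
  Real.le_sqrt_of_sq_le (by linarith)

lemma omPow_eq_wt {B : ℝ} (hB : 0 < B) (s t : ℝ) (x : Eu n) :
    omPow n hB s t x = wt B x ^ (2 * s) := by
  rw [omPow_ev, ← wt_sq hB, Real.rpow_mul (wt_pos hB x).le]
  norm_num

lemma wt_near {B : ℝ} (hB : 0 < B) {x x₀ : Eu n} (h : ‖x - x₀‖ ≤ wt B x₀ / 2) :
    wt B x₀ / 2 ≤ wt B x ∧ wt B x ≤ 3 / 2 * wt B x₀ := by
  have h0 := wt_pos hB x₀
  have h1 := norm_le_wt hB x₀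
  have h2 := wt_sq hB x₀
  have h3 := wt_sq hB x
  have h4 := wt_pos hB x
  have h5 : ‖x₀‖ - ‖x‖ ≤ ‖x - x₀‖ := by rw [norm_sub_rev]; exact norm_sub_norm_le _ _
  have h6 : ‖x‖ - ‖x₀‖ ≤ ‖x - x₀‖ := norm_sub_norm_le _ _
  have h7 := norm_nonneg x
  have h8 := norm_nonneg x₀
  set w := wt B x₀
  constructor
  · refine le_of_sq_le_sq ?_ h4.le
    rcases le_total ‖x₀‖ (w / 2) with h | h
    · nlinarith
    · nlinarith [mul_nonneg (sub_nonneg.2 h) h0.le, mul_self_le_mul_self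
        (sub_nonneg.2 h) (show ‖x₀‖ - w / 2 ≤ ‖x‖ by linarith)]
  · refine le_of_sq_le_sq ?_ (by positivity)
    nlinarith [mul_self_le_mul_self h7 (show ‖x‖ ≤ ‖x₀‖ + w / 2 by linarith)]

lemma wt_rpow_near {B : ℝ} (hB : 0 < B) {x x₀ : Eu n} (h : ‖x - x₀‖ ≤ wt B x₀ / 2) {e E : ℝ}
    (he : |e| ≤ E) : wt B x ^ e ≤ 2 ^ E * wt B x₀ ^ e := by
  obtain ⟨h1, h2⟩ := wt_near hB h
  have h0 := wt_pos hB x₀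
  have hx := wt_pos hB x
  have h3 : wt B x = wt B x / wt B x₀ * wt B x₀ := by field_simp
  have h4 : 0 < wt B x / wt B x₀ := by positivity
  rw [h3, Real.mul_rpow h4.le h0.le]
  gcongr
  have h5 : wt B x / wt B x₀ ≤ 2 := by rw [div_le_iff₀ h0]; linarith
  have h6 : 2⁻¹ ≤ wt B x / wt B x₀ := by rw [le_div_iff₀ h0]; linarith
  calc (wt B x / wt B x₀) ^ e ≤ 2 ^ |e| := by
        rcases le_total 0 e with he | he
        · rw [abs_of_nonneg he]; gcongr
        · rw [abs_of_nonpos he, Real.rpow_neg (by norm_num), ← Real.inv_rpow (by norm_num)]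
          exact Real.rpow_le_rpow_of_nonpos (by norm_num) h6 he
    _ ≤ 2 ^ E := Real.rpow_le_rpow_of_exponent_le (by norm_num) he

lemma first_order_absorption {C d y : ℝ} (hC : 0 ≤ C) (hd : 0 ≤ d) (hd1 : d ≤ 1)
    (hCd : 64 * (C * d) ≤ 1) :
    2 * (C * d * (2 * (d + y) + (d + y) ^ 2)) ≤ 1 / 8 * y ^ 2 + 1000 * (C ^ 2 + C + 1) * d ^ 2 := by
  have h1 : C * d * y ≤ y ^ 2 / 64 + 16 * (C * d) ^ 2 := by nlinarith [sq_nonneg (y / 8 - 4 * (C * d))]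
  have h2 : C * d * (d + y) ^ 2 ≤ 2 * (C * d ^ 2) + y ^ 2 / 32 := by
    have : C * d * (d + y) ^ 2 ≤ C * d * (2 * d ^ 2 + 2 * y ^ 2) := by
      gcongr; nlinarith [sq_nonneg (d - y)]
    have h3 : C * d ^ 2 * d ≤ C * d ^ 2 * 1 := by gcongr
    nlinarith [sq_nonneg y]
  nlinarith [sq_nonneg d, mul_nonneg hC (sq_nonneg d)]

lemma second_order_absorption {C d y z : ℝ} (hC : 0 ≤ C) (hd : 0 ≤ d) (hd1 : d ≤ 1) (hy : 0 ≤ y) :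
    2 * (C * y * (z + (d + y) + z * (d + y) + (d + y) ^ 2)) ≤
      1 / 8 * z ^ 2 + 1000 * (C ^ 2 + C + 1) * (y ^ 2 + (y ^ 2) ^ 2) +
        1000 * (C ^ 2 + C + 1) * d ^ 2 := by
  have h1 : C * y * z ≤ z ^ 2 / 64 + 16 * (C * y) ^ 2 := by
    nlinarith [sq_nonneg (z / 8 - 4 * (C * y))]
  have h2 : C * y * (d + y) * z ≤ z ^ 2 / 64 + 16 * (C * y * (d + y)) ^ 2 := by
    nlinarith [sq_nonneg (z / 8 - 4 * (C * y * (d + y)))]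
  have hdy : (d + y) ^ 2 ≤ 2 * d ^ 2 + 2 * y ^ 2 := by nlinarith [sq_nonneg (d - y)]
  have hd2 : d ^ 2 ≤ 1 := by nlinarith
  have h3 : (C * y * (d + y)) ^ 2 ≤ C ^ 2 * (2 * y ^ 2 + 2 * (y ^ 2) ^ 2) := by
    calc (C * y * (d + y)) ^ 2 = C ^ 2 * (y ^ 2 * (d + y) ^ 2) := by ring
      _ ≤ C ^ 2 * (y ^ 2 * (2 * 1 + 2 * y ^ 2)) := by gcongr; linarith
      _ = _ := by ring
  have h4 : y * (d + y) ≤ d ^ 2 + 2 * y ^ 2 := by nlinarith [sq_nonneg (d - y)]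
  have h5 : y * (d + y) ^ 2 ≤ 2 * d ^ 2 + 2 * y ^ 2 + 2 * (y ^ 2) ^ 2 := by
    have : y * (2 * d ^ 2 + 2 * y ^ 2) ≤ 2 * d ^ 2 + 2 * y ^ 2 + 2 * (y ^ 2) ^ 2 := by
      have a1 : y * y ^ 2 ≤ (y ^ 2 + (y ^ 2) ^ 2) / 2 := by nlinarith [sq_nonneg (y - y ^ 2)]
      have a2 : y * d ^ 2 ≤ d ^ 2 + y ^ 2 := by
        have : y * d ^ 2 ≤ (y ^ 2 + (d ^ 2) ^ 2) / 2 := by nlinarith [sq_nonneg (y - d ^ 2)]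
        nlinarith [sq_nonneg d, sq_nonneg y]
      nlinarith [sq_nonneg (y ^ 2), sq_nonneg d, sq_nonneg y]
    exact (mul_le_mul_of_nonneg_left hdy hy).trans this
  have h6 := mul_le_mul_of_nonneg_left h4 hC
  have h7 := mul_le_mul_of_nonneg_left h5 hC
  have p1 := mul_nonneg hC (sq_nonneg d)
  have p2 := mul_nonneg hC (sq_nonneg y)
  have p3 := mul_nonneg hC (sq_nonneg (y ^ 2))
  have p4 := mul_nonneg (sq_nonneg C) (sq_nonneg d)
  have p5 := mul_nonneg (sq_nonneg C) (sq_nonneg y)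
  have p6 := mul_nonneg (sq_nonneg C) (sq_nonneg (y ^ 2))
  have e : C * y * (z + (d + y) + z * (d + y) + (d + y) ^ 2) = C * y * z + C * (y * (d + y)) +
    C * y * (d + y) * z + C * (y * (d + y) ^ 2) := by ring
  rw [e]
  nlinarith [sq_nonneg d, sq_nonneg y, sq_nonneg (y ^ 2)]

lemma sum_abs_mul_le {ι : Type*} [Fintype ι] (u v : ι → ℝ) {A M : ℝ} (hA : 0 ≤ A)
    (hu : ∀ i, |u i| ≤ A) (hv : ∀ i, |v i| ≤ M) :
    ∑ i, u i * v i ≤ Fintype.card ι * (A * M) := by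
  calc ∑ i, u i * v i ≤ ∑ _i : ι, A * M := Finset.sum_le_sum fun i _ => by
        calc u i * v i ≤ |u i| * |v i| := by rw [← abs_mul]; exact le_abs_self _
          _ ≤ A * M := mul_le_mul (hu i) (hv i) (abs_nonneg _) hA
    _ = _ := by simp

set_option maxHeartbeats 4000000 in
/-- Interior estimate: bounds on the derivatives of order at most `k` of a solution on a parabolic
cylinder give bounds on the derivatives of order `k + 1`. -/
theorem interior_step {B c l κ ϑ s : ℝ} (hB : 0 < B) (f G : SF n) (hf : IsQSol B c l κ ϑ f G)
    (hs : ϑ = 0 ∨ s = 2) (k : ℕ) :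
    ∃ C δ₀ : ℝ, 0 < δ₀ ∧ 0 ≤ C ∧ ∀ δ : ℝ, 0 < δ → δ ≤ δ₀ → ∀ (t₀ : ℝ) (x₀ : Eu n),
      (∀ t ∈ Set.Icc (t₀ - 1) t₀, ∀ x, ‖x - x₀‖ ≤ wt B x₀ / 2 →
        (∀ J : List (Fin n), J.length ≤ k → |D J f t x| ≤ δ * wt B x ^ (s - J.length)) ∧
        (∀ J : List (Fin n), J.length ≤ k + 1 → |D J G t x| ≤ δ * wt B x ^ (s - J.length))) →
      ∀ J : List (Fin n), J.length = k + 1 → |D J f t₀ x₀| ≤ C * δ * wt B x₀ ^ (s - (k + 1)) := by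
  classical
  choose Cc hCc0 hCc using fun J : List (Fin n) =>
    bound_lowerTerms f G hs (equation_mem_lowerTerms hf J)
  set C₂ : ℝ := ∑ i : Fin k → Fin n, (Cc (List.ofFn i) + ∑ b, Cc (b :: List.ofFn i)) with hC₂
  have hterm0 : ∀ i : Fin k → Fin n, 0 ≤ Cc (List.ofFn i) + ∑ b, Cc (b :: List.ofFn i) :=
    fun i => add_nonneg (hCc0 _) (Finset.sum_nonneg fun b _ => hCc0 _)
  have hC₂0 : 0 ≤ C₂ := Finset.sum_nonneg fun i _ => hterm0 i
  have hC₂le : ∀ i : Fin k → Fin n, Cc (List.ofFn i) + ∑ b, Cc (b :: List.ofFn i) ≤ C₂ :=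
    fun i => Finset.single_le_sum (f := fun i : Fin k → Fin n =>
      Cc (List.ofFn i) + ∑ b, Cc (b :: List.ofFn i)) (fun j _ => hterm0 j) (Finset.mem_univ i)
  have hC₂a : ∀ i : Fin k → Fin n, Cc (List.ofFn i) ≤ C₂ := fun i => by
    have := hC₂le i
    have := Finset.sum_nonneg (s := Finset.univ) fun (b : Fin n) _ => hCc0 (b :: List.ofFn i)
    linarith
  have hC₂b : ∀ (i : Fin k → Fin n) b, Cc (b :: List.ofFn i) ≤ C₂ := fun i b => by
    have := hC₂le i
    have := Finset.single_le_sum (f := fun b : Fin n => Cc (b :: List.ofFn i))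
      (fun b _ => hCc0 _) (Finset.mem_univ b)
    linarith [hCc0 (List.ofFn i)]
  set N : ℝ := (Fintype.card (Fin k → Fin n) : ℝ) with hN
  have hN0 : 0 ≤ N := by positivity
  set C₃ : ℝ := N * (n + 1) * C₂ with hC₃
  have hC₃0 : 0 ≤ C₃ := by positivity
  set E : ℝ := (2 : ℝ) ^ (|s| + (k + 1)) with hE
  have hE0 : 0 < E := by positivity
  set A : ℝ := (N + 1) * E with hA
  have hA0 : 0 < A := by positivity
  set C₁ : ℝ := 1000 * (C₃ ^ 2 + C₃ + 1) with hC₁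
  have hC₁0 : 0 ≤ C₁ := by positivity
  obtain ⟨K, hK⟩ : ∃ K : ℝ, K = (2 + 2 * C₁ + 256 * 4 ^ 2 / (1 / 8) + 16 * n * 4) / (1 / 8) :=
    ⟨_, rfl⟩
  obtain ⟨L, hL⟩ : ∃ L : ℝ, L = C₁ + K * C₁ + 1 := ⟨_, rfl⟩
  have hK0 : 0 ≤ K := by rw [hK]; positivity
  have hL1 : 1 ≤ L := by rw [hL]; linarith only [mul_nonneg hK0 hC₁0, hC₁0]
  have hKL : 1 ≤ 2 * K + L := by linarith
  set Q : ℝ := 2 * K + L + 64 * C₃ + 2 * |ϑ| with hQ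
  have hQ1 : 1 ≤ Q := by have := abs_nonneg ϑ; linarith
  refine ⟨√(2 * K + L) * A, 1 / (A * Q + 2 * |ϑ| + 1), by positivity, by positivity, ?_⟩
  intro δ hδ hδ0 t₀ x₀ hyp J hJ
  rw [le_div_iff₀ (by positivity)] at hδ0
  set d : ℝ := A * δ with hd
  have hd0 : 0 < d := by positivity
  have hdQ : d * Q ≤ 1 := by
    have := mul_nonneg hδ.le (abs_nonneg ϑ); rw [hd]; linarith only [this, hδ0, hδ]
  have hd1 : d ≤ 1 := by nlinarith only [hdQ, hd0, hQ1]
  have hϑδ : |ϑ| * δ ≤ 1 / 2 := by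
    have h1 : 0 ≤ δ * (A * Q) := by positivity
    linarith only [h1, hδ, hδ0]
  have hC₃d : 64 * (C₃ * d) ≤ 1 := by
    have : d * (64 * C₃) ≤ d * Q := by
      gcongr; rw [hQ]; have := abs_nonneg ϑ; linarith
    linarith
  have hKLd : (2 * K + L) * d ^ 2 ≤ 1 := by
    have : d * (2 * K + L) ≤ d * Q := by
      gcongr; rw [hQ]; have := abs_nonneg ϑ; linarith
    nlinarith only [this, hdQ, hd0, hd1]
  set R : ℝ := wt B x₀ with hR
  have hR0 : 0 < R := wt_pos hB x₀
  have hEδ : E * δ ≤ d := by rw [hd, hA]; linarith only [mul_nonneg hN0 (mul_pos hE0 hδ).le]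
  clear_value N C₂ C₃ E A C₁ Q d
  have hyp1 : ∀ t ∈ Set.Icc (t₀ - 1) t₀, ∀ x, ‖x - x₀‖ ≤ R / 2 → ∀ J : List (Fin n),
      J.length ≤ k → |D J f t x| ≤ E * δ * R ^ (s - J.length) := by
    intro t ht x hx J hJ
    refine ((hyp t ht x hx).1 J hJ).trans ?_
    have : wt B x ^ (s - J.length) ≤ E * R ^ (s - J.length) := by
      rw [hE]
      refine wt_rpow_near hB hx ((abs_sub _ _).trans ?_)
      have h1 : (J.length : ℝ) ≤ k := by exact_mod_cast hJ
      rw [abs_of_nonneg (by positivity : (0 : ℝ) ≤ (J.length : ℝ))]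
      linarith
    calc δ * wt B x ^ (s - J.length) ≤ δ * (E * R ^ (s - J.length)) := by gcongr
      _ = _ := by ring
  have hyp2 : ∀ t ∈ Set.Icc (t₀ - 1) t₀, ∀ x, ‖x - x₀‖ ≤ R / 2 → ∀ J : List (Fin n),
      J.length ≤ k + 1 → |D J G t x| ≤ d * R ^ (s - J.length) := by
    intro t ht x hx J hJ
    refine ((hyp t ht x hx).2 J hJ).trans ?_
    have : wt B x ^ (s - J.length) ≤ E * R ^ (s - J.length) := by
      rw [hE]
      refine wt_rpow_near hB hx ((abs_sub _ _).trans ?_)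
      have h1 : (J.length : ℝ) ≤ k + 1 := by exact_mod_cast hJ
      rw [abs_of_nonneg (by positivity : (0 : ℝ) ≤ (J.length : ℝ))]
      linarith
    calc δ * wt B x ^ (s - J.length) ≤ δ * (E * R ^ (s - J.length)) := by gcongr
      _ = (E * δ) * R ^ (s - J.length) := by ring
      _ ≤ _ := by gcongr
  set F : (Fin k → Fin n) → SF n := fun i => R ^ (k - s) • D (List.ofFn i) f with hF
  have hRR : R ^ (k - s) * R ^ (s - k) = 1 := by
    rw [← Real.rpow_add hR0]; simp
  have hRp : 0 < R ^ (k - s) := Real.rpow_pos_of_pos hR0 _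
  have hRs : R ^ (s - k) = R * R ^ (s - (k + 1)) := by
    rw [show s - k = (s - (k + 1)) + 1 by ring, Real.rpow_add_one hR0.ne']; ring
  have hRs2 : R ^ (s - k) = R ^ 2 * R ^ (s - (k + 2)) := by
    rw [show s - k = (s - (k + 2)) + (2 : ℕ) by push_cast; ring, Real.rpow_add hR0,
      Real.rpow_natCast]; ring
  have hRk1 : R ^ (k - s) * R ^ (s - (k + 1)) = 1 / R := by
    rw [hRs] at hRR; field_simp; linarith
  have hofFn : ∀ J : List (Fin n), J.length = k → ∃ i : Fin k → Fin n, J = List.ofFn i := by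
    intro J hJ; subst hJ; exact ⟨J.get, (List.ofFn_get J).symm⟩
  set Y : ℝ → Eu n → ℝ := fun t x => ∑ i, ∑ b, dx b (F i) t x ^ 2 with hY
  set S : ℝ → Eu n → ℝ := fun t x => ∑ i, ∑ b, ∑ e, dx e (dx b (F i)) t x ^ 2 with hS
  have hY0 : ∀ t x, 0 ≤ Y t x := fun t x =>
    Finset.sum_nonneg fun i _ => Finset.sum_nonneg fun b _ => sq_nonneg _
  have hS0 : ∀ t x, 0 ≤ S t x := fun t x =>
    Finset.sum_nonneg fun i _ => Finset.sum_nonneg fun b _ => Finset.sum_nonneg fun e _ =>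
      sq_nonneg _
  have hYle : ∀ t x i b, |dx b (F i) t x| ≤ √(Y t x) := by
    intro t x i b
    refine Real.abs_le_sqrt ?_
    calc dx b (F i) t x ^ 2 ≤ ∑ b, dx b (F i) t x ^ 2 :=
          Finset.single_le_sum (f := fun b => dx b (F i) t x ^ 2) (fun _ _ => sq_nonneg _)
            (Finset.mem_univ b)
      _ ≤ Y t x := Finset.single_le_sum (f := fun i => ∑ b, dx b (F i) t x ^ 2)
            (fun _ _ => Finset.sum_nonneg fun _ _ => sq_nonneg _) (Finset.mem_univ i)
  have hSle : ∀ t x i b e, |dx e (dx b (F i)) t x| ≤ √(S t x) := by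
    intro t x i b e
    refine Real.abs_le_sqrt ?_
    calc dx e (dx b (F i)) t x ^ 2 ≤ ∑ e, dx e (dx b (F i)) t x ^ 2 :=
          Finset.single_le_sum (f := fun e => dx e (dx b (F i)) t x ^ 2) (fun _ _ => sq_nonneg _)
            (Finset.mem_univ e)
      _ ≤ ∑ b, ∑ e, dx e (dx b (F i)) t x ^ 2 :=
          Finset.single_le_sum (f := fun b => ∑ e, dx e (dx b (F i)) t x ^ 2)
            (fun _ _ => Finset.sum_nonneg fun _ _ => sq_nonneg _) (Finset.mem_univ b)
      _ ≤ S t x := Finset.single_le_sum (f := fun i => ∑ b, ∑ e, dx e (dx b (F i)) t x ^ 2)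
            (fun _ _ => Finset.sum_nonneg fun _ _ => Finset.sum_nonneg fun _ _ => sq_nonneg _)
            (Finset.mem_univ i)
  have hD1 : ∀ t x (J : List (Fin n)), J.length = k + 1 →
      |D J f t x| ≤ (R * √(Y t x)) * R ^ (s - (k + 1)) := by
    intro t x J hJ
    obtain ⟨b, J, rfl⟩ : ∃ b J', J = b :: J' := by
      cases J with
      | nil => simp at hJ
      | cons b J => exact ⟨b, J, rfl⟩
    obtain ⟨i, rfl⟩ := hofFn J (by simpa using hJ)
    have h1 := hYle t x i b
    simp only [hF, Derivation.map_smul, smul_ev, abs_mul, abs_of_pos hRp] at h1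
    calc |D (b :: List.ofFn i) f t x| = (R ^ (k - s) * |dx b (D (List.ofFn i) f) t x|) *
          R ^ (s - k) := by
          rw [D_cons, mul_right_comm, hRR, one_mul]
      _ ≤ √(Y t x) * R ^ (s - k) := by gcongr
      _ = _ := by rw [hRs]; ring
  have hD2 : ∀ t x (J : List (Fin n)), J.length = k + 2 →
      |D J f t x| ≤ (R ^ 2 * √(S t x)) * R ^ (s - (k + 2)) := by
    intro t x J hJ
    obtain ⟨e, b, J, rfl⟩ : ∃ e b J', J = e :: b :: J' := by
      match J with
      | [] => simp at hJ
      | [_] => simp at hJ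
      | e :: b :: J => exact ⟨e, b, J, rfl⟩
    obtain ⟨i, rfl⟩ := hofFn J (by simpa using hJ)
    have h1 := hSle t x i b e
    simp only [hF, Derivation.map_smul, smul_ev, abs_mul, abs_of_pos hRp] at h1
    calc |D (e :: b :: List.ofFn i) f t x| =
          (R ^ (k - s) * |dx e (dx b (D (List.ofFn i) f)) t x|) * R ^ (s - k) := by
          rw [D_cons, D_cons, mul_right_comm, hRR, one_mul]
      _ ≤ √(S t x) * R ^ (s - k) := by gcongr
      _ = _ := by rw [hRs2]; ring
  have hxR : ∀ x, ‖x - x₀‖ ≤ R / 2 → ‖x‖ ≤ 2 * R := fun x hx => by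
    have := (wt_near hB hx).2
    have := norm_le_wt hB x
    linarith
  have hmain := bernstein F (om n B + ϑ • f) (t₀ := t₀) (x₀ := x₀) (c₀ := 1 / 8) (C₀ := 4) hR0
    (by norm_num) (by norm_num) hC₁0 hd0 hK hL hKLd ?_ ?_ ?_ ?_
  · have h1 := hD1 t₀ x₀ J hJ
    refine h1.trans (mul_le_mul_of_nonneg_right ?_ (Real.rpow_pos_of_pos hR0 _).le)
    have h2 : R * √(Y t₀ x₀) = √(R ^ 2 * Y t₀ x₀) := by
      rw [Real.sqrt_mul (by positivity), Real.sqrt_sq hR0.le]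
    rw [h2, mul_assoc, ← hd, ← Real.sqrt_sq hd0.le, ← Real.sqrt_mul (by positivity)]
    exact Real.sqrt_le_sqrt hmain
  · intro t ht x hx
    have h1 : ∀ i, F i t x ^ 2 ≤ (E * δ) ^ 2 := by
      intro i
      refine sq_le_sq' ?_ ?_ <;>
      · have h2 := hyp1 t ht x hx (List.ofFn i) (by simp)
        rw [List.length_ofFn] at h2
        have h3 : |F i t x| ≤ E * δ := by
          simp only [hF, smul_ev, abs_mul, abs_of_pos hRp]
          calc R ^ (k - s) * |D (List.ofFn i) f t x| ≤ R ^ (k - s) * (E * δ * R ^ (s - k)) := by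
                gcongr
            _ = (R ^ (k - s) * R ^ (s - k)) * (E * δ) := by ring
            _ = _ := by rw [hRR, one_mul]
        have := abs_le.1 h3
        linarith [this.1, this.2]
    calc ∑ i, F i t x ^ 2 ≤ ∑ _i : Fin k → Fin n, (E * δ) ^ 2 := Finset.sum_le_sum fun i _ => h1 i
      _ = N * (E * δ) ^ 2 := by simp [hN]
      _ ≤ (N + 1) ^ 2 * (E * δ) ^ 2 := by gcongr; nlinarith only [hN0]
      _ = d ^ 2 := by rw [hd, hA]; ring
  · intro t ht x hx
    obtain ⟨h1, h2⟩ := wt_near hB hx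
    have hx0 := wt_pos hB x
    have h3 : |ϑ * f t x| ≤ 1 / 2 * wt B x ^ 2 := by
      rcases hs with hs | hs
      · rw [hs]; simp; positivity
      · have h4 := (hyp t ht x hx).1 [] (by simp)
        simp only [hs, D_nil, List.length_nil, Nat.cast_zero, sub_zero, Real.rpow_two] at h4
        rw [abs_mul]
        calc |ϑ| * |f t x| ≤ |ϑ| * (δ * wt B x ^ 2) := by gcongr
          _ = (|ϑ| * δ) * wt B x ^ 2 := by ring
          _ ≤ _ := by gcongr
    have h4 := abs_le.1 h3
    rw [add_ev, smul_ev, om_eq_wt_sq hB]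
    constructor <;> nlinarith only [h4.1, h4.2, h1, h2, hx0, hR0]
  · intro t ht x hx
    set y := R * √(Y t x) with hy
    have hy0 : 0 ≤ y := by positivity
    have hy2 : y ^ 2 = R ^ 2 * Y t x := by rw [hy, mul_pow, Real.sq_sqrt (hY0 t x)]
    have hyD := hD1 t x
    rw [← hy] at hyD
    clear_value y
    have hP : ∀ i, |dt (F i) t x - (om n B + ϑ • f) t x * lapl (F i) t x| ≤
        C₂ * (2 * (d + y) + (d + y) ^ 2) := by
      intro i
      have h1 := hCc (List.ofFn i) t x R (2 * (d + y) + (d + y) ^ 2) d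
        (fun j => if j ≤ k then d else y) hR0 (hxR x hx) hd0.le
        (fun j => by split_ifs <;> positivity) ?_ ?_ ?_ ?_
      · rw [List.length_ofFn] at h1
        have h2 : dt (F i) t x - (om n B + ϑ • f) t x * lapl (F i) t x = R ^ (k - s) *
            (dt (D (List.ofFn i) f) - (om n B + ϑ • f) * lapl (D (List.ofFn i) f)) t x := by
          simp only [hF, Derivation.map_smul, map_smul, smul_ev, sub_ev, mul_ev]; ring
        rw [h2, abs_mul, abs_of_pos hRp]
        calc _ ≤ R ^ (k - s) * (Cc (List.ofFn i) * ((2 * (d + y) + (d + y) ^ 2) * R ^ (s - k))) := by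
              gcongr
          _ = (R ^ (k - s) * R ^ (s - k)) * (Cc (List.ofFn i) * (2 * (d + y) + (d + y) ^ 2)) := by
              ring
          _ ≤ _ := by rw [hRR, one_mul]; gcongr; exact hC₂a i
      · intro J hJ
        rw [List.length_ofFn] at hJ
        split_ifs with h
        · exact (hyp1 t ht x hx J h).trans (by gcongr)
        · have h' : J.length = k + 1 := by omega
          rw [h']; push_cast; exact hyD J h'
      · intro J hJ
        rw [List.length_ofFn] at hJ
        exact hyp2 t ht x hx J (by omega)
      · simp only [List.length_ofFn, add_le_iff_nonpos_right, nonpos_iff_eq_zero, one_ne_zero,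
          if_false, le_refl, if_true]
        linarith [sq_nonneg (d + y)]
      · intro i j _ _ _
        have h2 : ∀ j, (if j ≤ k then d else y) ≤ d + y := fun j => by split_ifs <;> linarith
        have h3 : ∀ j, 0 ≤ (if j ≤ k then d else y) := fun j => by split_ifs <;> positivity
        calc _ ≤ (d + y) * (d + y) := mul_le_mul (h2 i) (h2 j) (h3 j) (by positivity)
          _ ≤ _ := by linarith [sq (d + y)]
    have hFd : ∀ i, |F i t x| ≤ d := by
      intro i
      have h2 := hyp1 t ht x hx (List.ofFn i) (by simp)
      rw [List.length_ofFn] at h2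
      simp only [hF, smul_ev, abs_mul, abs_of_pos hRp]
      calc R ^ (k - s) * |D (List.ofFn i) f t x| ≤ R ^ (k - s) * (E * δ * R ^ (s - k)) := by
            gcongr
        _ = (R ^ (k - s) * R ^ (s - k)) * (E * δ) := by ring
        _ ≤ _ := by rw [hRR, one_mul]; exact hEδ
    have h1 := sum_abs_mul_le (fun i => F i t x) _ hd0.le hFd hP
    rw [← hN] at h1
    have h2 := first_order_absorption (y := y) hC₃0 hd0.le hd1 hC₃d
    have h3 : N * (d * (C₂ * (2 * (d + y) + (d + y) ^ 2))) ≤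
        C₃ * d * (2 * (d + y) + (d + y) ^ 2) := by
      have : 0 ≤ N * (d * (C₂ * (2 * (d + y) + (d + y) ^ 2))) := by positivity
      have hn : (0 : ℝ) ≤ n := by positivity
      rw [hC₃]
      linarith only [mul_nonneg hn this]
    rw [hy2] at h2
    calc _ ≤ 2 * (C₃ * d * (2 * (d + y) + (d + y) ^ 2)) := by
          exact mul_le_mul_of_nonneg_left (h1.trans h3) (by norm_num)
      _ ≤ _ := by rw [hC₁]; linarith
  · intro t ht x hx
    set y := R * √(Y t x) with hy
    set z := R ^ 2 * √(S t x) with hz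
    have hy0 : 0 ≤ y := by positivity
    have hz0 : 0 ≤ z := by positivity
    have hy2 : y ^ 2 = R ^ 2 * Y t x := by rw [hy, mul_pow, Real.sq_sqrt (hY0 t x)]
    have hz2 : z ^ 2 = R ^ 4 * S t x := by rw [hz, mul_pow, Real.sq_sqrt (hS0 t x)]; ring
    set M : ℝ := z + (d + y) + z * (d + y) + (d + y) ^ 2 with hM
    have hM0 : 0 ≤ M := by positivity
    have hyD := hD1 t x
    have hzD := hD2 t x
    rw [← hy] at hyD
    rw [← hz] at hzD
    clear_value M y z
    have hP : ∀ i b, |dt (dx b (F i)) t x - (om n B + ϑ • f) t x * lapl (dx b (F i)) t x| ≤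
        C₂ * M / R := by
      intro i b
      have hle : (b :: List.ofFn i).length = k + 1 := by simp
      have h1 := hCc (b :: List.ofFn i) t x R M d
        (fun j => if j ≤ k then d else if j = k + 1 then y else z) hR0 (hxR x hx) hd0.le
        (fun j => by split_ifs <;> positivity) ?_ ?_ ?_ ?_
      · rw [hle] at h1
        have h2 : dt (dx b (F i)) t x - (om n B + ϑ • f) t x * lapl (dx b (F i)) t x =
            R ^ (k - s) * (dt (D (b :: List.ofFn i) f) -
              (om n B + ϑ • f) * lapl (D (b :: List.ofFn i) f)) t x := by
          simp only [hF, Derivation.map_smul, map_smul, smul_ev, sub_ev, mul_ev, D_cons]; ring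
        rw [h2, abs_mul, abs_of_pos hRp]
        push_cast at h1
        calc _ ≤ R ^ (k - s) * (Cc (b :: List.ofFn i) * (M * R ^ (s - (k + 1)))) := by
              gcongr
          _ = (R ^ (k - s) * R ^ (s - (k + 1))) * (Cc (b :: List.ofFn i) * M) := by
              ring
          _ = Cc (b :: List.ofFn i) * M / R := by rw [hRk1]; ring
          _ ≤ _ := by gcongr; exact hC₂b i b
      · intro J hJ
        rw [hle] at hJ
        split_ifs with h h'
        · exact (hyp1 t ht x hx J h).trans (by gcongr)
        · rw [h']; push_cast; exact hyD J h'
        · have h'' : J.length = k + 2 := by omega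
          rw [h'']; push_cast; exact hzD J h''
      · intro J hJ
        rw [hle] at hJ
        exact hyp2 t ht x hx J hJ.le
      · have e1 : ¬ (k + 1 + 1 ≤ k) := by omega
        have e2 : ¬ (k + 1 + 1 = k + 1) := by omega
        have e3 : ¬ (k + 1 ≤ k) := by omega
        simp only [hle, e1, e2, e3, if_false, if_true]
        rw [hM]
        have : 0 ≤ z * (d + y) := by positivity
        linarith only [this, sq_nonneg (d + y)]
      · intro i j hi hj hij
        rw [hle] at hij
        have hzw : 0 ≤ z * (d + y) := by positivity
        have hw : ∀ j, j ≤ k + 1 → (if j ≤ k then d else if j = k + 1 then y else z) ≤ d + y := by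
          intro j hj; split_ifs <;> first | linarith | omega
        have h3 : ∀ j, 0 ≤ (if j ≤ k then d else if j = k + 1 then y else z) :=
          fun j => by split_ifs <;> positivity
        have hb : ∀ j, (if j ≤ k then d else if j = k + 1 then y else z) ≤ z + (d + y) := by
          intro j; split_ifs <;> linarith
        rcases le_or_gt i (k + 1) with h | h
        · calc _ ≤ (d + y) * (z + (d + y)) := mul_le_mul (hw i h) (hb j) (h3 j) (by positivity)
            _ ≤ _ := by rw [hM]; linarith only [hzw, sq (d + y), hy0, hz0, hd0]
        · calc _ ≤ (z + (d + y)) * (d + y) := mul_le_mul (hb i) (hw j (by omega)) (h3 j)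
                (by positivity)
            _ ≤ _ := by rw [hM]; linarith only [hzw, sq (d + y), hy0, hz0, hd0]
    have hFy : ∀ i b, |dx b (F i) t x| ≤ y / R := fun i b => by
      rw [hy, mul_div_cancel_left₀ _ hR0.ne']; exact hYle t x i b
    have h1 : ∀ i, ∑ b, dx b (F i) t x *
        (dt (dx b (F i)) t x - (om n B + ϑ • f) t x * lapl (dx b (F i)) t x) ≤
        n * (y / R * (C₂ * M / R)) := by
      intro i
      have := sum_abs_mul_le (fun b => dx b (F i) t x) _ (by positivity) (hFy i) (hP i)
      rwa [Fintype.card_fin] at this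
    have h2 := second_order_absorption (y := y) (z := z) hC₃0 hd0.le hd1 hy0
    have h3 : ∑ i, ∑ b, dx b (F i) t x *
        (dt (dx b (F i)) t x - (om n B + ϑ • f) t x * lapl (dx b (F i)) t x) ≤
        N * (n * (y / R * (C₂ * M / R))) := by
      refine (Finset.sum_le_sum fun i _ => h1 i).trans ?_
      simp [hN]
    have h4 : R ^ 2 * (N * (n * (y / R * (C₂ * M / R)))) ≤ C₃ * y * M := by
      have : 0 ≤ N * (C₂ * y * M) := by positivity
      have e : R ^ 2 * (N * (n * (y / R * (C₂ * M / R)))) = n * (N * (C₂ * y * M)) := by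
        field_simp
      rw [e, hC₃]
      linarith only [this]
    rw [hy2, hz2, ← hM] at h2
    calc _ = 2 * (R ^ 2 * ∑ i, ∑ b, dx b (F i) t x *
          (dt (dx b (F i)) t x - (om n B + ϑ • f) t x * lapl (dx b (F i)) t x)) := by ring
      _ ≤ 2 * (C₃ * y * M) := by
          refine mul_le_mul_of_nonneg_left (le_trans ?_ h4) (by norm_num)
          gcongr
      _ ≤ _ := by rw [hC₁]; linarith

lemma wt_rpow_add {B : ℝ} (hB : 0 < B) (x : Eu n) (a b : ℝ) :
    wt B x ^ (a + b) = wt B x ^ a * wt B x ^ b := Real.rpow_add (wt_pos hB x) a b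

lemma wt_rpow_pos {B : ℝ} (hB : 0 < B) (x : Eu n) (a : ℝ) : 0 < wt B x ^ a :=
  Real.rpow_pos_of_pos (wt_pos hB x) a

lemma sqrt_le_wt {B : ℝ} (x : Eu n) : √B ≤ wt B x :=
  Real.sqrt_le_sqrt (by nlinarith [sq_nonneg ‖x‖])

/-- Weights are monotone in the exponent, up to constants. -/
lemma wt_rpow_le {B : ℝ} (hB : 0 < B) {a b : ℝ} (h : a ≤ b) (x : Eu n) :
    wt B x ^ a ≤ √B ^ (a - b) * wt B x ^ b := by
  have h0 := wt_pos hB x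
  have h1 : 0 < √B := Real.sqrt_pos.2 hB
  have h2 : wt B x ^ a = wt B x ^ (a - b) * wt B x ^ b := by
    rw [← wt_rpow_add hB]; congr 1; ring
  rw [h2]
  exact mul_le_mul_of_nonneg_right
    (Real.rpow_le_rpow_of_nonpos h1 (sqrt_le_wt x) (by linarith)) (wt_rpow_pos hB x b).le

lemma lapl_omPow {B : ℝ} (hB : 0 < B) (s t : ℝ) (x : Eu n) :
    lapl (omPow n hB s) t x = 2 * s * (n * omPow n hB (s - 1) t x +
      2 * (s - 1) * (‖x‖ ^ 2 * omPow n hB (s - 2) t x)) := by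
  have h : ∀ a, dx a (dx a (omPow n hB s)) t x = 2 * s * (omPow n hB (s - 1) t x +
      2 * (s - 1) * (x a ^ 2 * omPow n hB (s - 2) t x)) := by
    intro a
    rw [dx_omPow, Derivation.map_smul, Derivation.leibniz, dx_omPow, dx_X,
      show s - 1 - 1 = s - 2 by ring]
    simp only [smul_eq_mul, smul_ev, add_ev, mul_ev, X_ev, if_true, one_ev]
    ring
  rw [lapl_eq, sum_ev]
  simp only [h, ← Finset.mul_sum, Finset.sum_add_distrib, ← Finset.sum_mul]
  rw [EuclideanSpace.norm_sq_eq]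
  simp

lemma radial_omPow {B : ℝ} (hB : 0 < B) (s t : ℝ) (x : Eu n) :
    (∑ a, X a * dx a (omPow n hB s)) t x = 2 * s * (‖x‖ ^ 2 * omPow n hB (s - 1) t x) := by
  have h : ∀ a, X a t x * dx a (omPow n hB s) t x =
      2 * s * (x a ^ 2 * omPow n hB (s - 1) t x) := by
    intro a
    rw [dx_omPow]
    simp only [smul_ev, mul_ev, X_ev]
    ring
  simp only [sum_ev, mul_ev, h]
  rw [← Finset.mul_sum, ← Finset.sum_mul, EuclideanSpace.norm_sq_eq]
  simp

/-- The action of `Op` on powers of the weight. -/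
lemma Op_omPow {B : ℝ} (hB : 0 < B) (c l σ t : ℝ) (x : Eu n) :
    Op n B c l (omPow n hB (σ / 2)) t x =
      (σ * n + l + ‖x‖ ^ 2 / wt B x ^ 2 * (σ * (σ - 2 - c))) * wt B x ^ σ := by
  have e0 : omPow n hB (σ / 2) t x = wt B x ^ σ := by rw [omPow_eq_wt]; congr 1; ring
  have hw := wt_pos hB x
  have e1 : omPow n hB (σ / 2 - 1) t x = wt B x ^ σ / wt B x ^ 2 := by
    rw [omPow_eq_wt, show 2 * (σ / 2 - 1) = σ - (2 : ℕ) by push_cast; ring, Real.rpow_sub_natCast hw.ne']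
  have e2 : omPow n hB (σ / 2 - 2) t x = wt B x ^ σ / wt B x ^ 4 := by
    rw [omPow_eq_wt, show 2 * (σ / 2 - 2) = σ - (4 : ℕ) by push_cast; ring, Real.rpow_sub_natCast hw.ne']
  simp only [Op, add_ev, sub_ev, smul_ev, mul_ev, lapl_omPow, radial_omPow, om_eq_wt_sq hB, e0, e1, e2]
  field_simp
  ring

lemma vgrad_Op {B c l : ℝ} (f : SF n) (t : ℝ) (x : Eu n) :
    Op n B c l f t x = om n B t x * lapl f t x + vgrad (-(c • x)) f t x + l * f t x := by
  simp only [Op, add_ev, sub_ev, smul_ev, mul_ev, sum_ev, X_ev, vgrad, PiLp.neg_apply,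
    PiLp.smul_apply, smul_eq_mul, Finset.mul_sum, neg_mul, Finset.sum_neg_distrib, mul_assoc]
  ring

lemma inner_self_coord (x : Eu n) : ∑ i, x i * x i = ‖x‖ ^ 2 := by
  rw [EuclideanSpace.norm_sq_eq]
  exact Finset.sum_congr rfl fun i _ => by rw [Real.norm_eq_abs, sq_abs, sq]

lemma max_principle_Op {B c l : ℝ} (hB : 0 < B) (z : SF n) {t₁ T r₀ K' : ℝ} (L : ℕ)
    (hgrow : ∀ t ∈ Set.Icc t₁ T, ∀ x, r₀ ≤ ‖x‖ → z t x ≤ K' * om n B t x ^ L)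
    (h0 : ∀ x, r₀ ≤ ‖x‖ → z t₁ x ≤ 0)
    (hb : ∀ t ∈ Set.Icc t₁ T, ∀ x, ‖x‖ = r₀ → z t x ≤ 0)
    (hpde : ∀ t ∈ Set.Ioc t₁ T, ∀ x, r₀ < ‖x‖ → 0 < z t x → dt z t x ≤ Op n B c l z t x) :
    ∀ t ∈ Set.Icc t₁ T, ∀ x, r₀ ≤ ‖x‖ → z t x ≤ 0 := by
  refine max_principle hB z (K := 1 + |c| + |l|) (by positivity) L hgrow h0 hb
    fun t ht x hx hz => ⟨om n B t x, -(c • x), l, (om_pos hB t x).le, ?_, ?_, ?_, ?_⟩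
  · have := om_pos hB t x
    nlinarith [abs_nonneg c, abs_nonneg l]
  · have h1 : ∑ i, (-(c • x)) i * x i = -(c * ‖x‖ ^ 2) := by
      rw [← inner_self_coord, Finset.mul_sum, ← Finset.sum_neg_distrib]
      exact Finset.sum_congr rfl fun i _ => by simp; ring
    rw [h1, abs_neg, abs_mul, abs_of_nonneg (sq_nonneg ‖x‖), om_ev]
    nlinarith [abs_nonneg c, abs_nonneg l, mul_nonneg (abs_nonneg c) hB.le,
      mul_nonneg (abs_nonneg l) hB.le, mul_nonneg (abs_nonneg l) (sq_nonneg ‖x‖)]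
  · have := le_abs_self l
    linarith [abs_nonneg c]
  · rw [← vgrad_Op]; exact hpde t ht x hx hz

lemma Op_add (B c l : ℝ) (f g : SF n) : Op n B c l (f + g) = Op n B c l f + Op n B c l g := by
  simp only [Op, map_add, mul_add, smul_add, Finset.sum_add_distrib]
  abel

lemma Op_smul (B c l a : ℝ) (f : SF n) : Op n B c l (a • f) = a • Op n B c l f := by
  simp only [Op, map_smul, Derivation.map_smul, mul_smul_comm, smul_add, smul_sub,
    ← Finset.smul_sum, smul_comm a]

lemma Op_neg (B c l : ℝ) (f : SF n) : Op n B c l (-f) = -Op n B c l f := by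
  rw [← neg_one_smul ℝ, Op_smul, neg_one_smul]

lemma Op_sub (B c l : ℝ) (f g : SF n) : Op n B c l (f - g) = Op n B c l f - Op n B c l g := by
  rw [sub_eq_add_neg, Op_add, Op_neg, sub_eq_add_neg]

lemma Op_expT_mul (B c l μ : ℝ) (f : SF n) :
    Op n B c l (expT μ * f) = expT μ * Op n B c l f := by
  refine SF_ext fun t x => ?_
  have h1 : lapl (expT μ : SF n) = 0 := by simp [lapl_eq]
  simp only [Op, lapl_mul, Derivation.leibniz, dx_expT, h1]
  simp [Finset.mul_sum, mul_comm, mul_left_comm]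
  ring_nf
  congr 1
  simp only [Finset.mul_sum, mul_assoc]

/-- Comparison of a solution with a supersolution. -/
theorem abs_le_supersolution {B c l : ℝ} (hB : 0 < B) (f G H : SF n)
    (hf : dt f = Op n B c l f + G) {t₁ T r₀ K' : ℝ} (L : ℕ)
    (hH0 : ∀ t ∈ Set.Icc t₁ T, ∀ x, r₀ ≤ ‖x‖ → 0 ≤ H t x)
    (hH : ∀ t ∈ Set.Icc t₁ T, ∀ x, r₀ ≤ ‖x‖ → Op n B c l H t x + |G t x| ≤ dt H t x)
    (hgrow : ∀ t ∈ Set.Icc t₁ T, ∀ x, r₀ ≤ ‖x‖ → |f t x| ≤ K' * om n B t x ^ L)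
    (h0 : ∀ x, r₀ ≤ ‖x‖ → |f t₁ x| ≤ H t₁ x)
    (hb : ∀ t ∈ Set.Icc t₁ T, ∀ x, ‖x‖ = r₀ → |f t x| ≤ H t x) :
    ∀ t ∈ Set.Icc t₁ T, ∀ x, r₀ ≤ ‖x‖ → |f t x| ≤ H t x := by
  have hup : ∀ g : SF n, ∀ G' : SF n, dt g = Op n B c l g + G' → (∀ t x, |g t x| = |f t x|) →
      (∀ t x, |G' t x| = |G t x|) → ∀ t ∈ Set.Icc t₁ T, ∀ x, r₀ ≤ ‖x‖ → (g - H) t x ≤ 0 := by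
    intro g G' hg hgf hGG
    refine max_principle_Op (c := c) (l := l) hB (g - H) (K' := K') L ?_ ?_ ?_ ?_
    · intro t ht x hx
      have h1 := hgrow t ht x hx
      rw [← hgf] at h1
      rw [sub_ev]
      linarith only [hH0 t ht x hx, h1, le_abs_self (g t x)]
    · intro x hx
      have h1 := h0 x hx
      rw [← hgf] at h1
      rw [sub_ev]
      linarith only [h1, le_abs_self (g t₁ x)]
    · intro t ht x hx
      have h1 := hb t ht x hx
      rw [← hgf] at h1
      rw [sub_ev]
      linarith only [h1, le_abs_self (g t x)]
    · intro t ht x hx _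
      have h1 := hH t ⟨ht.1.le, ht.2⟩ x hx.le
      rw [← hGG] at h1
      rw [map_sub, hg, Op_sub, sub_ev, sub_ev, add_ev]
      linarith only [h1, le_abs_self (G' t x)]
  intro t ht x hx
  refine abs_le'.2 ⟨?_, ?_⟩
  · have := hup f G hf (fun _ _ => rfl) (fun _ _ => rfl) t ht x hx
    rw [sub_ev] at this; linarith only [this]
  · have := hup (-f) (-G) (by rw [map_neg, hf, Op_neg]; abel) (by simp) (by simp) t ht x hx
    rw [sub_ev, neg_ev] at this; linarith only [this]

lemma Op_expT_smul_mul (B c l μ A : ℝ) (h : SF n) (t : ℝ) (x : Eu n) :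
    Op n B c l (A • (expT μ * h)) t x = A * Real.exp (μ * t) * Op n B c l h t x := by
  rw [Op_smul, Op_expT_mul]; simp; ring

lemma dt_expT_smul_mul (μ A : ℝ) {h : SF n} (hh : dt h = 0) (t : ℝ) (x : Eu n) :
    dt (A • (expT μ * h)) t x = A * Real.exp (μ * t) * (μ * h t x) := by
  simp only [Derivation.map_smul, Derivation.leibniz, dt_expT, hh]; simp; ring

/-- Comparison with a separated barrier, for a forcing term that decays more slowly than the
solutions of the homogeneous equation. -/
theorem barrier_bound_slow {B c l : ℝ} (hB : 0 < B) (f G h : SF n) (hf : dt f = Op n B c l f + G)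
    (hh : dt h = 0) {t₁ T r₀ K' C₀ CF Λ₁ Λ₂ : ℝ} (L : ℕ) (hΛ : Λ₁ < Λ₂) (hCF : 0 ≤ CF)
    (hC₀ : 0 ≤ C₀) (hpos : ∀ t x, r₀ ≤ ‖x‖ → 0 ≤ h t x)
    (hOp : ∀ t x, r₀ ≤ ‖x‖ → Op n B c l h t x ≤ Λ₁ * h t x)
    (hG : ∀ t ∈ Set.Icc t₁ T, ∀ x, r₀ ≤ ‖x‖ → |G t x| ≤ CF * Real.exp (Λ₂ * t) * h t x)
    (hgrow : ∀ t ∈ Set.Icc t₁ T, ∀ x, r₀ ≤ ‖x‖ → |f t x| ≤ K' * om n B t x ^ L)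
    (h0 : ∀ x, r₀ ≤ ‖x‖ → |f t₁ x| ≤ C₀ * Real.exp (Λ₂ * t₁) * h t₁ x)
    (hb : ∀ t ∈ Set.Icc t₁ T, ∀ x, ‖x‖ = r₀ → |f t x| ≤ C₀ * Real.exp (Λ₂ * t) * h t x) :
    ∀ t ∈ Set.Icc t₁ T, ∀ x, r₀ ≤ ‖x‖ →
      |f t x| ≤ (C₀ + CF / (Λ₂ - Λ₁)) * Real.exp (Λ₂ * t) * h t x := by
  have hd : 0 < Λ₂ - Λ₁ := by linarith
  obtain ⟨A, hA⟩ : ∃ A, A = C₀ + CF / (Λ₂ - Λ₁) := ⟨_, rfl⟩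
  have hCA : C₀ ≤ A := by rw [hA]; have := div_nonneg hCF hd.le; linarith
  have hA0 : 0 ≤ A := hC₀.trans hCA
  have hAF : CF ≤ A * (Λ₂ - Λ₁) := by
    rw [hA, add_mul, div_mul_cancel₀ _ hd.ne']
    linarith [mul_nonneg hC₀ hd.le]
  rw [← hA]
  have hev : ∀ t x, (A • (expT Λ₂ * h) : SF n) t x = A * Real.exp (Λ₂ * t) * h t x :=
    fun t x => by simp [mul_assoc]
  have hmono : ∀ t x, r₀ ≤ ‖x‖ → C₀ * Real.exp (Λ₂ * t) * h t x ≤ A * Real.exp (Λ₂ * t) * h t x :=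
    fun t x hx => mul_le_mul_of_nonneg_right
      (mul_le_mul_of_nonneg_right hCA (Real.exp_pos _).le) (hpos t x hx)
  intro t ht x hx
  rw [← hev]
  refine abs_le_supersolution hB f G _ hf (K' := K') L ?_ ?_ hgrow ?_ ?_ t ht x hx
  · intro t _ x hx
    rw [hev]; exact mul_nonneg (mul_nonneg hA0 (Real.exp_pos _).le) (hpos t x hx)
  · intro t ht x hx
    rw [Op_expT_smul_mul, dt_expT_smul_mul _ _ hh]
    have h1 := hG t ht x hx
    have h2 := mul_le_mul_of_nonneg_left (hOp t x hx)
      (mul_nonneg hA0 (Real.exp_pos (Λ₂ * t)).le)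
    have h3 := mul_le_mul_of_nonneg_right hAF
      (mul_nonneg (Real.exp_pos (Λ₂ * t)).le (hpos t x hx))
    linarith only [h1, h2, h3]
  · intro x hx
    rw [hev]; exact (h0 x hx).trans (hmono t₁ x hx)
  · intro t ht x hx
    rw [hev]; exact (hb t ht x hx).trans (hmono t x hx.ge)

/-- Comparison with separated barriers. -/
theorem barrier_bound {B c l : ℝ} (hB : 0 < B) (f G h : SF n) (hf : dt f = Op n B c l f + G)
    (hh : dt h = 0) {t₁ T r₀ K' C₀ CF Λ₁ ΛF : ℝ} (L : ℕ) (hΛ : ΛF < Λ₁) (hCF : 0 ≤ CF)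
    (hC₀ : 0 ≤ C₀) (hpos : ∀ t x, r₀ ≤ ‖x‖ → 0 ≤ h t x)
    (hOp : ∀ t x, r₀ ≤ ‖x‖ → Op n B c l h t x ≤ Λ₁ * h t x)
    (hG : ∀ t ∈ Set.Icc t₁ T, ∀ x, r₀ ≤ ‖x‖ → |G t x| ≤ CF * Real.exp (ΛF * t) * h t x)
    (hgrow : ∀ t ∈ Set.Icc t₁ T, ∀ x, r₀ ≤ ‖x‖ → |f t x| ≤ K' * om n B t x ^ L)
    (h0 : ∀ x, r₀ ≤ ‖x‖ → |f t₁ x| ≤ C₀ * Real.exp (Λ₁ * t₁) * h t₁ x)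
    (hb : ∀ t ∈ Set.Icc t₁ T, ∀ x, ‖x‖ = r₀ → |f t x| ≤ C₀ * Real.exp (Λ₁ * t) * h t x) :
    ∀ t ∈ Set.Icc t₁ T, ∀ x, r₀ ≤ ‖x‖ →
      |f t x| ≤ (C₀ + CF / (Λ₁ - ΛF) * Real.exp ((ΛF - Λ₁) * t₁)) * Real.exp (Λ₁ * t) * h t x := by
  have hd : 0 < Λ₁ - ΛF := by linarith
  obtain ⟨A', hA'⟩ : ∃ A', A' = CF / (Λ₁ - ΛF) := ⟨_, rfl⟩
  have hA'0 : 0 ≤ A' := by rw [hA']; positivity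
  have hA'e : A' * (Λ₁ - ΛF) = CF := by rw [hA']; field_simp
  rw [← hA']
  obtain ⟨A, hA⟩ : ∃ A, A = C₀ + A' * Real.exp ((ΛF - Λ₁) * t₁) := ⟨_, rfl⟩
  rw [← hA]
  set H : SF n := A • (expT Λ₁ * h) - A' • (expT ΛF * h) with hH
  have hHev : ∀ t x, H t x = A * (Real.exp (Λ₁ * t) * h t x) - A' * (Real.exp (ΛF * t) * h t x) :=
    fun t x => by simp [hH]
  have hexp : ∀ t, t₁ ≤ t → Real.exp (ΛF * t) ≤ Real.exp ((ΛF - Λ₁) * t₁) * Real.exp (Λ₁ * t) := by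
    intro t ht
    rw [← Real.exp_add]
    refine Real.exp_le_exp.2 ?_
    nlinarith only [ht, hd]
  have hHlow : ∀ t x, t₁ ≤ t → r₀ ≤ ‖x‖ → C₀ * Real.exp (Λ₁ * t) * h t x ≤ H t x := by
    intro t x ht hx
    rw [hHev, hA]
    have := mul_le_mul_of_nonneg_right (mul_le_mul_of_nonneg_left (hexp t ht) hA'0) (hpos t x hx)
    linarith only [this]
  have hH0 : ∀ t x, t₁ ≤ t → r₀ ≤ ‖x‖ → 0 ≤ H t x := fun t x ht hx =>
    le_trans (mul_nonneg (mul_nonneg hC₀ (Real.exp_pos _).le) (hpos t x hx)) (hHlow t x ht hx)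
  have hHeq : ∀ t x, r₀ ≤ ‖x‖ → t₁ ≤ t →
      Op n B c l H t x + CF * Real.exp (ΛF * t) * h t x ≤ dt H t x := by
    intro t x hx ht
    have e1 : Op n B c l H t x = (A * Real.exp (Λ₁ * t) - A' * Real.exp (ΛF * t)) *
        Op n B c l h t x := by
      rw [hH, Op_sub, sub_ev, Op_expT_smul_mul, Op_expT_smul_mul]; ring
    have e2 : dt H t x = (A * (Λ₁ * Real.exp (Λ₁ * t)) - A' * (ΛF * Real.exp (ΛF * t))) * h t x := by
      rw [hH, map_sub, sub_ev, dt_expT_smul_mul _ _ hh, dt_expT_smul_mul _ _ hh]; ring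
    have e3 : 0 ≤ A * Real.exp (Λ₁ * t) - A' * Real.exp (ΛF * t) := by
      rw [hA]
      have := mul_le_mul_of_nonneg_left (hexp t ht) hA'0
      have h2 := mul_nonneg hC₀ (Real.exp_pos (Λ₁ * t)).le
      linarith only [this, h2]
    rw [e1, e2, ← hA'e]
    have := mul_le_mul_of_nonneg_left (hOp t x hx) e3
    linarith only [this]
  intro t ht x hx
  have hle : H t x ≤ A * Real.exp (Λ₁ * t) * h t x := by
    rw [hHev]
    have : 0 ≤ A' * (Real.exp (ΛF * t) * h t x) :=
      mul_nonneg hA'0 (mul_nonneg (Real.exp_pos _).le (hpos t x hx))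
    linarith only [this]
  refine le_trans ?_ hle
  refine abs_le_supersolution hB f G H hf (K' := K') L (fun t ht x hx => hH0 t x ht.1 hx)
    (fun t ht x hx => ?_) hgrow (fun x hx => (h0 x hx).trans (hHlow t₁ x le_rfl hx))
    (fun t ht x hx => (hb t ht x hx).trans (hHlow t x ht.1 hx.ge)) t ht x hx
  linarith only [hG t ht x hx, hHeq t x hx ht.1]

lemma Op_sum {ι : Type*} (s : Finset ι) (B c l : ℝ) (f : ι → SF n) :
    Op n B c l (∑ i ∈ s, f i) = ∑ i ∈ s, Op n B c l (f i) := by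
  classical
  induction s using Finset.induction_on with
  | empty => simpa using Op_smul B c l 0 (0 : SF n)
  | insert a s ha ih => rw [Finset.sum_insert ha, Finset.sum_insert ha, Op_add, ih]

lemma lapl_Op (B c l : ℝ) (f : SF n) :
    lapl (Op n B c l f) = Op n B (c - 4) (l + 2 * n - 2 * c) (lapl f) := by
  have h : ∀ a, dx a (dx a (Op n B c l f)) = Op n B c (l - 2 * c) (dx a (dx a f)) +
      ((4 : ℝ) • (X a * dx a (lapl f)) + (2 : ℝ) • lapl f) := by
    intro a
    rw [dx_Op, map_add, dx_Op, Derivation.map_smul, Derivation.leibniz, dx_X, ← dx_lapl]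
    refine SF_ext fun t x => ?_
    simp [Op]
    ring
  rw [lapl_eq (Op n B c l f)]
  simp only [h, Finset.sum_add_distrib, ← Finset.smul_sum, ← Op_sum, ← lapl_eq]
  refine SF_ext fun t x => ?_
  simp [Op]
  ring

/-- `f` is eventually bounded by a multiple of `e^{μt} (B + |x|²)^{s/2}`. -/
def Dec (B μ s : ℝ) (f : SF n) : Prop :=
  ∃ C T : ℝ, 0 ≤ C ∧ 0 ≤ T ∧ ∀ t, T ≤ t → ∀ x, |f t x| ≤ C * Real.exp (μ * t) * wt B x ^ s

/-- Symbol-type bounds for the spatial derivatives of order at least `r`. -/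
def Sym (B μ s : ℝ) (r : ℕ) (f : SF n) : Prop :=
  ∀ J : List (Fin n), r ≤ J.length → Dec B μ (s - J.length) (D J f)

section
variable {B μ μ' s s' : ℝ} {f g : SF n} {r r' : ℕ}

lemma Dec.mono (hB : 0 < B) (h : Dec B μ s f) (hμ : μ ≤ μ') (hs : s ≤ s') : Dec B μ' s' f := by
  obtain ⟨C, T, hC, hT, h⟩ := h
  refine ⟨C * √B ^ (s - s'), T, by positivity, hT, fun t ht x => (h t ht x).trans ?_⟩
  have h1 : Real.exp (μ * t) ≤ Real.exp (μ' * t) :=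
    Real.exp_le_exp.2 (mul_le_mul_of_nonneg_right hμ (hT.trans ht))
  calc C * Real.exp (μ * t) * wt B x ^ s
      ≤ C * Real.exp (μ' * t) * (√B ^ (s - s') * wt B x ^ s') :=
        mul_le_mul (mul_le_mul_of_nonneg_left h1 hC) (wt_rpow_le hB hs x)
          (wt_rpow_pos hB x s).le (by positivity)
    _ = _ := by ring

lemma Dec.add (hf : Dec B μ s f) (hg : Dec B μ s g) : Dec B μ s (f + g) := by
  obtain ⟨C, T, hC, hT, hf⟩ := hf
  obtain ⟨C', T', hC', hT', hg⟩ := hg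
  refine ⟨C + C', max T T', add_nonneg hC hC', le_max_of_le_left hT, fun t ht x => ?_⟩
  rw [add_ev]
  have h1 := hf t ((le_max_left _ _).trans ht) x
  have h2 := hg t ((le_max_right _ _).trans ht) x
  calc _ ≤ |f t x| + |g t x| := abs_add_le _ _
    _ ≤ _ := by linarith

lemma Dec.smul (a : ℝ) (hf : Dec B μ s f) : Dec B μ s (a • f) := by
  obtain ⟨C, T, hC, hT, hf⟩ := hf
  refine ⟨|a| * C, T, by positivity, hT, fun t ht x => ?_⟩
  rw [smul_ev, abs_mul, mul_assoc, mul_assoc]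
  exact mul_le_mul_of_nonneg_left ((hf t ht x).trans_eq (mul_assoc _ _ _)) (abs_nonneg a)

lemma Dec.mul (hB : 0 < B) (hf : Dec B μ s f) (hg : Dec B μ' s' g) :
    Dec B (μ + μ') (s + s') (f * g) := by
  obtain ⟨C, T, hC, hT, hf⟩ := hf
  obtain ⟨C', T', hC', hT', hg⟩ := hg
  refine ⟨C * C', max T T', mul_nonneg hC hC', le_max_of_le_left hT, fun t ht x => ?_⟩
  rw [mul_ev, abs_mul, wt_rpow_add hB, add_mul, Real.exp_add]
  have h1 := hf t ((le_max_left _ _).trans ht) x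
  have h2 := hg t ((le_max_right _ _).trans ht) x
  refine (mul_le_mul h1 h2 (abs_nonneg _) ((abs_nonneg _).trans h1)).trans_eq ?_
  ring

lemma Dec.zero : Dec B μ s (0 : SF n) := ⟨0, 0, le_rfl, le_rfl, fun t _ x => by simp⟩

lemma Dec.sum {ι : Type*} (S : Finset ι) {f : ι → SF n}
    (h : ∀ i ∈ S, Dec B μ s (f i)) : Dec B μ s (∑ i ∈ S, f i) := by
  classical
  induction S using Finset.induction_on with
  | empty => simpa using Dec.zero
  | insert a S ha ih =>
    rw [Finset.sum_insert ha]
    exact (h a (Finset.mem_insert_self a S)).add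
      (ih fun i hi => h i (Finset.mem_insert_of_mem hi))

lemma Sym.dec (h : Sym B μ s 0 f) : Dec B μ s f := by simpa using h [] le_rfl

lemma Sym.dec_D (h : Sym B μ s r f) (J : List (Fin n)) (hJ : r ≤ J.length) {s' : ℝ}
    (hs : s' = s - J.length) : Dec B μ s' (D J f) := hs ▸ h J hJ

lemma Sym.mono (hB : 0 < B) (h : Sym B μ s r f) (hμ : μ ≤ μ') (hs : s ≤ s') (hr : r ≤ r') :
    Sym B μ' s' r' f := fun J hJ => (h J (hr.trans hJ)).mono hB hμ (by linarith)

lemma Sym.add (hf : Sym B μ s r f) (hg : Sym B μ s r g) : Sym B μ s r (f + g) :=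
  fun J hJ => by rw [map_add]; exact (hf J hJ).add (hg J hJ)

lemma Sym.smul (a : ℝ) (hf : Sym B μ s r f) : Sym B μ s r (a • f) :=
  fun J hJ => by rw [map_smul]; exact (hf J hJ).smul a

lemma Sym.neg (hf : Sym B μ s r f) : Sym B μ s r (-f) := by
  rw [← neg_one_smul ℝ]; exact hf.smul _

lemma Sym.sub (hf : Sym B μ s r f) (hg : Sym B μ s r g) : Sym B μ s r (f - g) := by
  rw [sub_eq_add_neg]; exact hf.add hg.neg

lemma Sym.zero : Sym B μ s r (0 : SF n) := fun J _ => by rw [map_zero]; exact Dec.zero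

lemma Sym.sum {ι : Type*} (S : Finset ι) {f : ι → SF n}
    (h : ∀ i ∈ S, Sym B μ s r (f i)) : Sym B μ s r (∑ i ∈ S, f i) := fun J hJ => by
  rw [map_sum]; exact Dec.sum S fun i hi => h i hi J hJ

lemma Sym.dx (h : Sym B μ s r f) (a : Fin n) : Sym B μ (s - 1) (r - 1) (dx a f) := fun J hJ => by
  rw [D_dx]
  refine h.dec_D (a :: J) (by simp; omega) ?_
  simp; ring

lemma Sym.of_dx (h : ∀ a, Sym B μ (s - 1) r (FastDiffusion.dx a f)) : Sym B μ s (r + 1) f := fun J hJ => by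
  cases J with
  | nil => simp at hJ
  | cons a J =>
    rw [D_cons, ← D_dx]
    refine (h a).dec_D J (by simpa using hJ) ?_
    simp; ring

lemma Sym.D (h : Sym B μ s r f) (I : List (Fin n)) :
    Sym B μ (s - I.length) (r - I.length) (D I f) := fun J hJ => by
  rw [← D_append]
  refine h.dec_D (J ++ I) (by simp; omega) ?_
  simp; ring

lemma Sym.lapl (h : Sym B μ s r f) : Sym B μ (s - 2) (r - 2) (lapl f) := by
  rw [lapl_eq]
  refine Sym.sum _ fun a _ => ?_
  have := (h.dx a).dx a
  rw [show s - 2 = s - 1 - 1 by ring]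
  exact this

lemma Sym.mul (hB : 0 < B) (hf : Sym B μ s 0 f) (hg : Sym B μ' s' 0 g) :
    Sym B (μ + μ') (s + s') 0 (f * g) := by
  intro J _
  induction J generalizing f g s s' with
  | nil => simpa using hf.dec.mul hB hg.dec
  | cons a J ih =>
    rw [D_cons, ← D_dx, Derivation.leibniz, map_add, smul_eq_mul, smul_eq_mul]
    refine Dec.add ?_ ?_
    · have := ih hf (hg.dx a) (Nat.zero_le _)
      convert this using 1
      simp; ring
    · have := ih (hf.dx a) hg (Nat.zero_le _)
      rw [mul_comm]
      convert this using 1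
      simp; ring

lemma Sym.X (hB : 0 < B) (a : Fin n) : Sym B 0 1 0 (X a : SF n) := by
  intro J _
  match J with
  | [] =>
    refine ⟨1, 0, zero_le_one, le_rfl, fun t _ x => ?_⟩
    simpa using (abs_coord_le x a).trans (norm_le_wt hB x)
  | [b] =>
    refine ⟨1, 0, zero_le_one, le_rfl, fun t _ x => ?_⟩
    rw [D_cons, D_nil, dx_X]
    split_ifs <;> simp
  | b :: c :: J =>
    have h : FastDiffusion.D (b :: c :: J) (FastDiffusion.X a : SF n) = 0 := by
      rw [D_cons, ← D_dx, dx_X, D_cons, ← D_dx]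
      split_ifs <;> simp
    rw [h]; exact Dec.zero

/-- Multiplication by a coordinate for functions with control only on higher derivatives. -/
lemma Sym.X_mul (hB : 0 < B) (h : Sym B μ s r f) (a : Fin n) :
    Sym B μ (s + 1) (r + 1) (FastDiffusion.X a * f) := by
  induction r generalizing f s with
  | zero =>
    have := ((Sym.X hB a).mul hB h).mono hB (μ' := μ) (s' := s + 1) (by simp) (by linarith)
      (Nat.zero_le 1)
    exact this
  | succ r ih =>
    refine Sym.of_dx fun b => ?_
    rw [Derivation.leibniz, smul_eq_mul, smul_eq_mul, dx_X]
    refine Sym.add ?_ ?_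
    · have := ih (h.dx b)
      convert this using 1
      ring
    · split_ifs
      · rw [mul_one]; exact h.mono hB le_rfl (by linarith) (by omega)
      · rw [mul_zero]; exact Sym.zero

end

lemma Dec.unif {B μ s : ℝ} {f : SF n} {k : ℕ}
    (h : ∀ J : List (Fin n), J.length ≤ k → Dec B μ (s - J.length) (D J f)) :
    ∃ C T : ℝ, 0 ≤ C ∧ 0 ≤ T ∧ ∀ J : List (Fin n), J.length ≤ k → ∀ t, T ≤ t → ∀ x,
      |D J f t x| ≤ C * Real.exp (μ * t) * wt B x ^ (s - J.length) := by
  classical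
  choose! C T hC hT hb using h
  have hfin := List.finite_length_le (Fin n) k
  refine ⟨∑ J ∈ hfin.toFinset, C J, ∑ J ∈ hfin.toFinset, T J,
    Finset.sum_nonneg fun J hJ => hC J (by simpa using hJ),
    Finset.sum_nonneg fun J hJ => hT J (by simpa using hJ), fun J hJ t ht x => ?_⟩
  have hm : J ∈ hfin.toFinset := by simpa using hJ
  have h1 := Finset.single_le_sum (f := T) (fun J hJ => hT J (by simpa using hJ)) hm
  have h2 := Finset.single_le_sum (f := C) (fun J hJ => hC J (by simpa using hJ)) hm
  refine (hb J hJ t (h1.trans ht) x).trans ?_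
  have : 0 ≤ wt B x ^ (s - J.length) := Real.rpow_nonneg (Real.sqrt_nonneg _) _
  gcongr

/-- Decaying solutions satisfy symbol-type bounds. -/
theorem sym_of_bound {B c l κ ϑ s μ : ℝ} (hB : 0 < B) {f G : SF n}
    (hf : IsQSol B c l κ ϑ f G) (hs : ϑ = 0 ∨ s = 2) (hμ : μ < 0) (h : Dec B μ s f)
    (hG : Sym B μ s 0 G) : Sym B μ s 0 f := by
  suffices H : ∀ k, ∀ J : List (Fin n), J.length ≤ k → Dec B μ (s - J.length) (D J f) from
    fun J _ => H _ J le_rfl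
  intro k
  induction k with
  | zero =>
    intro J hJ
    obtain rfl := List.length_eq_zero_iff.1 (Nat.le_zero.1 hJ)
    simpa using h
  | succ k ih =>
    obtain ⟨C₁, T₁, hC₁, hT₁, h1⟩ := Dec.unif ih
    obtain ⟨C₂, T₂, hC₂, hT₂, h2⟩ := Dec.unif (k := k + 1) fun J _ => hG J (Nat.zero_le _)
    obtain ⟨C, δ₀, hδ₀, hC, hstep⟩ := interior_step hB f G hf hs k
    obtain ⟨A, hA⟩ : ∃ A, A = C₁ + C₂ + 1 := ⟨_, rfl⟩
    have hA0 : 0 < A := by rw [hA]; positivity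
    have hlim : Tendsto (fun t : ℝ => A * Real.exp (μ * (t - 1))) atTop (𝓝 0) := by
      rw [← mul_zero A]
      refine Tendsto.const_mul _ (Real.tendsto_exp_atBot.comp ?_)
      exact (tendsto_id.atTop_add tendsto_const_nhds).const_mul_atTop_of_neg hμ
    obtain ⟨T₃, hT₃⟩ := eventually_atTop.1 (hlim.eventually (ge_mem_nhds hδ₀))
    intro J hJ
    rcases hJ.lt_or_eq with hJ | hJ
    · exact ih J (by omega)
    refine ⟨C * A * Real.exp (-μ), max (T₁ + T₂ + 1) T₃, by positivity,
      le_max_of_le_left (by positivity), fun t ht x => ?_⟩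
    have ht1 : T₁ + T₂ + 1 ≤ t := (le_max_left _ _).trans ht
    have := hstep _ (mul_pos hA0 (Real.exp_pos _)) (hT₃ t ((le_max_right _ _).trans ht)) t x
      (fun t' ht' y _ => ?_) J hJ
    · rw [hJ]
      refine this.trans_eq ?_
      push_cast
      rw [mul_sub, mul_one, sub_eq_add_neg (μ * t), Real.exp_add]
      ring
    · have hexp : Real.exp (μ * t') ≤ Real.exp (μ * (t - 1)) :=
        Real.exp_le_exp.2 (mul_le_mul_of_nonpos_left ht'.1 hμ.le)
      have hw : ∀ J : List (Fin n), 0 ≤ wt B y ^ (s - J.length) := fun J =>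
        (wt_rpow_pos hB y _).le
      refine ⟨fun J hJ => (h1 J hJ t' (by linarith [ht'.1]) y).trans ?_,
        fun J hJ => (h2 J hJ t' (by linarith [ht'.1]) y).trans ?_⟩
      · refine mul_le_mul_of_nonneg_right ?_ (hw J)
        exact mul_le_mul (by rw [hA]; linarith) hexp (Real.exp_pos _).le hA0.le
      · refine mul_le_mul_of_nonneg_right ?_ (hw J)
        exact mul_le_mul (by rw [hA]; linarith) hexp (Real.exp_pos _).le hA0.le

lemma wt_rpow_le_om_pow {B : ℝ} (hB : 0 < B) (s t : ℝ) (x : Eu n) :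
    wt B x ^ s ≤ √B ^ (s - 2 * (⌈|s|⌉₊ : ℝ)) * om n B t x ^ ⌈|s|⌉₊ := by
  have h1 : om n B t x ^ ⌈|s|⌉₊ = wt B x ^ (2 * (⌈|s|⌉₊ : ℝ)) := by
    rw [om_eq_wt_sq hB, ← pow_mul, ← Real.rpow_natCast]; push_cast; rfl
  rw [h1]
  refine wt_rpow_le hB ?_ x
  have h2 := Nat.le_ceil |s|
  have h3 := le_abs_self s
  have h4 := abs_nonneg s
  linarith

lemma exp_mul_le {μ t T : ℝ} (h0 : 0 ≤ t) (h : t ≤ T) : Real.exp (μ * t) ≤ Real.exp (|μ| * T) :=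
  Real.exp_le_exp.2 ((mul_le_mul_of_nonneg_right (le_abs_self μ) h0).trans
    (mul_le_mul_of_nonneg_left h (abs_nonneg μ)))

/-- Action of `Op` on a power of the weight, bounded above. -/
lemma Op_omPow_le {B c l σ Λ₁ : ℝ} (hB : 0 < B) (h1 : σ * n + l ≤ Λ₁)
    (h2 : σ * (n + σ - 2 - c) + l ≤ Λ₁) (t : ℝ) (x : Eu n) :
    Op n B c l (omPow n hB (σ / 2)) t x ≤ Λ₁ * omPow n hB (σ / 2) t x := by
  have e0 : omPow n hB (σ / 2) t x = wt B x ^ σ := by rw [omPow_eq_wt]; congr 1; ring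
  rw [Op_omPow, e0]
  refine mul_le_mul_of_nonneg_right ?_ (wt_rpow_pos hB x σ).le
  have hw := wt_pos hB x
  obtain ⟨θ, hθ⟩ : ∃ θ, θ = ‖x‖ ^ 2 / wt B x ^ 2 := ⟨_, rfl⟩
  have hθ0 : 0 ≤ θ := by rw [hθ]; positivity
  have hθ1 : θ ≤ 1 := by
    rw [hθ, div_le_one (by positivity), wt_sq hB]; linarith
  rw [← hθ]
  nlinarith [mul_nonneg hθ0 (sub_nonneg.2 h2), mul_nonneg (sub_nonneg.2 hθ1) (sub_nonneg.2 h1)]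

lemma Dec.growth {B μ s : ℝ} (hB : 0 < B) {f : SF n} {C T₀ : ℝ} (hC : 0 ≤ C) (hT₀ : 0 ≤ T₀)
    (h : ∀ t, T₀ ≤ t → ∀ x, |f t x| ≤ C * Real.exp (μ * t) * wt B x ^ s) (T : ℝ) :
    ∃ K', ∀ t ∈ Set.Icc T₀ T, ∀ x, |f t x| ≤ K' * om n B t x ^ ⌈|s|⌉₊ := by
  refine ⟨C * Real.exp (|μ| * T) * √B ^ (s - 2 * (⌈|s|⌉₊ : ℝ)), fun t ht x => ?_⟩
  refine (h t ht.1 x).trans ?_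
  rw [mul_assoc (C * Real.exp (|μ| * T))]
  exact mul_le_mul (mul_le_mul_of_nonneg_left (exp_mul_le (hT₀.trans ht.1) ht.2) hC)
    (wt_rpow_le_om_pow hB s t x) (wt_rpow_pos hB x s).le (by positivity)

/-- Decay of solutions with a rapidly decaying forcing term, given a barrier `ω^{σ/2}`. -/
theorem dec_of_barrier {B c l μ₀ s₀ σ ΛF Λ₁ : ℝ} (hB : 0 < B) {f G : SF n}
    (hf : dt f = Op n B c l f + G) (h0 : Dec B μ₀ s₀ f) (hs₀ : s₀ ≤ σ) (hG : Dec B ΛF σ G)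
    (hΛ : ΛF < Λ₁) (h1 : σ * n + l ≤ Λ₁) (h2 : σ * (n + σ - 2 - c) + l ≤ Λ₁) :
    Dec B Λ₁ σ f := by
  obtain ⟨C, T₁, hC, hT₁, h0⟩ := h0.mono hB le_rfl hs₀
  obtain ⟨CF, T₂, hCF, hT₂, hG⟩ := hG
  obtain ⟨T, hT⟩ : ∃ T, T = max T₁ T₂ := ⟨_, rfl⟩
  have hTT1 : T₁ ≤ T := hT ▸ le_max_left _ _
  have hTT2 : T₂ ≤ T := hT ▸ le_max_right _ _
  have e0 : ∀ t x, omPow n hB (σ / 2) t x = wt B x ^ σ := fun t x => by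
    rw [omPow_eq_wt]; congr 1; ring
  obtain ⟨C₀, hC₀⟩ : ∃ C₀, C₀ = C * Real.exp (μ₀ * T) * Real.exp (-(Λ₁ * T)) := ⟨_, rfl⟩
  have hC₀0 : 0 ≤ C₀ := by rw [hC₀]; positivity
  have hd : 0 ≤ Λ₁ - ΛF := by linarith
  refine ⟨C₀ + CF / (Λ₁ - ΛF) * Real.exp ((ΛF - Λ₁) * T), T, by positivity, hT₁.trans hTT1,
    fun t ht x => ?_⟩
  obtain ⟨K', hK'⟩ := Dec.growth hB hC hT₁ h0 t
  have := barrier_bound hB f G (omPow n hB (σ / 2)) hf (dt_omPow hB _) (t₁ := T) (T := t)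
    (r₀ := -1) (K' := K') (C₀ := C₀) (CF := CF) ⌈|σ|⌉₊ hΛ hCF hC₀0
    (fun t x _ => by rw [e0]; exact (wt_rpow_pos hB x σ).le)
    (fun t x _ => Op_omPow_le hB h1 h2 t x)
    (fun t ht x _ => by rw [e0]; exact hG t (hTT2.trans ht.1) x)
    (fun t ht x _ => hK' t ⟨hTT1.trans ht.1, ht.2⟩ x)
    (fun x _ => by
      rw [e0, hC₀, mul_assoc _ _ (Real.exp (Λ₁ * T)), ← Real.exp_add]
      simpa using h0 T hTT1 x)
    (fun t _ x hx => by linarith [norm_nonneg x]) t ⟨ht, le_rfl⟩ x (by linarith [norm_nonneg x])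
  rwa [e0] at this

/-- Decay of solutions with a slowly decaying forcing term. -/
theorem dec_of_barrier_slow {B c l μ₀ s₀ Λ₁ : ℝ} (hB : 0 < B) {f G : SF n}
    (hf : dt f = Op n B c l f + G) (h0 : Dec B μ₀ s₀ f) (hs₀ : s₀ ≤ 0) (hG : Dec B Λ₁ 0 G)
    (hl : l < Λ₁) : Dec B Λ₁ 0 f := by
  obtain ⟨C, T₁, hC, hT₁, h0⟩ := h0.mono hB le_rfl hs₀
  obtain ⟨CF, T₂, hCF, hT₂, hG⟩ := hG
  obtain ⟨T, hT⟩ : ∃ T, T = max T₁ T₂ := ⟨_, rfl⟩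
  have hTT1 : T₁ ≤ T := hT ▸ le_max_left _ _
  have hTT2 : T₂ ≤ T := hT ▸ le_max_right _ _
  obtain ⟨C₀, hC₀⟩ : ∃ C₀, C₀ = C * Real.exp (μ₀ * T) * Real.exp (-(Λ₁ * T)) := ⟨_, rfl⟩
  have hC₀0 : 0 ≤ C₀ := by rw [hC₀]; positivity
  have hd : 0 ≤ Λ₁ - l := by linarith
  refine ⟨C₀ + CF / (Λ₁ - l), T, by positivity, hT₁.trans hTT1, fun t ht x => ?_⟩
  obtain ⟨K', hK'⟩ := Dec.growth hB hC hT₁ h0 t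
  have := barrier_bound_slow hB f G 1 hf (Derivation.map_one_eq_zero _) (t₁ := T) (T := t)
    (r₀ := -1) (K' := K') (C₀ := C₀) (CF := CF) (Λ₁ := l) ⌈|(0 : ℝ)|⌉₊ hl hCF hC₀0
    (fun t x _ => by simp) (fun t x _ => by simp [Op, lapl_eq])
    (fun t ht x _ => by simpa using hG t (hTT2.trans ht.1) x)
    (fun t ht x _ => hK' t ⟨hTT1.trans ht.1, ht.2⟩ x)
    (fun x _ => by
      rw [hC₀, mul_assoc _ _ (Real.exp (Λ₁ * T)), ← Real.exp_add]
      simpa using h0 T hTT1 x)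
    (fun t _ x hx => by linarith [norm_nonneg x]) t ⟨ht, le_rfl⟩ x (by linarith [norm_nonneg x])
  simpa using this

/-- The commutator of `D I` with `Op`. -/
def commOp : List (Fin n) → SF n → SF n
  | [], _ => 0
  | a :: I, w => dx a (commOp I w) + (2 : ℝ) • (X a * D I w)

lemma D_Op (B c l : ℝ) (I : List (Fin n)) (w : SF n) :
    D I (Op n B c l w) = Op n B c (l - I.length * c) (D I w) + commOp I (lapl w) := by
  induction I with
  | nil => simp [commOp]
  | cons a I ih =>
    rw [D_cons, ih, map_add, dx_Op, commOp, D_lapl, D_cons, List.length_cons]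
    rw [show l - I.length * c - c = l - ((I.length + 1 : ℕ) : ℝ) * c by push_cast; ring]
    abel

lemma commOp_sym {B μ s : ℝ} (hB : 0 < B) {w : SF n} {r : ℕ} (h : Sym B μ s r w)
    (I : List (Fin n)) (r' : ℕ) (hr : r = 0 ∨ r + 2 ≤ r' + I.length) :
    Sym B μ (s - I.length + 2) r' (commOp I w) := by
  induction I generalizing r' with
  | nil => exact Sym.zero
  | cons a I ih =>
    refine Sym.add ?_ (Sym.smul _ ?_)
    · have := (ih (r' + 1) (hr.imp id fun h => by simp at h; omega)).dx a
      rw [Nat.add_sub_cancel] at this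
      convert this using 1
      simp; ring
    · have h1 := h.D I
      by_cases hrI : r ≤ I.length
      · rw [Nat.sub_eq_zero_of_le hrI] at h1
        have h2 := ((Sym.X hB a).mul hB h1).mono hB (μ' := μ) (by simp) le_rfl (Nat.zero_le r')
        convert h2 using 1
        simp; ring
      · have h2 := (h1.X_mul hB a).mono hB le_rfl le_rfl (r' := r')
          (by rw [List.length_cons] at hr; omega)
        convert h2 using 1
        simp; ring

lemma Sym.of_D {B μ s : ℝ} {f : SF n} {ν : ℕ}
    (h : ∀ I : List (Fin n), I.length = ν → Sym B μ (s - ν) 0 (FastDiffusion.D I f)) :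
    Sym B μ s ν f := fun J hJ => by
  have h1 : J = J.take (J.length - ν) ++ J.drop (J.length - ν) := (List.take_append_drop _ _).symm
  have hl : (J.drop (J.length - ν)).length = ν := by simp; omega
  have h2 := h _ hl (J.take (J.length - ν)) (Nat.zero_le _)
  rw [← D_append, ← h1] at h2
  convert h2 using 1
  rw [List.length_take, min_eq_left (Nat.sub_le _ _), Nat.cast_sub hJ]
  ring

lemma iterate_lapl_eq {B p : ℝ} {q F : SF n} (hq : dt q = Op n B (p + n) 0 q + F) (i : ℕ) :
    dt (lapl^[i] q) = Op n B (p + n - 4 * i) (4 * (i : ℝ) ^ 2 - 2 * i * (p + 2)) (lapl^[i] q) +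
      lapl^[i] F := by
  induction i with
  | zero => simpa using hq
  | succ i ih =>
    rw [Function.iterate_succ_apply', Function.iterate_succ_apply', dt_lapl, ih, map_add, lapl_Op]
    congr 2 <;> push_cast <;> ring

lemma Sym.iterate_lapl {B μ s : ℝ} {r : ℕ} {f : SF n} (h : Sym B μ s r f) (i : ℕ) :
    Sym B μ (s - 2 * i) (r - 2 * i) (FastDiffusion.lapl^[i] f) := by
  induction i with
  | zero => simpa using h
  | succ i ih =>
    rw [Function.iterate_succ_apply']
    have := ih.lapl
    rw [Nat.sub_sub, ← Nat.mul_succ] at this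
    convert this using 1
    push_cast; ring

lemma isQSol_linear {B c l : ℝ} {f G : SF n} (hf : dt f = Op n B c l f + G) :
    IsQSol B c l 0 0 f G := by
  rw [IsQSol, hf]; simp

section
variable {B p γ Λ₁ ΛF μ₀ : ℝ} {N : ℕ} {q F : SF n}

/-- The outermost step of the derivative chain: decay of a power of the Laplacian. -/
lemma sym_iterate_lapl (hn : 2 ≤ n) (hB : 0 < B) (hγ2 : 2 ≤ γ) (hγ : 2 * γ ≤ p + 2)
    (hΛ : γ ^ 2 - (p + 2) * γ ≤ Λ₁) (hΛ0 : Λ₁ < 0) (hF : Sym B ΛF 2 0 F) (hFΛ : ΛF < Λ₁)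
    (hq : dt q = Op n B (p + n) 0 q + F) (hq0 : Sym B μ₀ 2 0 q) {k : ℕ} (hk1 : γ ≤ 2 * k)
    (hk2 : 2 * (k : ℝ) ≤ γ + 2) : Sym B Λ₁ (γ - 2 * k) 0 (lapl^[k] q) := by
  have he := iterate_lapl_eq hq k
  have hFk : Sym B ΛF (γ - 2 * k) 0 (lapl^[k] F) :=
    (hF.iterate_lapl k).mono hB le_rfl (by linarith) (by omega)
  have hn' : (2 : ℝ) ≤ n := by exact_mod_cast hn
  refine sym_of_bound hB (isQSol_linear he) (Or.inl rfl) hΛ0 ?_ (hFk.mono hB hFΛ.le le_rfl le_rfl)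
  refine dec_of_barrier hB he (hq0.iterate_lapl k |>.mono hB le_rfl le_rfl (by omega)).dec
    (by linarith) hFk.dec hFΛ ?_ ?_
  · refine le_trans ?_ hΛ
    nlinarith [mul_nonneg (sub_nonneg.2 hk1) (show 0 ≤ p + 2 + n - γ - 2 * k by linarith)]
  · refine le_trans (le_of_eq ?_) hΛ
    ring

/-- Descent in the derivative chain. -/
lemma sym_chain_step (hn : 2 ≤ n) (hB : 0 < B) (hγ2 : 2 ≤ γ) (hγ : 2 * γ ≤ p + 2)
    (hN1 : γ ≤ N) (hN2 : (N : ℝ) < γ + 1)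
    (hΛ : γ ^ 2 - (p + 2) * γ ≤ Λ₁) (hΛ0 : Λ₁ < 0) (hF : Sym B ΛF 2 0 F) (hFΛ : ΛF < Λ₁)
    (hq : dt q = Op n B (p + n) 0 q + F) (hq0 : Sym B μ₀ 2 0 q) {i : ℕ} (hi : 2 * i + 1 ≤ N)
    (h : Sym B Λ₁ (N - 2 * (i + 1 : ℕ)) (N - 2 * (i + 1)) (lapl^[i + 1] q)) :
    Sym B Λ₁ (N - 2 * i) (N - 2 * i) (lapl^[i] q) := by
  have hn' : (2 : ℝ) ≤ n := by exact_mod_cast hn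
  have hiN : 2 * (i : ℝ) + 1 ≤ N := by exact_mod_cast hi
  have hcast : ((N - 2 * i : ℕ) : ℝ) = N - 2 * i := by
    rw [Nat.cast_sub (by omega)]; push_cast; ring
  refine Sym.of_D fun I hI => ?_
  rw [hcast, sub_self]
  have he : dt (D I (lapl^[i] q)) = Op n B (p + n - 4 * i)
      (4 * (i : ℝ) ^ 2 - 2 * i * (p + 2) - I.length * (p + n - 4 * i)) (D I (lapl^[i] q)) +
      (commOp I (lapl^[i + 1] q) + D I (lapl^[i] F)) := by
    rw [← D_dt, iterate_lapl_eq hq i, map_add, D_Op, Function.iterate_succ_apply', add_assoc]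
  have hIr : (I.length : ℝ) = N - 2 * i := by rw [hI, hcast]
  have hG : Sym B Λ₁ 0 0 (commOp I (lapl^[i + 1] q) + D I (lapl^[i] F)) := by
    refine Sym.add ?_ ?_
    · have := commOp_sym hB h I 0 (by omega)
      convert this using 1
      rw [hIr]; push_cast; ring
    · have := (hF.iterate_lapl i).D I
      refine this.mono hB hFΛ.le ?_ (by omega)
      rw [hIr]; linarith
  refine sym_of_bound hB (isQSol_linear he) (Or.inl rfl) hΛ0 ?_ hG
  refine dec_of_barrier_slow hB he (((hq0.iterate_lapl i).D I).mono hB le_rfl le_rfl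
    (by omega)).dec ?_ hG.dec (lt_of_lt_of_le ?_ hΛ)
  · rw [hIr]; linarith
  · rw [hIr]
    have h1 : (N - γ) * (N + γ - p - 2) < 1 := by nlinarith
    have h2 : (1 : ℝ) ≤ (N - 2 * i) * (N - 2 * i + n - 2) := by nlinarith
    nlinarith

lemma sym_chain_one {q F : SF 1} (hB : 0 < B) (hγ2 : 2 ≤ γ) (hγ : 2 * γ ≤ p + 2)
    (hN1 : γ ≤ N) (hN2 : (N : ℝ) < γ + 1) (hΛ : γ ^ 2 - (p + 2) * γ ≤ Λ₁)
    (hΛ0 : Λ₁ < 0) (hF : Sym B ΛF 2 0 F) (hFΛ : ΛF < Λ₁) (hq : dt q = Op 1 B (p + 1) 0 q + F)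
    (hq0 : Sym B μ₀ 2 0 q) : Sym B Λ₁ N N q := by
  have hD : ∀ I : List (Fin 1), dt (D I q) = Op 1 B (p + 1 - 2 * I.length)
      ((I.length : ℝ) ^ 2 - (p + 2) * I.length) (D I q) + D I F := by
    intro I
    induction I with
    | nil => simpa using hq
    | cons a I ih =>
      rw [D_cons, D_cons, dt_dx, ih, map_add, dx_Op]
      refine SF_ext fun t x => ?_
      obtain rfl := Subsingleton.elim a 0
      simp [Op, lapl_eq]
      ring
  refine Sym.of_D fun I hI => ?_
  have hIr : (I.length : ℝ) = N := by rw [hI]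
  have hFI : Sym B ΛF (γ - N) 0 (D I F) := (hF.D I).mono hB le_rfl (by rw [hIr]; linarith) (by omega)
  suffices h : Dec B Λ₁ (γ - N) (D I q) from
    (sym_of_bound hB (isQSol_linear (hD I)) (Or.inl rfl) hΛ0 h
      (hFI.mono hB hFΛ.le le_rfl le_rfl)).mono hB le_rfl (by linarith) le_rfl
  have h := dec_of_barrier (σ := γ - N) (Λ₁ := Λ₁) hB (hD I) ((hq0.D I).mono hB le_rfl le_rfl
    (by omega)).dec (by rw [hIr]; linarith) hFI.dec hFΛ ?_ ?_
  · exact h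
  · refine le_trans ?_ hΛ
    rw [hIr]; push_cast
    nlinarith [mul_nonneg (sub_nonneg.2 hN1) (show 0 ≤ p + 3 - N - γ by linarith)]
  · refine le_trans (le_of_eq ?_) hΛ
    rw [hIr]; push_cast; ring

/-- Derivatives of high order of a solution decay at the rate of the barrier `ω^{γ/2}`. -/
theorem sym_chain (hn : 1 ≤ n) (hB : 0 < B) (hγ2 : 2 ≤ γ) (hγ : 2 * γ ≤ p + 2)
    (hN1 : γ ≤ N) (hN2 : (N : ℝ) < γ + 1)
    (hΛ : γ ^ 2 - (p + 2) * γ ≤ Λ₁) (hΛ0 : Λ₁ < 0) (hF : Sym B ΛF 2 0 F) (hFΛ : ΛF < Λ₁)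
    (hq : dt q = Op n B (p + n) 0 q + F) (hq0 : Sym B μ₀ 2 0 q) : Sym B Λ₁ N N q := by
  obtain rfl | hn := hn.eq_or_lt
  · exact sym_chain_one hB hγ2 hγ hN1 hN2 hΛ hΛ0 hF hFΛ (by simpa using hq) hq0
  have hk : ∃ k : ℕ, N ≤ 2 * k ∧ 2 * k ≤ N + 1 := ⟨(N + 1) / 2, by omega, by omega⟩
  obtain ⟨k, hk1, hk2⟩ := hk
  have hk1' : (N : ℝ) ≤ 2 * k := by exact_mod_cast hk1
  have hk2' : 2 * (k : ℝ) ≤ N + 1 := by exact_mod_cast hk2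
  have hdesc : ∀ j ≤ k, Sym B Λ₁ (N - 2 * (k - j : ℕ)) (N - 2 * (k - j)) (lapl^[k - j] q) := by
    intro j
    induction j with
    | zero =>
      intro _
      have := sym_iterate_lapl hn hB hγ2 hγ hΛ hΛ0 hF hFΛ hq hq0 (k := k) (by linarith)
        (by linarith)
      exact this.mono hB le_rfl (by rw [Nat.sub_zero]; linarith) (Nat.zero_le _)
    | succ j ih =>
      intro hj
      have h1 := ih (by omega)
      rw [show k - j = (k - (j + 1)) + 1 by omega] at h1
      exact sym_chain_step hn hB hγ2 hγ hN1 hN2 hΛ hΛ0 hF hFΛ hq hq0 (by omega) h1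
  simpa using hdesc k le_rfl

end

/-- The restriction of `f` to `x = 0`, as a function constant in space. -/
def atZero (f : SF n) : SF n :=
  ofTime (fun t => f t 0) ((contDiffSF f).comp (contDiff_id.prodMk contDiff_const))

@[simp] lemma atZero_ev (f : SF n) (t : ℝ) (x : Eu n) : atZero f t x = f t 0 := rfl

@[simp] lemma dx_atZero (f : SF n) (a : Fin n) : dx a (atZero f) = 0 := dx_ofTime _ _ a

lemma dt_atZero (f : SF n) : dt (atZero f) = atZero (dt f) := by
  refine SF_ext fun t x => ?_
  exact (hasDerivAt_dt (atZero f) t x).unique (hasDerivAt_dt f t 0)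

/-- The homogeneous part of degree `k` of the Taylor expansion at `x = 0`. -/
def homPart : ℕ → SF n → SF n
  | 0, f => atZero f
  | k + 1, f => (1 / ((k : ℝ) + 1)) • ∑ a, X a * homPart k (dx a f)

lemma dt_homPart (k : ℕ) (f : SF n) : dt (homPart k f) = homPart k (dt f) := by
  induction k generalizing f with
  | zero => exact dt_atZero f
  | succ k ih =>
    simp only [homPart, Derivation.map_smul, map_sum, Derivation.leibniz, dt_X, smul_eq_mul,
      mul_zero, add_zero, ih, dt_dx]

@[simp] lemma dx_homPart_zero (f : SF n) (b : Fin n) : dx b (homPart 0 f) = 0 := dx_atZero f b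

lemma dx_homPart_succ (k : ℕ) (f : SF n) (b : Fin n) :
    dx b (homPart (k + 1) f) = homPart k (dx b f) := by
  have key : ∀ (k : ℕ) (f : SF n) (b : Fin n), dx b (∑ a, X a * homPart k (dx a f)) =
      homPart k (dx b f) + ∑ a, X a * dx b (homPart k (dx a f)) := by
    intro k f b
    simp only [map_sum, Derivation.leibniz, dx_X, smul_eq_mul, mul_ite, mul_one, mul_zero,
      Finset.sum_add_distrib, Finset.sum_ite_eq, Finset.mem_univ, if_true]
    exact add_comm _ _
  induction k generalizing f b with
  | zero =>
    show dx b ((1 / (((0 : ℕ) : ℝ) + 1)) • ∑ a, X a * homPart 0 (dx a f)) = _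
    rw [Derivation.map_smul, key]
    simp
  | succ k ih =>
    have h1 : ∑ a, X a * dx b (homPart (k + 1) (dx a f)) =
        ((k : ℝ) + 1) • homPart (k + 1) (dx b f) := by
      have hk : ((k : ℝ) + 1) ≠ 0 := by positivity
      rw [homPart, smul_smul, mul_one_div_cancel hk, one_smul]
      refine Finset.sum_congr rfl fun a _ => ?_
      rw [ih, dx_comm]
    rw [homPart, Derivation.map_smul, key, h1]
    have hk : ((k : ℝ) + 2) ≠ 0 := by positivity
    have : homPart (k + 1) (dx b f) + ((k : ℝ) + 1) • homPart (k + 1) (dx b f) =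
        ((k : ℝ) + 2) • homPart (k + 1) (dx b f) := by
      rw [show ((k : ℝ) + 2) = 1 + (k + 1) by ring, add_smul 1, one_smul]
    rw [this, smul_smul]
    have h2 : 1 / (((k + 1 : ℕ) : ℝ) + 1) * ((k : ℝ) + 2) = 1 := by
      push_cast; field_simp; ring
    rw [h2, one_smul]

lemma homPart_succ_zero (k : ℕ) (f : SF n) (t : ℝ) : homPart (k + 1) f t 0 = 0 := by
  simp [homPart]

/-- The Taylor polynomial of degree `< N` at `x = 0`. -/
def taylor (N : ℕ) (f : SF n) : SF n := ∑ k ∈ Finset.range N, homPart k f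

lemma dt_taylor (N : ℕ) (f : SF n) : dt (taylor N f) = taylor N (dt f) := by
  simp only [taylor, map_sum, dt_homPart]

lemma dx_taylor (N : ℕ) (f : SF n) (b : Fin n) :
    dx b (taylor (N + 1) f) = taylor N (dx b f) := by
  simp only [taylor, Finset.sum_range_succ', map_add, map_sum, dx_homPart_succ, dx_homPart_zero,
    add_zero]

lemma taylor_zero_ev (N : ℕ) (f : SF n) (t : ℝ) : taylor (N + 1) f t 0 = f t 0 := by
  rw [taylor, Finset.sum_range_succ', add_ev, sum_ev]
  simp only [homPart_succ_zero, Finset.sum_const_zero, zero_add]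
  rfl

/-- Functions vanishing to order `k` on `x = 0`. -/
def VanishTo : ℕ → SF n → Prop
  | 0, _ => True
  | k + 1, f => (∀ t, f t 0 = 0) ∧ ∀ b, VanishTo k (dx b f)

/-- Functions which are polynomials of degree `< r` in the space variables. -/
def PolyLT : ℕ → SF n → Prop
  | 0, f => f = 0
  | r + 1, f => ∀ b, PolyLT r (dx b f)

namespace VanishTo

variable {k : ℕ} {f g : SF n}

lemma add (hf : VanishTo k f) (hg : VanishTo k g) : VanishTo k (f + g) := by
  induction k generalizing f g with
  | zero => trivial
  | succ k ih =>
    refine ⟨fun t => by simp [hf.1 t, hg.1 t], fun b => ?_⟩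
    rw [map_add]
    exact ih (hf.2 b) (hg.2 b)

lemma smul (a : ℝ) (hf : VanishTo k f) : VanishTo k (a • f) := by
  induction k generalizing f with
  | zero => trivial
  | succ k ih =>
    refine ⟨fun t => by simp [hf.1 t], fun b => ?_⟩
    rw [Derivation.map_smul]
    exact ih (hf.2 b)

protected lemma zero : VanishTo k (0 : SF n) := by
  induction k with
  | zero => trivial
  | succ k ih => exact ⟨fun t => rfl, fun b => by rw [map_zero]; exact ih⟩

lemma sum {ι : Type*} (s : Finset ι) {f : ι → SF n} (h : ∀ i ∈ s, VanishTo k (f i)) :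
    VanishTo k (∑ i ∈ s, f i) :=
  Finset.sum_induction f (VanishTo k) (fun _ _ => add) VanishTo.zero h

lemma X_mul (hf : VanishTo k f) (a : Fin n) : VanishTo (k + 1) (X a * f) := by
  induction k generalizing f with
  | zero => exact ⟨fun t => by simp, fun b => trivial⟩
  | succ k ih =>
    refine ⟨fun t => by simp, fun b => ?_⟩
    rw [Derivation.leibniz, dx_X, smul_eq_mul, smul_eq_mul]
    refine (ih (hf.2 b)).add ?_
    split_ifs
    · simpa using hf
    · simpa using VanishTo.zero

lemma D_zero (hf : VanishTo k f) (J : List (Fin n)) (hJ : J.length < k) (t : ℝ) :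
    D J f t 0 = 0 := by
  induction k generalizing f J with
  | zero => simp at hJ
  | succ k ih =>
    rcases List.eq_nil_or_concat J with rfl | ⟨L, a, rfl⟩
    · exact hf.1 t
    · rw [List.concat_eq_append, D_append]
      exact ih (hf.2 a) L (by simpa using hJ)

end VanishTo

namespace PolyLT

variable {r : ℕ} {f g : SF n}

protected lemma zero : PolyLT r (0 : SF n) := by
  induction r with
  | zero => rfl
  | succ k ih => exact fun b => by rw [map_zero]; exact ih

lemma succ (h : PolyLT r f) : PolyLT (r + 1) f := by
  induction r generalizing f with
  | zero => exact fun b => by rw [show f = 0 from h, map_zero]; rfl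
  | succ k ih => exact fun b => ih (h b)

lemma add (hf : PolyLT r f) (hg : PolyLT r g) : PolyLT r (f + g) := by
  induction r generalizing f g with
  | zero => rw [show f = 0 from hf, show g = 0 from hg, add_zero]; rfl
  | succ k ih => exact fun b => by rw [map_add]; exact ih (hf b) (hg b)

lemma smul (a : ℝ) (hf : PolyLT r f) : PolyLT r (a • f) := by
  induction r generalizing f with
  | zero => rw [show f = 0 from hf, smul_zero]; rfl
  | succ k ih => exact fun b => by rw [Derivation.map_smul]; exact ih (hf b)

lemma sum {ι : Type*} (s : Finset ι) {f : ι → SF n} (h : ∀ i ∈ s, PolyLT r (f i)) :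
    PolyLT r (∑ i ∈ s, f i) :=
  Finset.sum_induction f (PolyLT r) (fun _ _ => add) PolyLT.zero h

lemma X_mul (hf : PolyLT r f) (a : Fin n) : PolyLT (r + 1) (X a * f) := by
  induction r generalizing f with
  | zero => rw [show f = 0 from hf, mul_zero]; exact PolyLT.zero
  | succ k ih =>
    intro b
    rw [Derivation.leibniz, dx_X, smul_eq_mul, smul_eq_mul]
    refine (ih (hf b)).add ?_
    split_ifs
    · simpa using hf
    · simpa using PolyLT.zero

lemma D_eq_zero (hf : PolyLT r f) (J : List (Fin n)) (hJ : J.length = r) : D J f = 0 := by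
  induction r generalizing f J with
  | zero => rw [List.eq_nil_of_length_eq_zero hJ]; exact hf
  | succ k ih =>
    rcases List.eq_nil_or_concat J with rfl | ⟨L, a, rfl⟩
    · simp at hJ
    · rw [List.concat_eq_append, D_append]
      exact ih (hf a) L (by simpa using hJ)

end PolyLT

lemma polyLT_taylor (N : ℕ) (f : SF n) : PolyLT N (taylor N f) := by
  induction N generalizing f with
  | zero => rfl
  | succ N ih => exact fun b => by rw [dx_taylor]; exact ih _

lemma vanishTo_sub_taylor (N : ℕ) (f : SF n) : VanishTo N (f - taylor N f) := by
  induction N generalizing f with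
  | zero => trivial
  | succ N ih =>
    refine ⟨fun t => by rw [sub_ev, taylor_zero_ev, sub_self], fun b => ?_⟩
    rw [map_sub, dx_taylor]
    exact ih _

lemma Op_eq_add (B c l : ℝ) (f : SF n) :
    Op n B c l f = B • lapl f + ((∑ a, X a * (X a * lapl f)) + (-c) • (∑ a, X a * dx a f) +
      l • f) := by
  refine SF_ext fun t x => ?_
  simp only [Op, om, add_ev, sub_ev, mul_ev, smul_ev, sum_ev, algebraMap_ev, pow_ev, X_ev]
  rw [add_mul, Finset.sum_mul]
  have : ∀ a, x a ^ 2 * lapl f t x = x a * (x a * lapl f t x) := fun a => by ring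
  simp only [this]
  ring

lemma PolyLT.Op {N : ℕ} {f : SF n} (hf : PolyLT (N + 2) f) (B c l : ℝ) :
    PolyLT (N + 2) (FastDiffusion.Op n B c l f) := by
  have h1 : PolyLT N (lapl f) := by
    rw [lapl_eq]
    exact PolyLT.sum _ fun a _ => hf a a
  rw [Op_eq_add]
  exact (h1.succ.succ.smul B).add (((PolyLT.sum _ fun a _ => (h1.X_mul a).X_mul a).add
    ((PolyLT.sum _ fun a _ => (hf a).X_mul a).smul _)).add (hf.smul l))

lemma VanishTo.Op_sub {N : ℕ} {f : SF n} (hf : VanishTo (N + 2) f) (B c l : ℝ) :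
    VanishTo (N + 2) (FastDiffusion.Op n B c l f - B • lapl f) := by
  have h1 : VanishTo N (lapl f) := by
    rw [lapl_eq]
    exact VanishTo.sum _ fun a _ => (hf.2 a).2 a
  rw [Op_eq_add, add_sub_cancel_left]
  exact ((VanishTo.sum _ fun a _ => (h1.X_mul a).X_mul a).add
    ((VanishTo.sum _ fun a _ => (hf.2 a).X_mul a).smul _)).add (hf.smul l)

lemma D_Op_of_vanishTo {N : ℕ} {f : SF n} (hf : VanishTo (N + 2) f) (B c l : ℝ)
    (J : List (Fin n)) (hJ : J.length < N + 2) (t : ℝ) :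
    D J (Op n B c l f) t 0 = B * D J (lapl f) t 0 := by
  have := (hf.Op_sub B c l).D_zero J hJ t
  rw [map_sub, sub_ev, map_smul, smul_ev] at this
  linarith

lemma abs_le_taylor (N : ℕ) (f : SF n) (t : ℝ) {K K' : ℝ} (hK : 0 ≤ K) (hK' : 0 ≤ K')
    (h0 : ∀ J : List (Fin n), J.length < N → |D J f t 0| ≤ K)
    (h1 : ∀ J : List (Fin n), J.length = N → ∀ x, |D J f t x| ≤ K') (x : Eu n) :
    |f t x| ≤ K * ∑ i ∈ Finset.range N, (n * ‖x‖) ^ i + K' * (n * ‖x‖) ^ N := by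
  induction N generalizing f x with
  | zero => simpa using h1 [] rfl x
  | succ N ih =>
    set E : ℝ := K * ∑ i ∈ Finset.range N, (n * ‖x‖) ^ i + K' * (n * ‖x‖) ^ N with hE
    have hE0 : 0 ≤ E := by positivity
    have hd : ∀ a, ∀ s ∈ Set.Icc (0 : ℝ) 1, |dx a f t (0 + s • x)| ≤ E := by
      intro a s hs
      have hsx : ‖s • x‖ ≤ ‖x‖ := by
        rw [norm_smul, Real.norm_of_nonneg hs.1]
        exact mul_le_of_le_one_left (norm_nonneg _) hs.2
      refine (ih (dx a f) (fun J hJ => ?_) (fun J hJ y => ?_) (0 + s • x)).trans ?_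
      · have := h0 (J ++ [a]) (by simpa using hJ)
        rwa [D_append] at this
      · have := h1 (J ++ [a]) (by simpa using hJ) y
        rwa [D_append] at this
      · rw [zero_add, hE]
        gcongr
    have hmv : |f t (0 + (1 : ℝ) • x) - f t (0 + (0 : ℝ) • x)| ≤ n * ‖x‖ * E := by
      have := Convex.norm_image_sub_le_of_norm_hasDerivWithin_le
        (f := fun s : ℝ => f t (0 + s • x)) (s := Set.Icc (0 : ℝ) 1) (C := n * ‖x‖ * E)
        (x := 0) (y := 1)
        (fun s _ => (hasDerivAt_line f t 0 x s).hasDerivWithinAt) (fun s hs => ?_)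
        (convex_Icc 0 1) (by simp) (by simp)
      · simpa using this
      · rw [Real.norm_eq_abs]
        refine (Finset.abs_sum_le_sum_abs _ _).trans ?_
        refine (Finset.sum_le_sum (g := fun _ => ‖x‖ * E) fun a _ => ?_).trans (le_of_eq ?_)
        · rw [abs_mul]
          exact mul_le_mul (abs_coord_le x a) (hd a s hs) (abs_nonneg _) (norm_nonneg _)
        · simp; ring
    have h00 : |f t 0| ≤ K := h0 [] (by simp)
    simp only [one_smul, zero_smul, add_zero, zero_add] at hmv
    have : |f t x| ≤ K + n * ‖x‖ * E := by
      have := abs_sub_abs_le_abs_sub (f t x) (f t 0)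
      linarith
    refine this.trans (le_of_eq ?_)
    rw [hE, Finset.sum_range_succ' _ N]
    have : ∑ i ∈ Finset.range N, ((n : ℝ) * ‖x‖) ^ (i + 1) =
        (n * ‖x‖) * ∑ i ∈ Finset.range N, (n * ‖x‖) ^ i := by
      rw [Finset.mul_sum]
      exact Finset.sum_congr rfl fun i _ => pow_succ' _ _
    rw [this]
    ring

lemma Dec.at_zero {B μ s : ℝ} {f : SF n} (hB : 0 < B) (h : Dec B μ s f) :
    ∃ C T : ℝ, 0 ≤ C ∧ 0 ≤ T ∧ ∀ t, T ≤ t → ∀ _ : Unit, |f t 0| ≤ C * Real.exp (μ * t) := by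
  obtain ⟨C, T, hC, hT, hb⟩ := h
  refine ⟨C * wt B (0 : Eu n) ^ s, T, mul_nonneg hC (wt_rpow_pos hB 0 s).le, hT,
    fun t ht _ => (hb t ht 0).trans (le_of_eq (by ring))⟩

lemma exists_unif_list {α : Type*} {μ : ℝ} {φ : List (Fin n) → ℝ → α → ℝ} {k : ℕ}
    (h : ∀ J : List (Fin n), J.length ≤ k →
      ∃ C T : ℝ, 0 ≤ C ∧ 0 ≤ T ∧ ∀ t, T ≤ t → ∀ x, |φ J t x| ≤ C * Real.exp (μ * t)) :
    ∃ C T : ℝ, 0 ≤ C ∧ 0 ≤ T ∧ ∀ J : List (Fin n), J.length ≤ k →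
      ∀ t, T ≤ t → ∀ x, |φ J t x| ≤ C * Real.exp (μ * t) := by
  choose! C T hC hT hb using h
  have hfin := List.finite_length_le (Fin n) k
  have hle : ∀ (G : List (Fin n) → ℝ), (∀ J, J.length ≤ k → 0 ≤ G J) →
      ∀ J, J.length ≤ k → G J ≤ ∑ J ∈ hfin.toFinset, G J := fun G hG J hJ =>
    Finset.single_le_sum (f := G) (fun i hi => hG i (by simpa using hi)) (by simpa using hJ)
  refine ⟨∑ J ∈ hfin.toFinset, C J, ∑ J ∈ hfin.toFinset, T J,
    Finset.sum_nonneg fun i hi => hC i (by simpa using hi),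
    Finset.sum_nonneg fun i hi => hT i (by simpa using hi), fun J hJ t ht x => ?_⟩
  exact (hb J hJ t ((hle T hT J hJ).trans ht) x).trans
    (mul_le_mul_of_nonneg_right (hle C hC J hJ) (Real.exp_nonneg _))

lemma PolyLT.sym {B μ s : ℝ} {r : ℕ} {f : SF n} (hf : PolyLT r f) : Sym B μ s r f := by
  intro J hJ
  have h1 : J = J.take (J.length - r) ++ J.drop (J.length - r) := (List.take_append_drop _ _).symm
  rw [h1, D_append, hf.D_eq_zero _ (by rw [List.length_drop]; omega), map_zero]
  exact Dec.zero

lemma wt_one_le_pow_sum {B : ℝ} (hB : 0 < B) (N : ℕ) :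
    ∃ C : ℝ, 0 ≤ C ∧ ∀ x : Eu n,
      ∑ i ∈ Finset.range (N + 1), ((n : ℝ) * ‖x‖) ^ i ≤ C * wt B x ^ (N : ℝ) := by
  refine ⟨∑ i ∈ Finset.range (N + 1), (n : ℝ) ^ i * √B ^ ((i : ℝ) - N),
    by positivity, fun x => ?_⟩
  rw [Finset.sum_mul]
  refine Finset.sum_le_sum fun i hi => ?_
  rw [mul_pow, mul_assoc]
  refine mul_le_mul_of_nonneg_left ?_ (by positivity)
  have h1 : ‖x‖ ^ i ≤ wt B x ^ (i : ℝ) := by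
    rw [Real.rpow_natCast]
    exact pow_le_pow_left₀ (norm_nonneg _) (norm_le_wt hB x) i
  refine h1.trans (wt_rpow_le hB ?_ x)
  have := Finset.mem_range.1 hi
  exact_mod_cast (by omega : i ≤ N)

/-- A polynomial in space whose derivatives at `0` decay. -/
lemma PolyLT.dec {B μ : ℝ} (hB : 0 < B) {N : ℕ} {f : SF n} (hf : PolyLT (N + 1) f) {C T : ℝ}
    (hC : 0 ≤ C) (hT : 0 ≤ T)
    (h : ∀ J : List (Fin n), J.length ≤ N → ∀ t, T ≤ t → |D J f t 0| ≤ C * Real.exp (μ * t)) :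
    Dec B μ N f := by
  obtain ⟨C', hC', hw⟩ := wt_one_le_pow_sum (n := n) hB N
  refine ⟨C * C', T, mul_nonneg hC hC', hT, fun t ht x => ?_⟩
  refine (abs_le_taylor (N + 1) f t (K := C * Real.exp (μ * t)) (by positivity) le_rfl
    (fun J hJ => h J (by omega) t ht)
    (fun J hJ y => by rw [hf.D_eq_zero J hJ]; simp) x).trans ?_
  rw [zero_mul, add_zero, mul_right_comm C C', mul_assoc _ C']
  exact mul_le_mul_of_nonneg_left (hw x) (by positivity)

lemma Op_omPow_symm {p B : ℝ} (hB : 0 < B) (σ t : ℝ) (x : Eu n) :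
    Op n B (p + n) 0 (omPow n hB (σ / 2)) t x =
      (σ ^ 2 - (p + 2) * σ) * wt B x ^ σ + B * σ * (p + n + 2 - σ) * wt B x ^ (σ - 2) := by
  rw [Op_omPow, show σ = (σ - 2) + 2 by ring, wt_rpow_add hB x (σ - 2) 2]
  have h2 : wt B x ^ (2 : ℝ) = wt B x ^ 2 := by exact_mod_cast Real.rpow_natCast (wt B x) 2
  have hw := wt_pos hB x
  have h3 := wt_sq hB x
  rw [h2]
  have h4 : ‖x‖ ^ 2 = wt B x ^ 2 - B := by rw [h3]; ring
  rw [h4]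
  field_simp
  ring_nf

section outer

variable {B p γ : ℝ} {N : ℕ}

/-- The outer barrier profile. -/
def outerBarrier (n : ℕ) {B : ℝ} (hB : 0 < B) (γ σ : ℝ) : SF n :=
  omPow n hB (γ / 2) - omPow n hB (σ / 2)

@[simp] lemma dt_outerBarrier (hB : 0 < B) (γ σ : ℝ) : dt (outerBarrier n hB γ σ) = 0 := by
  rw [outerBarrier, map_sub, dt_omPow, dt_omPow, sub_zero]

lemma outerBarrier_ev (hB : 0 < B) (γ σ t : ℝ) (x : Eu n) :
    outerBarrier n hB γ σ t x = wt B x ^ γ - wt B x ^ σ := by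
  rw [outerBarrier, sub_ev, omPow_eq_wt, omPow_eq_wt]
  congr 2 <;> ring

lemma outerBarrier_bounds (hB : 0 < B) {γ σ Λ₁ : ℝ} (hσ0 : 0 ≤ σ) (hσγ : σ < γ)
    (hγσ : γ ≤ σ + 1) (hγ : 2 * γ ≤ p + 2) (hΛ : γ ^ 2 - (p + 2) * γ ≤ Λ₁) :
    ∃ r₀ d : ℝ, 0 ≤ r₀ ∧ 0 < d ∧ ∀ t (x : Eu n), r₀ ≤ ‖x‖ →
      wt B x ^ γ / 2 ≤ outerBarrier n hB γ σ t x ∧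
      Op n B (p + n) 0 (outerBarrier n hB γ σ) t x ≤
        Λ₁ * outerBarrier n hB γ σ t x - d * wt B x ^ σ := by
  have hd : 0 < (σ ^ 2 - (p + 2) * σ) - (γ ^ 2 - (p + 2) * γ) := by
    nlinarith only [hσγ, hγ, mul_pos (sub_pos.2 hσγ) (show 0 < p + 2 - σ - γ by linarith)]
  have hn0 : (0 : ℝ) ≤ n := Nat.cast_nonneg n
  obtain ⟨d, hd_def⟩ : ∃ d, d = ((σ ^ 2 - (p + 2) * σ) - (γ ^ 2 - (p + 2) * γ)) / 2 := ⟨_, rfl⟩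
  obtain ⟨c, hc_def⟩ : ∃ c, c = B * γ * (p + n + 2 - γ) := ⟨_, rfl⟩
  have hc : 0 ≤ c := by
    rw [hc_def]; exact mul_nonneg (mul_nonneg hB.le (by linarith)) (by linarith)
  have hd0 : 0 < d := by rw [hd_def]; linarith
  refine ⟨max 1 (max (c / d) (2 ^ (1 / (γ - σ)))), d, by positivity, hd0, fun t x hx => ?_⟩
  have hw1 : 1 ≤ wt B x := ((le_max_left _ _).trans hx).trans (norm_le_wt hB x)
  have hwc : c / d ≤ wt B x :=
    (((le_max_left _ _).trans (le_max_right _ _)).trans hx).trans (norm_le_wt hB x)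
  have hw2 : 2 ^ (1 / (γ - σ)) ≤ wt B x :=
    (((le_max_right _ _).trans (le_max_right _ _)).trans hx).trans (norm_le_wt hB x)
  have hw := wt_pos hB x
  have h2 : 2 ≤ wt B x ^ (γ - σ) := by
    have := Real.rpow_le_rpow (by positivity) hw2 (sub_pos.2 hσγ).le
    rwa [← Real.rpow_mul (by norm_num), one_div_mul_cancel (sub_pos.2 hσγ).ne',
      Real.rpow_one] at this
  have hσp := wt_rpow_pos hB x σ
  have hsplit : wt B x ^ γ = wt B x ^ (γ - σ) * wt B x ^ σ := by
    rw [← wt_rpow_add hB]; congr 1; ring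
  have hhalf : wt B x ^ γ / 2 ≤ wt B x ^ γ - wt B x ^ σ := by
    nlinarith only [hsplit, h2, hσp, mul_le_mul_of_nonneg_right h2 hσp.le]
  have hlow : c * wt B x ^ (γ - 2) ≤ d * wt B x ^ σ := by
    have h3 : wt B x * wt B x ^ (γ - 2) ≤ wt B x ^ σ := by
      have : wt B x * wt B x ^ (γ - 2) = wt B x ^ (γ - 1) := by
        rw [show γ - 1 = 1 + (γ - 2) by ring, wt_rpow_add hB, Real.rpow_one]
      rw [this]
      exact Real.rpow_le_rpow_of_exponent_le hw1 (by linarith)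
    have h4 : c ≤ d * wt B x := by rwa [div_le_iff₀' hd0] at hwc
    calc c * wt B x ^ (γ - 2) ≤ d * wt B x * wt B x ^ (γ - 2) :=
          mul_le_mul_of_nonneg_right h4 (wt_rpow_pos hB x _).le
      _ = d * (wt B x * wt B x ^ (γ - 2)) := by ring
      _ ≤ _ := mul_le_mul_of_nonneg_left h3 hd0.le
  rw [outerBarrier_ev]
  refine ⟨hhalf, ?_⟩
  rw [outerBarrier, Op_sub, sub_ev, Op_omPow_symm, Op_omPow_symm, ← hc_def]
  have hcσ : 0 ≤ B * σ * (p + n + 2 - σ) * wt B x ^ (σ - 2) :=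
    mul_nonneg (mul_nonneg (mul_nonneg hB.le hσ0) (by linarith)) (wt_rpow_pos hB x _).le
  have hγp := wt_rpow_pos hB x γ
  have h5 : (γ ^ 2 - (p + 2) * γ) * (wt B x ^ γ - wt B x ^ σ) ≤
      Λ₁ * (wt B x ^ γ - wt B x ^ σ) := mul_le_mul_of_nonneg_right hΛ (by linarith)
  have h6 : (σ ^ 2 - (p + 2) * σ) * wt B x ^ σ =
      (2 * d + (γ ^ 2 - (p + 2) * γ)) * wt B x ^ σ := by rw [hd_def]; ring
  linarith only [hlow, hcσ, h5, h6]

theorem dec_of_outerBarrier (hB : 0 < B) {γ σ μ₀ Λ₁ ΛF : ℝ} (hσ0 : 0 ≤ σ) (hσγ : σ < γ)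
    (hγσ : γ ≤ σ + 1) (hγ : 2 * γ ≤ p + 2) (hΛ : γ ^ 2 - (p + 2) * γ ≤ Λ₁) (hFΛ : ΛF < Λ₁)
    {g G₁ G₂ : SF n} (hg : dt g = Op n B (p + n) 0 g + (G₁ + G₂)) (hg0 : Dec B μ₀ γ g)
    (hG₁ : Dec B Λ₁ σ G₁) (hG₂ : Dec B ΛF γ G₂)
    (hloc : ∀ r₀, ∃ C T : ℝ, 0 ≤ C ∧ 0 ≤ T ∧ ∀ t, T ≤ t → ∀ x, ‖x‖ ≤ r₀ →
      |g t x| ≤ C * Real.exp (Λ₁ * t) * wt B x ^ γ) : Dec B Λ₁ γ g := by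
  obtain ⟨r₀, d, hr₀, hd, hbar⟩ := outerBarrier_bounds (n := n) hB hσ0 hσγ hγσ hγ hΛ
  obtain ⟨C₀, T₀, hC₀, hT₀, h0⟩ := hg0
  obtain ⟨C₁, T₁, hC₁, hT₁, h1⟩ := hG₁
  obtain ⟨C₂, T₂, hC₂, hT₂, h2⟩ := hG₂
  obtain ⟨C₃, T₃, hC₃, hT₃, h3⟩ := hloc r₀
  obtain ⟨S, hS⟩ : ∃ S, S = max (max T₀ T₁) (max T₂ T₃) := ⟨_, rfl⟩
  have hS0 : T₀ ≤ S := hS ▸ (le_max_left _ _).trans (le_max_left _ _)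
  have hS1 : T₁ ≤ S := hS ▸ (le_max_right _ _).trans (le_max_left _ _)
  have hS2 : T₂ ≤ S := hS ▸ (le_max_left _ _).trans (le_max_right _ _)
  have hS3 : T₃ ≤ S := hS ▸ (le_max_right _ _).trans (le_max_right _ _)
  clear hS
  obtain ⟨δ, hδ⟩ : ∃ δ, δ = Λ₁ - ΛF := ⟨_, rfl⟩
  have hδ0 : 0 < δ := by rw [hδ]; linarith
  obtain ⟨A', hA'⟩ : ∃ A', A' = 2 * C₂ / δ := ⟨_, rfl⟩
  have hA'0 : 0 ≤ A' := by rw [hA']; positivity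
  obtain ⟨A, hA⟩ : ∃ A, A = 2 * A' + 2 * C₁ / d + 4 * C₃ +
      4 * (C₀ * Real.exp (μ₀ * S) / Real.exp (Λ₁ * S)) := ⟨_, rfl⟩
  have hq1 : 0 ≤ 2 * C₁ / d := by positivity
  have hq2 : 0 ≤ C₀ * Real.exp (μ₀ * S) / Real.exp (Λ₁ * S) := by positivity
  have hA0 : 0 ≤ A := by rw [hA]; linarith only [hq1, hq2, hA'0, hC₃]
  obtain ⟨h, hh⟩ : ∃ h, h = outerBarrier n hB γ σ := ⟨_, rfl⟩
  rw [← hh] at hbar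
  have hdth : dt h = 0 := by rw [hh, dt_outerBarrier]
  have hexp : ∀ t, S ≤ t → Real.exp (ΛF * t) ≤ Real.exp (Λ₁ * t) := fun t ht =>
    Real.exp_le_exp.2 (mul_le_mul_of_nonneg_right hFΛ.le (hT₀.trans (hS0.trans ht)))
  have hhn : ∀ t (x : Eu n), r₀ ≤ ‖x‖ → 0 ≤ h t x := fun t x hx =>
    (div_nonneg (wt_rpow_pos hB x γ).le zero_le_two).trans (hbar t x hx).1
  have hcoef : ∀ t, S ≤ t → A / 2 * Real.exp (Λ₁ * t) ≤
      A * Real.exp (Λ₁ * t) - A' * Real.exp (ΛF * t) := by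
    intro t ht
    have h4 : 2 * A' ≤ A := by rw [hA]; linarith only [hq1, hq2, hA'0, hC₃]
    have := mul_le_mul_of_nonneg_left (hexp t ht) hA'0
    nlinarith only [this, mul_le_mul_of_nonneg_right h4 (Real.exp_nonneg (Λ₁ * t))]
  have hHev : ∀ t x, (A • (expT Λ₁ * h) - A' • (expT ΛF * h) : SF n) t x =
      (A * Real.exp (Λ₁ * t) - A' * Real.exp (ΛF * t)) * h t x := fun t x => by
    simp only [sub_ev, smul_ev, mul_ev, expT_ev]; ring
  have hsmall : ∀ t, S ≤ t → ∀ x, r₀ ≤ ‖x‖ → ∀ c, 4 * c ≤ A → 0 ≤ c →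
      c * Real.exp (Λ₁ * t) * wt B x ^ γ ≤
      (A • (expT Λ₁ * h) - A' • (expT ΛF * h) : SF n) t x := by
    intro t ht x hx c hc hc0
    rw [hHev]
    calc c * Real.exp (Λ₁ * t) * wt B x ^ γ
        = 2 * c * Real.exp (Λ₁ * t) * (wt B x ^ γ / 2) := by ring
      _ ≤ A / 2 * Real.exp (Λ₁ * t) * h t x := by
          refine mul_le_mul (mul_le_mul_of_nonneg_right (by linarith) (Real.exp_nonneg _))
            (hbar t x hx).1 (div_nonneg (wt_rpow_pos hB x γ).le zero_le_two) (by positivity)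
      _ ≤ _ := mul_le_mul_of_nonneg_right (hcoef t ht) (hhn t x hx)
  have main : ∀ t, S ≤ t → ∀ x, r₀ ≤ ‖x‖ → |g t x| ≤ A * Real.exp (Λ₁ * t) * wt B x ^ γ := by
    intro T hT x hx
    obtain ⟨K', hK'⟩ := Dec.growth hB hC₀ (hT₀.trans hS0)
      (fun t ht x => h0 t (hS0.trans ht) x) T
    have := abs_le_supersolution hB g (G₁ + G₂) (A • (expT Λ₁ * h) - A' • (expT ΛF * h)) hg
      (t₁ := S) (T := T) (r₀ := r₀) (K' := K') ⌈|γ|⌉₊ ?_ ?_ (fun t ht x _ => hK' t ht x) ?_ ?_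
      T ⟨hT, le_rfl⟩ x hx
    · rw [hHev] at this
      refine this.trans ?_
      have h8 : h T x ≤ wt B x ^ γ := by
        rw [hh, outerBarrier_ev]
        linarith only [wt_rpow_pos hB x σ]
      have h9 := mul_nonneg hA'0 (Real.exp_nonneg (ΛF * T))
      have h10 := mul_nonneg hA0 (Real.exp_nonneg (Λ₁ * T))
      nlinarith only [h8, mul_nonneg h9 (hhn T x hx), mul_le_mul_of_nonneg_left h8 h10]
    · intro t ht x hx
      refine le_trans ?_ (hsmall t ht.1 x hx 0 (by linarith) le_rfl)
      simp
    · intro t ht x hx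
      rw [Op_sub, sub_ev, Op_expT_smul_mul, Op_expT_smul_mul, map_sub, sub_ev,
        dt_expT_smul_mul _ _ hdth, dt_expT_smul_mul _ _ hdth, add_ev]
      have e1 := h1 t (hS1.trans ht.1) x
      have e2 := h2 t (hS2.trans ht.1) x
      have e3 := abs_add_le (G₁ t x) (G₂ t x)
      have hc := hcoef t ht.1
      have hO := mul_le_mul_of_nonneg_left (hbar t x hx).2
        (le_trans (by positivity) hc : (0 : ℝ) ≤ _)
      have hwσ := wt_rpow_pos hB x σ
      have e4 := mul_le_mul_of_nonneg_right hc (mul_nonneg hd.le hwσ.le)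
      have e5 : C₁ * Real.exp (Λ₁ * t) * wt B x ^ σ ≤
          A / 2 * Real.exp (Λ₁ * t) * (d * wt B x ^ σ) := by
        have h4 : 2 * C₁ ≤ A * d := by
          rw [← div_le_iff₀ hd, hA]; linarith only [hq2, hA'0, hC₃]
        have := mul_le_mul_of_nonneg_right h4
          (mul_nonneg (Real.exp_nonneg (Λ₁ * t)) hwσ.le)
        linarith only [this]
      have e6 : C₂ * Real.exp (ΛF * t) * wt B x ^ γ ≤
          A' * Real.exp (ΛF * t) * ((Λ₁ - ΛF) * h t x) := by
        have h4 : A' * (Λ₁ - ΛF) = 2 * C₂ := by rw [hA', ← hδ]; field_simp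
        have := mul_le_mul_of_nonneg_left (hbar t x hx).1
          (mul_nonneg (mul_nonneg zero_le_two hC₂) (Real.exp_nonneg (ΛF * t)))
        calc C₂ * Real.exp (ΛF * t) * wt B x ^ γ
            = 2 * C₂ * Real.exp (ΛF * t) * (wt B x ^ γ / 2) := by ring
          _ ≤ 2 * C₂ * Real.exp (ΛF * t) * h t x := this
          _ = _ := by rw [← h4]; ring
      nlinarith only [e1, e2, e3, hO, e4, e5, e6]
    · intro x hx
      refine (h0 S hS0 x).trans (le_trans (le_of_eq ?_) (hsmall S le_rfl x hx
        (C₀ * Real.exp (μ₀ * S) / Real.exp (Λ₁ * S)) ?_ hq2))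
      · rw [div_mul_cancel₀ _ (Real.exp_pos _).ne']
      · rw [hA]; linarith only [hq1, hA'0, hC₃]
    · intro t ht x hx
      refine (h3 t (hS3.trans ht.1) x hx.le).trans (hsmall t ht.1 x hx.ge C₃ ?_ hC₃)
      rw [hA]; linarith only [hq1, hq2, hA'0]
  refine ⟨max A C₃, S, le_max_of_le_right hC₃, hT₀.trans hS0, fun t ht x => ?_⟩
  have hmono : ∀ c, c ≤ max A C₃ → c * Real.exp (Λ₁ * t) * wt B x ^ γ ≤
      max A C₃ * Real.exp (Λ₁ * t) * wt B x ^ γ := fun c hc =>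
    mul_le_mul_of_nonneg_right (mul_le_mul_of_nonneg_right hc (Real.exp_nonneg _))
      (wt_rpow_pos hB x γ).le
  rcases le_total r₀ ‖x‖ with hx | hx
  · exact (main t ht x hx).trans (hmono A (le_max_left _ _))
  · exact (h3 t (hS3.trans ht) x hx).trans (hmono C₃ (le_max_right _ _))

end outer

/-- Away from the Taylor polynomial at the origin, solutions grow like `wt ^ γ`. -/
theorem dec_sub_taylor {B p γ μ₀ Λ₁ ΛF : ℝ} {N : ℕ} {q F : SF n} (hB : 0 < B) (hγ2 : 2 ≤ γ)
    (hγ : 2 * γ ≤ p + 2) (hN1 : γ ≤ N) (hN2 : (N : ℝ) < γ + 1)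
    (hΛ : γ ^ 2 - (p + 2) * γ ≤ Λ₁) (hF : Sym B ΛF 2 0 F) (hFΛ : ΛF < Λ₁)
    (hq : dt q = Op n B (p + n) 0 q + F) (hq0 : Sym B μ₀ 2 0 q) (hqN : Sym B Λ₁ N N q) :
    Dec B Λ₁ γ (q - taylor N q) := by
  obtain ⟨M, rfl⟩ : ∃ M, N = M + 2 := by
    refine ⟨N - 2, ?_⟩
    have : (2 : ℝ) ≤ N := hγ2.trans hN1
    have : 2 ≤ N := by exact_mod_cast this
    omega
  push_cast at hN1 hN2
  have hg0 := vanishTo_sub_taylor (M + 2) q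
  have hT := polyLT_taylor (M + 2) q
  obtain ⟨g, hgdef⟩ : ∃ g, g = q - taylor (M + 2) q := ⟨_, rfl⟩
  rw [← hgdef] at hg0 ⊢
  have hTg : taylor (M + 2) q = q - g := by rw [hgdef]; abel
  have hDT0 : ∀ J : List (Fin n), J.length ≤ M + 1 → ∀ t,
      D J (taylor (M + 2) q) t 0 = D J q t 0 := fun J hJ t => by
    rw [hTg, map_sub, sub_ev, hg0.D_zero J (by omega), sub_zero]
  -- the Taylor polynomial itself
  have hTdec : Dec B μ₀ ((M + 1 : ℕ) : ℝ) (taylor (M + 2) q) := by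
    obtain ⟨C, T, hC, hT', h⟩ := exists_unif_list (k := M + 1)
      fun J _ => (hq0 J (Nat.zero_le _)).at_zero hB
    refine hT.dec hB hC hT' fun J hJ t ht => ?_
    rw [hDT0 J hJ]
    exact h J hJ t ht ()
  have hMγ : ((M + 1 : ℕ) : ℝ) ≤ γ := by push_cast; linarith
  have hgdec : Dec B μ₀ γ g := by
    rw [hgdef, sub_eq_add_neg, ← neg_one_smul ℝ (taylor (M + 2) q)]
    exact (hq0.dec.mono hB le_rfl hγ2).add ((hTdec.mono hB le_rfl hMγ).smul _)
  have hgN : Sym B Λ₁ ((M + 2 : ℕ) : ℝ) (M + 2) g := hgdef ▸ hqN.sub hT.sym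
  -- the polynomial remainder
  obtain ⟨R, hR⟩ : ∃ R, R = dt (taylor (M + 2) q) - Op n B (p + n) 0 (taylor (M + 2) q) :=
    ⟨_, rfl⟩
  have hRpoly : PolyLT (M + 2) R := by
    rw [hR, sub_eq_add_neg, ← neg_one_smul ℝ (Op n B (p + n) 0 _), dt_taylor]
    exact (polyLT_taylor _ _).add ((hT.Op _ _ _).smul _)
  have hR0 : ∀ J : List (Fin n), J.length ≤ M + 1 → ∀ t,
      D J R t 0 = D J F t 0 + B * D J (lapl g) t 0 := fun J hJ t => by
    have h1 : D J (dt (taylor (M + 2) q)) t 0 = D J (dt q) t 0 := by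
      rw [dt_taylor]
      have := (vanishTo_sub_taylor (M + 2) (dt q)).D_zero J (by omega) t
      rw [map_sub, sub_ev] at this
      linarith
    have h2 := D_Op_of_vanishTo hg0 B (p + n) 0 J (by omega) t
    rw [hR, map_sub, sub_ev, h1, hq, hTg, Op_sub, map_add, map_sub, add_ev, sub_ev, h2]
    ring
  have hlap0 : ∀ J : List (Fin n), J.length + 2 < M + 2 → ∀ t, D J (lapl g) t 0 = 0 :=
    fun J hJ t => by
      rw [lapl_eq, map_sum, sum_ev]
      refine Finset.sum_eq_zero fun a _ => ?_
      have := hg0.D_zero (J ++ [a, a]) (by simpa using hJ) t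
      rwa [D_append] at this
  have hlapdec : ∀ J : List (Fin n), J.length ≤ M + 1 →
      ∃ C T : ℝ, 0 ≤ C ∧ 0 ≤ T ∧ ∀ t, T ≤ t → ∀ _ : Unit,
        |D J (lapl g) t 0| ≤ C * Real.exp (Λ₁ * t) := by
    intro J hJ
    rcases lt_or_ge (J.length + 2) (M + 2) with h | h
    · exact ⟨0, 0, le_rfl, le_rfl, fun t _ _ => by rw [hlap0 J h]; simp⟩
    · exact (hgN.lapl J (by omega)).at_zero hB
  obtain ⟨C₁, T₁, hC₁, hT₁, h1⟩ := exists_unif_list hlapdec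
  obtain ⟨C₂, T₂, hC₂, hT₂, h2⟩ := exists_unif_list (k := M + 1)
    fun J _ => (hF J (Nat.zero_le _)).at_zero hB
  have hRdec : Dec B Λ₁ ((M + 1 : ℕ) : ℝ) R := by
    refine hRpoly.dec hB (C := C₂ + B * C₁) (T := max T₁ T₂) (by positivity)
      (le_max_of_le_left hT₁) fun J hJ t ht => ?_
    have ht1 := (le_max_left _ _).trans ht
    have ht2 := (le_max_right _ _).trans ht
    have hexp : Real.exp (ΛF * t) ≤ Real.exp (Λ₁ * t) :=
      Real.exp_le_exp.2 (mul_le_mul_of_nonneg_right hFΛ.le (hT₁.trans ht1))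
    rw [hR0 J hJ]
    calc |D J F t 0 + B * D J (lapl g) t 0| ≤ |D J F t 0| + B * |D J (lapl g) t 0| := by
          refine (abs_add_le _ _).trans (le_of_eq ?_)
          rw [abs_mul, abs_of_pos hB]
      _ ≤ C₂ * Real.exp (Λ₁ * t) + B * (C₁ * Real.exp (Λ₁ * t)) := by
          refine add_le_add ((h2 J hJ t ht2 ()).trans (mul_le_mul_of_nonneg_left hexp hC₂))
            (mul_le_mul_of_nonneg_left (h1 J hJ t ht1 ()) hB.le)
      _ = _ := by ring
  have hgeq : dt g = Op n B (p + n) 0 g + ((-1 : ℝ) • R + F) := by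
    have : dt (taylor (M + 2) q) = Op n B (p + n) 0 (taylor (M + 2) q) + R := by rw [hR]; abel
    rw [hgdef, map_sub, hq, this, Op_sub, neg_one_smul]
    abel
  refine dec_of_outerBarrier hB (σ := ((M + 1 : ℕ) : ℝ)) (Nat.cast_nonneg _)
    (by push_cast; linarith) (by push_cast; linarith) hγ hΛ hFΛ hgeq hgdec
    (hRdec.smul _) (hF.dec.mono hB le_rfl hγ2) fun r₀ => ?_
  obtain ⟨C, T, hC, hT', hb⟩ := exists_unif_list (α := Eu n) (μ := Λ₁) (k := M + 2)
    (φ := fun J t x => if J.length = M + 2 then D J g t x else 0) fun J hJ => by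
      by_cases h : J.length = M + 2
      · obtain ⟨C, T, hC, hT', hb⟩ := hgN J h.ge
        refine ⟨C, T, hC, hT', fun t ht x => ?_⟩
        simpa [h] using hb t ht x
      · exact ⟨0, 0, le_rfl, le_rfl, fun t _ x => by simp [h]⟩
  obtain ⟨ρ, hρ⟩ : ∃ ρ, ρ = max r₀ 0 := ⟨_, rfl⟩
  have hρ0 : 0 ≤ ρ := hρ ▸ le_max_right _ _
  have hk0 : 0 ≤ (n : ℝ) ^ (M + 2) * ρ ^ (M + 2) * √B ^ (-γ) := by positivity
  refine ⟨C * ((n : ℝ) ^ (M + 2) * ρ ^ (M + 2) * √B ^ (-γ)), T, mul_nonneg hC hk0, hT',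
    fun t ht x hx => ?_⟩
  have h3 := abs_le_taylor (M + 2) g t (K := 0) (K' := C * Real.exp (Λ₁ * t)) le_rfl
    (by positivity) (fun J hJ => by rw [hg0.D_zero J hJ]; simp)
    (fun J hJ y => by simpa [hJ] using hb J hJ.le t ht y) x
  rw [zero_mul, zero_add] at h3
  refine h3.trans ?_
  have h4 : ((n : ℝ) * ‖x‖) ^ (M + 2) ≤ n ^ (M + 2) * ρ ^ (M + 2) := by
    rw [← mul_pow]
    have : ‖x‖ ≤ ρ := hρ ▸ hx.trans (le_max_left _ _)
    gcongr
  have h5 : 1 ≤ √B ^ (-γ) * wt B x ^ γ := by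
    have := wt_rpow_le hB (show (0 : ℝ) ≤ γ by linarith) x
    rwa [Real.rpow_zero, zero_sub] at this
  calc C * Real.exp (Λ₁ * t) * ((n : ℝ) * ‖x‖) ^ (M + 2)
      ≤ C * Real.exp (Λ₁ * t) * (n ^ (M + 2) * ρ ^ (M + 2)) * 1 := by
        rw [mul_one]; exact mul_le_mul_of_nonneg_left h4 (by positivity)
    _ ≤ C * Real.exp (Λ₁ * t) * (n ^ (M + 2) * ρ ^ (M + 2)) * (√B ^ (-γ) * wt B x ^ γ) :=
        mul_le_mul_of_nonneg_left h5 (by positivity)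
    _ = _ := by ring

lemma continuous_wt_rpow {B : ℝ} (hB : 0 < B) (s : ℝ) : Continuous fun x : Eu n => wt B x ^ s := by
  have : (fun x : Eu n => wt B x ^ s) = fun x => omPow n hB (s / 2) 0 x := by
    funext x; rw [omPow_eq_wt]; congr 1; ring
  rw [this]
  exact continuous_space _ 0

lemma integrable_wt_rpow {B : ℝ} (hB : 0 < B) {s : ℝ} (hs : s < -n) :
    Integrable fun x : Eu n => wt B x ^ s := by
  have h1 := integrable_one_add_norm (E := Eu n) (μ := volume) (r := -s)
    (by rw [finrank_euclideanSpace_fin]; linarith)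
  obtain ⟨c, hc, hcw⟩ : ∃ c : ℝ, 0 < c ∧ ∀ x : Eu n, c * (1 + ‖x‖) ≤ wt B x := by
    refine ⟨1 / (1 / √B + 1), by positivity, fun x => ?_⟩
    have hB' := Real.sqrt_pos.2 hB
    rw [one_div_mul_eq_div, div_le_iff₀ (by positivity)]
    have h1 : 1 ≤ wt B x * (1 / √B) := by
      rw [mul_one_div, le_div_iff₀ hB', one_mul]; exact sqrt_le_wt x
    linarith [norm_le_wt hB x]
  refine (h1.const_mul (c ^ s)).mono' (continuous_wt_rpow hB s).aestronglyMeasurable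
    (ae_of_all _ fun x => ?_)
  rw [Real.norm_of_nonneg (wt_rpow_pos hB x s).le, neg_neg, ← Real.mul_rpow hc.le (by positivity)]
  exact Real.rpow_le_rpow_of_nonpos (by positivity) (hcw x)
    (by linarith [Nat.cast_nonneg (α := ℝ) n])

/-- At time `t`, `f` grows at most like `wt ^ s`. -/
def Bd (B s : ℝ) (f : SF n) (t : ℝ) : Prop := ∃ C : ℝ, 0 ≤ C ∧ ∀ x, |f t x| ≤ C * wt B x ^ s

namespace Bd

variable {B s s' t : ℝ} {f g : SF n}

lemma mono (hB : 0 < B) (h : Bd B s f t) (hs : s ≤ s') : Bd B s' f t := by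
  obtain ⟨C, hC, hb⟩ := h
  refine ⟨C * √B ^ (s - s'), by positivity, fun x => (hb x).trans ?_⟩
  rw [mul_assoc]
  exact mul_le_mul_of_nonneg_left (wt_rpow_le hB hs x) hC

lemma add (hf : Bd B s f t) (hg : Bd B s g t) : Bd B s (f + g) t := by
  obtain ⟨C, hC, hb⟩ := hf
  obtain ⟨C', hC', hb'⟩ := hg
  refine ⟨C + C', by positivity, fun x => ?_⟩
  rw [add_ev, add_mul]
  exact (abs_add_le _ _).trans (add_le_add (hb x) (hb' x))

lemma smul (a : ℝ) (hf : Bd B s f t) : Bd B s (a • f) t := by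
  obtain ⟨C, hC, hb⟩ := hf
  refine ⟨|a| * C, by positivity, fun x => ?_⟩
  rw [smul_ev, abs_mul, mul_assoc]
  exact mul_le_mul_of_nonneg_left (hb x) (abs_nonneg _)

lemma sub (hf : Bd B s f t) (hg : Bd B s g t) : Bd B s (f - g) t := by
  rw [sub_eq_add_neg, ← neg_one_smul ℝ g]
  exact hf.add (hg.smul _)

lemma mul (hB : 0 < B) (hf : Bd B s f t) (hg : Bd B s' g t) : Bd B (s + s') (f * g) t := by
  obtain ⟨C, hC, hb⟩ := hf
  obtain ⟨C', hC', hb'⟩ := hg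
  refine ⟨C * C', by positivity, fun x => ?_⟩
  rw [mul_ev, abs_mul, wt_rpow_add hB]
  calc |f t x| * |g t x| ≤ (C * wt B x ^ s) * (C' * wt B x ^ s') :=
        mul_le_mul (hb x) (hb' x) (abs_nonneg _) ((abs_nonneg _).trans (hb x))
    _ = _ := by ring

protected lemma zero : Bd B s (0 : SF n) t := ⟨0, le_rfl, fun x => by simp⟩

lemma sum {ι : Type*} (S : Finset ι) {f : ι → SF n} (h : ∀ i ∈ S, Bd B s (f i) t) :
    Bd B s (∑ i ∈ S, f i) t :=
  Finset.sum_induction f (fun f => Bd B s f t) (fun _ _ => add) Bd.zero h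

protected lemma X (hB : 0 < B) (a : Fin n) : Bd B 1 (X a) t :=
  ⟨1, zero_le_one, fun x => by
    rw [X_ev, one_mul, Real.rpow_one]
    exact (abs_coord_le x a).trans (norm_le_wt hB x)⟩

protected lemma omPow (hB : 0 < B) (σ : ℝ) (hs : s = 2 * σ) : Bd B s (omPow n hB σ) t :=
  ⟨1, zero_le_one, fun x => by
    rw [omPow_eq_wt, ← hs, one_mul, abs_of_pos (wt_rpow_pos hB x s)]⟩

protected lemma om (hB : 0 < B) : Bd B 2 (om n B) t :=
  ⟨1, zero_le_one, fun x => by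
    rw [om_eq_wt_sq hB, one_mul, abs_of_pos (pow_pos (wt_pos hB x) 2)]
    exact_mod_cast (Real.rpow_natCast (wt B x) 2).ge⟩

lemma integrable (hB : 0 < B) (h : Bd B s f t) (hs : s < -n) : Integrable fun x => f t x := by
  obtain ⟨C, hC, hb⟩ := h
  exact ((integrable_wt_rpow hB hs).const_mul C).mono'
    (continuous_space f t).aestronglyMeasurable (ae_of_all _ hb)

end Bd

lemma hasLineDerivAt_space (f : SF n) (t : ℝ) (x : Eu n) (a : Fin n) :
    HasLineDerivAt ℝ (fun y => f t y) (dx a f t x) x (stdBasis n a) := by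
  have := hasDerivAt_dx f t x a 0
  simpa [HasLineDerivAt] using this

/-- The cutoff `k / (B + k + ‖x‖ ^ 2)`. -/
def cutoff (n : ℕ) {B : ℝ} (hB : 0 < B) (k : ℕ) : SF n :=
  (k : ℝ) • omPow n (add_pos_of_pos_of_nonneg hB (Nat.cast_nonneg k)) (-1)

lemma cutoff_ev {B : ℝ} (hB : 0 < B) (k : ℕ) (t : ℝ) (x : Eu n) :
    cutoff n hB k t x = k / (B + k + ‖x‖ ^ 2) := by
  rw [cutoff, smul_ev, omPow_ev, Real.rpow_neg_one]; rfl

lemma dx_cutoff_ev {B : ℝ} (hB : 0 < B) (k : ℕ) (a : Fin n) (t : ℝ) (x : Eu n) :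
    dx a (cutoff n hB k) t x = -(k * (2 * x a) / (B + k + ‖x‖ ^ 2) ^ 2) := by
  rw [cutoff, Derivation.map_smul, dx_omPow, smul_ev, smul_ev, mul_ev, X_ev, omPow_ev,
    show (-1 - 1 : ℝ) = -(2 : ℕ) by norm_num, Real.rpow_neg (by positivity), Real.rpow_natCast]
  ring

lemma cutoff_mem {B : ℝ} (hB : 0 < B) (k : ℕ) (t : ℝ) (x : Eu n) :
    0 ≤ cutoff n hB k t x ∧ cutoff n hB k t x ≤ 1 := by
  rw [cutoff_ev]
  have : (0 : ℝ) ≤ k := Nat.cast_nonneg k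
  refine ⟨by positivity, div_le_one_of_le₀ (by nlinarith [sq_nonneg ‖x‖]) (by positivity)⟩

lemma abs_dx_cutoff_le {B : ℝ} (hB : 0 < B) (k : ℕ) (a : Fin n) (t : ℝ) (x : Eu n) :
    |dx a (cutoff n hB k) t x| ≤ 2 * wt B x ^ (-1 : ℝ) := by
  rw [dx_cutoff_ev, abs_neg, Real.rpow_neg_one]
  have hk : (0 : ℝ) ≤ k := Nat.cast_nonneg k
  have hw := wt_pos hB x
  have h2 := wt_sq hB x
  have hxa := (abs_coord_le x a).trans (norm_le_wt hB x)
  rw [abs_div, abs_mul, abs_of_nonneg hk, abs_mul, abs_two,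
    abs_of_nonneg (sq_nonneg (B + k + ‖x‖ ^ 2)),
    ← div_eq_mul_inv, div_le_div_iff₀ (by positivity) hw]
  have h3 : B + k + ‖x‖ ^ 2 = k + wt B x ^ 2 := by rw [h2]; ring
  rw [h3]
  have h4 : k * (2 * |x a|) * wt B x ≤ k * (2 * wt B x) * wt B x := by gcongr
  nlinarith only [h4, sq_nonneg ((k : ℝ)), sq_nonneg (wt B x ^ 2), hk, sq_nonneg (wt B x),
    mul_nonneg hk (sq_nonneg (wt B x))]

lemma tendsto_cutoff {B : ℝ} (hB : 0 < B) (t : ℝ) (x : Eu n) :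
    Tendsto (fun k => cutoff n hB k t x) atTop (𝓝 1) := by
  simp only [cutoff_ev]
  have h := tendsto_natCast_div_add_atTop (𝕜 := ℝ) (B + ‖x‖ ^ 2)
  refine h.congr fun k => ?_
  rw [add_right_comm, add_comm (k : ℝ)]

lemma tendsto_dx_cutoff {B : ℝ} (hB : 0 < B) (a : Fin n) (t : ℝ) (x : Eu n) :
    Tendsto (fun k => dx a (cutoff n hB k) t x) atTop (𝓝 0) := by
  have h := tendsto_natCast_div_add_atTop (𝕜 := ℝ) (B + ‖x‖ ^ 2)
  have h1 : Tendsto (fun k : ℕ => (k : ℝ) + (B + ‖x‖ ^ 2)) atTop atTop :=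
    tendsto_atTop_add_const_right _ _ tendsto_natCast_atTop_atTop
  have h2 := (h.mul h1.inv_tendsto_atTop).const_mul (-(2 * x a))
  rw [mul_zero, mul_zero] at h2
  refine h2.congr fun k => ?_
  rw [dx_cutoff_ev]
  have : B + k + ‖x‖ ^ 2 = k + (B + ‖x‖ ^ 2) := by ring
  rw [this]
  have h5 : (0 : ℝ) < k + (B + ‖x‖ ^ 2) := by positivity
  simp only [Pi.inv_apply]
  field_simp

lemma bd_cutoff {B : ℝ} (hB : 0 < B) (k : ℕ) (t : ℝ) : Bd B (-2) (cutoff n hB k) t := by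
  refine ⟨k, Nat.cast_nonneg k, fun x => ?_⟩
  have hw := wt_pos hB x
  rw [abs_of_nonneg (cutoff_mem hB k t x).1, cutoff_ev,
    show (-2 : ℝ) = -(2 : ℕ) by norm_num, Real.rpow_neg hw.le, Real.rpow_natCast, wt_sq hB,
    ← div_eq_mul_inv]
  have hk : (0 : ℝ) ≤ k := Nat.cast_nonneg k
  gcongr
  linarith

/-- The integral of a derivative vanishes, under symbol bounds. -/
theorem integral_dx_eq_zero {B σ t : ℝ} (hB : 0 < B) (hσ : σ < -n) {f : SF n} {a : Fin n}
    (h1 : Bd B (σ + 1) f t) (h2 : Bd B σ (dx a f) t) : ∫ x, dx a f t x = 0 := by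
  have hbd' : ∀ k, Bd B (-1) (dx a (cutoff n hB k)) t := fun k =>
    ⟨2, zero_le_two, abs_dx_cutoff_le hB k a t⟩
  have hparts : ∀ k, ∫ x, dx a f t x * cutoff n hB k t x =
      -∫ x, f t x * dx a (cutoff n hB k) t x := by
    intro k
    have := integral_bilinear_hasLineDerivAt_right_eq_neg_left_of_integrable
      (μ := volume) (f := fun x => f t x) (f' := fun x => dx a f t x)
      (g := fun x => cutoff n hB k t x) (g' := fun x => dx a (cutoff n hB k) t x)
      (v := stdBasis n a) (B := ContinuousLinearMap.mul ℝ ℝ)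
      ?_ ?_ ?_ (fun x _ => hasLineDerivAt_space f t x a)
      (fun x _ => hasLineDerivAt_space (cutoff n hB k) t x a)
    · simp only [ContinuousLinearMap.mul_apply'] at this
      rw [this, neg_neg]
    · exact (h2.mul hB (bd_cutoff hB k t)).integrable hB (by linarith)
    · exact (h1.mul hB (hbd' k)).integrable hB (by linarith)
    · exact (h1.mul hB (bd_cutoff hB k t)).integrable hB (by linarith)
  obtain ⟨C₁, hC₁, hb1⟩ := h1
  obtain ⟨C₂, hC₂, hb2⟩ := h2
  have hint := integrable_wt_rpow (n := n) hB hσ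
  have hl : Tendsto (fun k => ∫ x, dx a f t x * cutoff n hB k t x) atTop
      (𝓝 (∫ x, dx a f t x)) := by
    refine tendsto_integral_of_dominated_convergence (fun x => C₂ * wt B x ^ σ)
      (fun k => (continuous_space (dx a f * cutoff n hB k) t).aestronglyMeasurable)
      (hint.const_mul _) (fun k => ae_of_all _ fun x => ?_) (ae_of_all _ fun x => ?_)
    · rw [norm_mul, Real.norm_eq_abs, Real.norm_of_nonneg (cutoff_mem hB k t x).1]
      exact (mul_le_of_le_one_right (abs_nonneg _) (cutoff_mem hB k t x).2).trans (hb2 x)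
    · simpa using (tendsto_cutoff hB t x).const_mul (dx a f t x)
  have hr : Tendsto (fun k => ∫ x, f t x * dx a (cutoff n hB k) t x) atTop (𝓝 0) := by
    rw [← integral_zero (Eu n) ℝ (μ := volume)]
    refine tendsto_integral_of_dominated_convergence (fun x => C₁ * 2 * wt B x ^ σ)
      (fun k => (continuous_space (f * dx a (cutoff n hB k)) t).aestronglyMeasurable)
      (hint.const_mul _) (fun k => ae_of_all _ fun x => ?_) (ae_of_all _ fun x => ?_)
    · rw [norm_mul, Real.norm_eq_abs, Real.norm_eq_abs]
      refine (mul_le_mul (hb1 x) (abs_dx_cutoff_le hB k a t x) (abs_nonneg _)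
        ((abs_nonneg _).trans (hb1 x))).trans (le_of_eq ?_)
      rw [show wt B x ^ σ = wt B x ^ (σ + 1) * wt B x ^ (-1 : ℝ) by
        rw [← wt_rpow_add hB]; congr 1; ring]
      ring
    · simpa using (tendsto_dx_cutoff hB a t x).const_mul (f t x)
  have := tendsto_nhds_unique hl (by simpa only [hparts, neg_zero] using hr.neg)
  exact this

/-- The weight `W = ω ^ (-(p + n) / 2 - 1)`. -/
def Wt (n : ℕ) {B : ℝ} (hB : 0 < B) (p : ℝ) : SF n := omPow n hB (-((p + n) / 2) - 1)

lemma sum_dx_flux {B p : ℝ} (hB : 0 < B) (f g : SF n) :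
    ∑ a, dx a (omPow n hB (-((p + n) / 2)) * (dx a f * g - f * dx a g)) =
      (Op n B (p + n) 0 f * g - f * Op n B (p + n) 0 g) * Wt n hB p := by
  have h1 : ∀ a, dx a (omPow n hB (-((p + n) / 2)) * (dx a f * g - f * dx a g)) =
      Wt n hB p * (om n B * (dx a (dx a f) * g - f * dx a (dx a g)) -
        (p + n) • (X a * dx a f * g - f * (X a * dx a g))) := by
    intro a
    have h2 : omPow n hB (-((p + n) / 2)) = om n B * Wt n hB p := by
      rw [Wt, om_mul_omPow, sub_add_cancel]
    rw [Derivation.leibniz, dx_omPow, ← Wt, h2]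
    simp only [map_sub, Derivation.leibniz, smul_eq_mul]
    refine SF_ext fun t x => ?_
    simp only [add_ev, sub_ev, mul_ev, smul_ev]
    ring
  simp only [h1]
  refine SF_ext fun t x => ?_
  simp only [Op, lapl_eq, sum_ev, add_ev, sub_ev, mul_ev, smul_ev, zero_mul, add_zero]
  rw [← Finset.mul_sum, mul_comm]
  congr 1
  simp only [Finset.sum_sub_distrib, ← Finset.mul_sum, ← Finset.sum_mul]
  ring

/-- `f` and its first two derivatives obey symbol bounds of order `s` at time `t`. -/
def Bd2 (B s : ℝ) (f : SF n) (t : ℝ) : Prop :=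
  Bd B s f t ∧ (∀ a, Bd B (s - 1) (dx a f) t) ∧ ∀ a b, Bd B (s - 2) (dx a (dx b f)) t

lemma Bd2.op {B s t : ℝ} (hB : 0 < B) {f : SF n} (h : Bd2 B s f t) (c l : ℝ) :
    Bd B s (Op n B c l f) t := by
  have h1 : Bd B (s - 2) (lapl f) t := by
    rw [lapl_eq]; exact Bd.sum _ fun a _ => h.2.2 a a
  rw [Op]
  refine (Bd.sub ?_ (Bd.smul c (Bd.sum _ fun a _ => ?_))).add (h.1.smul l)
  · exact ((Bd.om hB).mul hB h1).mono hB (by linarith)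
  · exact ((Bd.X hB a).mul hB (h.2.1 a)).mono hB (by linarith)

/-- Symmetry of `Op` in the weighted `L²` space. -/
theorem integral_Op_symm {B p s s' t : ℝ} (hB : 0 < B) {f g : SF n} (hf : Bd2 B s f t)
    (hg : Bd2 B s' g t) (hs : s + s' < p + 2) :
    ∫ x, (Op n B (p + n) 0 f * g * Wt n hB p) t x =
      ∫ x, (f * Op n B (p + n) 0 g * Wt n hB p) t x := by
  have hW : Bd B (-(p + n) - 2) (Wt n hB p) t := Bd.omPow hB _ (by ring)
  have e1 := ((hf.op hB (p + n) 0).mul hB hg.1).mul hB hW |>.integrable hB (by linarith)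
  have e2 := (hf.1.mul hB (hg.op hB (p + n) 0)).mul hB hW |>.integrable hB (by linarith)
  rw [← sub_eq_zero, ← integral_sub e1 e2]
  have h1 : ∀ a, Bd B (s + s' - (p + n) - 2) (dx a (omPow n hB (-((p + n) / 2)) *
      (dx a f * g - f * dx a g))) t := by
    intro a
    have hk : Bd B (-(p + n)) (omPow n hB (-((p + n) / 2))) t := Bd.omPow hB _ (by ring)
    have hk' : Bd B (-(p + n) - 2) (omPow n hB (-((p + n) / 2) - 1)) t := Bd.omPow hB _ (by ring)
    rw [Derivation.leibniz, dx_omPow, smul_eq_mul, smul_eq_mul, map_sub, Derivation.leibniz,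
      Derivation.leibniz]
    simp only [smul_eq_mul]
    refine Bd.add (((hk.mul hB (Bd.sub (s := s + s' - 2) (Bd.add ?_ ?_) (Bd.add ?_ ?_)))).mono hB
      (by linarith)) (((Bd.sub (s := s + s' - 1) ?_ ?_).mul hB
        ((((Bd.X hB a).mul hB hk').smul _))).mono hB (by linarith))
    · exact ((hf.2.1 a).mul hB (hg.2.1 a)).mono hB (by linarith)
    · exact (hg.1.mul hB (hf.2.2 a a)).mono hB (by linarith)
    · exact (hf.1.mul hB (hg.2.2 a a)).mono hB (by linarith)
    · exact ((hg.2.1 a).mul hB (hf.2.1 a)).mono hB (by linarith)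
    · exact ((hf.2.1 a).mul hB hg.1).mono hB (by linarith)
    · exact (hf.1.mul hB (hg.2.1 a)).mono hB (by linarith)
  have h2 : ∀ a, Bd B (s + s' - (p + n) - 2 + 1) (omPow n hB (-((p + n) / 2)) *
      (dx a f * g - f * dx a g)) t := by
    intro a
    refine ((Bd.omPow hB (s := -(p + n)) _ (by ring)).mul hB
      (Bd.sub (s := s + s' - 1) ?_ ?_)).mono hB (by linarith)
    · exact ((hf.2.1 a).mul hB hg.1).mono hB (by linarith)
    · exact (hf.1.mul hB (hg.2.1 a)).mono hB (by linarith)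
  have h3 : ∀ x, (Op n B (p + n) 0 f * g * Wt n hB p) t x -
      (f * Op n B (p + n) 0 g * Wt n hB p) t x =
      ∑ a, dx a (omPow n hB (-((p + n) / 2)) * (dx a f * g - f * dx a g)) t x := fun x => by
    rw [← sum_ev, sum_dx_flux, ← sub_ev, sub_mul]
  simp only [h3]
  rw [integral_finsetSum _ fun a _ => (h1 a).integrable hB (by linarith)]
  exact Finset.sum_eq_zero fun a _ => integral_dx_eq_zero hB (by linarith) (h2 a) (h1 a)

lemma exists_diagonalization {V : Type*} [AddCommGroup V] [Module ℝ V] [FiniteDimensional ℝ V]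
    (c : InnerProductSpace.Core ℝ V) (A : V →ₗ[ℝ] V)
    (hA : ∀ x y, c.inner (A x) y = c.inner x (A y)) :
    ∃ (d : ℕ) (b : Fin d → V) (μ : Fin d → ℝ), (∀ i, A (b i) = μ i • b i) ∧
      ∀ x, x = ∑ i, c.inner (b i) x • b i := by
  let _ : NormedAddCommGroup V := c.toNormedAddCommGroup
  let _ : InnerProductSpace ℝ V := InnerProductSpace.ofCore c.toCore
  have hT : A.IsSymmetric := hA
  refine ⟨_, hT.eigenvectorBasis rfl, hT.eigenvalues rfl, fun i => ?_, fun x => ?_⟩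
  · exact hT.apply_eigenvectorBasis rfl i
  · exact ((hT.eigenvectorBasis rfl).sum_repr' x).symm

/-- The function `f` at time `t`, as a function constant in time. -/
def freeze (t : ℝ) (f : SF n) : SF n := ofSpace (fun x => f t x) (contDiff_space f t)

@[simp] lemma freeze_ev (t s : ℝ) (f : SF n) (x : Eu n) : freeze t f s x = f t x := rfl

lemma dt_freeze (t : ℝ) (f : SF n) : dt (freeze t f) = 0 := dt_ofSpace _ _

lemma dx_freeze (t : ℝ) (f : SF n) (a : Fin n) : dx a (freeze t f) = freeze t (dx a f) := by
  refine SF_ext fun s x => ?_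
  rw [← fderiv_space, freeze_ev, ← fderiv_space]
  rfl

lemma PolyLT.freeze {N : ℕ} {f : SF n} (h : PolyLT N f) (t : ℝ) : PolyLT N (freeze t f) := by
  induction N generalizing f with
  | zero => rw [show f = 0 from h]; exact SF_ext fun _ _ => rfl
  | succ N ih => intro b; rw [dx_freeze]; exact ih (h b)

lemma PolyLT.bd {B : ℝ} (hB : 0 < B) {N : ℕ} {f : SF n} (h : PolyLT N f) (t : ℝ) :
    Bd B ((N : ℝ) - 1) f t := by
  cases N with
  | zero => rw [show f = 0 from h]; exact Bd.zero
  | succ N =>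
    obtain ⟨C, hC, hCb⟩ := wt_one_le_pow_sum (n := n) hB N
    obtain ⟨K, T, hK, -, hKb⟩ := exists_unif_list (n := n) (α := Unit) (μ := 0) (k := N)
      (φ := fun J _ _ => D J f t 0) fun J _ => ⟨|D J f t 0|, 0, abs_nonneg _, le_rfl,
        fun _ _ _ => by simp⟩
    have h0 : ∀ J : List (Fin n), J.length < N + 1 → |D J f t 0| ≤ K := fun J hJ => by
      simpa using hKb J (by omega) T le_rfl ()
    refine ⟨K * C, by positivity, fun x => ?_⟩
    have := abs_le_taylor (N + 1) f t hK le_rfl h0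
      (fun J hJ x => by rw [h.D_eq_zero J hJ]; simp) x
    rw [zero_mul, add_zero] at this
    push_cast
    rw [add_sub_cancel_right, mul_assoc]
    exact this.trans (mul_le_mul_of_nonneg_left (hCb x) hK)

lemma PolyLT.bd2 {B : ℝ} (hB : 0 < B) {N : ℕ} {f : SF n} (h : PolyLT (N + 2) f) (t : ℝ) :
    Bd2 B ((N : ℝ) + 1) f t := by
  refine ⟨?_, fun a => ?_, fun a b => ?_⟩
  · have := h.bd hB t; push_cast at this; exact this.mono hB (by linarith)
  · have := (h a).bd hB t; push_cast at this; exact this.mono hB (by linarith)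
  · exact (h b a).bd hB t |>.mono hB (by linarith)

/-- Time-independent polynomials of degree `< N`. -/
def polySpace (n N : ℕ) : Submodule ℝ (SF n) where
  carrier := {f | PolyLT N f ∧ dt f = 0}
  add_mem' := fun hf hg => ⟨hf.1.add hg.1, by rw [map_add, hf.2, hg.2, add_zero]⟩
  zero_mem' := ⟨PolyLT.zero, map_zero _⟩
  smul_mem' := fun a f hf => ⟨hf.1.smul a, by rw [Derivation.map_smul, hf.2, smul_zero]⟩

lemma ev_eq_of_dt_eq_zero {f : SF n} (h : dt f = 0) (t s : ℝ) (x : Eu n) : f t x = f s x := by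
  have h1 : ∀ t, HasDerivAt (fun t => f t x) 0 t := fun t => by
    have := hasDerivAt_dt f t x; rw [h] at this; exact this
  exact is_const_of_deriv_eq_zero (fun t => (h1 t).differentiableAt) (fun t => (h1 t).deriv) t s

instance (N : ℕ) : FiniteDimensional ℝ (polySpace n N) := by
  let φ : polySpace n N →ₗ[ℝ] ((k : Fin N) → (Fin k → Fin n) → ℝ) :=
    { toFun := fun P k J => D (List.ofFn J) P.1 0 0
      map_add' := fun P Q => by ext k J; simp
      map_smul' := fun a P => by ext k J; simp }
  refine Module.Finite.of_injective φ fun P Q h => ?_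
  rw [← sub_eq_zero]
  refine Subtype.ext (SF_ext fun t x => ?_)
  have hmem := (P - Q).2
  have h0 : ∀ J : List (Fin n), J.length < N → |D J (P - Q).1 t 0| ≤ 0 := fun J hJ => by
    have h1 := congrFun (congrFun h ⟨J.length, hJ⟩) J.get
    simp only [φ, LinearMap.coe_mk, AddHom.coe_mk, List.ofFn_get] at h1
    rw [ev_eq_of_dt_eq_zero (by rw [← D_dt, hmem.2, map_zero]) t 0]
    simp [h1]
  have := abs_le_taylor N (P - Q).1 t le_rfl le_rfl h0
    (fun J hJ x => by rw [hmem.1.D_eq_zero J hJ]; simp) x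
  simpa using this

/-- An orthonormal basis of eigenfunctions of `Op` in the space of polynomials. -/
theorem exists_eigenbasis {B p : ℝ} (hB : 0 < B) {N : ℕ} (hN : 2 ≤ N)
    (hNp : 2 * ((N : ℝ) - 1) < p + 2) :
    ∃ (d : ℕ) (b : Fin d → SF n) (μ : Fin d → ℝ),
      (∀ i, PolyLT N (b i) ∧ dt (b i) = 0 ∧ Op n B (p + n) 0 (b i) = μ i • b i) ∧
      ∀ f : SF n, PolyLT N f → ∀ t x, f t x = ∑ i, (∫ y, (f * b i * Wt n hB p) t y) * b i t x := by
  obtain ⟨N, rfl⟩ : ∃ k, N = k + 2 := ⟨N - 2, by omega⟩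
  have hW : ∀ t, Bd B (-(p + n) - 2) (Wt n hB p) t := fun t => Bd.omPow hB _ (by ring)
  push_cast at hNp
  have hint : ∀ f g : SF n, PolyLT (N + 2) f → PolyLT (N + 2) g → ∀ t,
      Integrable fun x => (f * g * Wt n hB p) t x := fun f g hf hg t =>
    (((hf.bd2 hB t).1.mul hB (hg.bd2 hB t).1).mul hB (hW t)).integrable hB (by linarith)
  let c : InnerProductSpace.Core ℝ (polySpace n (N + 2)) :=
    { inner := fun P Q => ∫ x, (P.1 * Q.1 * Wt n hB p) 0 x
      conj_inner_symm := fun P Q => by rw [mul_comm Q.1]; rfl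
      re_inner_nonneg := fun P => integral_nonneg fun x => by
        have := wt_rpow_pos hB x (2 * (-((p + n) / 2) - 1))
        simp only [mul_ev, Wt, omPow_eq_wt, Pi.zero_apply]
        exact mul_nonneg (mul_self_nonneg _) this.le
      add_left := fun P Q R => by
        rw [← integral_add (hint _ _ P.2.1 R.2.1 0) (hint _ _ Q.2.1 R.2.1 0)]
        refine integral_congr_ae (ae_of_all _ fun x => ?_)
        simp only [Submodule.coe_add, mul_ev, add_ev]; ring
      smul_left := fun P Q r => by
        rw [conj_trivial, ← integral_const_mul]
        refine integral_congr_ae (ae_of_all _ fun x => ?_)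
        simp only [Submodule.coe_smul, mul_ev, smul_ev]; ring
      definite := fun P h => by
        have h1 : ∀ x, 0 ≤ (P.1 * P.1 * Wt n hB p) 0 x := fun x => by
          have := wt_rpow_pos hB x (2 * (-((p + n) / 2) - 1))
          simp only [mul_ev, Wt, omPow_eq_wt]
          exact mul_nonneg (mul_self_nonneg _) this.le
        have h2 := (integral_eq_zero_iff_of_nonneg h1 (hint _ _ P.2.1 P.2.1 0)).1 h
        have h3 := (continuous_space _ 0).ae_eq_iff_eq volume continuous_const |>.1 h2
        refine Subtype.ext (SF_ext fun t x => ?_)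
        rw [ev_eq_of_dt_eq_zero P.2.2 t 0]
        have h4 : (P.1 * P.1 * Wt n hB p) 0 x = 0 := congrFun h3 x
        simp only [mul_ev, Wt, omPow_eq_wt] at h4
        have := (wt_rpow_pos hB x (2 * (-((p + n) / 2) - 1))).ne'
        simpa [this] using h4 }
  let A : polySpace n (N + 2) →ₗ[ℝ] polySpace n (N + 2) :=
    { toFun := fun P => ⟨Op n B (p + n) 0 P.1, P.2.1.Op _ _ _, by
        simp [Op, Derivation.leibniz, dt_om, dt_lapl, dt_dx, P.2.2]⟩
      map_add' := fun P Q => Subtype.ext (Op_add ..)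
      map_smul' := fun a P => Subtype.ext (Op_smul ..) }
  obtain ⟨d, b, μ, hb, hx⟩ := exists_diagonalization c A fun P Q =>
    integral_Op_symm hB (P.2.1.bd2 hB 0) (Q.2.1.bd2 hB 0) (by linarith)
  refine ⟨d, fun i => (b i).1, μ, fun i => ⟨(b i).2.1, (b i).2.2, congrArg Subtype.val (hb i)⟩,
    fun f hf t x => ?_⟩
  have h1 := congrArg (fun P : polySpace n (N + 2) => P.1 t x)
    (hx ⟨freeze t f, hf.freeze t, dt_freeze t f⟩)
  simp only [freeze_ev, AddSubmonoidClass.coe_finsetSum, SetLike.val_smul, sum_ev, smul_ev] at h1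
  refine h1.trans (Finset.sum_congr rfl fun i _ => ?_)
  congr 1
  refine integral_congr_ae (ae_of_all _ fun y => ?_)
  simp only [mul_ev, freeze_ev, Wt, omPow_eq_wt]
  rw [ev_eq_of_dt_eq_zero (b i).2.2 0 t]
  ring

lemma monotoneOn_Ici_of_hasDerivAt {f f' : ℝ → ℝ} {T : ℝ}
    (hf : ∀ t, T ≤ t → HasDerivAt f (f' t) t) (h : ∀ t, T ≤ t → 0 ≤ f' t) :
    MonotoneOn f (Set.Ici T) := by
  refine monotoneOn_of_deriv_nonneg (convex_Ici T)
    (fun t ht => (hf t ht).continuousAt.continuousWithinAt)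
    (fun t ht => (hf t (interior_subset ht)).differentiableAt.differentiableWithinAt)
    fun t ht => ?_
  rw [(hf t (interior_subset ht)).deriv]
  exact h t (interior_subset ht)

lemma hasDerivAt_exp_mul (c t : ℝ) :
    HasDerivAt (fun t => Real.exp (c * t)) (c * Real.exp (c * t)) t := by
  have := ((hasDerivAt_id t).const_mul c).exp
  simpa [mul_comm] using this

/-- A function whose derivative decays exponentially converges at the same rate. -/
lemma exists_limit_of_deriv_le_exp {β β' : ℝ → ℝ} {C T κ : ℝ} (hκ : κ < 0)
    (hβ : ∀ t, T ≤ t → HasDerivAt β (β' t) t)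
    (hb : ∀ t, T ≤ t → |β' t| ≤ C * Real.exp (κ * t)) :
    ∃ A : ℝ, ∀ t, T ≤ t → |β t - A| ≤ C / (-κ) * Real.exp (κ * t) := by
  have hκ0 : κ ≠ 0 := hκ.ne
  have hd : ∀ t, HasDerivAt (fun t => C / κ * Real.exp (κ * t)) (C * Real.exp (κ * t)) t := by
    intro t
    exact ((hasDerivAt_exp_mul κ t).const_mul (C / κ)).congr_deriv
      (by rw [← mul_assoc, div_mul_cancel₀ C hκ0])
  have hm := monotoneOn_Ici_of_hasDerivAt (fun t ht => (hβ t ht).add (hd t))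
    fun t ht => by linarith only [(abs_le.1 (hb t ht)).1]
  have ha := monotoneOn_Ici_of_hasDerivAt (fun t ht => ((hd t).sub (hβ t ht)))
    fun t ht => by linarith only [(abs_le.1 (hb t ht)).2]
  have hneg : ∀ t, T ≤ t → C / κ * Real.exp (κ * t) ≤ 0 := fun t ht => by
    have h1 : 0 ≤ C * Real.exp (κ * t) := (abs_nonneg _).trans (hb t ht)
    rw [div_mul_eq_mul_div]
    exact div_nonpos_of_nonneg_of_nonpos h1 hκ.le
  have hle : ∀ s t, T ≤ s → T ≤ t → β s + C / κ * Real.exp (κ * s) ≤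
      β t - C / κ * Real.exp (κ * t) := by
    intro s t hs ht
    have h1 := hm hs (hs.trans (le_max_left s t)) (le_max_left s t)
    have h2 := ha ht (ht.trans (le_max_right s t)) (le_max_right s t)
    have h3 := hneg _ (hs.trans (le_max_left s t))
    simp only [Pi.add_apply, Pi.sub_apply] at h1 h2
    linarith only [h1, h2, h3]
  have hne : ((fun s => β s + C / κ * Real.exp (κ * s)) '' Set.Ici T).Nonempty :=
    ⟨_, T, Set.self_mem_Ici, rfl⟩
  refine ⟨sSup ((fun s => β s + C / κ * Real.exp (κ * s)) '' Set.Ici T), fun t ht => ?_⟩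
  have h1 := le_csSup (a := β t + C / κ * Real.exp (κ * t)) (⟨_, by
    rintro _ ⟨s, hs, rfl⟩; exact hle s T hs le_rfl⟩ :
      BddAbove ((fun s => β s + C / κ * Real.exp (κ * s)) '' Set.Ici T)) ⟨t, ht, rfl⟩
  have h2 := csSup_le hne (by rintro _ ⟨s, hs, rfl⟩; exact hle s t hs ht)
  rw [div_neg, abs_le]
  constructor <;> linarith only [h1, h2]

lemma abs_le_of_deriv_le_exp {β β' : ℝ → ℝ} {C T κ : ℝ} (hκ : 0 < κ)
    (hβ : ∀ t, T ≤ t → HasDerivAt β (β' t) t)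
    (hb : ∀ t, T ≤ t → |β' t| ≤ C * Real.exp (κ * t)) :
    ∀ t, T ≤ t → |β t| ≤ |β T| + C / κ * Real.exp (κ * t) := by
  have hκ0 : κ ≠ 0 := hκ.ne'
  have hd : ∀ t, HasDerivAt (fun t => C / κ * Real.exp (κ * t)) (C * Real.exp (κ * t)) t := by
    intro t
    exact ((hasDerivAt_exp_mul κ t).const_mul (C / κ)).congr_deriv
      (by rw [← mul_assoc, div_mul_cancel₀ C hκ0])
  have hm := monotoneOn_Ici_of_hasDerivAt (fun t ht => (hβ t ht).add (hd t))
    fun t ht => by linarith only [(abs_le.1 (hb t ht)).1]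
  have ha := monotoneOn_Ici_of_hasDerivAt (fun t ht => ((hd t).sub (hβ t ht)))
    fun t ht => by linarith only [(abs_le.1 (hb t ht)).2]
  intro t ht
  have h1 := hm Set.self_mem_Ici ht ht
  have h2 := ha Set.self_mem_Ici ht ht
  have h3 : 0 ≤ C / κ * Real.exp (κ * T) := by
    have h1 : 0 ≤ C * Real.exp (κ * T) := (abs_nonneg _).trans (hb T le_rfl)
    rw [div_mul_eq_mul_div]
    positivity
  simp only [Pi.add_apply, Pi.sub_apply] at h1 h2
  rw [abs_le]
  constructor <;> linarith only [h1, h2, h3, neg_abs_le (β T), le_abs_self (β T)]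

/-- Asymptotics of solutions of `α' = μ α + h` with exponentially decaying `h`. -/
lemma ode_asymptotics {α h : ℝ → ℝ} {C T μ ΛF Λ₁ : ℝ} (hT : 0 ≤ T) (hΛ : ΛF < Λ₁)
    (hα : ∀ t, T ≤ t → HasDerivAt α (μ * α t + h t) t)
    (hh : ∀ t, T ≤ t → |h t| ≤ C * Real.exp (ΛF * t)) :
    ∃ A C' : ℝ, 0 ≤ C' ∧ (μ ≤ Λ₁ → A = 0) ∧
      ∀ t, T ≤ t → |α t - A * Real.exp (μ * t)| ≤ C' * Real.exp (Λ₁ * t) := by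
  have hC : 0 ≤ C := by
    have := (abs_nonneg _).trans (hh T le_rfl)
    exact nonneg_of_mul_nonneg_left this (Real.exp_pos _)
  have hβ : ∀ t, T ≤ t → HasDerivAt (fun t => Real.exp (-μ * t) * α t)
      (Real.exp (-μ * t) * h t) t := fun t ht =>
    ((hasDerivAt_exp_mul (-μ) t).mul (hα t ht)).congr_deriv (by ring)
  have hb : ∀ t, T ≤ t → |Real.exp (-μ * t) * h t| ≤ C * Real.exp ((ΛF - μ) * t) := by
    intro t ht
    rw [abs_mul, Real.abs_exp, show (ΛF - μ) * t = -μ * t + ΛF * t by ring, Real.exp_add]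
    nlinarith only [mul_le_mul_of_nonneg_left (hh t ht) (Real.exp_pos (-μ * t)).le]
  have hback : ∀ t a K, |Real.exp (-μ * t) * α t - a| ≤ K →
      |α t - a * Real.exp (μ * t)| ≤ K * Real.exp (μ * t) := by
    intro t a K hk
    have h1 : α t - a * Real.exp (μ * t) =
        (Real.exp (-μ * t) * α t - a) * Real.exp (μ * t) := by
      have : Real.exp (-μ * t) * Real.exp (μ * t) = 1 := by
        rw [← Real.exp_add, neg_mul, neg_add_cancel, Real.exp_zero]
      linear_combination (-α t) * this
    rw [h1, abs_mul, Real.abs_exp]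
    exact mul_le_mul_of_nonneg_right hk (Real.exp_pos _).le
  have hexp : ∀ t, Real.exp ((ΛF - μ) * t) * Real.exp (μ * t) = Real.exp (ΛF * t) := fun t => by
    rw [← Real.exp_add, ← add_mul, sub_add_cancel]
  rcases lt_or_ge μ Λ₁ with hμ | hμ
  · have hb' : ∀ t, T ≤ t → |Real.exp (-μ * t) * h t| ≤ C * Real.exp ((Λ₁ - μ) * t) :=
      fun t ht => (hb t ht).trans (mul_le_mul_of_nonneg_left (Real.exp_le_exp.2
        (mul_le_mul_of_nonneg_right (by linarith only [hΛ]) (hT.trans ht))) hC)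
    have h1 := abs_le_of_deriv_le_exp (sub_pos.2 hμ) hβ hb'
    have hpos : 0 < Λ₁ - μ := sub_pos.2 hμ
    refine ⟨0, |Real.exp (-μ * T) * α T| + C / (Λ₁ - μ), by positivity, fun _ => rfl,
      fun t ht => ?_⟩
    have h2 := hback t 0 _ ((sub_zero (Real.exp (-μ * t) * α t)).symm ▸ h1 t ht)
    refine h2.trans ?_
    have h3 : Real.exp (Λ₁ * t) = Real.exp ((Λ₁ - μ) * t) * Real.exp (μ * t) := by
      rw [← Real.exp_add, ← add_mul, sub_add_cancel]
    rw [h3, ← mul_assoc]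
    refine mul_le_mul_of_nonneg_right ?_ (Real.exp_pos _).le
    rw [add_mul]
    refine add_le_add ?_ le_rfl
    exact le_mul_of_one_le_right (abs_nonneg _)
      (Real.one_le_exp (mul_nonneg hpos.le (hT.trans ht)))
  · obtain ⟨A, hA⟩ := exists_limit_of_deriv_le_exp (by linarith only [hΛ, hμ]) hβ hb
    have hK : 0 ≤ C / (-(ΛF - μ)) := div_nonneg hC (by linarith only [hΛ, hμ])
    have h1 : ∀ t, T ≤ t → |α t - A * Real.exp (μ * t)| ≤
        C / (-(ΛF - μ)) * Real.exp (Λ₁ * t) := fun t ht => by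
      refine (hback t A _ (hA t ht)).trans ?_
      rw [mul_assoc, hexp]
      exact mul_le_mul_of_nonneg_left (Real.exp_le_exp.2
        (mul_le_mul_of_nonneg_right hΛ.le (hT.trans ht))) hK
    by_cases he : μ = Λ₁
    · refine ⟨0, C / (-(ΛF - μ)) + |A|, by positivity, fun _ => rfl, fun t ht => ?_⟩
      have h2 := h1 t ht
      rw [he] at h2 ⊢
      rw [zero_mul, sub_zero]
      calc |α t| ≤ |α t - A * Real.exp (Λ₁ * t)| + |A * Real.exp (Λ₁ * t)| := by
            have := abs_add_le (α t - A * Real.exp (Λ₁ * t)) (A * Real.exp (Λ₁ * t))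
            rwa [sub_add_cancel] at this
        _ ≤ _ := by
            rw [abs_mul, Real.abs_exp, add_mul]
            exact add_le_add h2 le_rfl
    · exact ⟨A, _, hK, fun h => absurd (le_antisymm h hμ) he, h1⟩

/-- The weighted inner product of `f` and `g` at time `t`. -/
def coef {B : ℝ} (hB : 0 < B) (p : ℝ) (f g : SF n) (t : ℝ) : ℝ :=
  ∫ x, (f * g * Wt n hB p) t x

lemma bd_Wt {B : ℝ} (hB : 0 < B) (p t : ℝ) : Bd B (-(p + n) - 2) (Wt n hB p) t :=
  Bd.omPow hB _ (by ring)

lemma coef_integrable {B p s s' t : ℝ} (hB : 0 < B) {f g : SF n} (hf : Bd B s f t)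
    (hg : Bd B s' g t) (hs : s + s' < p + 2) :
    Integrable fun x => (f * g * Wt n hB p) t x :=
  ((hf.mul hB hg).mul hB (bd_Wt hB p t)).integrable hB (by linarith)

lemma coef_sub {B p s s' t : ℝ} (hB : 0 < B) {f f' g : SF n} (hf : Bd B s f t)
    (hf' : Bd B s f' t) (hg : Bd B s' g t) (hs : s + s' < p + 2) :
    coef hB p (f - f') g t = coef hB p f g t - coef hB p f' g t := by
  rw [coef, coef, coef, ← integral_sub (coef_integrable hB hf hg hs)
    (coef_integrable hB hf' hg hs)]
  refine integral_congr_ae (ae_of_all _ fun x => ?_)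
  simp only [mul_ev, sub_ev]; ring

lemma abs_coef_le {B p s s' : ℝ} (hB : 0 < B) {g : SF n} (hg0 : dt g = 0) (hg : Bd B s' g 0)
    (hs : s + s' < p + 2) : ∃ K : ℝ, 0 ≤ K ∧ ∀ (f : SF n) (t C : ℝ),
      (∀ x, |f t x| ≤ C * wt B x ^ s) → |coef hB p f g t| ≤ C * K := by
  obtain ⟨C', hC', hb⟩ := hg
  have hint := integrable_wt_rpow (n := n) hB (s := s + s' - (p + n) - 2) (by linarith)
  refine ⟨C' * ∫ x : Eu n, wt B x ^ (s + s' - (p + n) - 2),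
    mul_nonneg hC' (integral_nonneg fun x => (wt_rpow_pos hB x _).le), fun f t C hf => ?_⟩
  rw [← mul_assoc, ← integral_const_mul, coef, ← Real.norm_eq_abs]
  refine norm_integral_le_of_norm_le (hint.const_mul _) (ae_of_all _ fun x => ?_)
  rw [Real.norm_eq_abs, mul_ev, mul_ev, abs_mul, abs_mul, ev_eq_of_dt_eq_zero hg0 t 0, Wt,
    omPow_eq_wt, abs_of_pos (wt_rpow_pos hB x _),
    show s + s' - (p + n) - 2 = s + s' + 2 * (-((p + n) / 2) - 1) by ring, wt_rpow_add hB,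
    wt_rpow_add hB]
  have := mul_le_mul (hf x) (hb x) (abs_nonneg _) ((abs_nonneg _).trans (hf x))
  nlinarith only [mul_le_mul_of_nonneg_right this (wt_rpow_pos hB x
    (2 * (-((p + n) / 2) - 1))).le]

lemma Sym.op {B μ s : ℝ} (hB : 0 < B) {f : SF n} (h : Sym B μ s 0 f) (c l : ℝ) :
    Sym B μ s 0 (Op n B c l f) := by
  rw [Op_eq_add]
  refine ((h.lapl.mono hB le_rfl (by linarith) (by simp)).smul B).add
    (((Sym.sum _ fun a _ => ?_).add ((Sym.sum _ fun a _ => ?_).smul _)).add (h.smul l))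
  · exact ((Sym.X hB a).mul hB ((Sym.X hB a).mul hB h.lapl)).mono hB (by linarith)
      (by linarith) le_rfl
  · exact ((Sym.X hB a).mul hB (h.dx a)).mono hB (by linarith) (by linarith) le_rfl

lemma Dec.exists_bound {B μ s : ℝ} {f : SF n} (h : Dec B μ s f) :
    ∃ C T : ℝ, 0 ≤ C ∧ 0 ≤ T ∧ ∀ t, T ≤ t → (∀ x, |f t x| ≤ C * Real.exp (μ * t) * wt B x ^ s) ∧
      Bd B s f t := by
  obtain ⟨C, T, hC, hT, hb⟩ := h
  exact ⟨C, T, hC, hT, fun t ht => ⟨hb t ht, _, by positivity, hb t ht⟩⟩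

/-- Projection onto polynomials of degree `< N`. -/
theorem dec_sub_projection {B p γ μ₀ Λ₁ ΛF : ℝ} {N d : ℕ} {q F : SF n} (hn : 1 ≤ n) (hB : 0 < B)
    (hγ2 : 2 ≤ γ) (hγ : 2 * γ ≤ p + 2) (hN1 : γ ≤ N) (hN2 : (N : ℝ) < γ + 1)
    (hΛ : γ ^ 2 - (p + 2) * γ ≤ Λ₁) (hΛ0 : Λ₁ < 0) (hF : Sym B ΛF 2 0 F) (hFΛ : ΛF < Λ₁)
    (hq : dt q = Op n B (p + n) 0 q + F) (hq0 : Sym B μ₀ 2 0 q) {b : Fin d → SF n}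
    (hb : ∀ i, PolyLT N (b i) ∧ dt (b i) = 0)
    (hexp : ∀ f : SF n, PolyLT N f → ∀ t x, f t x = ∑ i, coef hB p f (b i) t * b i t x) :
    ∃ C T : ℝ, 0 ≤ C ∧ 0 ≤ T ∧ ∀ t, T ≤ t → ∀ x,
      |q t x - ∑ i, coef hB p q (b i) t * b i t x| ≤ C * Real.exp (Λ₁ * t) * wt B x ^ γ := by
  have hqN := sym_chain hn hB hγ2 hγ hN1 hN2 hΛ hΛ0 hF hFΛ hq hq0
  obtain ⟨C, T, hC, hT, hg⟩ :=
    (dec_sub_taylor hB hγ2 hγ hN1 hN2 hΛ hF hFΛ hq hq0 hqN).exists_bound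
  obtain ⟨C₁, T₁, -, hT₁, hq1⟩ := hq0.dec.exists_bound
  have hbb : ∀ i t, Bd B ((N : ℝ) - 1) (b i) t := fun i t => (hb i).1.bd hB t
  choose K hK hKb using fun i => abs_coef_le (p := p) (s := γ) hB (hb i).2 (hbb i 0) (by linarith)
  choose K' hK' hKb' using fun i => (hbb i 0).mono hB (s' := γ) (by linarith)
  refine ⟨C + ∑ i, C * K i * K' i, max T T₁, add_nonneg hC (Finset.sum_nonneg fun i _ =>
    mul_nonneg (mul_nonneg hC (hK i)) (hK' i)), hT.trans (le_max_left _ _), fun t ht x => ?_⟩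
  have ht1 := (le_max_left _ _).trans ht
  have ht2 := (le_max_right _ _).trans ht
  have hTb : Bd B ((N : ℝ) - 1) (taylor N q) t := (polyLT_taylor N q).bd hB t
  have hsplit : q t x - ∑ i, coef hB p q (b i) t * b i t x =
      (q - taylor N q) t x - ∑ i, coef hB p (q - taylor N q) (b i) t * b i t x := by
    rw [sub_ev, hexp _ (polyLT_taylor N q) t x, sub_sub, ← Finset.sum_add_distrib]
    congr 1
    refine Finset.sum_congr rfl fun i _ => ?_
    rw [← add_mul]
    congr 1
    rw [coef_sub hB ((hq1 t ht2).2.mono hB (le_max_left 2 ((N : ℝ) - 1)))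
      (hTb.mono hB (le_max_right _ _)) (hbb i t)]
    · ring
    · rcases max_cases (2 : ℝ) ((N : ℝ) - 1) with h | h <;> rw [h.1] <;> linarith
  rw [hsplit, add_mul, add_mul, Finset.sum_mul, Finset.sum_mul]
  refine (abs_sub _ _).trans (add_le_add ((hg t ht1).1 x) ?_)
  refine (Finset.abs_sum_le_sum_abs _ _).trans (Finset.sum_le_sum fun i _ => ?_)
  rw [abs_mul, ev_eq_of_dt_eq_zero (hb i).2 t 0]
  calc _ ≤ (C * Real.exp (Λ₁ * t) * K i) * (K' i * wt B x ^ γ) :=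
        mul_le_mul (hKb i _ t _ (hg t ht1).1) (hKb' i x) (abs_nonneg _)
          (mul_nonneg (by positivity) (hK i))
    _ = _ := by ring

lemma Dec.eventually_bd {B μ s : ℝ} {f : SF n} (h : Dec B μ s f) :
    ∀ᶠ t in atTop, Bd B s f t := by
  obtain ⟨C, T, -, -, hb⟩ := h.exists_bound
  exact (eventually_ge_atTop T).mono fun t ht => (hb t ht).2

lemma Sym.eventually_bd2 {B μ s : ℝ} {f : SF n} (h : Sym B μ s 0 f) :
    ∀ᶠ t in atTop, Bd2 B s f t := by
  refine h.dec.eventually_bd.and ((eventually_all.2 fun a => (h.dx a).dec.eventually_bd).and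
    (eventually_all.2 fun a => eventually_all.2 fun b => ?_))
  refine (((h.dx b).dx a).dec.eventually_bd).mono fun t ht => ?_
  rwa [show s - 2 = s - 1 - 1 by ring]

/-- Evolution of the coefficient along an eigenfunction. -/
lemma hasDerivAt_coef {B p μ₀ μ : ℝ} {N : ℕ} {q F b : SF n} (hB : 0 < B)
    (hNp : 2 * ((N : ℝ) + 1) < p + 2) (hp : 2 < p) {ΛF : ℝ} (hF : Sym B ΛF 2 0 F)
    (hq : dt q = Op n B (p + n) 0 q + F) (hq0 : Sym B μ₀ 2 0 q)
    (hb : PolyLT (N + 2) b) (hb0 : dt b = 0) (hbμ : Op n B (p + n) 0 b = μ • b) :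
    ∀ᶠ t in atTop, HasDerivAt (coef hB p q b) (μ * coef hB p q b t + coef hB p F b t) t := by
  have hdt : Sym B (max μ₀ ΛF) 2 0 (dt q) := hq ▸
    ((hq0.op hB _ _).mono hB (le_max_left _ _) le_rfl le_rfl).add
      (hF.mono hB (le_max_right _ _) le_rfl le_rfl)
  generalize max μ₀ ΛF = ν at hdt
  obtain ⟨C, T, hC, hT, hd⟩ := hdt.dec.exists_bound
  have hsum : (2 : ℝ) + ((N : ℝ) + 1) < p + 2 := by linarith
  filter_upwards [hq0.eventually_bd2, hF.dec.eventually_bd, eventually_ge_atTop (T + 1)]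
    with t h1 h2 h3
  have hb2 := hb.bd2 hB t
  obtain ⟨C', hC', hbb⟩ := (hb.bd2 hB 0).1
  have hder : HasDerivAt (coef hB p q b) (∫ x, (dt q * b * Wt n hB p) t x) t := by
    refine (hasDerivAt_integral_of_dominated_loc_of_deriv_le (μ := volume)
      (F := fun s x => (q * b * Wt n hB p) s x) (F' := fun s x => (dt q * b * Wt n hB p) s x)
      (bound := fun x => C * Real.exp (|ν| * (t + 1)) * C' * wt B x ^ (2 + ((N : ℝ) + 1) -
        (p + n) - 2)) (Metric.ball_mem_nhds t one_pos)
      (Eventually.of_forall fun s => (continuous_space _ s).aestronglyMeasurable)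
      (coef_integrable hB h1.1 hb2.1 hsum) (continuous_space _ t).aestronglyMeasurable
      (ae_of_all _ fun x s hs => ?_)
      ((integrable_wt_rpow hB (by linarith)).const_mul _) (ae_of_all _ fun x s _ => ?_)).2
    · rw [Metric.mem_ball, Real.dist_eq, abs_lt] at hs
      have hs0 : T ≤ s := by linarith only [hs.1, h3]
      have he : Real.exp (ν * s) ≤ Real.exp (|ν| * (t + 1)) :=
        Real.exp_le_exp.2 (mul_le_mul (le_abs_self ν) (by linarith only [hs.2])
          (hT.trans hs0) (abs_nonneg _))
      have hdq := (hd s hs0).1 x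
      rw [Real.norm_eq_abs, mul_ev, mul_ev, abs_mul, abs_mul, ev_eq_of_dt_eq_zero hb0 s 0, Wt,
        omPow_eq_wt, abs_of_pos (wt_rpow_pos hB x _), show (2 : ℝ) + ((N : ℝ) + 1) - (p + n) - 2 =
          2 + (N + 1) + 2 * (-((p + n) / 2) - 1) by ring, wt_rpow_add hB x (2 + (N + 1)),
        wt_rpow_add hB x 2]
      have hdq' : |dt q s x| ≤ C * Real.exp (|ν| * (t + 1)) * wt B x ^ (2 : ℝ) :=
        hdq.trans (mul_le_mul_of_nonneg_right (mul_le_mul_of_nonneg_left he hC)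
          (wt_rpow_pos hB x _).le)
      have := mul_le_mul hdq' (hbb x) (abs_nonneg _) ((abs_nonneg _).trans hdq')
      have := mul_le_mul_of_nonneg_right this
        (wt_rpow_pos hB x (2 * (-((p + n) / 2) - 1))).le
      exact this.trans (le_of_eq (by ring))
    · have := hasDerivAt_dt (q * b * Wt n hB p) s x
      rwa [show dt (q * b * Wt n hB p) = dt q * b * Wt n hB p by
        rw [Derivation.leibniz, Derivation.leibniz, Wt, dt_omPow, hb0, smul_zero, smul_zero,
          zero_add, zero_add, smul_eq_mul, smul_eq_mul]
        ring] at this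
  refine hder.congr_deriv ?_
  have e1 := coef_integrable hB (h1.op hB (p + n) 0) hb2.1 hsum
  have e2 := coef_integrable hB h2 hb2.1 hsum
  have e3 := integral_Op_symm hB h1 hb2 hsum
  rw [coef, coef, ← integral_const_mul, ← sub_eq_zero]
  rw [hbμ] at e3
  have e4 : ∫ x, (dt q * b * Wt n hB p) t x = (∫ x, (Op n B (p + n) 0 q * b * Wt n hB p) t x) +
      ∫ x, (F * b * Wt n hB p) t x := by
    rw [← integral_add e1 e2, hq]
    refine integral_congr_ae (ae_of_all _ fun x => ?_)
    simp only [mul_ev, add_ev]; ring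
  rw [e4, e3, add_sub_add_right_eq_sub, sub_eq_zero]
  refine integral_congr_ae (ae_of_all _ fun x => ?_)
  simp only [mul_ev, smul_ev]; ring

/-- Eigenfunction expansion of a solution, up to an exponentially small remainder. -/
theorem exists_expansion {B p γ μ₀ Λ₁ ΛF : ℝ} {N d : ℕ} {q F : SF n} (hn : 1 ≤ n) (hB : 0 < B)
    (hγ2 : 2 ≤ γ) (hγ : 2 * γ ≤ p + 2) (hN1 : γ ≤ N) (hN2 : (N : ℝ) < γ + 1)
    (hΛ : γ ^ 2 - (p + 2) * γ ≤ Λ₁) (hΛ0 : Λ₁ < 0) (hF : Sym B ΛF 2 0 F) (hFΛ : ΛF < Λ₁)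
    (hq : dt q = Op n B (p + n) 0 q + F) (hμ₀ : μ₀ < 0) (hq0 : Sym B μ₀ 2 0 q)
    (hp : 2 < p) {b : Fin d → SF n} {μ : Fin d → ℝ}
    (hb : ∀ i, PolyLT N (b i) ∧ dt (b i) = 0 ∧ Op n B (p + n) 0 (b i) = μ i • b i)
    (hexp : ∀ f : SF n, PolyLT N f → ∀ t x, f t x = ∑ i, coef hB p f (b i) t * b i t x) :
    ∃ (A : Fin d → ℝ) (C T : ℝ), 0 ≤ C ∧ 0 ≤ T ∧
      (∀ i, ¬ (Λ₁ < μ i ∧ μ i < 0) → A i = 0) ∧ ∀ t, T ≤ t → ∀ x,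
      |q t x - ∑ i, A i * Real.exp (μ i * t) * b i t x| ≤
        C * Real.exp (Λ₁ * t) * wt B x ^ γ := by
  obtain ⟨C, T, hC, hT, hproj⟩ := dec_sub_projection hn hB hγ2 hγ hN1 hN2 hΛ hΛ0 hF hFΛ hq hq0
    (fun i => ⟨(hb i).1, (hb i).2.1⟩) hexp
  have hN : 2 ≤ N := by exact_mod_cast hγ2.trans hN1
  obtain ⟨M, rfl⟩ : ∃ k, N = k + 2 := ⟨N - 2, by omega⟩
  push_cast at hN1 hN2
  have hbb : ∀ i t, Bd B ((M : ℝ) + 1) (b i) t := fun i t => ((hb i).1.bd2 hB t).1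
  choose K hK hKb using fun i => abs_coef_le (p := p) (s := 2) hB (hb i).2.1 (hbb i 0)
    (by linarith)
  choose K' hK' hKb' using fun i => (hbb i 0).mono hB (s' := γ) (by linarith)
  obtain ⟨C₁, T₁, hC₁, hT₁, hq1⟩ := hq0.dec.exists_bound
  obtain ⟨C₂, T₂, hC₂, hT₂, hF1⟩ := hF.dec.exists_bound
  have hcoef : ∀ i, ∃ A C' T' : ℝ, 0 ≤ C' ∧ (¬ (Λ₁ < μ i ∧ μ i < 0) → A = 0) ∧ ∀ t, T' ≤ t →
      |coef hB p q (b i) t - A * Real.exp (μ i * t)| ≤ C' * Real.exp (Λ₁ * t) := by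
    intro i
    obtain ⟨T₃, hT₃⟩ := eventually_atTop.1 (hasDerivAt_coef hB (N := M) (by linarith) hp hF hq hq0
      (hb i).1 (hb i).2.1 (hb i).2.2)
    obtain ⟨A, C', hC', hA, hAb⟩ := ode_asymptotics (T := max T₂ T₃) (C := C₂ * K i)
      (hT₂.trans (le_max_left _ _)) hFΛ (fun t ht => hT₃ t ((le_max_right _ _).trans ht))
      fun t ht => (hKb i F t _ (hF1 t ((le_max_left _ _).trans ht)).1).trans
        (le_of_eq (by ring))
    refine ⟨A, C', max T₂ T₃, hC', fun h => ?_, hAb⟩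
    rcases le_or_gt (μ i) Λ₁ with h1 | h1
    · exact hA h1
    have hμi : 0 ≤ μ i := not_lt.1 fun h2 => h ⟨h1, h2⟩
    have hlim : Tendsto (fun t => C' * Real.exp (Λ₁ * t) + C₁ * Real.exp (μ₀ * t) * K i) atTop
        (𝓝 0) := by
      have he : ∀ c : ℝ, c < 0 → Tendsto (fun t => Real.exp (c * t)) atTop (𝓝 0) := fun c hc =>
        Real.tendsto_exp_atBot.comp (tendsto_id.const_mul_atTop_of_neg hc)
      simpa using ((he _ hΛ0).const_mul C').add (((he _ hμ₀).const_mul C₁).mul_const (K i))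
    rw [← abs_nonpos_iff]
    refine ge_of_tendsto hlim ?_
    filter_upwards [eventually_ge_atTop (max T₂ T₃), eventually_ge_atTop T₁] with t ht ht1
    have ht0 : 0 ≤ t := hT₁.trans ht1
    calc |A| ≤ |A * Real.exp (μ i * t)| := by
          rw [abs_mul, Real.abs_exp]
          exact le_mul_of_one_le_right (abs_nonneg _) (Real.one_le_exp (mul_nonneg hμi ht0))
      _ ≤ |coef hB p q (b i) t - A * Real.exp (μ i * t)| + |coef hB p q (b i) t| := by
          rw [abs_sub_comm]
          have := abs_add_le (A * Real.exp (μ i * t) - coef hB p q (b i) t) (coef hB p q (b i) t)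
          rwa [sub_add_cancel] at this
      _ ≤ _ := add_le_add (hAb t ht) (hKb i q t _ (hq1 t ht1).1)
  choose A C' T' hC' hA hAb using hcoef
  refine ⟨A, C + ∑ i, C' i * K' i, T + ∑ i, |T' i|, add_nonneg hC (Finset.sum_nonneg fun i _ =>
    mul_nonneg (hC' i) (hK' i)), by positivity, hA, fun t ht x => ?_⟩
  have hT' : ∀ i, T' i ≤ t := fun i => (le_abs_self _).trans
    ((Finset.single_le_sum (f := fun i => |T' i|) (fun _ _ => abs_nonneg _)
      (Finset.mem_univ i)).trans (by linarith only [ht, hT]))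
  have hTt : T ≤ t := by
    linarith only [ht, Finset.sum_nonneg fun i (_ : i ∈ Finset.univ) => abs_nonneg (T' i)]
  have hsplit : q t x - ∑ i, A i * Real.exp (μ i * t) * b i t x =
      (q t x - ∑ i, coef hB p q (b i) t * b i t x) +
        ∑ i, (coef hB p q (b i) t - A i * Real.exp (μ i * t)) * b i t x := by
    simp only [sub_mul, Finset.sum_sub_distrib]; ring
  rw [hsplit, add_mul, add_mul, Finset.sum_mul, Finset.sum_mul]
  refine (abs_add_le _ _).trans (add_le_add (hproj t hTt x) ?_)
  refine (Finset.abs_sum_le_sum_abs _ _).trans (Finset.sum_le_sum fun i _ => ?_)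
  rw [abs_mul, ev_eq_of_dt_eq_zero (hb i).2.1 t 0]
  calc _ ≤ (C' i * Real.exp (Λ₁ * t)) * (K' i * wt B x ^ γ) :=
        mul_le_mul (hAb i t (hT' i)) (hKb' i x) (abs_nonneg _)
          (mul_nonneg (hC' i) (Real.exp_pos _).le)
    _ = _ := by ring

/-- The squared length of the spatial gradient. -/
def gradSq (f : SF n) : SF n := ∑ a, dx a f ^ 2

lemma gradSq_ev (f : SF n) (t : ℝ) (x : Eu n) : gradSq f t x = ∑ a, dx a f t x ^ 2 := by
  simp [gradSq]

lemma dx_gradSq (f : SF n) (b : Fin n) (t : ℝ) (x : Eu n) :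
    dx b (gradSq f) t x = 2 * ∑ a, dx a f t x * dx b (dx a f) t x := by
  simp [gradSq, map_sum, Finset.mul_sum]

lemma lapl_gradSq (f : SF n) (t : ℝ) (x : Eu n) :
    lapl (gradSq f) t x = 2 * ∑ a, dx a f t x * lapl (dx a f) t x +
      2 * ∑ a, ∑ b, dx b (dx a f) t x ^ 2 := by
  simp [gradSq, map_sum, lapl_sq, Finset.mul_sum, Finset.sum_add_distrib]

lemma dt_dx_of_isQSol {B c κ : ℝ} {q G : SF n} (hq : IsQSol B c 0 κ 1 q G) (a : Fin n) (t : ℝ)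
    (x : Eu n) :
    dt (dx a q) t x = (om n B t x + q t x) * lapl (dx a q) t x -
      c * (∑ b, x b * dx b (dx a q) t x) - c * dx a q t x + 2 * (x a * lapl q t x) +
      dx a G t x + dx a q t x * lapl q t x - κ * dx a (gradSq q) t x := by
  have h : dt (dx a q) = Op n B c (0 - c) (dx a q) + (2 : ℝ) • (X a * lapl q) + dx a G +
      (dx a q * lapl q + q * lapl (dx a q) - κ • dx a (gradSq q)) := by
    rw [dt_dx, show dt q = _ from hq, map_add, map_add, dx_Op, one_smul, map_sub,
      Derivation.map_smul, Derivation.leibniz, dx_lapl, ← gradSq]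
    simp only [smul_eq_mul]
    ring
  rw [h]
  simp [Op]
  ring

lemma dt_gradSq {B c κ : ℝ} {q G : SF n} (hq : IsQSol B c 0 κ 1 q G) (t : ℝ) (x : Eu n) :
    ∃ b : Eu n, (∀ a, b a = -(c * x a) - 2 * κ * dx a q t x) ∧
      dt (gradSq q) t x = (om n B t x + q t x) *
        (lapl (gradSq q) t x - 2 * ∑ a, ∑ b, dx b (dx a q) t x ^ 2) + vgrad b (gradSq q) t x -
        2 * c * gradSq q t x + (4 * (∑ a, x a * dx a q t x) + 2 * gradSq q t x) * lapl q t x +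
        2 * ∑ a, dx a q t x * dx a G t x := by
  refine ⟨WithLp.toLp 2 fun a => -(c * x a) - 2 * κ * dx a q t x, fun a => rfl, ?_⟩
  have h1 : dt (gradSq q) t x = ∑ a, 2 * (dx a q t x * dt (dx a q) t x) := by
    simp [gradSq, map_sum]
  have h2 : ∑ a, dx a q t x * ∑ b, x b * dx b (dx a q) t x =
      ∑ b, x b * ∑ a, dx a q t x * dx b (dx a q) t x := by
    simp_rw [Finset.mul_sum]
    rw [Finset.sum_comm]
    exact Finset.sum_congr rfl fun b _ => Finset.sum_congr rfl fun a _ => by ring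
  have h3 : vgrad (WithLp.toLp 2 fun a => -(c * x a) - 2 * κ * dx a q t x) (gradSq q) t x =
      -2 * c * ∑ b, x b * ∑ a, dx a q t x * dx b (dx a q) t x -
        2 * κ * ∑ b, dx b q t x * dx b (gradSq q) t x := by
    have h : ∀ b, (-(c * x b) - 2 * κ * dx b q t x) * dx b (gradSq q) t x =
        -2 * c * (x b * ∑ a, dx a q t x * dx b (dx a q) t x) +
          -2 * κ * (dx b q t x * dx b (gradSq q) t x) := fun b => by
      rw [dx_gradSq]
      ring
    simp only [vgrad, h, Finset.sum_add_distrib, ← Finset.mul_sum (Finset.univ : Finset (Fin n))]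
    ring
  have h4 : ∑ a, 2 * (dx a q t x * dt (dx a q) t x) =
      (om n B t x + q t x) * (2 * ∑ a, dx a q t x * lapl (dx a q) t x) -
      2 * c * ∑ a, dx a q t x * ∑ b, x b * dx b (dx a q) t x - 2 * c * ∑ a, dx a q t x ^ 2 +
      (4 * (∑ a, x a * dx a q t x) + 2 * ∑ a, dx a q t x ^ 2) * lapl q t x +
      2 * ∑ a, dx a q t x * dx a G t x - 2 * κ * ∑ a, dx a q t x * dx a (gradSq q) t x := by
    have h : ∀ a, 2 * (dx a q t x * dt (dx a q) t x) =
        (om n B t x + q t x) * 2 * (dx a q t x * lapl (dx a q) t x) +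
        -2 * c * (dx a q t x * ∑ b, x b * dx b (dx a q) t x) +
        (-2 * c + 2 * lapl q t x) * dx a q t x ^ 2 + 4 * lapl q t x * (x a * dx a q t x) +
        2 * (dx a q t x * dx a G t x) + -2 * κ * (dx a q t x * dx a (gradSq q) t x) := fun a => by
      rw [dt_dx_of_isQSol hq]
      ring
    simp only [h, Finset.sum_add_distrib, ← Finset.mul_sum (Finset.univ : Finset (Fin n))]
    ring
  rw [h1, h4, h3, lapl_gradSq, gradSq_ev, h2]
  ring

lemma sq_lapl_le (f : SF n) (t : ℝ) (x : Eu n) :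
    lapl f t x ^ 2 ≤ n * ∑ a, ∑ b, dx b (dx a f) t x ^ 2 := by
  have h1 : lapl f t x = ∑ a, dx a (dx a f) t x := by simp [lapl_eq]
  have h2 := sq_sum_le_card_mul_sum_sq (s := (Finset.univ : Finset (Fin n)))
    (f := fun a => dx a (dx a f) t x)
  rw [h1]
  refine h2.trans ?_
  simp only [Finset.card_univ, Fintype.card_fin]
  refine mul_le_mul_of_nonneg_left (Finset.sum_le_sum fun a _ => ?_) (Nat.cast_nonneg n)
  exact Finset.single_le_sum (f := fun b => dx b (dx a f) t x ^ 2) (fun b _ => sq_nonneg _)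
    (Finset.mem_univ a)

lemma sq_radial_le (f : SF n) (t : ℝ) (x : Eu n) :
    (∑ a, x a * dx a f t x) ^ 2 ≤ ‖x‖ ^ 2 * gradSq f t x := by
  have h := Finset.sum_mul_sq_le_sq_mul_sq Finset.univ (fun a => x a) (fun a => dx a f t x)
  rw [gradSq_ev, ← inner_self_coord]
  simpa [sq] using h

lemma D_eq_zero_of_slice {f : SF n} {t : ℝ} (h : ∀ x, f t x = 0) (J : List (Fin n)) (x : Eu n) :
    D J f t x = 0 := by
  induction J generalizing x with
  | nil => exact h x
  | cons a J ih =>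
    have h1 := hasDerivAt_dx (D J f) t x a 0
    simp only [ih] at h1
    have := h1.unique (hasDerivAt_const _ _)
    simpa using this

/-- The pointwise differential inequality behind the exponential decay of the gradient. -/
lemma gradient_inequality {k S L M Y r w a ε : ℝ} (hk : 0 < k) (hL : L ^ 2 ≤ k * S)
    (hM : M ^ 2 ≤ r ^ 2 * Y) (hY0 : 0 ≤ Y) (hε0 : 0 ≤ ε) (hε : ε ≤ 1 / 5) (hw : 0 < w)
    (hr : r ^ 2 ≤ w) (hY : Y ≤ ε ^ 2 * w) (ha : (1 - ε) * w ≤ a) :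
    (4 * M + 2 * Y) * L - 2 * a * S ≤ 2 * k * (1 + 4 * ε) * Y := by
  have ha0 : 0 < a := by nlinarith
  have hm : (4 * M + 2 * Y) ^ 2 ≤ 16 * (1 + ε) ^ 2 * w * Y := by
    have h1 : M ^ 2 ≤ w * Y := hM.trans (mul_le_mul_of_nonneg_right hr hY0)
    have h2 : Y ^ 2 ≤ ε ^ 2 * (w * Y) := by nlinarith only [mul_le_mul_of_nonneg_right hY hY0]
    have h3 : M * Y ≤ ε * (w * Y) := by
      refine abs_le_of_sq_le_sq' ?_ (by positivity) |>.2
      calc (M * Y) ^ 2 = M ^ 2 * Y ^ 2 := by ring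
        _ ≤ (w * Y) * (ε ^ 2 * (w * Y)) := mul_le_mul h1 h2 (sq_nonneg _) (by positivity)
        _ = _ := by ring
    nlinarith only [h1, h2, h3, mul_nonneg hε0 (mul_nonneg hw.le hY0),
      mul_nonneg (mul_nonneg hε0 hε0) (mul_nonneg hw.le hY0)]
  have key : ((4 * M + 2 * Y) * L) ≤ 2 * a * S + k * (4 * M + 2 * Y) ^ 2 / (8 * a) := by
    have hx : (4 * M + 2 * Y) * L * (8 * a) ≤ (2 * a * S) * (8 * a) + k * (4 * M + 2 * Y) ^ 2 := by
      have h4 : 0 ≤ (4 * a * L - k * (4 * M + 2 * Y)) ^ 2 := sq_nonneg _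
      have h5 : k * ((4 * M + 2 * Y) * L * (8 * a)) ≤
          k * ((2 * a * S) * (8 * a) + k * (4 * M + 2 * Y) ^ 2) := by
        nlinarith only [h4, mul_le_mul_of_nonneg_left hL (by positivity : 0 ≤ 16 * a ^ 2)]
      exact le_of_mul_le_mul_left h5 hk
    rw [← sub_le_iff_le_add', le_div_iff₀ (by positivity)]
    linarith
  have h6 : k * (4 * M + 2 * Y) ^ 2 / (8 * a) ≤ 2 * k * (1 + 4 * ε) * Y := by
    rw [div_le_iff₀ (by positivity)]
    have h7 : (1 + ε) ^ 2 ≤ (1 + 4 * ε) * (1 - ε) := by nlinarith only [hε0, hε]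
    calc k * (4 * M + 2 * Y) ^ 2 ≤ k * (16 * (1 + ε) ^ 2 * w * Y) := by gcongr
      _ = 16 * k * Y * w * (1 + ε) ^ 2 := by ring
      _ ≤ 16 * k * Y * w * ((1 + 4 * ε) * (1 - ε)) := by gcongr
      _ = 16 * k * Y * (1 + 4 * ε) * ((1 - ε) * w) := by ring
      _ ≤ 16 * k * Y * (1 + 4 * ε) * a := by gcongr
      _ = _ := by ring
  linarith

lemma eventually_small_gradient {B c l κ : ℝ} (hB : 0 < B) {q G : SF n}
    (hq : IsQSol B c l κ 1 q G) {T₀ : ℝ} (hG : ∀ t x, T₀ < t → G t x = 0)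
    (hconv : ∀ ε > 0, ∃ T, ∀ t, T ≤ t → ∀ x, |q t x| ≤ ε * wt B x ^ 2) {ε : ℝ} (hε : 0 < ε) :
    ∃ T, T₀ < T ∧ ∀ t, T ≤ t → ∀ x, |q t x| ≤ ε * wt B x ^ 2 ∧ ∀ a, |dx a q t x| ≤ ε * wt B x := by
  obtain ⟨C, δ₀, hδ₀, hC, H⟩ := interior_step (s := 2) hB q G hq (Or.inr rfl) 0
  obtain ⟨δ, hδ, hδ1, hδ2, hδ3⟩ : ∃ δ : ℝ, 0 < δ ∧ δ ≤ δ₀ ∧ δ ≤ ε ∧ C * δ ≤ ε := by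
    refine ⟨min δ₀ (min ε (ε / (C + 1))), lt_min hδ₀ (lt_min hε (by positivity)), min_le_left _ _,
      (min_le_right _ _).trans (min_le_left _ _), ?_⟩
    calc C * min δ₀ (min ε (ε / (C + 1))) ≤ (C + 1) * (ε / (C + 1)) :=
          mul_le_mul (by linarith) ((min_le_right _ _).trans (min_le_right _ _))
            (le_min hδ₀.le (le_min hε.le (by positivity))) (by positivity)
      _ = ε := by field_simp
  obtain ⟨T, hT⟩ := hconv δ hδ
  refine ⟨max T T₀ + 2, by linarith [le_max_right T T₀], fun t ht x => ⟨?_, fun a => ?_⟩⟩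
  · refine (hT t (by linarith [le_max_left T T₀]) x).trans ?_
    gcongr
  · have h := H δ hδ hδ1 t x (fun s hs y _ => ⟨fun J hJ => ?_, fun J _ => ?_⟩) [a] rfl
    · norm_num at h
      refine h.trans ?_
      gcongr
      exact (wt_pos hB x).le
    · obtain rfl := List.length_eq_zero_iff.1 (Nat.le_zero.1 hJ)
      have := hT s (by linarith [le_max_left T T₀, hs.1]) y
      simpa using this
    · rw [D_eq_zero_of_slice (fun z => hG s z (by linarith [le_max_right T T₀, hs.1])) J y, abs_zero]
      have := wt_rpow_pos hB y (2 - J.length)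
      positivity

lemma vgrad_sub (b : Eu n) (f g : SF n) (t : ℝ) (x : Eu n) :
    vgrad b (f - g) t x = vgrad b f t x - vgrad b g t x := by
  simp [vgrad, mul_sub]

lemma dx_radial_barrier (A μ K B : ℝ) (a : Fin n) :
    dx a (A • (expT μ * (algebraMap ℝ (SF n) K + om n B))) = (2 * A) • (expT μ * X a) := by
  apply SF_ext
  intro t x
  rw [Derivation.map_smul, Derivation.leibniz, map_add, dx_om]
  simp
  ring

lemma vgrad_radial_barrier (b : Eu n) (A μ K B t : ℝ) (x : Eu n) :
    vgrad b (A • (expT μ * (algebraMap ℝ (SF n) K + om n B))) t x =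
      2 * A * Real.exp (μ * t) * ∑ i, b i * x i := by
  simp only [vgrad, dx_radial_barrier, Finset.mul_sum, smul_ev, mul_ev, expT_ev, X_ev]
  exact Finset.sum_congr rfl fun i _ => by ring

lemma lapl_radial_barrier (A μ K B t : ℝ) (x : Eu n) :
    lapl (A • (expT μ * (algebraMap ℝ (SF n) K + om n B))) t x =
      2 * A * Real.exp (μ * t) * n := by
  rw [lapl_eq, Finset.sum_congr rfl fun a _ => by rw [dx_radial_barrier]]
  simp [Derivation.leibniz, dx_X]
  ring

/-- The squared gradient of the pressure perturbation decays at any rate below `2p`. -/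
theorem gradSq_decay {B p : ℝ} (hn : 1 ≤ n) (hp : 0 < p) (hB : 0 < B) {q G : SF n}
    (hq : IsQSol B (p + n) 0 ((p + n) / 2) 1 q G) {T₀ : ℝ} (hG : ∀ t x, T₀ < t → G t x = 0)
    (hconv : ∀ ε > 0, ∃ T, ∀ t, T ≤ t → ∀ x, |q t x| ≤ ε * wt B x ^ 2) {μ : ℝ}
    (hμ0 : 0 < μ) (hμ : μ < 2 * p) :
    ∃ C T : ℝ, 0 ≤ C ∧ ∀ t, T ≤ t → ∀ x, gradSq q t x ≤ C * Real.exp (-μ * t) * wt B x ^ 2 := by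
  have hn' : (1 : ℝ) ≤ n := by exact_mod_cast hn
  obtain ⟨ν, hν0, hν⟩ : ∃ ν : ℝ, 0 < ν ∧ μ + 2 * ν = 2 * p := ⟨(2 * p - μ) / 2, by linarith, by ring⟩
  obtain ⟨ε, hε0, hε1, hε2, hε3⟩ : ∃ ε : ℝ, 0 < ε ∧ ε ≤ 1 / 5 ∧ 8 * n * ε ≤ ν ∧
      ε * (4 * n + 2 * p) ≤ ν := by
    refine ⟨min (1 / 5) (ν / (8 * n + 2 * p)), lt_min (by norm_num) (by positivity),
      min_le_left _ _, ?_, ?_⟩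
    · calc 8 * n * min (1 / 5) (ν / (8 * n + 2 * p)) ≤ (8 * n + 2 * p) * (ν / (8 * n + 2 * p)) :=
            mul_le_mul (by linarith) (min_le_right _ _) (le_min (by norm_num) (by positivity))
              (by positivity)
        _ = ν := by field_simp
    · rw [mul_comm]
      calc (4 * n + 2 * p) * min (1 / 5) (ν / (8 * n + 2 * p)) ≤
            (8 * n + 2 * p) * (ν / (8 * n + 2 * p)) :=
            mul_le_mul (by linarith) (min_le_right _ _) (le_min (by norm_num) (by positivity))
              (by positivity)
        _ = ν := by field_simp
  obtain ⟨T, hT0, hT⟩ := eventually_small_gradient hB hq hG hconv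
    (show 0 < ε / n by positivity)
  have hεn : ε / n ≤ ε := div_le_self hε0.le hn'
  have hqb : ∀ t, T ≤ t → ∀ x, |q t x| ≤ ε * om n B t x := fun t ht x => by
    rw [om_eq_wt_sq hB]
    exact (hT t ht x).1.trans (mul_le_mul_of_nonneg_right hεn (sq_nonneg _))
  have hY0 : ∀ t x, 0 ≤ gradSq q t x := fun t x => by
    rw [gradSq_ev]; exact Finset.sum_nonneg fun a _ => sq_nonneg _
  have hYb : ∀ t, T ≤ t → ∀ x, gradSq q t x ≤ ε ^ 2 * om n B t x := fun t ht x => by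
    rw [om_eq_wt_sq hB, gradSq_ev]
    calc ∑ a, dx a q t x ^ 2 ≤ ∑ _a : Fin n, (ε / n * wt B x) ^ 2 :=
          Finset.sum_le_sum fun a _ => sq_le_sq' (abs_le.1 ((hT t ht x).2 a)).1
            (abs_le.1 ((hT t ht x).2 a)).2
      _ = (ε ^ 2 * wt B x ^ 2) / n := by
          simp only [Finset.sum_const, Finset.card_univ, Fintype.card_fin, nsmul_eq_mul]
          field_simp
      _ ≤ ε ^ 2 * wt B x ^ 2 := div_le_self (by positivity) hn'
  obtain ⟨K, hK0, hK⟩ : ∃ K : ℝ, 0 ≤ K ∧ ν * K = 2 * (p + n) * B :=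
    ⟨2 * (p + n) * B / ν, by positivity, by field_simp⟩
  obtain ⟨A, hA0, hA⟩ : ∃ A : ℝ, 0 ≤ A ∧ A * Real.exp (-μ * T) = ε ^ 2 :=
    ⟨ε ^ 2 * Real.exp (μ * T), by positivity, by
      rw [mul_assoc, ← Real.exp_add]; simp⟩
  have hmain : ∀ t, T ≤ t → ∀ x,
      (gradSq q - A • (expT (-μ) * (algebraMap ℝ (SF n) K + om n B)) : SF n) t x ≤ 0 := by
    intro t₁ ht₁ x₁
    refine max_principle (T := t₁) (t₁ := T) (r₀ := -1) (K := 2 + 2 * (p + n) * 2) (K' := ε ^ 2) hB _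
      (by positivity) 1 ?_ ?_ ?_ ?_ t₁ ⟨ht₁, le_rfl⟩ x₁ (by linarith [norm_nonneg x₁])
    · intro t ht x _
      have h1 := hYb t ht.1 x
      have h2 : 0 ≤ A * (Real.exp (-μ * t) * (K + om n B t x)) := by
        have := om_pos hB t x
        positivity
      simp only [sub_ev, smul_ev, mul_ev, expT_ev, add_ev, algebraMap_ev, pow_one]
      linarith
    · intro x _
      have h1 := hYb T le_rfl x
      have h2 : A * (Real.exp (-μ * T) * (K + om n B T x)) = ε ^ 2 * K + ε ^ 2 * om n B T x := by
        rw [← mul_assoc, hA]; ring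
      simp only [sub_ev, smul_ev, mul_ev, expT_ev, add_ev, algebraMap_ev]
      have : 0 ≤ ε ^ 2 * K := by positivity
      linarith
    · intro t _ x hx
      linarith [norm_nonneg x]
    · intro t ht x _ _
      obtain ⟨b, hb, hdt⟩ := dt_gradSq hq t x
      have hw := om_pos hB t x
      have hq1 := abs_le.1 (hqb t ht.1.le x)
      have hx2 : ‖x‖ ^ 2 ≤ om n B t x := by rw [om_ev]; linarith
      have hrad : |∑ a, x a * dx a q t x| ≤ ε * om n B t x := by
        refine abs_le_of_sq_le_sq ?_ (by positivity)
        refine (sq_radial_le q t x).trans ?_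
        calc ‖x‖ ^ 2 * gradSq q t x ≤ om n B t x * (ε ^ 2 * om n B t x) :=
              mul_le_mul hx2 (hYb t ht.1.le x) (hY0 t x) hw.le
          _ = _ := by ring
      have hbx : ∑ i, b i * x i = -(p + n) * ‖x‖ ^ 2 - (p + n) * ∑ a, x a * dx a q t x := by
        rw [← inner_self_coord, Finset.mul_sum, Finset.mul_sum, ← Finset.sum_sub_distrib]
        exact Finset.sum_congr rfl fun i _ => by rw [hb]; ring
      have hr := abs_le.1 hrad
      have hpn : 0 < p + n := by positivity
      refine ⟨om n B t x + q t x, b, -(2 * p - ν), by nlinarith only [hq1.1, hε1, hw],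
        by nlinarith only [hq1.2, hε1, hw, mul_pos hpn hw], ?_, by linarith, ?_⟩
      · rw [hbx, abs_le]
        constructor
        · nlinarith only [mul_le_mul_of_nonneg_left hr.2 hpn.le, mul_le_mul_of_nonneg_left hx2 hpn.le,
            mul_pos hpn hw, hw, mul_le_mul_of_nonneg_right hε1 (mul_pos hpn hw).le]
        · nlinarith only [mul_le_mul_of_nonneg_left hr.1 hpn.le, mul_nonneg hpn.le (sq_nonneg ‖x‖),
            mul_pos hpn hw, hw, mul_le_mul_of_nonneg_right hε1 (mul_pos hpn hw).le]
      · have hineq := gradient_inequality (a := om n B t x + q t x) (w := om n B t x)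
          (show (0 : ℝ) < n by positivity) (sq_lapl_le q t x) (sq_radial_le q t x) (hY0 t x) hε0.le
          hε1 hw hx2 (hYb t ht.1.le x) (by linarith)
        have hG0 : ∑ a, dx a q t x * dx a G t x = 0 := Finset.sum_eq_zero fun a _ => by
          have h : dx a G t x = 0 := D_eq_zero_of_slice (fun z => hG t z (hT0.trans ht.1)) [a] x
          rw [h, mul_zero]
        have hE : 0 ≤ A * Real.exp (-μ * t) := by positivity
        have h1 : 2 * n * (om n B t x + q t x) + 2 * ∑ i, b i * x i ≤ ν * (K + om n B t x) := by
          rw [hbx]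
          have : ‖x‖ ^ 2 = om n B t x - B := by rw [om_ev]; ring
          rw [this]
          nlinarith only [mul_le_mul_of_nonneg_left hq1.2 (by positivity : 0 ≤ 2 * (n : ℝ)), hK,
            mul_le_mul_of_nonneg_left hr.1 hpn.le, mul_le_mul_of_nonneg_right hε3 hw.le,
            mul_pos hp hw]
        rw [map_sub, map_sub, sub_ev, sub_ev, dt_expT_smul_mul _ _ (by simp), lapl_radial_barrier,
          vgrad_sub, vgrad_radial_barrier, hdt, hG0]
        simp only [sub_ev, smul_ev, mul_ev, expT_ev, add_ev, algebraMap_ev]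
        have h2 := mul_le_mul_of_nonneg_left h1 hE
        have h3 := mul_le_mul_of_nonneg_right hε2 (hY0 t x)
        linear_combination hineq + h2 + h3 + A * Real.exp (-μ * t) * (K + om n B t x) * hν
  refine ⟨A * (1 + K / B), T, by positivity, fun t ht x => ?_⟩
  have h := hmain t ht x
  simp only [sub_ev, smul_ev, mul_ev, expT_ev, add_ev, algebraMap_ev] at h
  have hw : B ≤ om n B t x := le_om t x
  have h1 : K ≤ K / B * om n B t x := by
    rw [div_mul_eq_mul_div, le_div_iff₀ hB]
    exact mul_le_mul_of_nonneg_left hw hK0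
  have hE : 0 ≤ A * Real.exp (-μ * t) := by positivity
  rw [← om_eq_wt_sq hB t]
  linear_combination h + A * Real.exp (-μ * t) * h1

lemma ev_eq_of_dx_eq_zero {f : SF n} (h : ∀ a, dx a f = 0) (t : ℝ) (x : Eu n) : f t x = f t 0 := by
  refine is_const_of_fderiv_eq_zero (𝕜 := ℝ) (differentiable_space f t) (fun y => ?_) x 0
  ext v
  rw [fderiv_space_apply]
  simp [h]

lemma PolyLT.eq_zero {k : ℕ} {f : SF n} (h : PolyLT k f) (hv : VanishTo k f) : f = 0 := by
  induction k generalizing f with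
  | zero => exact h
  | succ k ih =>
    refine SF_ext fun t x => ?_
    rw [ev_eq_of_dx_eq_zero (fun a => ih (h a) (hv.2 a)) t x, hv.1 t]
    rfl

lemma PolyLT.eq_taylor {k : ℕ} {f : SF n} (h : PolyLT k f) : f = taylor k f := by
  have h1 : PolyLT k (f - taylor k f) := by
    rw [sub_eq_add_neg, ← neg_one_smul ℝ (taylor k f)]
    exact h.add ((polyLT_taylor k f).smul _)
  exact sub_eq_zero.1 (h1.eq_zero (vanishTo_sub_taylor k f))

lemma PolyLT.affine {g : SF n} (h : PolyLT 2 g) (t : ℝ) (x : Eu n) :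
    g t x = g t 0 + ∑ a, dx a g t 0 * x a := by
  conv_lhs => rw [h.eq_taylor]
  simp [taylor, Finset.sum_range_succ, homPart, mul_comm]

lemma abs_sub_zero_le_of_gradSq {B C t : ℝ} (hB : 0 < B) {f : SF n} (hC : 0 ≤ C)
    (h : ∀ x, gradSq f t x ≤ C ^ 2 * wt B x ^ 2) (x : Eu n) :
    |f t x - f t 0| ≤ C * wt B x ^ 2 := by
  have hderiv := hasDerivAt_line f t 0 x
  simp only [zero_add] at hderiv
  have hb : ∀ s ∈ Set.Ico (0 : ℝ) 1, ‖∑ a, x a * dx a f t (s • x)‖ ≤ C * wt B x ^ 2 := by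
    intro s hs
    have h1 : (∑ a, x a * dx a f t (s • x)) ^ 2 ≤ ‖x‖ ^ 2 * gradSq f t (s • x) := by
      have h := Finset.sum_mul_sq_le_sq_mul_sq Finset.univ (fun a => x a)
        (fun a => dx a f t (s • x))
      rw [gradSq_ev, ← inner_self_coord]
      simpa [sq] using h
    have h2 : wt B (s • x) ^ 2 ≤ wt B x ^ 2 := by
      rw [wt_sq hB, wt_sq hB, norm_smul, mul_pow, Real.norm_eq_abs, sq_abs]
      have : s ^ 2 ≤ 1 := by nlinarith [hs.1, hs.2]
      nlinarith [sq_nonneg ‖x‖]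
    have hx : ‖x‖ ^ 2 ≤ wt B x ^ 2 := by rw [wt_sq hB]; linarith
    refine abs_le_of_sq_le_sq (h1.trans ?_) (by positivity)
    calc ‖x‖ ^ 2 * gradSq f t (s • x) ≤ wt B x ^ 2 * (C ^ 2 * wt B x ^ 2) :=
          mul_le_mul hx ((h _).trans (mul_le_mul_of_nonneg_left h2 (sq_nonneg C)))
            (by rw [gradSq_ev]; exact Finset.sum_nonneg fun a _ => sq_nonneg _) (sq_nonneg _)
      _ = _ := by ring
  have := norm_image_sub_le_of_norm_deriv_le_segment_01'
    (fun s _ => (hderiv s).hasDerivWithinAt) hb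
  simpa using this

/-- The moment of `q` against `g` is quadratically small in the relative size of `q`. -/
def SmallMoment {B : ℝ} (hB : 0 < B) (p : ℝ) (q g : SF n) : Prop :=
  ∃ K T : ℝ, 0 ≤ K ∧ ∀ t, T ≤ t → ∀ δ, 0 ≤ δ → δ ≤ 1 / 2 →
    (∀ x, |q t x| ≤ δ * wt B x ^ 2) → |coef hB p q g t| ≤ K * δ ^ 2

lemma bd_two_of_le {B t δ : ℝ} {q : SF n} (hδ : 0 ≤ δ) (h : ∀ x, |q t x| ≤ δ * wt B x ^ 2) :
    Bd B 2 q t := ⟨δ, hδ, fun x => by simpa using h x⟩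

lemma bd_one {B : ℝ} (t : ℝ) : Bd B 0 (1 : SF n) t := ⟨1, zero_le_one, fun x => by simp⟩

lemma bd_X {B : ℝ} (hB : 0 < B) (a : Fin n) (t : ℝ) : Bd B 1 (X a : SF n) t :=
  ⟨1, zero_le_one, fun x => by
    simpa using (abs_coord_le x a).trans (norm_le_wt hB x)⟩

lemma SmallMoment.affine {B p : ℝ} (hB : 0 < B) (hp : 1 < p) {q g : SF n} (hg : PolyLT 2 g)
    (hg0 : dt g = 0) (h1 : SmallMoment hB p q 1) (hX : ∀ a, SmallMoment hB p q (X a)) :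
    SmallMoment hB p q g := by
  obtain ⟨K, T, hK, H⟩ := h1
  choose K' T' hK' H' using hX
  obtain ⟨T₁, hT₁⟩ : ∃ T₁, ∀ a, T' a ≤ T₁ := ⟨∑ a, |T' a|, fun a => (le_abs_self _).trans
    (Finset.single_le_sum (f := fun a => |T' a|) (fun _ _ => abs_nonneg _) (Finset.mem_univ a))⟩
  refine ⟨|g 0 0| * K + ∑ a, |dx a g 0 0| * K' a, max T T₁, add_nonneg (by positivity)
    (Finset.sum_nonneg fun a _ => mul_nonneg (abs_nonneg _) (hK' a)), fun t ht δ hδ hδ1 hq => ?_⟩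
  have hqb := bd_two_of_le hδ hq
  have i1 := coef_integrable (p := p) hB hqb (bd_one t) (by linarith)
  have i2 := fun a => coef_integrable (p := p) hB hqb (bd_X hB a t) (by linarith)
  have e : coef hB p q g t = g 0 0 * coef hB p q 1 t + ∑ a, dx a g 0 0 * coef hB p q (X a) t := by
    simp only [coef, ← integral_const_mul]
    rw [← integral_finsetSum _ fun a _ => (i2 a).const_mul _, ← integral_add (i1.const_mul _)
      (integrable_finsetSum _ fun a _ => (i2 a).const_mul _)]
    refine integral_congr_ae (Eventually.of_forall fun x => ?_)
    simp only [mul_ev, one_ev, X_ev]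
    rw [ev_eq_of_dt_eq_zero hg0 t 0 x, hg.affine, mul_add, add_mul, Finset.mul_sum, Finset.sum_mul]
    refine congrArg₂ _ (by ring) (Finset.sum_congr rfl fun a _ => by ring)
  rw [e, add_mul, Finset.sum_mul]
  refine (abs_add_le _ _).trans (add_le_add ?_ ((Finset.abs_sum_le_sum_abs _ _).trans
    (Finset.sum_le_sum fun a _ => ?_)))
  · rw [abs_mul, mul_assoc]
    exact mul_le_mul_of_nonneg_left (H t ((le_max_left _ _).trans ht) δ hδ hδ1 hq) (abs_nonneg _)
  · rw [abs_mul, mul_assoc]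
    exact mul_le_mul_of_nonneg_left (H' a t ((hT₁ a).trans ((le_max_right _ _).trans ht)) δ hδ hδ1 hq)
      (abs_nonneg _)

/-- If the gradient decays exponentially and the mass is balanced, then `q` decays. -/
lemma dec_of_gradSq {B p ν : ℝ} (hB : 0 < B) (hp : 0 < p) (hν : 0 < ν) {q : SF n}
    (hgrad : ∃ C T : ℝ, 0 ≤ C ∧ ∀ t, T ≤ t → ∀ x,
      gradSq q t x ≤ C * Real.exp (-(2 * ν) * t) * wt B x ^ 2)
    (hconv : ∀ ε > 0, ∃ T, ∀ t, T ≤ t → ∀ x, |q t x| ≤ ε * wt B x ^ 2)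
    (h1 : SmallMoment hB p q 1) : Dec B (-ν) 2 q := by
  obtain ⟨C, T, hC, H⟩ := hgrad
  obtain ⟨K, T₁, hK, H₁⟩ := h1
  obtain ⟨K₂, hK₂, H₂⟩ := abs_coef_le (p := p) (s := 2) hB (n := n) (g := 1) (by simp) (bd_one 0)
    (by linarith)
  have hW : 0 < ∫ x, Wt n hB p 0 x := by
    refine (integral_pos_iff_support_of_nonneg (fun x => ?_) ?_).2 ?_
    · simp only [Wt, omPow_eq_wt]; exact (wt_rpow_pos hB x _).le
    · exact (bd_Wt hB p 0).integrable hB (by linarith)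
    · have : Function.support (fun x => Wt n hB p 0 x) = Set.univ := by
        ext x
        simp only [Function.mem_support, Set.mem_univ, iff_true, Wt, omPow_eq_wt]
        exact (wt_rpow_pos hB x _).ne'
      rw [this]
      exact isOpen_univ.measure_pos _ Set.univ_nonempty
  obtain ⟨w, hw⟩ : ∃ w, w = ∫ x, Wt n hB p 0 x := ⟨_, rfl⟩
  rw [← hw] at hW
  have hs0 : ∀ t x, T ≤ t → |q t x - q t 0| ≤ √C * Real.exp (-ν * t) * wt B x ^ 2 := by
    intro t x ht
    refine abs_sub_zero_le_of_gradSq hB (by positivity) (fun y => (H t ht y).trans (le_of_eq ?_)) x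
    rw [mul_pow, Real.sq_sqrt hC, ← Real.exp_nat_mul]
    congr 3
    push_cast; ring
  obtain ⟨ε, hε0, hε1, hε2⟩ : ∃ ε : ℝ, 0 < ε ∧ ε ≤ 1 / 2 ∧ K * ε * (2 / B) ≤ w / 2 := by
    refine ⟨min (1 / 2) (w * B / (4 * (K + 1))), by positivity, min_le_left _ _, ?_⟩
    calc K * min (1 / 2) (w * B / (4 * (K + 1))) * (2 / B) ≤
          (K + 1) * (w * B / (4 * (K + 1))) * (2 / B) := by
          gcongr
          · linarith
          · exact min_le_right _ _
      _ = w / 2 := by field_simp; ring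
  obtain ⟨T₂, hT₂⟩ := hconv (ε / 2) (by positivity)
  have hexp : Tendsto (fun t => √C * Real.exp (-ν * t)) atTop (𝓝 0) := by
    rw [show (0 : ℝ) = √C * 0 by ring]
    refine (Real.tendsto_exp_atBot.comp ?_).const_mul _
    exact (tendsto_const_mul_atBot_of_neg (by linarith)).2 tendsto_id
  obtain ⟨T₃, hT₃⟩ := eventually_atTop.1 (hexp.eventually_le_const (by positivity : 0 < ε / 2))
  have hwt0 : wt B (0 : Eu n) ^ 2 = B := by rw [wt_sq hB]; simp
  have hBwt : ∀ x : Eu n, B ≤ wt B x ^ 2 := fun x => by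
    rw [wt_sq hB]; linarith only [sq_nonneg ‖x‖]
  have main : ∀ t, max (max T T₁) (max T₂ T₃) ≤ t →
      |q t 0| ≤ 2 / w * (K * ε + K₂) * (√C * Real.exp (-ν * t)) := by
    intro t ht
    obtain ⟨⟨h1, h2⟩, h3, h4⟩ := (by simpa using ht : (T ≤ t ∧ T₁ ≤ t) ∧ T₂ ≤ t ∧ T₃ ≤ t)
    obtain ⟨e, he⟩ : ∃ e, e = √C * Real.exp (-ν * t) := ⟨_, rfl⟩
    have he0 : 0 ≤ e := by rw [he]; positivity
    have heε : e ≤ ε / 2 := by rw [he]; exact hT₃ t h4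
    have hs : ∀ x, |q t x - q t 0| ≤ e * wt B x ^ 2 := fun x => by rw [he]; exact hs0 t x h1
    rw [← he]
    have hsB : |q t 0| / B ≤ ε / 2 := by
      rw [div_le_iff₀ hB]; have := hT₂ t h3 0; rwa [hwt0] at this
    have hδ : ∀ x, |q t x| ≤ (|q t 0| / B + e) * wt B x ^ 2 := by
      intro x
      have h5 : |q t x| ≤ |q t 0| + |q t x - q t 0| := by
        have := abs_add_le (q t 0) (q t x - q t 0); rwa [add_sub_cancel] at this
      have h6 : |q t 0| ≤ |q t 0| / B * wt B x ^ 2 := by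
        rw [div_mul_eq_mul_div, le_div_iff₀ hB]
        exact mul_le_mul_of_nonneg_left (hBwt x) (abs_nonneg _)
      rw [add_mul]
      linarith only [h5, h6, hs x]
    have hd0 : 0 ≤ |q t 0| / B := by positivity
    have hco := H₁ t h2 _ (by positivity) (by linarith) hδ
    have hbq := bd_two_of_le (by positivity) hδ
    have hsplit : coef hB p q 1 t = q t 0 * w + coef hB p (q - algebraMap ℝ (SF n) (q t 0)) 1 t := by
      have hbc : Bd B 2 (algebraMap ℝ (SF n) (q t 0)) t :=
        bd_two_of_le (δ := |q t 0| / B) hd0 fun x => by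
          rw [algebraMap_ev, div_mul_eq_mul_div, le_div_iff₀ hB]
          exact mul_le_mul_of_nonneg_left (hBwt x) (abs_nonneg _)
      rw [coef_sub hB hbq hbc (bd_one t) (by linarith), hw, ← integral_const_mul]
      have : coef hB p (algebraMap ℝ (SF n) (q t 0)) 1 t = ∫ x, q t 0 * Wt n hB p 0 x := by
        refine integral_congr_ae (Eventually.of_forall fun x => ?_)
        simp [Wt]
      rw [this]; ring
    have hrem : |coef hB p (q - algebraMap ℝ (SF n) (q t 0)) 1 t| ≤ e * K₂ := by
      refine H₂ _ t e fun x => ?_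
      simpa using hs x
    have hsw : |q t 0| * w ≤ K * (|q t 0| / B + e) ^ 2 + e * K₂ := by
      calc |q t 0| * w = |coef hB p q 1 t - coef hB p (q - algebraMap ℝ (SF n) (q t 0)) 1 t| := by
            rw [hsplit, add_sub_cancel_right, abs_mul, abs_of_pos hW]
        _ ≤ _ := (abs_sub _ _).trans (add_le_add hco hrem)
    have h7 : K * (|q t 0| / B + e) ^ 2 ≤ K * ε * (|q t 0| / B + e) := by
      rw [sq, ← mul_assoc]
      refine mul_le_mul_of_nonneg_right (mul_le_mul_of_nonneg_left ?_ hK) (by positivity)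
      linarith
    have h8 : K * ε * (|q t 0| / B) ≤ w / 2 * |q t 0| := by
      have e1 : K * ε * (|q t 0| / B) = K * ε * (2 / B) / 2 * |q t 0| := by ring
      rw [e1]
      refine mul_le_mul_of_nonneg_right ?_ (abs_nonneg _)
      linarith
    have h9 : |q t 0| * (w / 2) ≤ (K * ε + K₂) * e := by
      linarith only [hsw, h7, h8]
    calc |q t 0| = 2 / w * (|q t 0| * (w / 2)) := by field_simp
      _ ≤ 2 / w * ((K * ε + K₂) * e) := mul_le_mul_of_nonneg_left h9 (by positivity)
      _ = _ := by ring
  refine ⟨(2 / w * (K * ε + K₂) / B + 1) * √C, max 0 (max (max T T₁) (max T₂ T₃)), by positivity,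
    le_max_left _ _, fun t ht x => ?_⟩
  have hm := main t ((le_max_right _ _).trans ht)
  have hsx := hs0 t x (((le_max_left _ _).trans (le_max_left _ _)).trans ((le_max_right _ _).trans ht))
  have h5 : |q t x| ≤ |q t 0| + |q t x - q t 0| := by
    have := abs_add_le (q t 0) (q t x - q t 0); rwa [add_sub_cancel] at this
  have h6 : |q t 0| ≤ |q t 0| / B * wt B x ^ 2 := by
    rw [div_mul_eq_mul_div, le_div_iff₀ hB]
    exact mul_le_mul_of_nonneg_left (hBwt x) (abs_nonneg _)
  have h7 : |q t 0| / B * wt B x ^ 2 ≤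
      2 / w * (K * ε + K₂) * (√C * Real.exp (-ν * t)) / B * wt B x ^ 2 := by gcongr
  rw [show wt B x ^ (2 : ℝ) = wt B x ^ 2 from Real.rpow_natCast _ 2]
  refine h5.trans ((add_le_add (h6.trans h7) hsx).trans (le_of_eq (by ring)))

lemma Sym.of_eventually_zero {B μ s : ℝ} {G : SF n} {T₀ : ℝ}
    (hG : ∀ t x, T₀ < t → G t x = 0) (r : ℕ) : Sym B μ s r G := fun J _ =>
  ⟨0, max 0 (T₀ + 1), le_rfl, le_max_left _ _, fun t ht x => by
    rw [D_eq_zero_of_slice (fun y => hG t y (by linarith [(le_max_right 0 (T₀ + 1)).trans ht]))]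
    simp⟩

lemma Sym.gradSq {B μ : ℝ} (hB : 0 < B) {q : SF n} (h : Sym B μ 2 0 q) :
    Sym B (μ + μ) 2 0 (gradSq q) := by
  refine Sym.sum _ fun a _ => ?_
  rw [sq]
  have := (h.dx a).mul hB (h.dx a)
  norm_num at this
  exact this

lemma Sym.quadratic {B μ κ : ℝ} (hB : 0 < B) {q : SF n} (h : Sym B μ 2 0 q) :
    Sym B (μ + μ) 2 0 (q * FastDiffusion.lapl q - κ • FastDiffusion.gradSq q) := by
  refine Sym.sub ?_ ((h.gradSq hB).smul κ)
  have := h.mul hB h.lapl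
  norm_num at this
  exact this

/-- Decay of a relatively small solution with balanced mass and first moments,
up to almost the rate `2p`. -/
lemma sym_of_smallMoment {B p δ : ℝ} (hn : 1 ≤ n) (hB : 0 < B) (hp : 2 < p) {q G : SF n}
    (hq : IsQSol B (p + n) 0 ((p + n) / 2) 1 q G) {T₀ : ℝ} (hG : ∀ t x, T₀ < t → G t x = 0)
    (hconv : ∀ ε > 0, ∃ T, ∀ t, T ≤ t → ∀ x, |q t x| ≤ ε * wt B x ^ 2)
    (h1 : SmallMoment hB p q 1) (hX : ∀ a, SmallMoment hB p q (X a))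
    (hδ : 0 < δ) (hδp : δ ≤ p / 4) : Sym B (-2 * p + 3 * δ) 2 0 q := by
  have hdec : Dec B (-(p - δ)) 2 q := dec_of_gradSq hB (by linarith) (by linarith)
    (gradSq_decay hn (by linarith) hB hq hG hconv (by linarith) (by linarith)) hconv h1
  have hsym : Sym B (-(p - δ)) 2 0 q := sym_of_bound hB hq (Or.inr rfl) (by linarith) hdec
    (Sym.of_eventually_zero hG 0)
  refine sym_of_bound hB hq (Or.inr rfl) (by linarith) ?_ (Sym.of_eventually_zero hG 0)
  obtain ⟨d, b, μ, hb, hexp⟩ := exists_eigenbasis (n := n) hB (N := 2) (p := p) le_rfl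
    (by norm_num; linarith)
  have hF := (Sym.of_eventually_zero (B := B) (μ := -(p - δ) + -(p - δ)) (s := 2) hG 0).add
    (hsym.quadratic (κ := (p + n) / 2) hB)
  have heq : dt q = Op n B (p + n) 0 q + (G + (q * lapl q - ((p + n) / 2) • gradSq q)) := by
    rw [← add_assoc, ← one_smul ℝ (q * lapl q - ((p + n) / 2) • gradSq q)]; exact hq
  obtain ⟨C, T, hC, hT, H⟩ := dec_sub_projection (γ := 2) (N := 2) (Λ₁ := -2 * p + 3 * δ) hn hB
    le_rfl (by linarith) (by norm_num) (by norm_num) (by linarith) (by linarith) hF (by linarith)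
    heq hsym (fun i => ⟨(hb i).1, (hb i).2.1⟩) hexp
  have hco : ∀ i, ∃ C T : ℝ, 0 ≤ C ∧ ∀ t, T ≤ t → ∀ x,
      |coef hB p q (b i) t * b i t x| ≤ C * Real.exp ((-2 * p + 3 * δ) * t) * wt B x ^ (2 : ℝ) := by
    intro i
    obtain ⟨K, T₁, hK, H₁⟩ := SmallMoment.affine hB (by linarith) (hb i).1 (hb i).2.1 h1 hX
    obtain ⟨C₁, T₂, hC₁, hT₂, H₂⟩ := hdec
    obtain ⟨C₂, hC₂, H₃⟩ := ((hb i).1.bd hB 0).mono hB (show ((2 : ℕ) : ℝ) - 1 ≤ 2 by norm_num)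
    have hlim : Tendsto (fun t => C₁ * Real.exp (-(p - δ) * t)) atTop (𝓝 0) := by
      rw [show (0 : ℝ) = C₁ * 0 by ring]
      refine (Real.tendsto_exp_atBot.comp ?_).const_mul _
      exact (tendsto_const_mul_atBot_of_neg (by linarith)).2 tendsto_id
    obtain ⟨T₃, hT₃⟩ := eventually_atTop.1
      (hlim.eventually_le_const (by norm_num : (0 : ℝ) < 1 / 2))
    refine ⟨K * C₁ ^ 2 * C₂, max (max 0 T₁) (max T₂ T₃), by positivity, fun t ht x => ?_⟩
    obtain ⟨⟨h0, h2⟩, h3, h4⟩ := (by simpa using ht : (0 ≤ t ∧ T₁ ≤ t) ∧ T₂ ≤ t ∧ T₃ ≤ t)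
    have e1 := H₁ t h2 (C₁ * Real.exp (-(p - δ) * t)) (by positivity) (hT₃ t h4)
      fun y => by simpa using H₂ t h3 y
    have e2 := H₃ x
    rw [ev_eq_of_dt_eq_zero (hb i).2.1 0 t x] at e2
    have e3 : (Real.exp (-(p - δ) * t)) ^ 2 ≤ Real.exp ((-2 * p + 3 * δ) * t) := by
      rw [← Real.exp_nat_mul]
      refine Real.exp_le_exp.2 ?_
      push_cast
      nlinarith only [mul_nonneg hδ.le h0]
    rw [abs_mul]
    calc |coef hB p q (b i) t| * |b i t x|
        ≤ K * (C₁ * Real.exp (-(p - δ) * t)) ^ 2 * (C₂ * wt B x ^ (2 : ℝ)) :=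
          mul_le_mul e1 e2 (abs_nonneg _) (by positivity)
      _ = K * C₁ ^ 2 * C₂ * (Real.exp (-(p - δ) * t)) ^ 2 * wt B x ^ (2 : ℝ) := by ring
      _ ≤ _ := by
          refine mul_le_mul_of_nonneg_right (mul_le_mul_of_nonneg_left e3 (by positivity)) ?_
          exact (wt_rpow_pos hB x _).le
  choose C' T' hC' H' using hco
  obtain ⟨T₁, hT₁⟩ : ∃ T₁, ∀ i, T' i ≤ T₁ := ⟨∑ i, |T' i|, fun i => (le_abs_self _).trans
    (Finset.single_le_sum (f := fun i => |T' i|) (fun _ _ => abs_nonneg _) (Finset.mem_univ i))⟩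
  refine ⟨C + ∑ i, C' i, max T T₁, add_nonneg hC (Finset.sum_nonneg fun i _ => hC' i),
    hT.trans (le_max_left _ _), fun t ht x => ?_⟩
  have e1 := H t ((le_max_left _ _).trans ht) x
  have e2 : |∑ i, coef hB p q (b i) t * b i t x| ≤
      ∑ i, C' i * Real.exp ((-2 * p + 3 * δ) * t) * wt B x ^ (2 : ℝ) :=
    (Finset.abs_sum_le_sum_abs _ _).trans
      (Finset.sum_le_sum fun i _ => H' i t ((hT₁ i).trans ((le_max_right _ _).trans ht)) x)
  have e3 : |q t x| ≤ |q t x - ∑ i, coef hB p q (b i) t * b i t x| +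
      |∑ i, coef hB p q (b i) t * b i t x| := by
    have := abs_add_le (q t x - ∑ i, coef hB p q (b i) t * b i t x)
      (∑ i, coef hB p q (b i) t * b i t x)
    rwa [sub_add_cancel] at this
  rw [add_mul, add_mul, Finset.sum_mul, Finset.sum_mul]
  exact e3.trans (add_le_add e1 e2)

/-- Higher-order expansion of a relatively small solution with balanced mass and first moments. -/
theorem exists_expansion_of_smallMoment {B p γ Λ : ℝ} (hn : 1 ≤ n) (hB : 0 < B) (hp : 2 < p)
    {q G : SF n} (hq : IsQSol B (p + n) 0 ((p + n) / 2) 1 q G) {T₀ : ℝ}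
    (hG : ∀ t x, T₀ < t → G t x = 0)
    (hconv : ∀ ε > 0, ∃ T, ∀ t, T ≤ t → ∀ x, |q t x| ≤ ε * wt B x ^ 2)
    (h1 : SmallMoment hB p q 1) (hX : ∀ a, SmallMoment hB p q (X a))
    (hγ2 : 2 ≤ γ) (hγ : 2 * γ ≤ p + 2) (hΛγ : γ ^ 2 - (p + 2) * γ ≤ Λ) (hΛ0 : Λ < 0)
    (hΛ : -4 * p < Λ) :
    (∃ C T : ℝ, 0 ≤ C ∧ ∀ t, T ≤ t → ∀ x,
      |q t x| ^ 2 ≤ C * Real.exp (Λ * t) * wt B x ^ 4) ∧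
    ∃ (N d : ℕ) (b : Fin d → SF n) (μ : Fin d → ℝ) (A : Fin d → ℝ) (C T : ℝ),
      (∀ i, PolyLT N (b i) ∧ dt (b i) = 0 ∧ Op n B (p + n) 0 (b i) = μ i • b i) ∧
      (∀ i, ¬ (Λ < μ i ∧ μ i < 0) → A i = 0) ∧
      ∀ t, T ≤ t → ∀ x, |q t x - ∑ i, A i * Real.exp (μ i * t) * b i t x| ≤
        C * Real.exp (Λ * t) * wt B x ^ γ := by
  obtain ⟨δ, hδ, hδp, hδΛ⟩ : ∃ δ : ℝ, 0 < δ ∧ δ ≤ p / 4 ∧ δ ≤ (Λ + 4 * p) / 12 :=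
    ⟨min (p / 4) ((Λ + 4 * p) / 12), lt_min (by linarith) (by linarith), min_le_left _ _,
      min_le_right _ _⟩
  have hsym := sym_of_smallMoment hn hB hp hq hG hconv h1 hX hδ hδp
  have hF := (Sym.of_eventually_zero (B := B) (μ := (-2 * p + 3 * δ) + (-2 * p + 3 * δ)) (s := 2)
    hG 0).add (hsym.quadratic (κ := (p + n) / 2) hB)
  have heq : dt q = Op n B (p + n) 0 q + (G + (q * lapl q - ((p + n) / 2) • gradSq q)) := by
    rw [← add_assoc, ← one_smul ℝ (q * lapl q - ((p + n) / 2) • gradSq q)]; exact hq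
  have hN1 : γ ≤ ⌈γ⌉₊ := Nat.le_ceil γ
  have hN2 : (⌈γ⌉₊ : ℝ) < γ + 1 := Nat.ceil_lt_add_one (by linarith)
  obtain ⟨d, b, μ, hb, hexp⟩ := exists_eigenbasis (n := n) hB (N := ⌈γ⌉₊) (p := p)
    (by exact_mod_cast hγ2.trans hN1) (by linarith)
  obtain ⟨A, C, T, -, -, hA, H⟩ := exists_expansion hn hB hγ2 hγ hN1 hN2 hΛγ hΛ0 hF
    (by linarith) heq (by linarith) hsym hp hb hexp
  refine ⟨?_, _, d, b, μ, A, C, T, hb, hA, H⟩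
  obtain ⟨C₁, T₁, hC₁, hT₁, H₁⟩ := hsym.dec
  refine ⟨C₁ ^ 2, T₁, sq_nonneg _, fun t ht x => ?_⟩
  have h2 : (Real.exp ((-2 * p + 3 * δ) * t)) ^ 2 ≤ Real.exp (Λ * t) := by
    rw [← Real.exp_nat_mul]
    refine Real.exp_le_exp.2 ?_
    push_cast
    nlinarith only [mul_le_mul_of_nonneg_right (show 2 * (-2 * p + 3 * δ) ≤ Λ by linarith)
      (hT₁.trans ht)]
  have h3 : |q t x| ≤ C₁ * Real.exp ((-2 * p + 3 * δ) * t) * wt B x ^ 2 := by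
    simpa using H₁ t ht x
  calc |q t x| ^ 2 ≤ (C₁ * Real.exp ((-2 * p + 3 * δ) * t) * wt B x ^ 2) ^ 2 :=
        pow_le_pow_left₀ (abs_nonneg _) h3 2
    _ = C₁ ^ 2 * (Real.exp ((-2 * p + 3 * δ) * t)) ^ 2 * wt B x ^ 4 := by ring
    _ ≤ _ := by gcongr

/-- The Euler field `x · ∇`. -/
def euler (f : SF n) : SF n := ∑ a, X a * dx a f

lemma euler_add (f g : SF n) : euler (f + g) = euler f + euler g := by
  simp only [euler, map_add, mul_add, Finset.sum_add_distrib]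

lemma euler_smul (c : ℝ) (f : SF n) : euler (c • f) = c • euler f := by
  simp only [euler, Derivation.map_smul, mul_smul_comm, Finset.smul_sum]

lemma dx_euler (f : SF n) (b : Fin n) : dx b (euler f) = euler (dx b f) + dx b f := by
  simp only [euler, map_sum, Derivation.leibniz, dx_X, smul_eq_mul, Finset.sum_add_distrib]
  congr 1
  · exact Finset.sum_congr rfl fun a _ => by rw [dx_comm]
  · simp

lemma lapl_euler (f : SF n) : lapl (euler f) = euler (lapl f) + (2 : ℝ) • lapl f := by
  have h : ∀ a, dx a (dx a (euler f)) = euler (dx a (dx a f)) + (2 : ℝ) • dx a (dx a f) := by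
    intro a
    rw [dx_euler, map_add, dx_euler, two_smul, add_assoc]
  rw [lapl_eq, Finset.sum_congr rfl fun a _ => h a, Finset.sum_add_distrib, ← Finset.smul_sum,
    ← lapl_eq]
  congr 1
  simp only [euler, lapl_eq, map_sum, Finset.mul_sum]
  exact Finset.sum_comm

lemma euler_om (B : ℝ) : euler (om n B) = (2 : ℝ) • (om n B - algebraMap ℝ (SF n) B) := by
  refine SF_ext fun t x => ?_
  simp only [euler, sum_ev, mul_ev, X_ev, dx_om, smul_ev, sub_ev, om_ev, algebraMap_ev,
    ← inner_self_coord, Finset.mul_sum, add_sub_cancel_left]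
  exact Finset.sum_congr rfl fun a _ => by ring

lemma euler_mul (f g : SF n) : euler (f * g) = f * euler g + g * euler f := by
  simp only [euler, Derivation.leibniz, smul_eq_mul, Finset.mul_sum, ← Finset.sum_add_distrib]
  exact Finset.sum_congr rfl fun a _ => by ring

lemma lapl_om (B : ℝ) : lapl (om n B) = algebraMap ℝ (SF n) (2 * n) := by
  refine SF_ext fun t x => ?_
  simp [lapl_eq, dx_om, Derivation.map_smul, dx_X, mul_comm]

lemma lapl_om_mul (B : ℝ) (f : SF n) :
    lapl (om n B * f) = om n B * lapl f + (4 : ℝ) • euler f + (2 * n : ℝ) • f := by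
  rw [lapl_mul, lapl_om]
  refine SF_ext fun t x => ?_
  simp only [dx_om, smul_mul_assoc, ← Finset.smul_sum, smul_smul, ← euler.eq_1, add_ev, mul_ev,
    smul_ev, algebraMap_ev]
  ring

lemma Op_eq_euler (B c l : ℝ) (f : SF n) :
    Op n B c l f = om n B * lapl f - c • euler f + l • f := rfl

lemma PolyLT.lapl {k : ℕ} {f : SF n} (h : PolyLT (k + 2) f) : PolyLT k (lapl f) := by
  rw [lapl_eq]
  exact PolyLT.sum _ fun a _ => h a a

lemma lapl_eq_zero_of_polyLT_one {f : SF n} (h : PolyLT 1 f) : lapl f = 0 := by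
  rw [lapl_eq]
  exact Finset.sum_eq_zero fun a _ => by rw [show dx a f = 0 from h a, map_zero]

lemma PolyLT.Op' {k : ℕ} {f : SF n} (h : PolyLT k f) (B c l : ℝ) : PolyLT k (FastDiffusion.Op n B c l f) := by
  induction k generalizing f l with
  | zero =>
    rw [show f = 0 from h]
    simp [FastDiffusion.Op, PolyLT.zero]
  | succ k ih =>
    intro b
    rw [dx_Op]
    refine (ih (h b) _).add (PolyLT.smul _ ?_)
    cases k with
    | zero => rw [lapl_eq_zero_of_polyLT_one h, mul_zero]; exact PolyLT.zero
    | succ k => exact h.lapl.X_mul b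

/-- A polynomial of degree less than `k` which is homogeneous of degree `k` vanishes. -/
lemma PolyLT.eq_zero_of_euler {k : ℕ} {f : SF n} (h : PolyLT k f)
    (he : euler f = (k : ℝ) • f) : f = 0 := by
  induction k generalizing f with
  | zero => exact h
  | succ k ih =>
    have h0 : ∀ a, dx a f = 0 := fun a => ih (h a) <| by
      have := dx_euler f a
      rw [he, Derivation.map_smul] at this
      rw [← sub_eq_iff_eq_add] at this
      rw [← this]
      push_cast
      rw [add_smul, one_smul, add_sub_cancel_right]
    have h1 : euler f = 0 := by simp [euler, h0]
    rw [he] at h1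
    exact (smul_eq_zero.1 h1).resolve_left (by positivity)

lemma euler_homPart (k : ℕ) (f : SF n) : euler (homPart k f) = (k : ℝ) • homPart k f := by
  cases k with
  | zero => simp [euler]
  | succ k =>
    simp only [euler, dx_homPart_succ]
    rw [homPart, smul_smul]
    push_cast
    rw [mul_one_div_cancel (by positivity), one_smul]

/-- Homogeneous polynomial eigenfunctions of `|x|²Δ`. -/
lemma eigenvalue_of_homogeneous {σ : ℝ} {j : ℕ} {H : SF n} (hn : 1 ≤ n) (hH : H ≠ 0)
    (hP : PolyLT (j + 1) H) (he : euler H = (j : ℝ) • H) {B : ℝ}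
    (hσ : om n B * lapl H = B • lapl H + σ • H) :
    ∃ ℓ k : ℕ, ℓ + 2 * k = j ∧ σ = 2 * k * (2 * ℓ + 2 * k + n - 2) ∧ (n = 1 → ℓ ≤ 1) := by
  induction j using Nat.strong_induction_on generalizing σ H with
  | _ j ih =>
    by_cases hL : lapl H = 0
    · have hσ0 : σ = 0 := by
        rw [hL, mul_zero, smul_zero, zero_add] at hσ
        exact (smul_eq_zero.1 hσ.symm).resolve_right hH
      refine ⟨j, 0, by simp, by simp [hσ0], fun h1 => ?_⟩
      by_contra! hj
      subst h1
      apply hH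
      have h0 : dx 0 H = 0 := by
        have h2 := dx_euler H 0
        have h3 : dx 0 (dx 0 H) = 0 := by simpa [lapl_eq] using hL
        have h4 : euler (dx 0 H) = 0 := by simp [euler, h3]
        rw [he, Derivation.map_smul, h4, zero_add] at h2
        have h5 : ((j : ℝ) - 1) • dx 0 H = 0 := by rw [sub_smul, h2, one_smul, sub_self]
        refine (smul_eq_zero.1 h5).resolve_left ?_
        have : (1 : ℝ) < j := by exact_mod_cast hj
        linarith
      have h6 : euler H = 0 := by simp [euler, h0]
      rw [he] at h6
      exact (smul_eq_zero.1 h6).resolve_left (by positivity)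
    · obtain _ | _ | j := j
      · exact absurd (lapl_eq_zero_of_polyLT_one hP) hL
      · refine absurd ?_ hL
        rw [lapl_eq]
        exact Finset.sum_eq_zero fun a _ => hP a a
      · have he' : euler (lapl H) = (j : ℝ) • lapl H := by
          have h := lapl_euler H
          rw [he, map_smul, ← sub_eq_iff_eq_add, ← sub_smul] at h
          rw [← h]
          congr 1
          push_cast; ring
        have hσ' : om n B * lapl (lapl H) =
            B • lapl (lapl H) + (σ - 4 * j - 2 * n) • lapl H := by
          have h := congrArg lapl hσ
          rw [lapl_om_mul, map_add, map_smul, map_smul, he', smul_smul] at h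
          rw [sub_smul, sub_smul]
          linear_combination h
        obtain ⟨ℓ, k, h1, h2, h3⟩ := ih j (by omega) hL hP.lapl he' hσ'
        refine ⟨ℓ, k + 1, by omega, ?_, h3⟩
        have hj : (ℓ : ℝ) + 2 * k = j := by exact_mod_cast h1
        push_cast
        linear_combination h2 - 4 * hj

/-- A nonzero polynomial eigenfunction has degree `ℓ + 2k` and eigenvalue `λ_{ℓk}`. -/
lemma exists_lamEig {B p lam : ℝ} {N : ℕ} {E : SF n} (hn : 1 ≤ n) (hE : E ≠ 0)
    (hP : PolyLT N E) (hlam : Op n B (p + n) 0 E = lam • E) :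
    ∃ ℓ k : ℕ, lam = lamEig n p ℓ k ∧ (n = 1 → ℓ ≤ 1) ∧ PolyLT (ℓ + 2 * k + 1) E ∧
      homPart (ℓ + 2 * k) E ≠ 0 := by
  classical
  have hex : ∃ N, PolyLT N E := ⟨N, hP⟩
  obtain ⟨j, hj⟩ : ∃ j, Nat.find hex = j + 1 := by
    refine Nat.exists_eq_succ_of_ne_zero fun h => hE ?_
    have := Nat.find_spec hex
    rwa [h] at this
  have hPj : PolyLT (j + 1) E := by have := Nat.find_spec hex; rwa [hj] at this
  have hsum : E = taylor j E + homPart j E := by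
    conv_lhs => rw [hPj.eq_taylor]
    simp [taylor, Finset.sum_range_succ]
  have hH0 : homPart j E ≠ 0 := by
    intro h
    rw [h, add_zero] at hsum
    have : PolyLT j E := by rw [hsum]; exact polyLT_taylor j E
    have := Nat.find_min' hex this
    omega
  have hHP : PolyLT (j + 1) (homPart j E) := by
    have h : homPart j E = E + (-1 : ℝ) • taylor j E := by
      rw [neg_one_smul, ← sub_eq_add_neg, eq_sub_iff_add_eq, add_comm]; exact hsum.symm
    rw [h]
    exact hPj.add ((polyLT_taylor j E).succ.smul _)
  have heH := euler_homPart j E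
  have hlap : PolyLT j (lapl (homPart j E)) := by
    cases j with
    | zero => rw [lapl_eq_zero_of_polyLT_one hHP]; exact PolyLT.zero
    | succ j => exact hHP.lapl.succ
  have hR : om n B * lapl (homPart j E) = B • lapl (homPart j E) +
      (lam + (p + n) * j) • homPart j E := by
    rw [← sub_eq_zero]
    refine PolyLT.eq_zero_of_euler (k := j) ?_ ?_
    · have h : om n B * lapl (homPart j E) - (B • lapl (homPart j E) +
          (lam + (p + n) * j) • homPart j E) = lam • taylor j E +
          (-1 : ℝ) • Op n B (p + n) 0 (taylor j E) + (-B) • lapl (homPart j E) := by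
        have h1 : Op n B (p + n) 0 (taylor j E) + Op n B (p + n) 0 (homPart j E) =
            lam • taylor j E + lam • homPart j E := by
          rw [← smul_add, ← Op_add, ← hsum, hlam]
        rw [Op_eq_euler _ _ _ (homPart j E), heH, smul_smul] at h1
        simp only [zero_smul, add_zero] at h1
        rw [add_smul, neg_one_smul, neg_smul]
        linear_combination h1
      rw [h]
      exact (((polyLT_taylor j E).smul _).add (((polyLT_taylor j E).Op' _ _ _).smul _)).add
        (hlap.smul _)
    · have h2 : euler (lapl (homPart j E)) = ((j : ℝ) - 2) • lapl (homPart j E) := by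
        have h := lapl_euler (homPart j E)
        rw [heH, map_smul, ← sub_eq_iff_eq_add, ← sub_smul] at h
        exact h.symm
      have h3 : om n B * lapl (homPart j E) - (B • lapl (homPart j E) +
          (lam + (p + n) * j) • homPart j E) = om n B * lapl (homPart j E) +
          ((-B) • lapl (homPart j E) + (-(lam + (p + n) * j)) • homPart j E) := by
        rw [neg_smul, neg_smul]; ring
      rw [h3, euler_add, euler_add, euler_mul, euler_om, euler_smul, euler_smul, heH, h2]
      refine SF_ext fun t x => ?_
      simp only [add_ev, mul_ev, smul_ev, sub_ev, algebraMap_ev]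
      ring
  obtain ⟨ℓ, k, h1, h2, h3⟩ := eigenvalue_of_homogeneous hn hH0 hHP heH hR
  refine ⟨ℓ, k, ?_, h3, by rwa [h1], by rwa [h1]⟩
  have hj' : (ℓ : ℝ) + 2 * k = j := by exact_mod_cast h1
  rw [lamEig]
  rw [← hj'] at h2
  linear_combination h2

/-- The degree `k` part of the Taylor polynomial at the origin, as a formal polynomial. -/
def polyPart : ℕ → SF n → MvPolynomial (Fin n) ℝ
  | 0, f => MvPolynomial.C (f 0 0)
  | k + 1, f => MvPolynomial.C (1 / ((k : ℝ) + 1)) *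
      ∑ a, MvPolynomial.X a * polyPart k (dx a f)

lemma polyPart_isHomogeneous (k : ℕ) (f : SF n) : (polyPart k f).IsHomogeneous k := by
  induction k generalizing f with
  | zero => exact MvPolynomial.isHomogeneous_C _ _
  | succ k ih =>
    have h := (MvPolynomial.isHomogeneous_C (Fin n) (1 / ((k : ℝ) + 1))).mul
      (MvPolynomial.IsHomogeneous.sum Finset.univ
        (fun a : Fin n => MvPolynomial.X a * polyPart k (dx a f)) (1 + k)
        fun a _ => (MvPolynomial.isHomogeneous_X ℝ a).mul (ih (dx a f)))
    rw [zero_add, add_comm 1 k] at h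
    exact h

lemma evalPoly_polyPart (k : ℕ) (f : SF n) (x : Eu n) :
    evalPoly n (polyPart k f) x = homPart k f 0 x := by
  induction k generalizing f with
  | zero => simp [polyPart, evalPoly, homPart]
  | succ k ih =>
    simp only [evalPoly] at ih
    simp [polyPart, evalPoly, homPart, ih]

lemma homPart_map_zero (k : ℕ) : homPart k (0 : SF n) = 0 := by
  induction k with
  | zero => exact SF_ext fun t x => by simp [homPart]
  | succ k ih => simp [homPart, ih]

/-- A polynomial function of degree `j` as a formal polynomial. -/
lemma exists_evalPoly_eq {j : ℕ} {E : SF n} (hE0 : dt E = 0) (hP : PolyLT (j + 1) E)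
    (hH : homPart j E ≠ 0) : ∃ P : MvPolynomial (Fin n) ℝ, P.totalDegree = j ∧
      ∀ t x, evalPoly n P x = E t x := by
  refine ⟨∑ k ∈ Finset.range (j + 1), polyPart k E, ?_, fun t x => ?_⟩
  · have hne : polyPart j E ≠ 0 := by
      intro h
      apply hH
      refine SF_ext fun t x => ?_
      rw [ev_eq_of_dt_eq_zero (by rw [dt_homPart, hE0, homPart_map_zero]) t 0 x, ← evalPoly_polyPart, h]
      simp [evalPoly]
    have hdeg := (polyPart_isHomogeneous j E).totalDegree hne
    rw [Finset.sum_range_succ]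
    cases j with
    | zero => simpa using hdeg
    | succ j =>
      rw [MvPolynomial.totalDegree_add_eq_right_of_totalDegree_lt, hdeg]
      rw [hdeg]
      refine Nat.lt_succ_of_le (MvPolynomial.totalDegree_finsetSum_le fun k hk => ?_)
      exact (polyPart_isHomogeneous k E).totalDegree_le.trans (by simpa [Nat.lt_succ_iff] using hk)
  · rw [ev_eq_of_dt_eq_zero hE0 t 0 x]
    conv_rhs => rw [hP.eq_taylor]
    simp only [taylor, sum_ev, ← evalPoly_polyPart]
    simp only [evalPoly, map_sum]

lemma lap_eq_lapl (f : SF n) (t : ℝ) (x : Eu n) : lap n (fun y => f t y) x = lapl f t x := by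
  simp only [lap, fderiv_space, lapl_eq, sum_ev]

lemma gradDot_eq_euler (f : SF n) (t : ℝ) (x : Eu n) :
    gradDot n (fun y => f t y) x = euler f t x := by
  simp only [gradDot, fderiv_space, euler, sum_ev, mul_ev, X_ev]

lemma Lop_div_om {m B lam : ℝ} (hm : m < 1) (hB : 0 < B) {E : SF n}
    (hE : Op n B (pPar n m + n) 0 E = lam • E) (x : Eu n) :
    Lop n m B (fun z => E 0 z / (B + ‖z‖ ^ 2)) x = lam * (E 0 x / (B + ‖x‖ ^ 2)) := by
  have hf : (fun z : Eu n => E 0 z / (B + ‖z‖ ^ 2)) = fun z => (E * omPow n hB (-1)) 0 z := by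
    funext z
    rw [mul_ev, omPow_ev, Real.rpow_neg_one, div_eq_mul_inv]
  obtain ⟨w, hw⟩ : ∃ w, w = B + ‖x‖ ^ 2 := ⟨_, rfl⟩
  have hw0 : 0 < w := by rw [hw]; positivity
  have e1 : omPow n hB (-1) 0 x = w⁻¹ := by rw [omPow_ev, ← hw, Real.rpow_neg_one]
  have e2 : omPow n hB (-1 - 1) 0 x = (w ^ 2)⁻¹ := by
    rw [omPow_ev, ← hw, show (-1 - 1 : ℝ) = -(2 : ℕ) by norm_num, Real.rpow_neg hw0.le,
      Real.rpow_natCast]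
  have e3 : omPow n hB (-1 - 2) 0 x = (w ^ 3)⁻¹ := by
    rw [omPow_ev, ← hw, show (-1 - 2 : ℝ) = -(3 : ℕ) by norm_num, Real.rpow_neg hw0.le,
      Real.rpow_natCast]
  have e4 : (∑ a, dx a E * dx a (omPow n hB (-1))) 0 x = -2 * (w ^ 2)⁻¹ * euler E 0 x := by
    rw [← e2]
    simp only [dx_omPow, euler, sum_ev, mul_ev, smul_ev, X_ev, Finset.mul_sum]
    exact Finset.sum_congr rfl fun a _ => by ring
  have e5 : euler (omPow n hB (-1)) 0 x = -2 * (‖x‖ ^ 2 * (w ^ 2)⁻¹) := by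
    rw [← e2, euler, radial_omPow]; ring
  have hE' : w * lapl E 0 x = (pPar n m + n) * euler E 0 x + lam * E 0 x := by
    have := congrArg (fun f : SF n => f 0 x) hE
    simp only [Op_eq_euler, add_ev, sub_ev, mul_ev, smul_ev, om_ev, ← hw] at this
    linarith
  have hpn : pPar n m + n = 2 / (1 - m) := by rw [pPar]; ring
  have hc : 2 * (1 - 2 * m) / (1 - m) = 4 - 2 / (1 - m) := by
    have : 1 - m ≠ 0 := by linarith
    field_simp
    ring
  rw [hpn] at hE'
  rw [Lop, hf, lap_eq_lapl, gradDot_eq_euler, lapl_mul, euler_mul, hc]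
  simp only [add_ev, mul_ev, smul_ev, e1, e4, e5, lapl_omPow, e2, e3, ← hw]
  rw [show ‖x‖ ^ 2 = w - B by rw [hw]; ring]
  generalize 2 / (1 - m) = c at *
  have hL : lapl E 0 x = (c * euler E 0 x + lam * E 0 x) / w := by
    rw [← hE']; field_simp
  rw [hL]
  field_simp
  ring

/-- Collecting the terms of an eigenfunction expansion according to the eigenvalues `λ_{ℓk}`. -/
theorem exists_polynomials {B p Λ : ℝ} (hn : 1 ≤ n) {N d : ℕ} {b : Fin d → SF n}
    {μ A : Fin d → ℝ}
    (hb : ∀ i, PolyLT N (b i) ∧ dt (b i) = 0 ∧ Op n B (p + n) 0 (b i) = μ i • b i)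
    (hA : ∀ i, ¬ (Λ < μ i ∧ μ i < 0) → A i = 0) :
    ∃ u : ℕ → ℕ → MvPolynomial (Fin n) ℝ,
      (∀ ℓ k, (u ℓ k = 0 ∨ (u ℓ k).totalDegree = ℓ + 2 * k) ∧
        ∃ E : SF n, Op n B (p + n) 0 E = lamEig n p ℓ k • E ∧
          ∀ t x, evalPoly n (u ℓ k) x = E t x) ∧
      ∀ (φ : ℝ → ℝ) (t : ℝ) (x : Eu n),
        ∑ᶠ (q : ℕ × ℕ) (_ : Λ < lamEig n p q.1 q.2 ∧ lamEig n p q.1 q.2 < 0 ∧ (n = 1 → q.1 ≤ 1)),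
          evalPoly n (u q.1 q.2) x * φ (lamEig n p q.1 q.2) = ∑ i, A i * φ (μ i) * b i t x := by
  classical
  obtain ⟨E, hEdef⟩ : ∃ E : ℝ → SF n, ∀ lam, E lam = ∑ i with μ i = lam, A i • b i :=
    ⟨_, fun _ => rfl⟩
  have hEop : ∀ lam, Op n B (p + n) 0 (E lam) = lam • E lam := by
    intro lam
    rw [hEdef, Op_sum, Finset.smul_sum]
    refine Finset.sum_congr rfl fun i hi => ?_
    rw [Op_smul, (hb i).2.2, (Finset.mem_filter.1 hi).2, smul_comm]
  have hE0 : ∀ lam, dt (E lam) = 0 := by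
    intro lam
    rw [hEdef, map_sum]
    exact Finset.sum_eq_zero fun i _ => by rw [Derivation.map_smul, (hb i).2.1, smul_zero]
  have hEP : ∀ lam, PolyLT N (E lam) := by
    intro lam
    rw [hEdef]
    exact PolyLT.sum _ fun i _ => (hb i).1.smul _
  have hEne : ∀ lam, E lam ≠ 0 → (Λ < lam ∧ lam < 0) ∧ ∃ i, μ i = lam := by
    intro lam h
    rw [hEdef] at h
    obtain ⟨i, hi, hne⟩ := Finset.exists_ne_zero_of_sum_ne_zero h
    have hi' := (Finset.mem_filter.1 hi).2
    refine ⟨?_, i, hi'⟩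
    by_contra hc
    rw [← hi'] at hc
    exact hne (by rw [hA i hc, zero_smul])
  have hex : ∀ lam, ∃ (π : ℕ × ℕ) (P : MvPolynomial (Fin n) ℝ), E lam ≠ 0 →
      lam = lamEig n p π.1 π.2 ∧ (n = 1 → π.1 ≤ 1) ∧ P.totalDegree = π.1 + 2 * π.2 ∧
      ∀ t x, evalPoly n P x = E lam t x := by
    intro lam
    by_cases h : E lam = 0
    · exact ⟨0, 0, fun h' => absurd h h'⟩
    · obtain ⟨ℓ, k, h1, h2, h3, h4⟩ := exists_lamEig hn h (hEP lam) (hEop lam)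
      obtain ⟨P, h5, h6⟩ := exists_evalPoly_eq (hE0 lam) h3 h4
      exact ⟨(ℓ, k), P, fun _ => ⟨h1, h2, h5, h6⟩⟩
  choose π P H using hex
  obtain ⟨u, hu⟩ : ∃ u : ℕ → ℕ → MvPolynomial (Fin n) ℝ, ∀ ℓ k, u ℓ k =
      if E (lamEig n p ℓ k) ≠ 0 ∧ π (lamEig n p ℓ k) = (ℓ, k) then P (lamEig n p ℓ k) else 0 :=
    ⟨_, fun _ _ => rfl⟩
  refine ⟨u, fun ℓ k => ?_, fun φ t x => ?_⟩
  · rw [hu]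
    split_ifs with h
    · obtain ⟨_, _, h3, h4⟩ := H _ h.1
      rw [h.2] at h3
      exact ⟨Or.inr h3, E _, hEop _, h4⟩
    · exact ⟨Or.inl rfl, 0, by simp [Op], fun t x => by simp [evalPoly]⟩
  · rw [finsum_cond_eq_sum_of_cond_iff (t := ((Finset.univ.image μ).filter (E · ≠ 0)).image π) _ ?_]
    · rw [Finset.sum_image]
      · calc ∑ lam ∈ Finset.univ.image μ with E lam ≠ 0,
              evalPoly n (u (π lam).1 (π lam).2) x * φ (lamEig n p (π lam).1 (π lam).2)
            = ∑ lam ∈ Finset.univ.image μ with E lam ≠ 0, E lam t x * φ lam := by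
              refine Finset.sum_congr rfl fun lam hl => ?_
              have hne := (Finset.mem_filter.1 hl).2
              obtain ⟨h1, -, -, h4⟩ := H lam hne
              rw [hu, ← h1, if_pos ⟨hne, rfl⟩, h4 t x]
          _ = ∑ lam ∈ Finset.univ.image μ, E lam t x * φ lam := by
              rw [Finset.sum_filter]
              refine Finset.sum_congr rfl fun lam _ => ?_
              by_cases h : E lam = 0 <;> simp [h]
          _ = ∑ i, A i * φ (μ i) * b i t x := by
              refine Finset.sum_image' _ fun i _ => ?_
              rw [hEdef, sum_ev, Finset.sum_mul]
              refine Finset.sum_congr rfl fun j hj => ?_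
              rw [(Finset.mem_filter.1 hj).2, smul_ev]
              ring
      · intro l hl l' hl' he
        rw [(H l (Finset.mem_filter.1 hl).2).1, (H l' (Finset.mem_filter.1 hl').2).1, he]
    · intro q hq
      have hq1 : E (lamEig n p q.1 q.2) ≠ 0 ∧ π (lamEig n p q.1 q.2) = q := by
        by_contra hc
        exact hq (by rw [hu, if_neg hc]; simp [evalPoly])
      obtain ⟨h1, i, hi⟩ := hEne _ hq1.1
      refine ⟨fun _ => ?_, fun _ => ⟨h1.1, h1.2, ?_⟩⟩
      · refine Finset.mem_image.2 ⟨_, Finset.mem_filter.2 ⟨?_, hq1.1⟩, hq1.2⟩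
        exact Finset.mem_image.2 ⟨i, Finset.mem_univ _, hi⟩
      · have := (H _ hq1.1).2.1
        rwa [hq1.2] at this

/-- Post-composition with a smooth function of one variable. -/
def compSF (h : ℝ → ℝ) (hh : ContDiff ℝ (⊤ : ℕ∞) h) (f : SF n) : SF n :=
  ⟨fun z => h (f.1 z), hh.comp (contDiffSF f)⟩

@[simp] lemma compSF_ev (h : ℝ → ℝ) (hh : ContDiff ℝ (⊤ : ℕ∞) h) (f : SF n) (t : ℝ) (x : Eu n) :
    compSF h hh f t x = h (f t x) := rfl

lemma contDiff_deriv {h : ℝ → ℝ} (hh : ContDiff ℝ (⊤ : ℕ∞) h) : ContDiff ℝ (⊤ : ℕ∞) (deriv h) :=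
  (contDiff_infty_iff_deriv.1 hh).2

lemma dx_compSF (h : ℝ → ℝ) (hh : ContDiff ℝ (⊤ : ℕ∞) h) (f : SF n) (a : Fin n) :
    dx a (compSF h hh f) = compSF (deriv h) (contDiff_deriv hh) f * dx a f := by
  refine SF_ext fun t x => ?_
  change fderiv ℝ (h ∘ f.1) (t, x) (0, stdBasis n a) = _
  rw [fderiv_comp _ (hh.differentiable (by simp) _) (differentiableSF f _)]
  change fderiv ℝ h (f.1 (t, x)) (fderiv ℝ f.1 (t, x) (0, stdBasis n a)) =
    deriv h (f.1 (t, x)) * fderiv ℝ f.1 (t, x) (0, stdBasis n a)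
  rw [fderiv_eq_smul_deriv, smul_eq_mul, mul_comm]

lemma lapl_compSF (h : ℝ → ℝ) (hh : ContDiff ℝ (⊤ : ℕ∞) h) (f : SF n) (t : ℝ) (x : Eu n) :
    lapl (compSF h hh f) t x =
      deriv h (f t x) * lapl f t x + deriv (deriv h) (f t x) * gradSq f t x := by
  simp only [lapl_eq, dx_compSF, Derivation.leibniz, smul_eq_mul, sum_ev, add_ev, mul_ev,
    compSF_ev, gradSq_ev, Finset.mul_sum, ← Finset.sum_add_distrib]
  exact Finset.sum_congr rfl fun a _ => by ring

/-- The profile `r ↦ g (1 - r) ^ (e + 2)` of the cutoffs, `g` being the smooth transition. -/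
def cutProfile (e : ℕ) (r : ℝ) : ℝ := Real.smoothTransition (1 - r) ^ (e + 2)

lemma contDiff_smoothTransition_one_sub :
    ContDiff ℝ (⊤ : ℕ∞) fun r : ℝ => Real.smoothTransition (1 - r) :=
  Real.smoothTransition.contDiff.comp (contDiff_const.sub contDiff_id)

lemma contDiff_cutProfile (e : ℕ) : ContDiff ℝ (⊤ : ℕ∞) (cutProfile e) :=
  contDiff_smoothTransition_one_sub.pow _

lemma cutProfile_nonneg (e : ℕ) (r : ℝ) : 0 ≤ cutProfile e r :=
  pow_nonneg (Real.smoothTransition.nonneg _) _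

lemma cutProfile_le_one (e : ℕ) (r : ℝ) : cutProfile e r ≤ 1 :=
  pow_le_one₀ (Real.smoothTransition.nonneg _) (Real.smoothTransition.le_one _)

lemma cutProfile_eq_zero (e : ℕ) {r : ℝ} (hr : 1 ≤ r) : cutProfile e r = 0 := by
  rw [cutProfile, Real.smoothTransition.zero_of_nonpos (by linarith), zero_pow (by omega)]

lemma cutProfile_zero (e : ℕ) : cutProfile e 0 = 1 := by
  simp [cutProfile]

lemma exists_cutProfile_bound {e : ℕ} (he : 1 ≤ e) :
    ∃ C : ℝ, 0 ≤ C ∧ ∀ r, 0 ≤ r →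
      |deriv (cutProfile e) r| ≤ C * Real.smoothTransition (1 - r) ^ e ∧
      |deriv (deriv (cutProfile e)) r| ≤ C * Real.smoothTransition (1 - r) ^ e := by
  let g : ℝ → ℝ := fun r => Real.smoothTransition (1 - r)
  have hg : ContDiff ℝ (⊤ : ℕ∞) g := contDiff_smoothTransition_one_sub
  have hg' := contDiff_deriv hg
  have d0 : ∀ r, HasDerivAt g (deriv g r) r := fun r =>
    (hg.differentiable (by simp) r).hasDerivAt
  have d1 : ∀ r, HasDerivAt (deriv g) (deriv (deriv g) r) r := fun r =>
    (hg'.differentiable (by simp) r).hasDerivAt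
  have e1 : deriv (cutProfile e) = fun r => (e + 2 : ℝ) * g r ^ (e + 1) * deriv g r := by
    funext r
    have := ((d0 r).pow (e + 2)).deriv
    rw [show e + 2 - 1 = e + 1 from rfl] at this
    rw [show cutProfile e = g ^ (e + 2) from rfl, this]
    push_cast
    rfl
  have e2 : deriv (deriv (cutProfile e)) = fun r =>
      (e + 2 : ℝ) * (((e + 1 : ℝ) * g r ^ e * deriv g r) * deriv g r +
        g r ^ (e + 1) * deriv (deriv g) r) := by
    funext r
    have := ((((d0 r).pow (e + 1)).mul (d1 r)).const_mul (e + 2 : ℝ)).deriv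
    rw [e1]
    convert this using 1
    · congr 1
      funext s
      simp only [Pi.mul_apply, Pi.pow_apply, mul_assoc]
    · simp only [Nat.add_sub_cancel, Pi.pow_apply]
      push_cast
      rfl
  obtain ⟨C₁, hC₁⟩ := (isCompact_Icc (a := (0 : ℝ)) (b := 1)).exists_bound_of_continuousOn
    hg'.continuous.continuousOn
  obtain ⟨C₂, hC₂⟩ := (isCompact_Icc (a := (0 : ℝ)) (b := 1)).exists_bound_of_continuousOn
    (contDiff_deriv hg').continuous.continuousOn
  have hz : (0 : ℝ) ∈ Set.Icc (0 : ℝ) 1 := ⟨le_rfl, zero_le_one⟩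
  have p1 : 0 ≤ C₁ := (norm_nonneg _).trans (hC₁ 0 hz)
  have p2 : 0 ≤ C₂ := (norm_nonneg _).trans (hC₂ 0 hz)
  refine ⟨(e + 2 : ℝ) * C₁ + (e + 2 : ℝ) * ((e + 1 : ℝ) * C₁ * C₁ + C₂), by positivity,
    fun r hr => ?_⟩
  have g0 : 0 ≤ g r := Real.smoothTransition.nonneg _
  have g1 : g r ≤ 1 := Real.smoothTransition.le_one _
  rw [e2, e1]
  change |(e + 2 : ℝ) * g r ^ (e + 1) * deriv g r| ≤ _ * g r ^ e ∧
    |(e + 2 : ℝ) * (((e + 1 : ℝ) * g r ^ e * deriv g r) * deriv g r +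
        g r ^ (e + 1) * deriv (deriv g) r)| ≤ _ * g r ^ e
  by_cases h1 : r ≤ 1
  · have a1 : |deriv g r| ≤ C₁ := hC₁ r ⟨hr, h1⟩
    have a2 : |deriv (deriv g) r| ≤ C₂ := hC₂ r ⟨hr, h1⟩
    have hle : g r ^ (e + 1) ≤ g r ^ e := pow_le_pow_of_le_one g0 g1 (by omega)
    have b1 : |(e + 2 : ℝ) * g r ^ (e + 1) * deriv g r| ≤ (e + 2 : ℝ) * g r ^ e * C₁ := by
      rw [abs_mul, abs_of_nonneg (by positivity)]
      gcongr
    have b2 : |(e + 2 : ℝ) * (((e + 1 : ℝ) * g r ^ e * deriv g r) * deriv g r +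
        g r ^ (e + 1) * deriv (deriv g) r)| ≤
        (e + 2 : ℝ) * (((e + 1 : ℝ) * g r ^ e * C₁) * C₁ + g r ^ e * C₂) := by
      rw [abs_mul, abs_of_nonneg (by positivity : (0 : ℝ) ≤ e + 2)]
      refine mul_le_mul_of_nonneg_left ((abs_add_le _ _).trans ?_) (by positivity)
      rw [abs_mul _ (deriv g r), abs_mul _ (deriv g r), abs_mul _ (deriv (deriv g) r),
        abs_of_nonneg (by positivity : (0 : ℝ) ≤ (e + 1) * g r ^ e),
        abs_of_nonneg (by positivity : 0 ≤ g r ^ (e + 1))]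
      gcongr
    have q1 : 0 ≤ (e + 2 : ℝ) * C₁ * g r ^ e := by positivity
    have q2 : 0 ≤ (e + 2 : ℝ) * ((e + 1 : ℝ) * C₁ * C₁ + C₂) * g r ^ e := by positivity
    exact ⟨by linarith only [b1, q2], by linarith only [b2, q1]⟩
  · have : g r = 0 := Real.smoothTransition.zero_of_nonpos (by linarith)
    rw [this, zero_pow (by omega : e ≠ 0), zero_pow (by omega : e + 1 ≠ 0)]
    simp

/-- The compactly supported cutoff `h (k |x| ^ 2)`. -/
def bumpSF (n e : ℕ) (k : ℝ) : SF n := compSF (cutProfile e) (contDiff_cutProfile e) (k • om n 0)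

lemma om_zero_ev (t : ℝ) (x : Eu n) : om n 0 t x = ‖x‖ ^ 2 := by
  rw [om_ev, zero_add]

lemma bumpSF_ev (e : ℕ) (k t : ℝ) (x : Eu n) : bumpSF n e k t x = cutProfile e (k * ‖x‖ ^ 2) := by
  rw [bumpSF, compSF_ev, smul_ev, om_zero_ev]

lemma bumpSF_eq_zero (e : ℕ) {k : ℝ} (hk : 0 < k) (t : ℝ) {x : Eu n} (hx : 1 / k ≤ ‖x‖ ^ 2) :
    bumpSF n e k t x = 0 := by
  rw [bumpSF_ev, cutProfile_eq_zero]
  rwa [div_le_iff₀' hk] at hx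

lemma dx_bumpSF (e : ℕ) (k : ℝ) (a : Fin n) (t : ℝ) (x : Eu n) :
    dx a (bumpSF n e k) t x = deriv (cutProfile e) (k * ‖x‖ ^ 2) * (2 * k * x a) := by
  rw [bumpSF, dx_compSF, Derivation.map_smul, dx_om, mul_ev, compSF_ev, smul_ev, smul_ev, smul_ev,
    X_ev, om_zero_ev]
  ring

lemma lapl_bumpSF (e : ℕ) (k t : ℝ) (x : Eu n) :
    lapl (bumpSF n e k) t x = deriv (cutProfile e) (k * ‖x‖ ^ 2) * (2 * n * k) +
      deriv (deriv (cutProfile e)) (k * ‖x‖ ^ 2) * (4 * k ^ 2 * ‖x‖ ^ 2) := by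
  rw [bumpSF, lapl_compSF, gradSq_ev, map_smul, lapl_om, smul_ev, smul_ev, om_zero_ev,
    algebraMap_ev]
  have : ∑ a, dx a (k • om n 0) t x ^ 2 = 4 * k ^ 2 * ‖x‖ ^ 2 := by
    rw [← inner_self_coord x, Finset.mul_sum]
    refine Finset.sum_congr rfl fun a _ => ?_
    rw [Derivation.map_smul, dx_om, smul_ev, smul_ev, X_ev]
    ring
  rw [this]
  ring

lemma lapl_mul_bumpSF (e : ℕ) (k : ℝ) (F : SF n) (t : ℝ) (x : Eu n) :
    lapl (F * bumpSF n e k) t x = F t x * lapl (bumpSF n e k) t x +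
      4 * k * (deriv (cutProfile e) (k * ‖x‖ ^ 2) * euler F t x) +
      bumpSF n e k t x * lapl F t x := by
  rw [lapl_mul, add_ev, add_ev, mul_ev, mul_ev, smul_ev, sum_ev, euler, sum_ev]
  congr 2
  simp only [mul_ev, X_ev, dx_bumpSF, Finset.mul_sum]
  exact Finset.sum_congr rfl fun a _ => by ring

/-- The commutator of the Laplacian with the cutoffs, on functions of linear growth. -/
lemma exists_lapl_mul_cutoff_bound (n : ℕ) {e : ℕ} (he : 1 ≤ e) :
    ∃ C : ℝ, 0 ≤ C ∧ ∀ (F : SF n), (∀ t x, |F t x| ≤ wt 1 x) → (∀ t x, |euler F t x| ≤ wt 1 x) →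
      ∀ k, 0 < k → ∀ t x,
        |lapl (F * bumpSF n e k) t x - bumpSF n e k t x * lapl F t x| ≤
          C * (k * wt 1 x * Real.smoothTransition (1 - k * ‖x‖ ^ 2) ^ e) := by
  obtain ⟨C, hC, hb⟩ := exists_cutProfile_bound he
  refine ⟨C * (2 * n + 8), by positivity, fun F hF hE k hk t x => ?_⟩
  have hr : 0 ≤ k * ‖x‖ ^ 2 := by positivity
  obtain ⟨h1, h2⟩ := hb _ hr
  have hw := wt_pos one_pos x
  by_cases hk1 : k * ‖x‖ ^ 2 < 1
  · generalize hs : Real.smoothTransition (1 - k * ‖x‖ ^ 2) ^ e = s at h1 h2 ⊢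
    have s0 : 0 ≤ s := hs ▸ pow_nonneg (Real.smoothTransition.nonneg _) _
    have hL : |lapl (bumpSF n e k) t x| ≤ C * s * ((2 * n + 4) * k) := by
      rw [lapl_bumpSF]
      refine (abs_add_le _ _).trans ?_
      rw [abs_mul, abs_mul _ (4 * k ^ 2 * ‖x‖ ^ 2),
        abs_of_nonneg (by positivity : (0 : ℝ) ≤ 2 * n * k),
        abs_of_nonneg (by positivity : (0 : ℝ) ≤ 4 * k ^ 2 * ‖x‖ ^ 2)]
      have e3 : 4 * k ^ 2 * ‖x‖ ^ 2 ≤ 4 * k := by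
        have := mul_le_mul_of_nonneg_left hk1.le hk.le
        linarith only [this]
      have q1 := mul_le_mul_of_nonneg_right h1 (by positivity : (0 : ℝ) ≤ 2 * n * k)
      have q2 := mul_le_mul h2 e3 (by positivity) (by positivity)
      linarith only [q1, q2]
    rw [lapl_mul_bumpSF, add_sub_cancel_right]
    refine (abs_add_le _ _).trans ?_
    rw [abs_mul, abs_mul (4 * k), abs_mul (deriv _ _),
      abs_of_nonneg (by positivity : (0 : ℝ) ≤ 4 * k)]
    have q1 := mul_le_mul (hF t x) hL (abs_nonneg _) hw.le
    have q2 := mul_le_mul_of_nonneg_left (mul_le_mul h1 (hE t x) (abs_nonneg _) (by positivity))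
      (by positivity : (0 : ℝ) ≤ 4 * k)
    linarith only [q1, q2]
  · have hz : Real.smoothTransition (1 - k * ‖x‖ ^ 2) = 0 :=
      Real.smoothTransition.zero_of_nonpos (by linarith)
    rw [hz, zero_pow (by omega), mul_zero] at h1 h2
    rw [lapl_mul_bumpSF, add_sub_cancel_right, lapl_bumpSF, abs_nonpos_iff.1 h1,
      abs_nonpos_iff.1 h2]
    simp only [zero_mul, mul_zero, add_zero, abs_zero]
    have := pow_nonneg (Real.smoothTransition.nonneg (1 - k * ‖x‖ ^ 2)) e
    positivity

/-- The weight `x ↦ √(1 + |x| ^ 2)` as a smooth function. -/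
def jap (n : ℕ) : SF n := omPow n one_pos (1 / 2)

lemma jap_ev (t : ℝ) (x : Eu n) : jap n t x = wt 1 x := by
  rw [jap, omPow_eq_wt, show (2 * (1 / 2) : ℝ) = 1 by norm_num, Real.rpow_one]

lemma one_le_wt (x : Eu n) : 1 ≤ wt 1 x := by
  have := sqrt_le_wt (B := 1) x
  rwa [Real.sqrt_one] at this

lemma abs_euler_jap_le (t : ℝ) (x : Eu n) : |euler (jap n) t x| ≤ wt 1 x := by
  have hw := wt_pos one_pos x
  rw [jap, euler, radial_omPow, omPow_eq_wt, show 2 * ((1 / 2 : ℝ) - 1) = -1 by norm_num,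
    Real.rpow_neg_one, abs_of_nonneg (by positivity), show (2 * (1 / 2 : ℝ)) = 1 by norm_num,
    one_mul, ← div_eq_mul_inv, div_le_iff₀ hw]
  have := norm_le_wt one_pos x
  nlinarith only [this, norm_nonneg x]

lemma abs_lapl_jap_le (t : ℝ) (x : Eu n) : |lapl (jap n) t x| ≤ (n + 1) * (wt 1 x)⁻¹ := by
  have hw := wt_pos one_pos x
  have e : lapl (jap n) t x = n * (wt 1 x)⁻¹ - (‖x‖ * (wt 1 x)⁻¹) ^ 2 * (wt 1 x)⁻¹ := by
    rw [jap, lapl_omPow, omPow_eq_wt, omPow_eq_wt, show 2 * ((1 / 2 : ℝ) - 1) = -1 by norm_num,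
      show 2 * ((1 / 2 : ℝ) - 2) = ((-3 : ℤ) : ℝ) by norm_num, Real.rpow_intCast,
      Real.rpow_neg_one, show (-3 : ℤ) = -(3 : ℕ) by norm_num, zpow_neg, zpow_natCast, mul_pow,
      ← inv_pow]
    ring
  have h1 : ‖x‖ * (wt 1 x)⁻¹ ≤ 1 := by
    rw [← div_eq_mul_inv, div_le_one hw]
    exact norm_le_wt one_pos x
  have h2 : (‖x‖ * (wt 1 x)⁻¹) ^ 2 ≤ 1 := pow_le_one₀ (by positivity) h1
  have hi : 0 < (wt 1 x)⁻¹ := inv_pos.2 hw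
  have q1 := mul_le_mul_of_nonneg_right h2 hi.le
  have q2 : 0 ≤ (‖x‖ * (wt 1 x)⁻¹) ^ 2 * (wt 1 x)⁻¹ := by positivity
  have q3 : (0 : ℝ) ≤ n * (wt 1 x)⁻¹ := by positivity
  rw [e, abs_le]
  constructor <;> linarith only [q1, q2, q3, hi]

/-- Real powers of a positive smooth function. -/
def powSF (f : SF n) (hf : ∀ t x, 0 < f t x) (s : ℝ) : SF n :=
  ⟨fun z => f.1 z ^ s, (contDiffSF f).rpow_const_of_ne fun z => (hf z.1 z.2).ne'⟩

/-- `f` vanishes outside the ball of radius `R`. -/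
def SuppIn (R : ℝ) (f : SF n) : Prop := ∀ t x, R < ‖x‖ → f t x = 0

namespace SuppIn

variable {R : ℝ} {f g : SF n}

lemma mul_right (hf : SuppIn R f) (g : SF n) : SuppIn R (f * g) := fun t x hx => by
  rw [mul_ev, hf t x hx, zero_mul]

lemma mul_left (hf : SuppIn R f) (g : SF n) : SuppIn R (g * f) := fun t x hx => by
  rw [mul_ev, hf t x hx, mul_zero]

lemma sub (hf : SuppIn R f) (hg : SuppIn R g) : SuppIn R (f - g) := fun t x hx => by
  rw [sub_ev, hf t x hx, hg t x hx, sub_zero]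

lemma pd (hf : SuppIn R f) (v : ℝ × Eu n) : SuppIn R (pd v f) := fun t x hx => by
  have : f.1 =ᶠ[𝓝 (t, x)] fun _ => 0 := by
    filter_upwards [(isOpen_lt continuous_const (continuous_snd.norm)).mem_nhds
      (show (t, x) ∈ {z : ℝ × Eu n | R < ‖z.2‖} from hx)] with z hz using hf z.1 z.2 hz
  rw [pd_ev, this.fderiv_eq]
  simp

lemma hasCompactSupport (hf : SuppIn R f) (t : ℝ) : HasCompactSupport fun x => f t x :=
  HasCompactSupport.of_support_subset_isCompact (isCompact_closedBall (0 : Eu n) R) fun x hx => by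
    rw [mem_closedBall_zero_iff]
    exact not_lt.1 fun h => hx (hf t x h)

lemma integrable (hf : SuppIn R f) (t : ℝ) : Integrable fun x => f t x :=
  (continuous_space f t).integrable_of_hasCompactSupport (hf.hasCompactSupport t)

lemma bd {B : ℝ} (hB : 0 < B) (hf : SuppIn R f) (s t : ℝ) : Bd B s f t := by
  have hc : Continuous fun x => f t x * wt B x ^ (-s) :=
    (continuous_space f t).mul (continuous_wt_rpow hB _)
  obtain ⟨C, hC⟩ := (isCompact_closedBall (0 : Eu n) R).exists_bound_of_continuousOn
    hc.continuousOn
  refine ⟨|C|, abs_nonneg _, fun x => ?_⟩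
  have hw := wt_rpow_pos hB x s
  by_cases hx : ‖x‖ ≤ R
  · have := (hC x (mem_closedBall_zero_iff.2 hx)).trans (le_abs_self C)
    rw [Real.norm_eq_abs, Real.rpow_neg (wt_pos hB x).le, abs_mul, abs_inv, abs_of_pos hw,
      ← div_eq_mul_inv, div_le_iff₀ hw] at this
    exact this
  · rw [hf t x (not_le.1 hx), abs_zero]
    positivity

lemma integral_dx (hf : SuppIn R f) (a : Fin n) (t : ℝ) : ∫ x, dx a f t x = 0 :=
  integral_dx_eq_zero one_pos (σ := -n - 1) (by linarith) (hf.bd one_pos _ t)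
    ((hf.pd _).bd one_pos _ t)

/-- Green's formula. -/
lemma integral_mul_lapl (hf : SuppIn R f) (g : SF n) (t : ℝ) :
    ∫ x, (f * lapl g) t x = ∫ x, (lapl f * g) t x := by
  have hl : SuppIn R (lapl f) := fun t x hx => by
    rw [lapl_eq, sum_ev]
    exact Finset.sum_eq_zero fun a _ => (hf.pd _).pd _ t x hx
  have hs : ∀ a, SuppIn R (f * dx a g - dx a f * g) := fun a =>
    (hf.mul_right _).sub ((SuppIn.pd hf _).mul_right g)
  have e : f * lapl g - lapl f * g = ∑ a, dx a (f * dx a g - dx a f * g) := by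
    refine SF_ext fun t x => ?_
    simp only [lapl_eq, map_sub, Derivation.leibniz, smul_eq_mul, Finset.mul_sum, Finset.sum_mul,
      ← Finset.sum_sub_distrib, sum_ev, sub_ev, add_ev, mul_ev]
    exact Finset.sum_congr rfl fun a _ => by ring
  rw [← sub_eq_zero, ← integral_sub ((hf.mul_right _).integrable t) ((hl.mul_right g).integrable t)]
  have : ∀ x, (f * lapl g) t x - (lapl f * g) t x =
      ∑ a, dx a (f * dx a g - dx a f * g) t x := fun x => by
    rw [← sub_ev, e, sum_ev]
  simp only [this]
  have hi : ∀ a, Integrable fun x => dx a (f * dx a g - dx a f * g) t x := fun a =>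
    ((hs a).pd _).integrable t
  rw [integral_finsetSum _ fun a _ => hi a]
  exact Finset.sum_eq_zero fun a _ => (hs a).integral_dx a t

lemma hasDerivAt_integral (hf : SuppIn R f) (t : ℝ) :
    HasDerivAt (fun s => ∫ x, f s x) (∫ x, dt f t x) t := by
  obtain ⟨C, hC⟩ := ((isCompact_closedBall t 1).prod
    (isCompact_closedBall (0 : Eu n) R)).exists_bound_of_continuousOn
    (continuousSF (dt f)).continuousOn
  refine (hasDerivAt_integral_of_dominated_loc_of_deriv_le (μ := volume)
    (F := fun s x => f s x) (F' := fun s x => dt f s x)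
    (bound := (Metric.closedBall (0 : Eu n) R).indicator fun _ => C)
    (Metric.ball_mem_nhds t one_pos)
    (Eventually.of_forall fun s => (continuous_space _ s).aestronglyMeasurable)
    (hf.integrable t) (continuous_space _ t).aestronglyMeasurable
    (ae_of_all _ fun x s hs => ?_)
    ((integrable_indicator_iff measurableSet_closedBall).2
      (integrableOn_const (isCompact_closedBall _ _).measure_lt_top.ne))
    (ae_of_all _ fun x s _ => hasDerivAt_dt f s x)).2
  by_cases hx : x ∈ Metric.closedBall (0 : Eu n) R
  · rw [Set.indicator_of_mem hx]
    exact hC (s, x) ⟨Metric.ball_subset_closedBall hs, hx⟩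
  · rw [Set.indicator_of_notMem hx, norm_le_zero_iff]
    rw [mem_closedBall_zero_iff, not_le] at hx
    exact hf.pd _ s x hx

end SuppIn

/-- A solution of the fast diffusion equation agrees after any positive time with a smooth
positive function on space-time. -/
lemma exists_extension {m : ℝ} {ρ : ℝ → Eu n → ℝ} (hρ : IsFDESol n m ρ) {c : ℝ} (hc : 0 < c) :
    ∃ (f : SF n) (hf : ∀ t x, 0 < f t x), (∀ t x, c ≤ t → f t x = ρ t x) ∧
      ∀ t x, c < t → dt f t x = 1 / m * lapl (powSF f hf m) t x := by
  let χ : ℝ → ℝ := fun t => Real.smoothTransition ((t - c / 2) / (c / 2))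
  let θ : ℝ → ℝ := fun t => c / 2 + (t - c / 2) * χ t
  have hχ : ContDiff ℝ (⊤ : ℕ∞) χ :=
    Real.smoothTransition.contDiff.comp ((contDiff_id.sub contDiff_const).div_const _)
  have hθ : ContDiff ℝ (⊤ : ℕ∞) θ :=
    contDiff_const.add ((contDiff_id.sub contDiff_const).mul hχ)
  have hθ0 : ∀ t, 0 < θ t := by
    intro t
    have h0 : 0 ≤ (t - c / 2) * χ t := by
      by_cases h : c / 2 ≤ t
      · exact mul_nonneg (by linarith) (Real.smoothTransition.nonneg _)
      · have : χ t = 0 := Real.smoothTransition.zero_of_nonpos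
          (div_nonpos_of_nonpos_of_nonneg (by linarith) (by linarith))
        rw [this, mul_zero]
    exact add_pos_of_pos_of_nonneg (by linarith) h0
  have hθ1 : ∀ t, c ≤ t → θ t = t := by
    intro t ht
    have : χ t = 1 := Real.smoothTransition.one_of_one_le
      ((one_le_div (by linarith)).2 (by linarith))
    change c / 2 + (t - c / 2) * χ t = t
    rw [this]
    ring
  let f : SF n := ⟨fun z => ρ (θ z.1) z.2, hρ.2.2.1.comp_contDiff
    (f := fun z : ℝ × Eu n => (θ z.1, z.2)) ((hθ.comp contDiff_fst).prodMk contDiff_snd)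
    fun z => ⟨hθ0 z.1, trivial⟩⟩
  have hf : ∀ t x, 0 < f t x := fun t x => hρ.1 _ (hθ0 t).le x
  have hfρ : ∀ t x, c ≤ t → f t x = ρ t x := fun t x ht => by
    change ρ (θ t) x = _
    rw [hθ1 t ht]
  refine ⟨f, hf, hfρ, fun t x ht => ?_⟩
  have h1 : (fun s => ρ s x) =ᶠ[𝓝 t] fun s => f s x := by
    filter_upwards [lt_mem_nhds ht] with s hs using (hfρ s x hs.le).symm
  have h2 := hρ.2.2.2 t (hc.trans ht) x
  rw [h1.deriv_eq, (hasDerivAt_dt f t x).deriv] at h2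
  rw [h2, ← lap_eq_lapl]
  congr 2
  funext y
  change ρ t y ^ m = f t y ^ m
  rw [hfρ t y ht.le]

/-- The weak formulation of the equation. -/
lemma hasDerivAt_integral_solution {m : ℝ} {ρ : ℝ → Eu n → ℝ} (hρ : IsFDESol n m ρ) {R : ℝ}
    {φ : SF n} (hφ : SuppIn R φ) (hdt : dt φ = 0) {τ : ℝ} (hτ : 0 < τ) :
    HasDerivAt (fun s => ∫ x, φ 0 x * ρ s x) (1 / m * ∫ x, lapl φ 0 x * ρ τ x ^ m) τ := by
  obtain ⟨f, hf, hfρ, hdf⟩ := exists_extension hρ (half_pos hτ)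
  have h := (hφ.mul_right f).hasDerivAt_integral τ
  have e1 : (fun s => ∫ x, φ 0 x * ρ s x) =ᶠ[𝓝 τ] fun s => ∫ x, (φ * f) s x := by
    filter_upwards [lt_mem_nhds (half_lt_self hτ)] with s hs
    refine integral_congr_ae (ae_of_all _ fun x => ?_)
    rw [mul_ev, hfρ s x hs.le, ev_eq_of_dt_eq_zero hdt s 0]
  refine (h.congr_of_eventuallyEq e1).congr_deriv ?_
  have hl : dt (lapl φ) = 0 := by rw [dt_lapl, hdt, map_zero]
  have e2 : ∀ x, dt (φ * f) τ x = 1 / m * (φ * lapl (powSF f hf m)) τ x := fun x => by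
    rw [Derivation.leibniz, hdt, smul_zero, add_zero, smul_eq_mul, mul_ev, mul_ev,
      hdf τ x (half_lt_self hτ)]
    ring
  simp only [e2]
  rw [integral_const_mul, hφ.integral_mul_lapl]
  congr 1
  refine integral_congr_ae (ae_of_all _ fun x => ?_)
  rw [mul_ev, ev_eq_of_dt_eq_zero hl τ 0]
  change _ * f τ x ^ m = _
  rw [hfρ τ x (half_lt_self hτ).le]

lemma continuousOn_integral_solution {m : ℝ} {ρ : ℝ → Eu n → ℝ} (hρ : IsFDESol n m ρ) {R : ℝ}
    {φ : SF n} (hφ : SuppIn R φ) :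
    ContinuousOn (fun s => ∫ x, φ 0 x * ρ s x) (Set.Ici 0) := by
  refine continuousOn_integral_of_compact_support (isCompact_closedBall (0 : Eu n) R)
    (((continuous_space φ 0).comp continuous_snd).continuousOn.mul hρ.2.1) fun s x _ hx => ?_
  rw [mem_closedBall_zero_iff, not_le] at hx
  rw [hφ 0 x hx, zero_mul]

lemma continuous_solution {m : ℝ} {ρ : ℝ → Eu n → ℝ} (hρ : IsFDESol n m ρ) {τ : ℝ} (hτ : 0 ≤ τ) :
    Continuous (ρ τ) :=
  hρ.2.1.comp_continuous (f := fun x : Eu n => (τ, x)) (by fun_prop) fun x => ⟨hτ, trivial⟩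

/-- An elementary interpolation inequality for the flux term. -/
lemma young_flux {m r s j p' : ℝ} (hm0 : 0 < m) (hm1 : m < 1) (hr : 0 < r) (hs0 : 0 ≤ s)
    (hs1 : s ≤ 1) (hj : 0 < j) {e : ℕ} (he : 1 ≤ e) (hem : 2 * m / (1 - m) ≤ e)
    (hp' : p' = -(2 * m / (1 - m))) :
    j ^ (-m) * r ^ m * s ^ e ≤ s ^ (e + 2) * (j * r) + j ^ p' := by
  have hm : 0 < 1 - m := by linarith
  rcases hs0.eq_or_lt with rfl | hs
  · rw [zero_pow (by omega), zero_pow (by omega), mul_zero, zero_mul, zero_add]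
    positivity
  by_cases h : r ^ (m - 1) ≤ s ^ 2 * j ^ (1 + m)
  · have e1 : r ^ m = r * r ^ (m - 1) := by
      rw [Real.rpow_sub_one hr.ne']
      field_simp
    have e2 : j ^ (-m) * j ^ (1 + m) = j := by
      rw [← Real.rpow_add hj, show -m + (1 + m) = 1 by ring, Real.rpow_one]
    have q := mul_le_mul_of_nonneg_left h (by positivity : 0 ≤ j ^ (-m) * r * s ^ e)
    have q2 : j ^ (-m) * r * s ^ e * (s ^ 2 * j ^ (1 + m)) =
        (j ^ (-m) * j ^ (1 + m)) * (s ^ (e + 2) * r) := by ring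
    rw [q2, e2] at q
    rw [e1]
    have : 0 ≤ j ^ p' := by positivity
    linarith only [q, this]
  · have h' : s ^ 2 * j ^ (1 + m) < r ^ (m - 1) := not_le.1 h
    have hpos : 0 < s ^ 2 * j ^ (1 + m) := by positivity
    have q1 : r ^ m ≤ (s ^ 2 * j ^ (1 + m)) ^ (-(m / (1 - m))) := by
      have := Real.rpow_le_rpow_of_nonpos hpos h'.le
        (by have : 0 < m / (1 - m) := by positivity
            linarith : -(m / (1 - m)) ≤ 0)
      rwa [← Real.rpow_mul hr.le, show (m - 1) * -(m / (1 - m)) = m by field_simp; ring] at this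
    have q2 : (s ^ 2 * j ^ (1 + m)) ^ (-(m / (1 - m))) =
        s ^ (-(2 * m / (1 - m))) * j ^ (-((1 + m) * m / (1 - m))) := by
      rw [Real.mul_rpow (by positivity) (by positivity), ← Real.rpow_natCast s 2,
        ← Real.rpow_mul hs.le, ← Real.rpow_mul hj.le]
      congr 2
      · push_cast; ring
      · ring
    have q3 : s ^ (-(2 * m / (1 - m))) * s ^ e ≤ 1 := by
      rw [← Real.rpow_natCast s e, ← Real.rpow_add hs]
      exact Real.rpow_le_one hs.le hs1 (by linarith)
    have q4 : j ^ (-m) * j ^ (-((1 + m) * m / (1 - m))) = j ^ p' := by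
      rw [← Real.rpow_add hj, hp']
      congr 1
      field_simp
      ring
    calc j ^ (-m) * r ^ m * s ^ e
        ≤ j ^ (-m) * (s ^ (-(2 * m / (1 - m))) * j ^ (-((1 + m) * m / (1 - m)))) * s ^ e := by
          rw [← q2]; gcongr
      _ = (j ^ (-m) * j ^ (-((1 + m) * m / (1 - m)))) * (s ^ (-(2 * m / (1 - m))) * s ^ e) := by
          ring
      _ ≤ j ^ p' * 1 := by rw [q4]; gcongr
      _ ≤ s ^ (e + 2) * (j * r) + j ^ p' := by
          have : 0 ≤ s ^ (e + 2) * (j * r) := by positivity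
          linarith

lemma bumpSF_nonneg (e : ℕ) (k t : ℝ) (x : Eu n) : 0 ≤ bumpSF n e k t x := by
  rw [bumpSF_ev]; exact cutProfile_nonneg _ _

lemma bumpSF_le_one (e : ℕ) (k t : ℝ) (x : Eu n) : bumpSF n e k t x ≤ 1 := by
  rw [bumpSF_ev]; exact cutProfile_le_one _ _

lemma suppIn_bumpSF (e : ℕ) {k : ℝ} (hk : 0 < k) : SuppIn (√(1 / k)) (bumpSF n e k) :=
  fun t x hx => bumpSF_eq_zero e hk t ((Real.sqrt_le_left (norm_nonneg x)).1 hx.le)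

lemma dt_eq_zero_of_const {f : SF n} (h : ∀ t s x, f t x = f s x) : dt f = 0 :=
  SF_ext fun t x => by
    have h1 := (hasDerivAt_dt f t x).deriv
    rw [show (fun s => f s x) = fun _ => f t x from funext fun s => h s t x, deriv_const] at h1
    rw [← h1, zero_ev]

lemma dt_mul_bumpSF {F : SF n} (hF : dt F = 0) (e : ℕ) (k : ℝ) : dt (F * bumpSF n e k) = 0 :=
  dt_eq_zero_of_const fun t s x => by
    rw [mul_ev, mul_ev, bumpSF_ev, bumpSF_ev, ev_eq_of_dt_eq_zero hF t s]

lemma tendsto_bumpSF (e : ℕ) (t : ℝ) (x : Eu n) :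
    Tendsto (fun k => bumpSF n e k t x) (𝓝[>] 0) (𝓝 1) := by
  have h : Continuous fun k : ℝ => cutProfile e (k * ‖x‖ ^ 2) :=
    (contDiff_cutProfile e).continuous.comp (by fun_prop)
  have := (h.tendsto 0).mono_left (nhdsWithin_le_nhds (s := Set.Ioi 0))
  rw [zero_mul, cutProfile_zero] at this
  exact this.congr fun k => (bumpSF_ev e k t x).symm

/-- On the support of the cutoff of parameter `k`, powers of `k` are traded for decay. -/
lemma cutoff_weight_le {m k w : ℝ} (hm0 : 0 < m) (hm1 : m < 1) (hk : 0 < k) (hw : 0 < w)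
    (hkw : k * w ^ 2 ≤ 2) : k * w ≤ 2 * k ^ ((1 - m) / 2) * w ^ (-m) := by
  have e1 : k = k ^ ((1 - m) / 2) * k ^ ((1 + m) / 2) := by
    rw [← Real.rpow_add hk, show (1 - m) / 2 + (1 + m) / 2 = 1 by ring, Real.rpow_one]
  have e2 : k ^ ((1 + m) / 2) * w ^ (1 + m) = (k * w ^ 2) ^ ((1 + m) / 2) := by
    rw [Real.mul_rpow hk.le (by positivity), ← Real.rpow_natCast w 2, ← Real.rpow_mul hw.le]
    congr 2
    push_cast
    ring
  have e3 : w ^ (1 + m) * w ^ (-m) = w := by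
    rw [← Real.rpow_add hw, show 1 + m + -m = 1 by ring, Real.rpow_one]
  have h1 : (k * w ^ 2) ^ ((1 + m) / 2) ≤ 2 := by
    calc (k * w ^ 2) ^ ((1 + m) / 2) ≤ 2 ^ ((1 + m) / 2) :=
          Real.rpow_le_rpow (by positivity) hkw (by linarith)
      _ ≤ 2 ^ (1 : ℝ) := Real.rpow_le_rpow_of_exponent_le one_le_two (by linarith)
      _ = 2 := Real.rpow_one 2
  have h2 : 0 ≤ k ^ ((1 - m) / 2) * w ^ (-m) := by positivity
  calc k * w = (k ^ ((1 - m) / 2) * k ^ ((1 + m) / 2)) * (w ^ (1 + m) * w ^ (-m)) := by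
        rw [← e1, e3]
    _ = k ^ ((1 - m) / 2) * w ^ (-m) * (k ^ ((1 + m) / 2) * w ^ (1 + m)) := by ring
    _ ≤ k ^ ((1 - m) / 2) * w ^ (-m) * 2 := by rw [e2]; gcongr
    _ = 2 * k ^ ((1 - m) / 2) * w ^ (-m) := by ring

section Conservation

variable {m : ℝ} {ρ : ℝ → Eu n → ℝ} {e : ℕ}

/-- The flux through the cutoffs is controlled by the weighted mass. -/
lemma exists_flux_bound (hm0 : 0 < m) (hm1 : m < 1) (hp : 2 < pPar n m) (hρ : IsFDESol n m ρ)
    (he : 1 ≤ e) (hem : 2 * m / (1 - m) ≤ e) :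
    ∃ C K : ℝ, 0 ≤ C ∧ 0 ≤ K ∧ ∀ (F : SF n), (∀ t x, |F t x| ≤ wt 1 x) →
      (∀ t x, |euler F t x| ≤ wt 1 x) → (∀ t x, |lapl F t x| ≤ (n + 1) * (wt 1 x)⁻¹) →
      ∀ k, 0 < k → k ≤ 1 → ∀ τ, 0 < τ →
        |1 / m * ∫ x, lapl (F * bumpSF n e k) 0 x * ρ τ x ^ m| ≤
          C * ((∫ x, (jap n * bumpSF n e k) 0 x * ρ τ x) + K) ∧
        (lapl F = 0 → |1 / m * ∫ x, lapl (F * bumpSF n e k) 0 x * ρ τ x ^ m| ≤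
          C * k ^ ((1 - m) / 2) * ((∫ x, (jap n * bumpSF n e k) 0 x * ρ τ x) + K)) := by
  obtain ⟨C, hC, hb⟩ := exists_lapl_mul_cutoff_bound n he
  have hm : 0 < 1 - m := by linarith
  have hint : Integrable fun x : Eu n => wt 1 x ^ (-(2 * m / (1 - m))) := by
    refine integrable_wt_rpow one_pos ?_
    have : 2 * m / (1 - m) = pPar n m + n - 2 := by
      rw [pPar]; field_simp; ring
    linarith
  refine ⟨1 / m * (2 * C + (n + 1)), ∫ x : Eu n, wt 1 x ^ (-(2 * m / (1 - m))), by positivity,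
    integral_nonneg fun x => (wt_rpow_pos one_pos x _).le, fun F hF hE hL k hk hk1 τ hτ => ?_⟩
  have hρc := continuous_solution hρ hτ.le
  have hint2 : Integrable fun x => (jap n * bumpSF n e k) 0 x * ρ τ x := by
    refine ((continuous_space _ 0).mul hρc).integrable_of_hasCompactSupport ?_
    exact (((suppIn_bumpSF e hk).mul_left (jap n)).hasCompactSupport 0).mul_right
  -- pointwise bound of the commutator term
  have hflux : ∀ x, wt 1 x ^ (-m) * ρ τ x ^ m * Real.smoothTransition (1 - k * ‖x‖ ^ 2) ^ e ≤
      (jap n * bumpSF n e k) 0 x * ρ τ x + wt 1 x ^ (-(2 * m / (1 - m))) := fun x => by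
    have := young_flux hm0 hm1 (hρ.1 τ hτ.le x)
      (Real.smoothTransition.nonneg (1 - k * ‖x‖ ^ 2)) (Real.smoothTransition.le_one _)
      (wt_pos one_pos x) he hem rfl
    rw [mul_ev, jap_ev, bumpSF_ev, cutProfile]
    linarith only [this]
  have hcomm : ∀ x, |lapl (F * bumpSF n e k) 0 x - bumpSF n e k 0 x * lapl F 0 x| * ρ τ x ^ m ≤
      2 * C * k ^ ((1 - m) / 2) *
        ((jap n * bumpSF n e k) 0 x * ρ τ x + wt 1 x ^ (-(2 * m / (1 - m)))) := fun x => by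
    have h1 := hb F hF hE k hk 0 x
    have hw := wt_pos one_pos x
    have hr := Real.rpow_pos_of_pos (hρ.1 τ hτ.le x) m
    by_cases hkx : k * ‖x‖ ^ 2 ≤ 1
    · have h2 : k * wt 1 x ^ 2 ≤ 2 := by
        rw [wt_sq one_pos]; linarith
      have h3 := cutoff_weight_le hm0 hm1 hk hw h2
      have h4 := hflux x
      have hs : 0 ≤ Real.smoothTransition (1 - k * ‖x‖ ^ 2) ^ e :=
        pow_nonneg (Real.smoothTransition.nonneg _) _
      generalize Real.smoothTransition (1 - k * ‖x‖ ^ 2) ^ e = s at h1 h4 hs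
      have h5 := mul_le_mul_of_nonneg_left (mul_le_mul_of_nonneg_right h3 hs) hC
      have h6 := mul_le_mul_of_nonneg_right (h1.trans h5) hr.le
      have h7 := mul_le_mul_of_nonneg_left h4
        (by positivity : 0 ≤ 2 * C * k ^ ((1 - m) / 2))
      refine h6.trans (le_trans (le_of_eq ?_) h7)
      ring
    · rw [Real.smoothTransition.zero_of_nonpos (by linarith), zero_pow (by omega), mul_zero,
        mul_zero] at h1
      rw [abs_nonpos_iff.1 h1, abs_zero, zero_mul]
      have h4 : 0 ≤ (jap n * bumpSF n e k) 0 x * ρ τ x :=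
        mul_nonneg (by rw [mul_ev, jap_ev]; exact mul_nonneg hw.le (bumpSF_nonneg _ _ _ _))
          (hρ.1 τ hτ.le x).le
      positivity
  have hmain : ∀ A : ℝ, 0 ≤ A → (∀ x, |lapl (F * bumpSF n e k) 0 x| * ρ τ x ^ m ≤
      A * ((jap n * bumpSF n e k) 0 x * ρ τ x + wt 1 x ^ (-(2 * m / (1 - m))))) →
      |1 / m * ∫ x, lapl (F * bumpSF n e k) 0 x * ρ τ x ^ m| ≤ 1 / m * A *
        ((∫ x, (jap n * bumpSF n e k) 0 x * ρ τ x) +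
          ∫ x : Eu n, wt 1 x ^ (-(2 * m / (1 - m)))) := fun A hA h => by
    rw [abs_mul, abs_of_pos (by positivity : 0 < 1 / m), mul_assoc]
    refine mul_le_mul_of_nonneg_left ?_ (by positivity)
    rw [← integral_add hint2 hint, ← integral_const_mul]
    refine (Real.norm_eq_abs _).ge.trans (norm_integral_le_of_norm_le ((hint2.add hint).const_mul A) (ae_of_all _ fun x => ?_))
    rw [Real.norm_eq_abs, abs_mul, abs_of_pos (Real.rpow_pos_of_pos (hρ.1 τ hτ.le x) m)]
    exact h x
  have hI : 0 ≤ (∫ x, (jap n * bumpSF n e k) 0 x * ρ τ x) +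
      ∫ x : Eu n, wt 1 x ^ (-(2 * m / (1 - m))) :=
    add_nonneg (integral_nonneg fun x => mul_nonneg (by
        rw [mul_ev, jap_ev]
        exact mul_nonneg (wt_pos one_pos x).le (bumpSF_nonneg _ _ _ _)) (hρ.1 τ hτ.le x).le)
      (integral_nonneg fun x => (wt_rpow_pos one_pos x _).le)
  refine ⟨hmain (2 * C + (n + 1)) (by positivity) fun x => ?_, fun hz => ?_⟩
  · have h1 := hcomm x
    have hk2 : k ^ ((1 - m) / 2) ≤ 1 := Real.rpow_le_one hk.le hk1 (by linarith)
    have hw := wt_pos one_pos x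
    have hr := Real.rpow_pos_of_pos (hρ.1 τ hτ.le x) m
    have h4 : 0 ≤ (jap n * bumpSF n e k) 0 x * ρ τ x + wt 1 x ^ (-(2 * m / (1 - m))) :=
      add_nonneg (mul_nonneg (by
        rw [mul_ev, jap_ev]; exact mul_nonneg hw.le (bumpSF_nonneg _ _ _ _)) (hρ.1 τ hτ.le x).le)
        (wt_rpow_pos one_pos x _).le
    have h2 : |bumpSF n e k 0 x * lapl F 0 x| * ρ τ x ^ m ≤ (n + 1) *
        ((jap n * bumpSF n e k) 0 x * ρ τ x + wt 1 x ^ (-(2 * m / (1 - m)))) := by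
      have hs0 := Real.smoothTransition.nonneg (1 - k * ‖x‖ ^ 2)
      have q1 : bumpSF n e k 0 x ≤ Real.smoothTransition (1 - k * ‖x‖ ^ 2) ^ e := by
        rw [bumpSF_ev]
        exact pow_le_pow_of_le_one hs0 (Real.smoothTransition.le_one _) (by omega)
      have q2 : (wt 1 x)⁻¹ ≤ wt 1 x ^ (-m) := by
        rw [← Real.rpow_neg_one]
        exact Real.rpow_le_rpow_of_exponent_le (one_le_wt x) (by linarith)
      have q3 : |lapl F 0 x| ≤ (n + 1) * wt 1 x ^ (-m) :=
        (hL 0 x).trans (mul_le_mul_of_nonneg_left q2 (by positivity))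
      rw [abs_mul, abs_of_nonneg (bumpSF_nonneg _ _ _ _)]
      have q4 := mul_le_mul_of_nonneg_right (mul_le_mul q1 q3 (abs_nonneg _) (by positivity)) hr.le
      have q5 := mul_le_mul_of_nonneg_left (hflux x) (by positivity : (0 : ℝ) ≤ n + 1)
      refine q4.trans (le_trans (le_of_eq ?_) q5)
      ring
    have h3 : |lapl (F * bumpSF n e k) 0 x| ≤
        |lapl (F * bumpSF n e k) 0 x - bumpSF n e k 0 x * lapl F 0 x| +
          |bumpSF n e k 0 x * lapl F 0 x| := by
      have := abs_add_le (lapl (F * bumpSF n e k) 0 x - bumpSF n e k 0 x * lapl F 0 x)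
        (bumpSF n e k 0 x * lapl F 0 x)
      rwa [sub_add_cancel] at this
    have h5 := mul_le_mul_of_nonneg_right h3 hr.le
    have h6 := mul_le_mul_of_nonneg_right hk2 (mul_nonneg (by positivity : 0 ≤ 2 * C) h4)
    linarith only [h1, h2, h5, h6]
  · refine (hmain (2 * C * k ^ ((1 - m) / 2)) (by positivity) fun x => ?_).trans ?_
    · have := hcomm x
      rwa [hz, zero_ev, mul_zero, sub_zero] at this
    · refine mul_le_mul_of_nonneg_right ?_ hI
      have : 0 ≤ 1 / m * (n + 1) * k ^ ((1 - m) / 2) := by positivity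
      linarith only [this]

lemma integrable_mul_bumpSF (hρ : IsFDESol n m ρ) (F : SF n) {k : ℝ} (hk : 0 < k) {τ : ℝ}
    (hτ : 0 ≤ τ) : Integrable fun x => (F * bumpSF n e k) 0 x * ρ τ x := by
  refine ((continuous_space _ 0).mul (continuous_solution hρ hτ)).integrable_of_hasCompactSupport ?_
  exact (((suppIn_bumpSF e hk).mul_left F).hasCompactSupport 0).mul_right

lemma tendsto_integral_mul_bumpSF (hρ : IsFDESol n m ρ) {F : SF n} (hF : ∀ t x, |F t x| ≤ wt 1 x)
    {τ : ℝ} (hτ : 0 ≤ τ) (hi : Integrable fun x => wt 1 x * ρ τ x) :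
    Tendsto (fun k => ∫ x, (F * bumpSF n e k) 0 x * ρ τ x) (𝓝[>] 0)
      (𝓝 (∫ x, F 0 x * ρ τ x)) := by
  refine tendsto_integral_filter_of_dominated_convergence (fun x => wt 1 x * ρ τ x)
    (Eventually.of_forall fun k =>
      ((continuous_space _ 0).mul (continuous_solution hρ hτ)).aestronglyMeasurable)
    (Eventually.of_forall fun k => ae_of_all _ fun x => ?_) hi (ae_of_all _ fun x => ?_)
  · have hr := hρ.1 τ hτ x
    rw [Real.norm_eq_abs, abs_mul, mul_ev, abs_mul, abs_of_pos hr,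
      abs_of_nonneg (bumpSF_nonneg e k 0 x)]
    refine mul_le_mul_of_nonneg_right ?_ hr.le
    have := mul_le_mul (hF 0 x) (bumpSF_le_one e k 0 x) (bumpSF_nonneg e k 0 x)
      (wt_pos one_pos x).le
    rwa [mul_one] at this
  · have := ((tendsto_bumpSF e 0 x).const_mul (F 0 x)).mul_const (ρ τ x)
    rw [mul_one] at this
    exact this

lemma jap_bumpSF_le (hρ : IsFDESol n m ρ) {k : ℝ} (hk : 0 < k)
    (h0 : Integrable fun x => wt 1 x * ρ 0 x) :
    ∫ x, (jap n * bumpSF n e k) 0 x * ρ 0 x ≤ ∫ x, wt 1 x * ρ 0 x := by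
  refine integral_mono (integrable_mul_bumpSF hρ _ hk le_rfl) h0 fun x => ?_
  refine mul_le_mul_of_nonneg_right ?_ (hρ.1 0 Set.self_mem_Ici x).le
  have := mul_le_mul_of_nonneg_left (bumpSF_le_one e k 0 x) (wt_pos one_pos x).le
  rw [mul_ev, jap_ev]
  rwa [mul_one] at this

/-- Conservation of the integrals against affine functions. -/
theorem conservation (hm0 : 0 < m) (hm1 : m < 1) (hp : 2 < pPar n m) (hρ : IsFDESol n m ρ)
    (h0 : Integrable fun x => wt 1 x * ρ 0 x) {T : ℝ} (hT : 0 ≤ T) :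
    (Integrable fun x => wt 1 x * ρ T x) ∧
      ∀ F : SF n, dt F = 0 → lapl F = 0 → (∀ t x, |F t x| ≤ wt 1 x) →
        (∀ t x, |euler F t x| ≤ wt 1 x) → ∫ x, F 0 x * ρ T x = ∫ x, F 0 x * ρ 0 x := by
  obtain ⟨e, he⟩ := exists_nat_ge (2 * m / (1 - m) + 1)
  have hm : 0 < 1 - m := by linarith
  have he1 : 1 ≤ e := by
    have : 0 < 2 * m / (1 - m) := by positivity
    exact_mod_cast (by linarith : (1 : ℝ) ≤ e)
  obtain ⟨C, K, hC, hK, hflux⟩ := exists_flux_bound hm0 hm1 hp hρ he1 (by linarith)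
  have hM0 : 0 ≤ ∫ x, wt 1 x * ρ 0 x :=
    integral_nonneg fun x => mul_nonneg (wt_pos one_pos x).le (hρ.1 0 Set.self_mem_Ici x).le
  -- Gronwall estimate for the truncated first moment
  have hgron : ∀ k, 0 < k → k ≤ 1 → ∀ τ, 0 ≤ τ → τ ≤ T →
      ∫ x, (jap n * bumpSF n e k) 0 x * ρ τ x ≤
        Real.exp (C * T) * ((∫ x, wt 1 x * ρ 0 x) + K) := by
    intro k hk hk1 τ hτ hτT
    have hs := (suppIn_bumpSF e hk).mul_left (jap n)
    have hd := fun s (hs0 : 0 < s) =>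
      hasDerivAt_integral_solution hρ hs (dt_mul_bumpSF (dt_omPow _ _) e k) hs0
    have hd2 := fun s (hs0 : 0 < s) => (hasDerivAt_exp_mul (-C) s).mul ((hd s hs0).add_const K)
    have hanti := antitoneOn_of_deriv_nonpos (convex_Ici 0)
      (f := fun s => Real.exp (-C * s) * ((∫ x, (jap n * bumpSF n e k) 0 x * ρ s x) + K))
      ((Continuous.continuousOn (by fun_prop)).mul
        ((continuousOn_integral_solution hρ hs).add continuousOn_const))
      (by
        rw [interior_Ici]
        exact fun s hs0 => (hd2 s hs0).differentiableAt.differentiableWithinAt)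
      (by
        rw [interior_Ici]
        intro s hs0
        refine (hd2 s hs0).deriv.trans_le ?_
        have := (abs_le.1 (hflux (jap n) (fun t x => by
          rw [jap_ev, abs_of_pos (wt_pos one_pos x)]) abs_euler_jap_le abs_lapl_jap_le
          k hk hk1 s hs0).1).2
        have h2 := mul_le_mul_of_nonneg_left this (Real.exp_pos (-C * s)).le
        linarith only [h2])
    have h1 := hanti Set.self_mem_Ici hτ hτ
    simp only [mul_zero, Real.exp_zero, one_mul] at h1
    have h2 := h1.trans (add_le_add_left (jap_bumpSF_le hρ hk h0) K)
    rw [neg_mul, Real.exp_neg, inv_mul_le_iff₀ (Real.exp_pos _)] at h2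
    have h3 : Real.exp (C * τ) ≤ Real.exp (C * T) :=
      Real.exp_le_exp.2 (mul_le_mul_of_nonneg_left hτT hC)
    have h4 := mul_le_mul_of_nonneg_right h3 (add_nonneg hM0 hK)
    linarith only [h2, h4, hK]
  generalize hM : Real.exp (C * T) * ((∫ x, wt 1 x * ρ 0 x) + K) = M at hgron
  have hM' : 0 ≤ M := hM ▸ mul_nonneg (Real.exp_pos _).le (add_nonneg hM0 hK)
  have hint : Integrable fun x => wt 1 x * ρ T x := by
    have hc : Continuous fun x => wt 1 x * ρ T x := by
      have := continuous_space (jap n) 0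
      simp only [jap_ev] at this
      exact this.mul (continuous_solution hρ hT)
    refine ⟨hc.aestronglyMeasurable, ?_⟩
    let k : ℕ → ℝ := fun j => 1 / ((j : ℝ) + 1)
    have hk : ∀ j, 0 < k j := fun j => Nat.one_div_pos_of_nat
    have hk1 : ∀ j, k j ≤ 1 := fun j => by
      rw [div_le_one (by positivity)]
      have : (0 : ℝ) ≤ j := j.cast_nonneg
      linarith
    have hkt : Tendsto k atTop (𝓝[>] 0) :=
      tendsto_nhdsWithin_iff.2 ⟨tendsto_one_div_add_atTop_nhds_zero_nat,
        Eventually.of_forall hk⟩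
    have hnn : ∀ j x, 0 ≤ (jap n * bumpSF n e (k j)) 0 x * ρ T x := fun j x => by
      rw [mul_ev, jap_ev]
      exact mul_nonneg (mul_nonneg (wt_pos one_pos x).le (bumpSF_nonneg _ _ _ _)) (hρ.1 T hT x).le
    have hlim : ∀ x, Tendsto (fun j => ENNReal.ofReal ((jap n * bumpSF n e (k j)) 0 x * ρ T x))
        atTop (𝓝 ‖wt 1 x * ρ T x‖ₑ) := fun x => by
      rw [Real.enorm_of_nonneg (mul_nonneg (wt_pos one_pos x).le (hρ.1 T hT x).le)]
      refine ENNReal.tendsto_ofReal ?_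
      have := (((tendsto_bumpSF e 0 x).comp hkt).const_mul (jap n 0 x)).mul_const (ρ T x)
      rw [mul_one, jap_ev] at this
      simpa only [mul_ev, jap_ev, Function.comp_apply] using this
    calc ∫⁻ x, ‖wt 1 x * ρ T x‖ₑ
        = ∫⁻ x, liminf (fun j => ENNReal.ofReal ((jap n * bumpSF n e (k j)) 0 x * ρ T x)) atTop :=
          lintegral_congr fun x => (hlim x).liminf_eq.symm
      _ ≤ liminf (fun j => ∫⁻ x, ENNReal.ofReal ((jap n * bumpSF n e (k j)) 0 x * ρ T x)) atTop :=
          lintegral_liminf_le fun j => (((continuous_space _ 0).mul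
            (continuous_solution hρ hT)).measurable).ennreal_ofReal
      _ ≤ ENNReal.ofReal M := by
          refine liminf_le_of_le ⟨0, Eventually.of_forall fun _ => bot_le⟩ fun b hb => ?_
          obtain ⟨j, hj⟩ := hb.exists
          rw [← ofReal_integral_eq_lintegral_ofReal (integrable_mul_bumpSF hρ _ (hk j) hT)
            (ae_of_all _ (hnn j))] at hj
          exact hj.trans (ENNReal.ofReal_le_ofReal (hgron _ (hk j) (hk1 j) T hT le_rfl))
      _ < ⊤ := ENNReal.ofReal_lt_top
  refine ⟨hint, fun F hdt hlap hF hE => ?_⟩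
  have hdiff : ∀ k, 0 < k → k ≤ 1 → |(∫ x, (F * bumpSF n e k) 0 x * ρ T x) -
      ∫ x, (F * bumpSF n e k) 0 x * ρ 0 x| ≤ C * k ^ ((1 - m) / 2) * (M + K) * T := by
    intro k hk hk1
    have hs := (suppIn_bumpSF e hk).mul_left F
    have hd := fun s (hs0 : 0 < s) =>
      hasDerivAt_integral_solution hρ hs (dt_mul_bumpSF hdt e k) hs0
    have hcont := (continuousOn_integral_solution hρ hs).mono
      fun s (hs0 : s ∈ Set.Icc 0 T) => hs0.1
    have hdo : DifferentiableOn ℝ (fun s => ∫ x, (F * bumpSF n e k) 0 x * ρ s x)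
        (interior (Set.Icc 0 T)) := by
      rw [interior_Icc]
      exact fun s hs0 => (hd s hs0.1).differentiableAt.differentiableWithinAt
    have hbd : ∀ s ∈ interior (Set.Icc 0 T),
        |deriv (fun s => ∫ x, (F * bumpSF n e k) 0 x * ρ s x) s| ≤
          C * k ^ ((1 - m) / 2) * (M + K) := by
      rw [interior_Icc]
      intro s hs0
      rw [(hd s hs0.1).deriv]
      refine ((hflux F hF hE (fun t x => ?_) k hk hk1 s hs0.1).2 hlap).trans
        (mul_le_mul_of_nonneg_left
          (add_le_add_left (hgron k hk hk1 s hs0.1.le hs0.2.le) K) (by positivity))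
      rw [hlap, zero_ev, abs_zero]
      have := wt_pos one_pos x
      positivity
    have h1 := (convex_Icc 0 T).image_sub_le_mul_sub_of_deriv_le hcont hdo
      (fun s hs0 => (abs_le.1 (hbd s hs0)).2) 0 ⟨le_rfl, hT⟩ T ⟨hT, le_rfl⟩ hT
    have h2 := (convex_Icc 0 T).mul_sub_le_image_sub_of_le_deriv hcont hdo
      (fun s hs0 => (abs_le.1 (hbd s hs0)).1) 0 ⟨le_rfl, hT⟩ T ⟨hT, le_rfl⟩ hT
    rw [abs_le]
    constructor <;> linarith only [h1, h2]
  have hl := ((tendsto_integral_mul_bumpSF (e := e) hρ hF hT hint).sub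
    (tendsto_integral_mul_bumpSF (e := e) hρ hF le_rfl h0)).abs
  have hr : Tendsto (fun k : ℝ => C * k ^ ((1 - m) / 2) * (M + K) * T) (𝓝[>] 0) (𝓝 0) := by
    have h1 : ContinuousAt (fun k : ℝ => k ^ ((1 - m) / 2)) 0 :=
      Real.continuousAt_rpow_const _ _ (Or.inr (by linarith))
    have h2 := ((((h1.tendsto.mono_left (nhdsWithin_le_nhds (s := Set.Ioi 0))).const_mul
      C).mul_const (M + K)).mul_const T)
    rwa [Real.zero_rpow (by linarith), mul_zero, zero_mul, zero_mul] at h2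
  have hle := le_of_tendsto_of_tendsto hl hr (by
    filter_upwards [Ioc_mem_nhdsGT one_pos] with k hk using hdiff k hk.1 hk.2)
  exact sub_eq_zero.1 (abs_nonpos_iff.1 hle)

end Conservation

lemma pd_powSF {f : SF n} (hf : ∀ t x, 0 < f t x) (s : ℝ) (v : ℝ × Eu n) :
    pd v (powSF f hf s) = s • (powSF f hf (s - 1) * pd v f) := by
  refine SF_ext fun t x => ?_
  have h : HasFDerivAt (powSF f hf s).1 _ (t, x) :=
    (hasFDerivAt_pair f t x).rpow_const (p := s) (Or.inl (hf t x).ne')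
  rw [pd_ev, h.fderiv, smul_ev, mul_ev, pd_ev, ← mul_assoc]
  rfl

lemma dx_powSF {f : SF n} (hf : ∀ t x, 0 < f t x) (s : ℝ) (a : Fin n) :
    dx a (powSF f hf s) = s • (powSF f hf (s - 1) * dx a f) := pd_powSF hf s _

lemma dt_powSF {f : SF n} (hf : ∀ t x, 0 < f t x) (s : ℝ) :
    dt (powSF f hf s) = s • (powSF f hf (s - 1) * dt f) := pd_powSF hf s _

lemma gradSq_powSF {f : SF n} (hf : ∀ t x, 0 < f t x) (s t : ℝ) (x : Eu n) :
    gradSq (powSF f hf s) t x = s ^ 2 * (f t x ^ (s - 1)) ^ 2 * gradSq f t x := by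
  rw [gradSq_ev, gradSq_ev, Finset.mul_sum]
  refine Finset.sum_congr rfl fun a _ => ?_
  rw [dx_powSF, smul_ev, mul_ev]
  change (s * (f t x ^ (s - 1) * dx a f t x)) ^ 2 = _
  ring

lemma lapl_powSF {f : SF n} (hf : ∀ t x, 0 < f t x) (s t : ℝ) (x : Eu n) :
    lapl (powSF f hf s) t x =
      s * (f t x ^ (s - 1) * lapl f t x) + s * (s - 1) * f t x ^ (s - 2) * gradSq f t x := by
  have h : ∀ a, dx a (dx a (powSF f hf s)) t x =
      s * (f t x ^ (s - 1) * dx a (dx a f) t x) +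
        s * (s - 1) * f t x ^ (s - 2) * dx a f t x ^ 2 := by
    intro a
    rw [dx_powSF, Derivation.map_smul, Derivation.leibniz, dx_powSF, smul_eq_mul, smul_eq_mul,
      smul_ev, add_ev, mul_ev, mul_ev, smul_ev, mul_ev, show s - 1 - 1 = s - 2 by ring]
    change s * (f t x ^ (s - 1) * _ + _ * ((s - 1) * (f t x ^ (s - 2) * _))) = _
    ring
  rw [lapl_eq, lapl_eq, gradSq_ev, sum_ev, sum_ev, Finset.sum_congr rfl fun a _ => h a,
    Finset.sum_add_distrib, Finset.mul_sum, Finset.mul_sum, Finset.mul_sum]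

/-- The pressure equation. -/
lemma dt_pressure {m : ℝ} (hm0 : 0 < m) (hm1 : m < 1) {f : SF n} (hf : ∀ t x, 0 < f t x)
    {t : ℝ} {x : Eu n} (h : dt f t x = 1 / m * lapl (powSF f hf m) t x) :
    dt (powSF f hf (m - 1)) t x =
      powSF f hf (m - 1) t x * lapl (powSF f hf (m - 1)) t x -
        1 / (1 - m) * gradSq (powSF f hf (m - 1)) t x := by
  have hF := hf t x
  have h1 : f t x ^ (m - 1 - 1) = f t x ^ (m - 1) / f t x := Real.rpow_sub_one hF.ne' _
  have h2 : f t x ^ (m - 2) = f t x ^ (m - 1) / f t x := by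
    rw [← h1]; congr 1; ring
  have h3 : f t x ^ (m - 1 - 2) = f t x ^ (m - 1) / f t x ^ 2 := Real.rpow_sub_natCast hF.ne' _ 2
  rw [dt_powSF, smul_ev, mul_ev, h, lapl_powSF, lapl_powSF, gradSq_powSF, h3, h2]
  change (m - 1) * (f t x ^ (m - 1 - 1) * _) = f t x ^ (m - 1) * _ - _
  rw [h1]
  generalize f t x ^ (m - 1) = A
  generalize f t x = F at hF
  generalize lapl f t x = Lf
  generalize gradSq f t x = gf
  have hm : 1 - m ≠ 0 := by linarith
  field_simp
  ring

/-- The self-similar change of variables. -/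
def scaleSF (a b : ℝ) (f : SF n) : SF n :=
  ⟨fun z => f.1 ((Real.exp (b * z.1) - 1) / b, Real.exp (a * z.1) • z.2), by
    refine (contDiffSF f).comp (ContDiff.prodMk ?_ ?_)
    · exact ((Real.contDiff_exp.comp (contDiff_const.mul contDiff_fst)).sub
        contDiff_const).div_const _
    · exact (Real.contDiff_exp.comp (contDiff_const.mul contDiff_fst)).smul contDiff_snd⟩

lemma scaleSF_ev (a b : ℝ) (f : SF n) (t : ℝ) (x : Eu n) :
    scaleSF a b f t x = f ((Real.exp (b * t) - 1) / b) (Real.exp (a * t) • x) := rfl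

lemma dx_scaleSF (a b : ℝ) (f : SF n) (i : Fin n) :
    dx i (scaleSF a b f) = expT a * scaleSF a b (dx i f) := by
  refine SF_ext fun t x => ?_
  have h1 := hasDerivAt_dx (scaleSF a b f) t x i 0
  have h2 := hasDerivAt_line f ((Real.exp (b * t) - 1) / b) (Real.exp (a * t) • x)
    (Real.exp (a * t) • stdBasis n i) 0
  have e : (fun s : ℝ => scaleSF a b f t (x + s • stdBasis n i)) = fun s : ℝ =>
      f ((Real.exp (b * t) - 1) / b)
        (Real.exp (a * t) • x + s • Real.exp (a * t) • stdBasis n i) := by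
    funext s
    rw [scaleSF_ev, smul_add, smul_comm s]
  rw [e] at h1
  have := h1.unique h2
  simp only [zero_smul, add_zero] at this
  rw [this, mul_ev, expT_ev, scaleSF_ev]
  simp [stdBasis]

lemma dt_scaleSF (a : ℝ) {b : ℝ} (hb : b ≠ 0) (f : SF n) :
    dt (scaleSF a b f) = expT b * scaleSF a b (dt f) + a • euler (scaleSF a b f) := by
  refine SF_ext fun t x => ?_
  have h1 : HasDerivAt (fun s : ℝ => ((Real.exp (b * s) - 1) / b, Real.exp (a * s) • x))
      (Real.exp (b * t), (a * Real.exp (a * t)) • x) t := by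
    refine HasDerivAt.prodMk ?_ ?_
    · have := ((hasDerivAt_exp_mul b t).sub_const 1).div_const b
      rwa [mul_div_cancel_left₀ _ hb] at this
    · exact (hasDerivAt_exp_mul a t).smul_const x
  have h2 := (hasFDerivAt_pair f ((Real.exp (b * t) - 1) / b)
    (Real.exp (a * t) • x)).comp_hasDerivAt t h1
  rw [(hasDerivAt_dt (scaleSF a b f) t x).unique h2]
  have e : ((Real.exp (b * t), (a * Real.exp (a * t)) • x) : ℝ × Eu n) =
      Real.exp (b * t) • ((1 : ℝ), (0 : Eu n)) + (0, (a * Real.exp (a * t)) • x) := by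
    simp
  have h3 := (hasFDerivAt_space f ((Real.exp (b * t) - 1) / b) (Real.exp (a * t) • x)).fderiv
  have h4 := fderiv_space_apply f ((Real.exp (b * t) - 1) / b) (Real.exp (a * t) • x)
    ((a * Real.exp (a * t)) • x)
  rw [h3] at h4
  have h5 : fderiv ℝ f.1 ((Real.exp (b * t) - 1) / b, Real.exp (a * t) • x)
      (0, (a * Real.exp (a * t)) • x) =
        ∑ i, ((a * Real.exp (a * t)) • x) i *
          dx i f ((Real.exp (b * t) - 1) / b) (Real.exp (a * t) • x) := h4
  rw [e, map_add, map_smul, h5, add_ev, mul_ev, smul_ev, expT_ev, scaleSF_ev, euler, sum_ev,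
    Finset.mul_sum, smul_eq_mul]
  refine congrArg₂ _ rfl (Finset.sum_congr rfl fun i _ => ?_)
  rw [mul_ev, dx_scaleSF, mul_ev, expT_ev, scaleSF_ev, X_ev, PiLp.smul_apply, smul_eq_mul]
  ring

lemma lapl_scaleSF (a b : ℝ) (f : SF n) (t : ℝ) (x : Eu n) :
    lapl (scaleSF a b f) t x = Real.exp (a * t) ^ 2 * scaleSF a b (lapl f) t x := by
  rw [lapl_eq, lapl_eq, sum_ev, scaleSF_ev, sum_ev, Finset.mul_sum]
  refine Finset.sum_congr rfl fun i _ => ?_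
  rw [dx_scaleSF, Derivation.leibniz, dx_expT, smul_zero, add_zero, smul_eq_mul, dx_scaleSF,
    mul_ev, mul_ev, expT_ev, scaleSF_ev]
  ring

lemma gradSq_scaleSF (a b : ℝ) (f : SF n) (t : ℝ) (x : Eu n) :
    gradSq (scaleSF a b f) t x = Real.exp (a * t) ^ 2 * scaleSF a b (gradSq f) t x := by
  rw [scaleSF_ev, gradSq_ev, gradSq_ev, Finset.mul_sum]
  refine Finset.sum_congr rfl fun i _ => ?_
  rw [dx_scaleSF, mul_ev, expT_ev, scaleSF_ev]
  ring

lemma lapl_expT_mul (c : ℝ) (f : SF n) (t : ℝ) (x : Eu n) :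
    lapl (expT c * f) t x = Real.exp (c * t) * lapl f t x := by
  simp only [lapl_eq, sum_ev, Finset.mul_sum]
  refine Finset.sum_congr rfl fun i _ => ?_
  rw [Derivation.leibniz, dx_expT, smul_zero, add_zero, smul_eq_mul, Derivation.leibniz, dx_expT,
    smul_zero, add_zero, smul_eq_mul, mul_ev, expT_ev]

lemma gradSq_expT_mul (c : ℝ) (f : SF n) (t : ℝ) (x : Eu n) :
    gradSq (expT c * f) t x = Real.exp (c * t) ^ 2 * gradSq f t x := by
  rw [gradSq_ev, gradSq_ev, Finset.mul_sum]
  refine Finset.sum_congr rfl fun i _ => ?_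
  rw [Derivation.leibniz, dx_expT, smul_zero, add_zero, smul_eq_mul, mul_ev, expT_ev]
  ring

lemma euler_expT_mul (c : ℝ) (f : SF n) (t : ℝ) (x : Eu n) :
    euler (expT c * f) t x = Real.exp (c * t) * euler f t x := by
  simp only [euler, sum_ev, Finset.mul_sum]
  refine Finset.sum_congr rfl fun i _ => ?_
  rw [mul_ev, mul_ev, Derivation.leibniz, dx_expT, smul_zero, add_zero, smul_eq_mul, mul_ev,
    expT_ev]
  ring

/-- The pressure equation in self-similar variables. -/
lemma dt_scaled_pressure {p κ : ℝ} (hp : p ≠ 0) {P : SF n} {t : ℝ} {x : Eu n}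
    (h : dt P ((Real.exp (2 * p * t) - 1) / (2 * p)) (Real.exp ((p + n) * t) • x) =
      (P * lapl P - κ • gradSq P) ((Real.exp (2 * p * t) - 1) / (2 * p))
        (Real.exp ((p + n) * t) • x)) {Q : SF n}
    (hQ : Q = expT (-2 * n) * scaleSF (p + n) (2 * p) P) :
    dt Q t x = Q t x * lapl Q t x - κ * gradSq Q t x + (p + n) * euler Q t x - 2 * n * Q t x := by
  have e1 : Real.exp (2 * p * t) = Real.exp ((p + n) * t) ^ 2 * Real.exp (-2 * n * t) := by
    rw [← Real.exp_nat_mul, ← Real.exp_add]; congr 1; push_cast; ring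
  rw [hQ, lapl_expT_mul, gradSq_expT_mul, euler_expT_mul, Derivation.leibniz, dt_expT,
    dt_scaleSF _ (by simpa using hp), lapl_scaleSF, gradSq_scaleSF]
  simp only [sub_ev, mul_ev, smul_ev, add_ev, smul_eq_mul, expT_ev, scaleSF_ev] at h ⊢
  rw [h, e1]
  ring

lemma isQSol_of_scaled_pressure {p κ : ℝ} (hκ : 2 * κ = p + n) (B : ℝ) {Q q : SF n}
    (hq : q = Q - om n B) {t : ℝ} {x : Eu n}
    (h : dt Q t x =
      Q t x * lapl Q t x - κ * gradSq Q t x + (p + n) * euler Q t x - 2 * n * Q t x) :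
    dt q t x = (Op n B (p + n) 0 q + (1 : ℝ) • (q * lapl q - κ • ∑ a, dx a q ^ 2)) t x := by
  have hQ : Q = q + om n B := by rw [hq]; ring
  have e1 : dt Q = dt q := by rw [hQ, map_add, dt_om, add_zero]
  have e2 : lapl Q = lapl q + algebraMap ℝ (SF n) (2 * n) := by rw [hQ, map_add, lapl_om]
  have e3 : euler Q = euler q + (2 : ℝ) • (om n B - algebraMap ℝ (SF n) B) := by
    rw [hQ, euler_add, euler_om]
  have e4 : gradSq Q t x = gradSq q t x + 4 * euler q t x + 4 * ‖x‖ ^ 2 := by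
    rw [gradSq_ev, gradSq_ev, ← inner_self_coord x, euler, sum_ev, Finset.mul_sum, Finset.mul_sum,
      ← Finset.sum_add_distrib, ← Finset.sum_add_distrib]
    refine Finset.sum_congr rfl fun a _ => ?_
    rw [hQ, map_add, dx_om, add_ev, mul_ev, smul_ev, X_ev]
    ring
  rw [← e1, h, e2, e3, e4, Op_eq_euler, hQ]
  change _ = (_ + (1 : ℝ) • (q * lapl q - κ • gradSq q)) t x
  simp only [add_ev, sub_ev, mul_ev, smul_ev, algebraMap_ev, om_ev, zero_smul, zero_ev]
  linear_combination (-2 * ‖x‖ ^ 2 * 1 - 2 * euler q t x) * hκ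

variable {m B : ℝ} {ρ : ℝ → Eu n → ℝ}

lemma abs_rpow_sub_one_le (s : ℝ) :
    ∃ C : ℝ, 0 ≤ C ∧ ∀ z : ℝ, |z| ≤ 1 / 2 → |(1 + z) ^ s - 1| ≤ C * |z| := by
  have hpos : ∀ z ∈ Set.Icc (-(1 / 2) : ℝ) (1 / 2), (0 : ℝ) < 1 + z := fun z hz => by
    linarith [hz.1]
  have hcont : ContinuousOn (fun z : ℝ => s * (1 + z) ^ (s - 1)) (Set.Icc (-(1 / 2)) (1 / 2)) :=
    continuousOn_const.mul ((continuousOn_const.add continuousOn_id).rpow_const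
      fun z hz => Or.inl (hpos z hz).ne')
  obtain ⟨C, hC⟩ := isCompact_Icc.exists_bound_of_continuousOn hcont
  have h0 : (0 : ℝ) ∈ Set.Icc (-(1 / 2) : ℝ) (1 / 2) := by constructor <;> norm_num
  refine ⟨C, (norm_nonneg _).trans (hC 0 h0), fun z hz => ?_⟩
  have := (convex_Icc (-(1 / 2) : ℝ) (1 / 2)).norm_image_sub_le_of_norm_hasDerivWithin_le
    (f := fun z => (1 + z) ^ s) (f' := fun z => s * (1 + z) ^ (s - 1)) (C := C)
    (fun y hy => by
      have := (((hasDerivAt_id y).const_add 1).rpow_const (p := s)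
        (Or.inl (hpos y hy).ne')).hasDerivWithinAt (s := Set.Icc (-(1 / 2) : ℝ) (1 / 2))
      simpa using this) hC h0 (abs_le.1 hz)
  simpa using this

lemma exists_rpow_expansion (s : ℝ) :
    ∃ K : ℝ, 0 ≤ K ∧ ∀ z : ℝ, |z| ≤ 1 / 2 → |(1 + z) ^ s - 1 - s * z| ≤ K * z ^ 2 := by
  obtain ⟨C, hC, hb⟩ := abs_rpow_sub_one_le (s - 1)
  refine ⟨|s| * C, by positivity, fun z hz => ?_⟩
  have hz' := abs_le.1 hz
  have h0 : (0 : ℝ) ∈ Set.Icc (-|z|) |z| := by constructor <;> simp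
  have := (convex_Icc (-|z|) |z|).norm_image_sub_le_of_norm_hasDerivWithin_le
    (f := fun z => (1 + z) ^ s - s * z) (f' := fun z => s * (1 + z) ^ (s - 1) - s)
    (C := |s| * C * |z|)
    (fun y hy => by
      have hy0 : (0 : ℝ) < 1 + y := by linarith [hy.1]
      have h : HasDerivAt (fun z => (1 + z) ^ s - s * z) _ y :=
        (((hasDerivAt_id y).const_add 1).rpow_const (p := s) (Or.inl hy0.ne')).sub
          ((hasDerivAt_id y).const_mul s)
      exact (h.congr_deriv (by simp)).hasDerivWithinAt)
    (fun y hy => by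
      have hy1 : |y| ≤ |z| := abs_le.2 hy
      have := mul_le_mul_of_nonneg_left ((hb y (hy1.trans hz)).trans
        (mul_le_mul_of_nonneg_left hy1 hC)) (abs_nonneg s)
      rw [Real.norm_eq_abs, show s * (1 + y) ^ (s - 1) - s = s * ((1 + y) ^ (s - 1) - 1) by ring,
        abs_mul]
      linarith only [this])
    h0 ⟨neg_abs_le z, le_abs_self z⟩
  simp only [Real.norm_eq_abs, add_zero, Real.one_rpow, mul_zero, sub_zero] at this
  rw [show |s| * C * |z| * |z| = |s| * C * z ^ 2 by rw [← sq_abs z]; ring] at this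
  rwa [sub_right_comm] at this

/-- The solution in self-similar variables. -/
def rescaled (m : ℝ) (ρ : ℝ → Eu n → ℝ) (t : ℝ) (x : Eu n) : ℝ :=
  Real.exp (n * (pPar n m + n) * t) *
    ρ ((Real.exp (2 * pPar n m * t) - 1) / (2 * pPar n m)) (Real.exp ((pPar n m + n) * t) • x)

lemma pPar_add (hm1 : m < 1) : (pPar n m + n) / 2 = 1 / (1 - m) := by
  have : 1 - m ≠ 0 := by linarith
  rw [pPar]
  field_simp
  ring

lemma rescaled_rhoB (hm1 : m < 1) (hp : 0 < pPar n m) (hB : 0 < B) (t : ℝ) (x : Eu n) :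
    rescaled m (rhoB n m B) t x = wt B x ^ (-(pPar n m + n)) := by
  have e0 : 1 + 2 * pPar n m * ((Real.exp (2 * pPar n m * t) - 1) / (2 * pPar n m)) =
      Real.exp (2 * pPar n m * t) := by
    field_simp
    ring
  have e1 : 2 * pPar n m * t * betaPar n m = (pPar n m + n) * t := by
    rw [betaPar]
    field_simp
  rw [rescaled, rhoB, uB, e0, ← Real.exp_mul, ← Real.exp_mul, smul_smul, ← Real.exp_add,
    mul_neg, e1, neg_add_cancel, Real.exp_zero, one_smul, ← mul_assoc, ← Real.exp_add,
    neg_mul, mul_neg, mul_left_comm, e1, ← mul_assoc, add_neg_cancel, Real.exp_zero, one_mul,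
    ← wt_sq hB, ← pPar_add (n := n) hm1, ← Real.rpow_natCast, ← Real.rpow_mul (wt_pos hB x).le]
  congr 1
  push_cast
  ring

lemma exists_rescaled_pressure (hm0 : 0 < m) (hm1 : m < 1) (hp : 0 < pPar n m) (hB : 0 < B)
    (hρ : IsFDESol n m ρ) :
    ∃ q G : SF n, IsQSol B (pPar n m + n) 0 ((pPar n m + n) / 2) 1 q G ∧
      ∃ T₀ : ℝ, (∀ t x, T₀ < t → G t x = 0) ∧
        ∀ t x, T₀ < t → 0 < 1 + q t x / wt B x ^ 2 ∧ rescaled m ρ t x =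
          (1 + q t x / wt B x ^ 2) ^ (-((pPar n m + n) / 2)) * wt B x ^ (-(pPar n m + n)) := by
  obtain ⟨f, hf, hfρ, heq⟩ := exists_extension hρ one_pos
  generalize hp' : pPar n m = p at hp
  have hκ : (p + n) / 2 = 1 / (1 - m) := hp' ▸ pPar_add hm1
  have hm : 1 - m ≠ 0 := by linarith
  have hτ : ∀ t, Real.log (1 + 2 * p) / (2 * p) < t → 1 < (Real.exp (2 * p * t) - 1) / (2 * p) := by
    intro t ht
    rw [div_lt_iff₀ (by positivity), mul_comm t, Real.log_lt_iff_lt_exp (by positivity)] at ht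
    rw [lt_div_iff₀ (by positivity)]
    linarith
  let P := powSF f hf (m - 1)
  let Q := expT (-2 * n) * scaleSF (p + n) (2 * p) P
  let q := Q - om n B
  refine ⟨q, dt q - (Op n B (p + n) 0 q + (1 : ℝ) • (q * lapl q - ((p + n) / 2) • ∑ a, dx a q ^ 2)),
    ?_, Real.log (1 + 2 * p) / (2 * p), fun t x ht => ?_, fun t x ht => ?_⟩
  · rw [IsQSol]
    abel
  · rw [sub_ev, sub_eq_zero]
    refine isQSol_of_scaled_pressure (by ring) B rfl (dt_scaled_pressure (P := P) hp.ne' ?_ rfl)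
    rw [dt_pressure hm0 hm1 hf (heq _ _ (hτ t ht)), hκ]
    simp only [sub_ev, mul_ev, smul_ev]
    rfl
  · have hw := wt_pos hB x
    have e : 1 + q t x / wt B x ^ 2 = Q t x / wt B x ^ 2 := by
      change 1 + (Q - om n B) t x / _ = _
      rw [sub_ev, om_eq_wt_sq hB]
      field_simp
      ring
    have hρ' := hfρ ((Real.exp (2 * p * t) - 1) / (2 * p)) (Real.exp ((p + n) * t) • x)
      (hτ t ht).le
    have hpos := hf ((Real.exp (2 * p * t) - 1) / (2 * p)) (Real.exp ((p + n) * t) • x)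
    have hQ : Q t x = Real.exp (-2 * n * t) *
        f ((Real.exp (2 * p * t) - 1) / (2 * p)) (Real.exp ((p + n) * t) • x) ^ (m - 1) := by
      rw [mul_ev, expT_ev, scaleSF_ev]
      rfl
    rw [rescaled, hp', ← hρ', e, hQ]
    generalize f ((Real.exp (2 * p * t) - 1) / (2 * p)) (Real.exp ((p + n) * t) • x) = F at hpos
    refine ⟨by positivity, ?_⟩
    have hw2 : (wt B x ^ 2) ^ (-((p + n) / 2)) = wt B x ^ (-(p + n)) := by
      rw [← Real.rpow_natCast, ← Real.rpow_mul hw.le]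
      congr 1
      push_cast
      ring
    have hF : (F ^ (m - 1)) ^ (-((p + n) / 2)) = F := by
      rw [← Real.rpow_mul hpos.le, hκ, show (m - 1) * -(1 / (1 - m)) = 1 by field_simp; ring,
        Real.rpow_one]
    rw [Real.div_rpow (by positivity) (by positivity), hw2, div_mul_cancel₀ _ (by positivity),
      Real.mul_rpow (Real.exp_pos _).le (by positivity), hF, ← Real.exp_mul]
    congr 2
    ring

lemma smallMoment_of_integral_eq {p C T₀ : ℝ} (hB : 0 < B) (hp : 1 < p) {q g : SF n}
    {σ : ℝ → Eu n → ℝ} (hg : ∀ t x, |g t x| ≤ C * wt B x)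
    (hσ : ∀ t x, T₀ < t → σ t x =
      (1 + q t x / wt B x ^ 2) ^ (-((p + n) / 2)) * wt B x ^ (-(p + n)))
    (hi : ∀ t, T₀ < t → Integrable fun x => g t x * σ t x)
    (he : ∀ t, T₀ < t → ∫ x, g t x * σ t x = ∫ x, g t x * wt B x ^ (-(p + n))) :
    SmallMoment hB p q g := by
  obtain ⟨K, hK, hexp⟩ := exists_rpow_expansion (-((p + n) / 2))
  have hC : 0 ≤ C := nonneg_of_mul_nonneg_left ((abs_nonneg _).trans (hg 0 0)) (wt_pos hB _)
  have hκ : 0 < (p + n) / 2 := by positivity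
  have hbd : ∀ t, Bd B 1 g t := fun t => ⟨C, hC, fun x => by rw [Real.rpow_one]; exact hg t x⟩
  have hI : 0 ≤ ∫ x : Eu n, wt B x ^ (1 - (p + n)) :=
    integral_nonneg fun x => (wt_rpow_pos hB x _).le
  refine ⟨K * C * (∫ x : Eu n, wt B x ^ (1 - (p + n))) / ((p + n) / 2), T₀ + 1, by positivity,
    fun t ht δ hδ0 hδ1 hδ => ?_⟩
  have ht' : T₀ < t := by linarith
  have hi1 : Integrable fun x => (q * g * Wt n hB p) t x :=
    coef_integrable hB (bd_two_of_le hδ0 hδ) (hbd t) (by linarith)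
  have hi2 : Integrable fun x => g t x * wt B x ^ (-(p + n)) := by
    have := ((hbd t).mul hB (Bd.omPow hB (s := -(p + n)) (-((p + n) / 2)) (by ring))).integrable hB
      (by linarith)
    refine this.congr (ae_of_all _ fun x => ?_)
    change (g * omPow n hB _) t x = _
    rw [mul_ev, omPow_eq_wt]
    congr 2
    ring
  have hz : ∀ x, |q t x / wt B x ^ 2| ≤ δ := fun x => by
    rw [abs_div, abs_of_pos (pow_pos (wt_pos hB x) 2), div_le_iff₀ (pow_pos (wt_pos hB x) 2)]
    exact hδ x
  have key : ∀ x, (p + n) / 2 * (q * g * Wt n hB p) t x +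
      (g t x * σ t x - g t x * wt B x ^ (-(p + n))) =
        ((1 + q t x / wt B x ^ 2) ^ (-((p + n) / 2)) - 1 -
          -((p + n) / 2) * (q t x / wt B x ^ 2)) * (g t x * wt B x ^ (-(p + n))) := by
    intro x
    have hW : Wt n hB p t x = wt B x ^ (-(p + n)) / wt B x ^ 2 := by
      rw [Wt, omPow_eq_wt, show 2 * (-((p + n) / 2) - 1) = -(p + n) - (2 : ℕ) by push_cast; ring,
        Real.rpow_sub_natCast (wt_pos hB x).ne']
    rw [hσ t x ht', mul_ev, mul_ev, hW]
    ring
  have hint := integral_add (hi1.const_mul ((p + n) / 2)) ((hi t ht').sub hi2)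
  simp only [Pi.sub_apply] at hint
  rw [integral_sub (hi t ht') hi2, he t ht', sub_self, add_zero, integral_const_mul] at hint
  have hle : |∫ x, ((p + n) / 2 * (q * g * Wt n hB p) t x +
      (g t x * σ t x - g t x * wt B x ^ (-(p + n))))| ≤
        ∫ x : Eu n, K * δ ^ 2 * C * wt B x ^ (1 - (p + n)) := by
    have hi3 : Integrable fun x : Eu n => wt B x ^ (1 - (p + n)) :=
      integrable_wt_rpow hB (by linarith)
    rw [← Real.norm_eq_abs]
    refine norm_integral_le_of_norm_le (hi3.const_mul _) (ae_of_all _ fun x => ?_)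
    rw [key, Real.norm_eq_abs, abs_mul, abs_mul (g t x), abs_of_pos (wt_rpow_pos hB x _)]
    have h1 := (hexp _ ((hz x).trans hδ1)).trans
      (mul_le_mul_of_nonneg_left (sq_le_sq' (neg_le_of_abs_le (hz x)) (le_of_abs_le (hz x))) hK)
    have h2 := mul_le_mul_of_nonneg_right (hg t x) (wt_rpow_pos hB x (-(p + n))).le
    have h3 : wt B x ^ (1 - (p + n)) = wt B x * wt B x ^ (-(p + n)) := by
      rw [sub_eq_add_neg, Real.rpow_add (wt_pos hB x), Real.rpow_one]
    rw [h3]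
    refine (mul_le_mul h1 h2 (mul_nonneg (abs_nonneg _) (wt_rpow_pos hB x _).le)
      (by positivity)).trans_eq (by ring)
  rw [hint, integral_const_mul, abs_mul, abs_of_pos hκ] at hle
  rw [div_mul_eq_mul_div, le_div_iff₀ hκ, coef]
  linarith only [hle]

lemma integrable_wt_mul_initial (hρ : IsFDESol n m ρ)
    (hmom : Integrable fun y : Eu n => ‖y‖ * ρ 0 y) : Integrable fun x => wt 1 x * ρ 0 x := by
  have hpos : ∀ x, 0 < ρ 0 x := hρ.1 0 Set.self_mem_Ici
  have hc : Continuous (ρ 0) := continuous_solution hρ le_rfl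
  have hw : Continuous fun x : Eu n => wt 1 x := by
    have := continuous_space (jap n) 0
    simpa only [jap_ev] using this
  have h1 : IntegrableOn (fun x => wt 1 x * ρ 0 x) (Metric.closedBall (0 : Eu n) 1) :=
    (hw.mul hc).continuousOn.integrableOn_compact (isCompact_closedBall _ _)
  have h2 : IntegrableOn (fun x => wt 1 x * ρ 0 x) (Metric.closedBall (0 : Eu n) 1)ᶜ := by
    refine ((hmom.const_mul 2).integrableOn).mono' (hw.mul hc).aestronglyMeasurable
      ((ae_restrict_iff' Metric.isClosed_closedBall.measurableSet.compl).2
        (ae_of_all _ fun x hx => ?_))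
    rw [Set.mem_compl_iff, mem_closedBall_zero_iff, not_le] at hx
    have : wt 1 x ≤ 2 * ‖x‖ := by
      refine (sq_le_sq₀ (wt_pos one_pos x).le (by positivity)).1 ?_
      rw [wt_sq one_pos]
      nlinarith only [hx]
    rw [Real.norm_of_nonneg (mul_pos (wt_pos one_pos x) (hpos x)).le]
    exact (mul_le_mul_of_nonneg_right this (hpos x).le).trans_eq (by ring)
  have := h1.union h2
  rwa [Set.union_compl_self, integrableOn_univ] at this

lemma integral_coord_initial (hρ : IsFDESol n m ρ)
    (hmom : Integrable fun y : Eu n => ‖y‖ * ρ 0 y)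
    (hctr : ∫ y : Eu n, ρ 0 y • y = 0) (a : Fin n) : ∫ y : Eu n, y a * ρ 0 y = 0 := by
  have hi : Integrable fun y : Eu n => ρ 0 y • y := by
    refine hmom.mono ((continuous_solution hρ le_rfl).smul continuous_id).aestronglyMeasurable
      (ae_of_all _ fun x => ?_)
    rw [norm_smul, norm_mul, norm_norm, mul_comm]
  have := (EuclideanSpace.proj (𝕜 := ℝ) a).integral_comp_comm hi
  rw [hctr, map_zero] at this
  refine (integral_congr_ae (ae_of_all _ fun y => ?_)).trans this
  simp [mul_comm]

lemma integral_comp_mul_rescaled (h : Eu n → ℝ) (t : ℝ) :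
    ∫ x, h (Real.exp ((pPar n m + n) * t) • x) * rescaled m ρ t x =
      ∫ y, h y * ρ ((Real.exp (2 * pPar n m * t) - 1) / (2 * pPar n m)) y := by
  have h1 := Measure.integral_comp_smul volume
    (fun y => h y * ρ ((Real.exp (2 * pPar n m * t) - 1) / (2 * pPar n m)) y)
    (Real.exp ((pPar n m + n) * t))
  have e : Real.exp (n * (pPar n m + n) * t) = Real.exp ((pPar n m + n) * t) ^ n := by
    rw [← Real.exp_nat_mul, mul_assoc]
  have e2 : ∀ x, h (Real.exp ((pPar n m + n) * t) • x) * rescaled m ρ t x =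
      Real.exp ((pPar n m + n) * t) ^ n * (h (Real.exp ((pPar n m + n) * t) • x) *
        ρ ((Real.exp (2 * pPar n m * t) - 1) / (2 * pPar n m))
          (Real.exp ((pPar n m + n) * t) • x)) := fun x => by
    rw [rescaled, e]
    ring
  simp only [e2, integral_const_mul]
  rw [h1, finrank_euclideanSpace_fin, abs_of_pos (by positivity), smul_eq_mul,
    mul_inv_cancel_left₀ (by positivity)]

lemma integrable_comp_mul_rescaled {h : Eu n → ℝ} {t : ℝ}
    (hi : Integrable fun y => h y * ρ ((Real.exp (2 * pPar n m * t) - 1) / (2 * pPar n m)) y) :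
    Integrable fun x => h (Real.exp ((pPar n m + n) * t) • x) * rescaled m ρ t x := by
  refine ((hi.comp_smul (Real.exp_pos ((pPar n m + n) * t)).ne').const_mul
    (Real.exp (n * (pPar n m + n) * t))).congr (ae_of_all _ fun x => ?_)
  simp only [rescaled]
  ring

lemma integral_rescaled_eq {M p : ℝ} (hB : 0 < B) (hp : 0 < p)
    (hconv : ∀ ε > 0, ∃ t : ℝ, Integrable (rescaled m ρ t) ∧ ∫ x, rescaled m ρ t x = M ∧
      ∀ x, |rescaled m ρ t x - wt B x ^ (-(p + n))| ≤ ε * wt B x ^ (-(p + n))) :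
    M = ∫ x : Eu n, wt B x ^ (-(p + n)) := by
  have hu : Integrable fun x : Eu n => wt B x ^ (-(p + n)) :=
    integrable_wt_rpow hB (by linarith)
  generalize hI : ∫ x : Eu n, wt B x ^ (-(p + n)) = I
  have hI0 : 0 ≤ I := hI ▸ integral_nonneg fun x => (wt_rpow_pos hB x _).le
  refine eq_of_abs_sub_nonpos (le_of_forall_pos_le_add fun ε hε => ?_)
  obtain ⟨t, hi, hM, hb⟩ := hconv (ε / (I + 1)) (by positivity)
  have h1 := norm_integral_le_of_norm_le
    (f := fun x => rescaled m ρ t x - wt B x ^ (-(p + n)))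
    (hu.const_mul (ε / (I + 1))) (ae_of_all _ hb)
  rw [integral_sub hi hu, hM, integral_const_mul, hI] at h1
  refine h1.trans ?_
  rw [zero_add, div_mul_eq_mul_div, div_le_iff₀ (by positivity)]
  nlinarith only [hε, hI0]

lemma integral_coord_mul_wt_rpow (a : Fin n) (s : ℝ) : ∫ x : Eu n, x a * wt B x ^ s = 0 := by
  have h := integral_neg_eq_self (fun x : Eu n => x a * wt B x ^ s) volume
  have e : ∀ x : Eu n, (-x) a * wt B (-x) ^ s = -(x a * wt B x ^ s) := fun x => by
    rw [wt, norm_neg, PiLp.neg_apply, neg_mul, wt]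
  simp only [e, integral_neg] at h
  linarith

/-- Mass and center of mass in self-similar variables. -/
lemma rescaled_moments (hm0 : 0 < m) (hm1 : m < 1) (hp : 2 < pPar n m) (hB : 0 < B)
    (hρ : IsFDESol n m ρ) (hmom : Integrable fun y : Eu n => ‖y‖ * ρ 0 y)
    (hctr : ∫ y : Eu n, ρ 0 y • y = 0)
    (hconv : ∀ ε > 0, ∃ T : ℝ, ∀ t, T ≤ t → ∀ x,
      |rescaled m ρ t x - wt B x ^ (-(pPar n m + n))| ≤ ε * wt B x ^ (-(pPar n m + n)))
    {t : ℝ} (ht : 0 ≤ t) :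
    (Integrable (rescaled m ρ t) ∧
      ∫ x, rescaled m ρ t x = ∫ x : Eu n, wt B x ^ (-(pPar n m + n))) ∧
    ∀ a : Fin n, (Integrable fun x => x a * rescaled m ρ t x) ∧
      ∫ x, x a * rescaled m ρ t x = ∫ x : Eu n, x a * wt B x ^ (-(pPar n m + n)) := by
  have hτ : ∀ s : ℝ, 0 ≤ s → 0 ≤ (Real.exp (2 * pPar n m * s) - 1) / (2 * pPar n m) :=
    fun s hs => div_nonneg (by
      rw [sub_nonneg, ← Real.exp_zero]
      exact Real.exp_le_exp.2 (by positivity)) (by positivity)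
  have h0 := integrable_wt_mul_initial hρ hmom
  have hc := fun s (hs : 0 ≤ s) => conservation hm0 hm1 hp hρ h0 (hτ s hs)
  have hcont := fun s (hs : 0 ≤ s) => continuous_solution hρ (hτ s hs)
  have hdom : ∀ s, 0 ≤ s → ∀ (h : Eu n → ℝ), Continuous h → (∀ x, |h x| ≤ wt 1 x) →
      Integrable fun y => h y * ρ ((Real.exp (2 * pPar n m * s) - 1) / (2 * pPar n m)) y := by
    intro s hs h hh hb
    refine (hc s hs).1.mono' (hh.mul (hcont s hs)).aestronglyMeasurable
      (ae_of_all _ fun x => ?_)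
    have := (hρ.1 _ (hτ s hs) x).le
    rw [norm_mul, Real.norm_of_nonneg this]
    exact mul_le_mul_of_nonneg_right (hb x) this
  have hone : ∀ x : Eu n, |(1 : ℝ)| ≤ wt 1 x := fun x => by rw [abs_one]; exact one_le_wt x
  have hX : ∀ (a : Fin n) (x : Eu n), |x a| ≤ wt 1 x := fun a x =>
    (abs_coord_le x a).trans (norm_le_wt one_pos x)
  have hmass : ∀ s, 0 ≤ s → Integrable (rescaled m ρ s) ∧
      ∫ x, rescaled m ρ s x = ∫ x, ρ 0 x := by
    intro s hs
    have h1 := integrable_comp_mul_rescaled (hdom s hs (fun _ => 1) continuous_const hone)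
    have h2 := integral_comp_mul_rescaled (m := m) (ρ := ρ) (fun _ => 1) s
    have h3 := (hc s hs).2 1 (Derivation.map_one_eq_zero _)
      (by simp [lapl_eq]) (fun _ x => hone x) (fun t x => by
        simpa [euler] using (wt_pos one_pos x).le)
    simp only [one_mul, one_ev] at h1 h2 h3
    exact ⟨h1, h2.trans h3⟩
  refine ⟨⟨(hmass t ht).1, (hmass t ht).2.trans (integral_rescaled_eq (m := m) (ρ := ρ) hB
    (by linarith) fun ε hε => ?_)⟩, fun a => ?_⟩
  · obtain ⟨T, hT⟩ := hconv ε hε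
    obtain ⟨h1, h2⟩ := hmass (max T 0) (le_max_right _ _)
    exact ⟨max T 0, h1, h2, hT _ (le_max_left _ _)⟩
  · have h1 := integrable_comp_mul_rescaled
      (hdom t ht (fun x => x a) (by fun_prop) (hX a))
    have h2 := integral_comp_mul_rescaled (m := m) (ρ := ρ) (fun x => x a) t
    have hE : euler (X a : SF n) = X a := by
      simp [euler, dx_X]
    have h3 := (hc t ht).2 (X a) (dt_X a)
      (by
        rw [lapl_eq]
        refine Finset.sum_eq_zero fun b _ => ?_
        rw [dx_X]
        split_ifs <;> simp)
      (fun _ x => hX a x) (fun t x => by rw [hE]; exact hX a x)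
    simp only [X_ev] at h3
    rw [h3, integral_coord_initial hρ hmom hctr] at h2
    simp only [PiLp.smul_apply, smul_eq_mul, mul_assoc] at h1 h2
    rw [integral_const_mul] at h2
    have hR := Real.exp_pos ((pPar n m + n) * t)
    rw [integral_coord_mul_wt_rpow]
    exact ⟨(integrable_const_mul_iff (IsUnit.mk0 _ hR.ne') _).1 h1,
      (mul_eq_zero.1 h2).resolve_left hR.ne'⟩

lemma rhoB_pos (hB : 0 < B) {τ : ℝ} (hτ : 0 < 1 + 2 * pPar n m * τ)
    (y : Eu n) : 0 < rhoB n m B τ y := by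
  rw [rhoB, uB]
  positivity

lemma exp_eq_time {p t τ : ℝ} (hp : 0 < p) (hτ : τ = (Real.exp (2 * p * t) - 1) / (2 * p)) :
    1 + 2 * p * τ = Real.exp (2 * p * t) := by
  rw [hτ]
  field_simp
  ring

lemma rescaled_eq_mul (hm1 : m < 1) (hp : 0 < pPar n m) (hB : 0 < B) (t : ℝ) (x : Eu n) :
    rescaled m ρ t x =
      ρ ((Real.exp (2 * pPar n m * t) - 1) / (2 * pPar n m)) (Real.exp ((pPar n m + n) * t) • x) /
        rhoB n m B ((Real.exp (2 * pPar n m * t) - 1) / (2 * pPar n m))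
          (Real.exp ((pPar n m + n) * t) • x) * wt B x ^ (-(pPar n m + n)) := by
  rw [← rescaled_rhoB hm1 hp hB t x, rescaled, rescaled, mul_left_comm, div_mul_cancel₀]
  exact (rhoB_pos hB (by rw [exp_eq_time hp rfl]; exact Real.exp_pos _) _).ne'

lemma rescaled_tendsto (hm1 : m < 1) (hp : 0 < pPar n m) (hB : 0 < B)
    (hconv : ∀ ε > (0 : ℝ), ∀ᶠ τ in atTop, ∀ y, |ρ τ y / rhoB n m B τ y - 1| ≤ ε)
    {ε : ℝ} (hε : 0 < ε) : ∃ T : ℝ, ∀ t, T ≤ t → ∀ x,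
      |rescaled m ρ t x - wt B x ^ (-(pPar n m + n))| ≤ ε * wt B x ^ (-(pPar n m + n)) := by
  have h1 : Tendsto (fun t : ℝ => (Real.exp (2 * pPar n m * t) - 1) / (2 * pPar n m))
      atTop atTop :=
    (tendsto_atTop_add_const_right _ (-1) (Real.tendsto_exp_atTop.comp
      (tendsto_id.const_mul_atTop (by positivity)))).atTop_div_const (by positivity)
  obtain ⟨T, hT⟩ := eventually_atTop.1 (h1.eventually (hconv ε hε))
  refine ⟨T, fun t ht x => ?_⟩
  have hw := wt_rpow_pos hB x (-(pPar n m + n))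
  rw [rescaled_eq_mul hm1 hp hB, ← sub_one_mul, abs_mul, abs_of_pos hw]
  exact mul_le_mul_of_nonneg_right (hT t ht _) hw.le

lemma exists_abs_le_of_rpow {κ ε : ℝ} (hκ : 0 < κ) (hε : 0 < ε) :
    ∃ δ : ℝ, 0 < δ ∧ ∀ z, 0 < 1 + z → |(1 + z) ^ (-κ) - 1| ≤ δ → |z| ≤ ε := by
  have hc : ContinuousAt (fun r : ℝ => r ^ (-κ⁻¹)) 1 :=
    continuousAt_id.rpow_const (Or.inl one_ne_zero)
  obtain ⟨δ, hδ, h⟩ := Metric.continuousAt_iff.1 hc ε hε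
  refine ⟨δ / 2, by positivity, fun z hz hle => ?_⟩
  have := h (x := (1 + z) ^ (-κ)) (by
    rw [Real.dist_eq]
    linarith)
  rw [← Real.rpow_mul hz.le, neg_mul_neg, mul_inv_cancel₀ hκ.ne', Real.rpow_one, Real.one_rpow,
    Real.dist_eq, add_sub_cancel_left] at this
  exact this.le

/-- The asymptotic expansion of the pressure in self-similar variables. -/
lemma exists_pressure_expansion (hn : 1 ≤ n) (hm0 : 0 < m) (hm1 : m < 1) (hp : 2 < pPar n m)
    (hB : 0 < B) (hρ : IsFDESol n m ρ)
    (hconv : ∀ ε > (0 : ℝ), ∀ᶠ τ in atTop, ∀ y, |ρ τ y / rhoB n m B τ y - 1| ≤ ε)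
    (hmom : Integrable fun y : Eu n => ‖y‖ * ρ 0 y) (hctr : ∫ y : Eu n, ρ 0 y • y = 0)
    {γ Λ : ℝ} (hγ2 : 2 ≤ γ) (hγ : 2 * γ ≤ pPar n m + 2)
    (hΛγ : γ ^ 2 - (pPar n m + 2) * γ ≤ Λ) (hΛ0 : Λ < 0) (hΛ : -4 * pPar n m < Λ) :
    ∃ q : SF n, (∃ T : ℝ, ∀ t, T ≤ t → ∀ x, |q t x / wt B x ^ 2| ≤ 1 / 2 ∧
      rescaled m ρ t x =
        (1 + q t x / wt B x ^ 2) ^ (-((pPar n m + n) / 2)) * wt B x ^ (-(pPar n m + n))) ∧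
    (∃ C T : ℝ, 0 ≤ C ∧ ∀ t, T ≤ t → ∀ x,
      |q t x| ^ 2 ≤ C * Real.exp (Λ * t) * wt B x ^ 4) ∧
    ∃ (N d : ℕ) (b : Fin d → SF n) (μ : Fin d → ℝ) (A : Fin d → ℝ) (C T : ℝ),
      (∀ i, PolyLT N (b i) ∧ dt (b i) = 0 ∧ Op n B (pPar n m + n) 0 (b i) = μ i • b i) ∧
      (∀ i, ¬ (Λ < μ i ∧ μ i < 0) → A i = 0) ∧
      ∀ t, T ≤ t → ∀ x, |q t x - ∑ i, A i * Real.exp (μ i * t) * b i t x| ≤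
        C * Real.exp (Λ * t) * wt B x ^ γ := by
  have hp0 : 0 < pPar n m := by linarith
  obtain ⟨q, G, hq, T₀, hG, hσ⟩ := exists_rescaled_pressure hm0 hm1 hp0 hB hρ
  have hconv' := fun ε (hε : (0 : ℝ) < ε) => rescaled_tendsto hm1 hp0 hB hconv hε
  have hκ : 0 < (pPar n m + n) / 2 := by positivity
  have hqconv : ∀ ε > 0, ∃ T, ∀ t, T ≤ t → ∀ x, |q t x / wt B x ^ 2| ≤ ε := by
    intro ε hε
    obtain ⟨δ, hδ, hz⟩ := exists_abs_le_of_rpow hκ hε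
    obtain ⟨T, hT⟩ := hconv' δ hδ
    refine ⟨max T (T₀ + 1), fun t ht x => ?_⟩
    have ht1 := (le_max_left _ _).trans ht
    have ht2 := (le_max_right _ _).trans ht
    obtain ⟨hpos, hs⟩ := hσ t x (by linarith only [ht2])
    have hw := wt_rpow_pos hB x (-(pPar n m + n))
    have := hT t ht1 x
    rw [hs, ← sub_one_mul, abs_mul, abs_of_pos hw, mul_le_mul_iff_left₀ hw] at this
    exact hz _ hpos this
  have hmom' := fun t (ht : max T₀ 0 < t) =>
    rescaled_moments hm0 hm1 hp hB hρ hmom hctr hconv' ((le_max_right _ _).trans ht.le)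
  have hσ' := fun t x (ht : max T₀ 0 < t) => (hσ t x ((le_max_left _ _).trans_lt ht)).2
  have h1 : SmallMoment hB (pPar n m) q 1 :=
    smallMoment_of_integral_eq (C := 1 / √B) hB (by linarith) (fun t x => by
      rw [one_ev, abs_one, one_div_mul_eq_div, one_le_div (by positivity)]
      exact sqrt_le_wt x) hσ'
      (fun t ht => by simpa only [one_ev, one_mul] using (hmom' t ht).1.1)
      (fun t ht => by simpa only [one_ev, one_mul] using (hmom' t ht).1.2)
  have hX : ∀ a, SmallMoment hB (pPar n m) q (X a) := fun a =>
    smallMoment_of_integral_eq (C := 1) hB (by linarith) (fun t x => by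
      rw [one_mul]
      exact (abs_coord_le x a).trans (norm_le_wt hB x)) hσ'
      (fun t ht => ((hmom' t ht).2 a).1) (fun t ht => ((hmom' t ht).2 a).2)
  refine ⟨q, ?_, exists_expansion_of_smallMoment hn hB hp hq hG (fun ε hε => ?_) h1 hX hγ2 hγ hΛγ
    hΛ0 hΛ⟩
  · obtain ⟨T, hT⟩ := hqconv (1 / 2) (by norm_num)
    refine ⟨max T (T₀ + 1), fun t ht x => ⟨hT t ((le_max_left _ _).trans ht) x, ?_⟩⟩
    have ht2 := (le_max_right _ _).trans ht
    exact (hσ t x (by linarith only [ht2])).2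
  · obtain ⟨T, hT⟩ := hqconv ε hε
    refine ⟨T, fun t ht x => ?_⟩
    have := hT t ht x
    rwa [abs_div, abs_of_pos (pow_pos (wt_pos hB x) 2), div_le_iff₀ (pow_pos (wt_pos hB x) 2)]
      at this

/-- From the expansion of the pressure to the expansion of the relative error. -/
lemma abs_relative_error_le {B w q S κ K C₁ C₂ E γ D v : ℝ} (hB : 0 < B) (hw : √B ≤ w)
    (hκ : 0 ≤ κ) (hK : 0 ≤ K) (hC₁ : 0 ≤ C₁) (hE : 0 < E) (hγ : 2 ≤ γ)
    (hv : |v - -κ * (q / w ^ 2)| ≤ K * (q / w ^ 2) ^ 2) (hq : |q| ^ 2 ≤ C₁ * E * w ^ 4)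
    (hS : |q - S| ≤ C₂ * E * w ^ γ) (hD : E ≤ D) :
    |(w ^ 2 / B * v - -κ * S / B) / ((w / √B) ^ γ * D)| ≤
      (K * C₁ * √B ^ (2 - γ) + κ * C₂) / B * √B ^ γ := by
  have hb : 0 < √B := Real.sqrt_pos.2 hB
  have hw0 : 0 < w := hb.trans_le hw
  have hw2 : w ^ 2 ≤ √B ^ (2 - γ) * w ^ γ := by
    have := Real.rpow_le_rpow_of_nonpos hb hw (by linarith : 2 - γ ≤ 0)
    have h2 := mul_le_mul_of_nonneg_right this (Real.rpow_pos_of_pos hw0 γ).le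
    rwa [← Real.rpow_add hw0, sub_add_cancel, Real.rpow_two] at h2
  have hv2 : w ^ 2 * |v - -κ * (q / w ^ 2)| ≤ K * C₁ * √B ^ (2 - γ) * E * w ^ γ := by
    have h1 : w ^ 2 * (K * (q / w ^ 2) ^ 2) ≤ K * (C₁ * E * w ^ 2) := by
      rw [div_pow, ← sq_abs q, show w ^ 2 * (K * (|q| ^ 2 / (w ^ 2) ^ 2)) = K * (|q| ^ 2 / w ^ 2) by
        field_simp]
      refine mul_le_mul_of_nonneg_left ?_ hK
      rw [div_le_iff₀ (by positivity)]
      exact hq.trans_eq (by ring)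
    refine (mul_le_mul_of_nonneg_left hv (by positivity)).trans (h1.trans ?_)
    have := mul_le_mul_of_nonneg_left hw2 (by positivity : 0 ≤ K * (C₁ * E))
    linarith only [this]
  have hnum : |w ^ 2 / B * v - -κ * S / B| ≤
      (K * C₁ * √B ^ (2 - γ) + κ * C₂) / B * (E * w ^ γ) := by
    have e : w ^ 2 / B * v - -κ * S / B =
        (w ^ 2 * (v - -κ * (q / w ^ 2)) - κ * (q - S)) / B := by
      field_simp
      ring
    rw [e, abs_div, abs_of_pos hB, div_mul_eq_mul_div, div_le_div_iff_of_pos_right hB]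
    refine (abs_sub _ _).trans ?_
    rw [abs_mul, abs_mul, abs_of_pos (pow_pos hw0 2), abs_of_nonneg hκ]
    have := mul_le_mul_of_nonneg_left hS hκ
    linarith only [this, hv2]
  have hD0 : 0 < D := hE.trans_le hD
  have hden : 0 < (w / √B) ^ γ * D := by positivity
  rw [abs_div, abs_of_pos hden, div_le_iff₀ hden, Real.div_rpow hw0.le hb.le]
  have hpos : 0 ≤ (K * C₁ * √B ^ (2 - γ) + κ * C₂) / B * w ^ γ := by
    have h := (abs_nonneg _).trans hnum
    rw [mul_comm E, ← mul_assoc] at h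
    exact nonneg_of_mul_nonneg_left h hE
  refine hnum.trans ?_
  have h3 := mul_le_mul_of_nonneg_left hD hpos
  have hbγ : √B ^ γ ≠ 0 := (Real.rpow_pos_of_pos hb γ).ne'
  calc _ ≤ (K * C₁ * √B ^ (2 - γ) + κ * C₂) / B * w ^ γ * D := by linarith only [h3]
    _ = _ := by field_simp

lemma rhoB_quotient (hm1 : m < 1) (hp : 0 < pPar n m) (hB : 0 < B) {t τ : ℝ}
    (hτ : τ = (Real.exp (2 * pPar n m * t) - 1) / (2 * pPar n m)) (x : Eu n) :
    rhoB n m B τ 0 / rhoB n m B τ (Real.exp ((pPar n m + n) * t) • x) =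
      (wt B x / √B) ^ (pPar n m + n) := by
  have h0 := rescaled_rhoB hm1 hp hB t (0 : Eu n)
  have h1 := rescaled_rhoB hm1 hp hB t x
  have hw0 : wt B (0 : Eu n) = √B := by simp [wt]
  rw [rescaled, smul_zero, ← hτ, hw0] at h0
  rw [rescaled, ← hτ] at h1
  have hb : 0 < √B := Real.sqrt_pos.2 hB
  rw [Real.div_rpow (wt_pos hB x).le hb.le, ← mul_div_mul_left _ _ (Real.exp_pos _).ne', h0, h1,
    Real.rpow_neg hb.le, Real.rpow_neg (wt_pos hB x).le, inv_div_inv]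

end FastDiffusion

open FastDiffusion

/-- **Higher-order asymptotics in weighted norms, in the original variables.** -/
theorem statement1
    (n : ℕ) (hn : 1 ≤ n) (m : ℝ) (hm0 : 0 < m) (hm1 : m < 1)
    (hp : 2 < pPar n m)
    (Λ : ℝ) (hΛ1 : -(pPar n m / 2 + 1) ^ 2 ≤ Λ) (hΛ2 : Λ ≤ -2 * pPar n m)
    (hΛ3 : -4 * pPar n m < Λ)
    (B : ℝ) (hB : 0 < B)
    (ρ : ℝ → EuclideanSpace ℝ (Fin n) → ℝ) (hρ : IsFDESol n m ρ)
    (hconv : ∀ ε > (0 : ℝ), ∀ᶠ τ in atTop, ∀ y, |ρ τ y / rhoB n m B τ y - 1| ≤ ε)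
    (hmom : Integrable (fun y : EuclideanSpace ℝ (Fin n) => ‖y‖ * ρ 0 y))
    (hctr : ∫ y : EuclideanSpace ℝ (Fin n), ρ 0 y • y = 0) :
    ∃ u : ℕ → ℕ → MvPolynomial (Fin n) ℝ,
      (∀ ℓ k : ℕ, Λ < lamEig n (pPar n m) ℓ k → lamEig n (pPar n m) ℓ k < 0 →
        (n = 1 → ℓ ≤ 1) →
        (u ℓ k = 0 ∨ (u ℓ k).totalDegree = ℓ + 2 * k) ∧
        (∀ x, Lop n m B (fun z => evalPoly n (u ℓ k) z / (B + ‖z‖ ^ 2)) x =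
          lamEig n (pPar n m) ℓ k * (evalPoly n (u ℓ k) x / (B + ‖x‖ ^ 2)))) ∧
      ∃ C : ℝ, ∀ᶠ τ in atTop, ∀ y,
        |((rhoB n m B τ 0 / rhoB n m B τ y) ^ (2 / (pPar n m + n)) *
            (ρ τ y / rhoB n m B τ y - 1) -
          ∑ᶠ (q : ℕ × ℕ) (_ : Λ < lamEig n (pPar n m) q.1 q.2 ∧
              lamEig n (pPar n m) q.1 q.2 < 0 ∧ (n = 1 → q.1 ≤ 1)),
            evalPoly n (u q.1 q.2) ((1 + 2 * pPar n m * τ) ^ (-betaPar n m) • y) *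
              (1 + 2 * pPar n m * τ) ^ (lamEig n (pPar n m) q.1 q.2 / (2 * pPar n m)) / B) /
          ((rhoB n m B τ 0 / rhoB n m B τ y) ^
              ((pPar n m + 2 - Real.sqrt ((pPar n m + 2) ^ 2 + 4 * Λ)) /
                (2 * pPar n m + 2 * n)) *
            τ ^ (Λ / (2 * pPar n m)))| ≤ C := by
  have hp0 : 0 < pPar n m := by linarith
  have hpn : 0 < pPar n m + n := by positivity
  obtain ⟨s, hs_def⟩ : ∃ s, s = √((pPar n m + 2) ^ 2 + 4 * Λ) := ⟨_, rfl⟩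
  have hs0 : 0 ≤ s := hs_def ▸ Real.sqrt_nonneg _
  have hs2 : s ^ 2 = (pPar n m + 2) ^ 2 + 4 * Λ := by
    rw [hs_def, Real.sq_sqrt]
    nlinarith only [hΛ1]
  have hsp : s ≤ pPar n m - 2 := abs_le_of_sq_le_sq' (by linarith only [hs2, hΛ2])
    (by linarith only [hp]) |>.2
  obtain ⟨γ, hγ_def⟩ : ∃ γ, γ = (pPar n m + 2 - s) / 2 := ⟨_, rfl⟩
  have hγ2 : 2 ≤ γ := by linarith only [hγ_def, hsp]
  have hΛ0 : Λ < 0 := by linarith only [hΛ2, hp]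
  obtain ⟨κ, hκ_def⟩ : ∃ κ, κ = (pPar n m + n) / 2 := ⟨_, rfl⟩
  obtain ⟨q, ⟨T₀, hq⟩, ⟨C₁, T₁, hC₁, hq2⟩, N, d, b, μ, A, C₂, T₂, hb, hA, hS⟩ :=
    exists_pressure_expansion hn hm0 hm1 hp hB hρ hconv hmom hctr hγ2 (by linarith only [hγ_def, hs0])
      (show γ ^ 2 - (pPar n m + 2) * γ ≤ Λ from le_of_eq (by
        rw [hγ_def]
        linear_combination hs2 / 4)) hΛ0 (by linarith only [hΛ3])
  obtain ⟨K, hK, hexp⟩ := exists_rpow_expansion (-κ)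
  obtain ⟨u, hu, hsum⟩ := exists_polynomials hn (A := fun i => -κ * A i) hb fun i hi => by
    rw [hA i hi, mul_zero]
  refine ⟨u, fun ℓ k _ _ _ => ⟨(hu ℓ k).1, fun x => ?_⟩,
    (K * C₁ * √B ^ (2 - γ) + κ * C₂) / B * √B ^ γ, ?_⟩
  · obtain ⟨E, hE, hev⟩ := (hu ℓ k).2
    simp only [hev 0]
    exact Lop_div_om hm1 hB hE x
  obtain ⟨T, hT⟩ : ∃ T, T = max T₀ (max T₁ T₂) := ⟨_, rfl⟩
  filter_upwards [eventually_gt_atTop 0,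
    eventually_ge_atTop ((Real.exp (2 * pPar n m * T) - 1) / (2 * pPar n m))] with τ hτ0 hτT y
  have h1τ : 0 < 1 + 2 * pPar n m * τ := by positivity
  obtain ⟨t, ht_def⟩ : ∃ t, t = Real.log (1 + 2 * pPar n m * τ) / (2 * pPar n m) := ⟨_, rfl⟩
  have h1 : 1 + 2 * pPar n m * τ = Real.exp (2 * pPar n m * t) := by
    rw [ht_def, mul_div_cancel₀ _ (by positivity), Real.exp_log h1τ]
  have hτ : τ = (Real.exp (2 * pPar n m * t) - 1) / (2 * pPar n m) := by
    rw [← h1]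
    field_simp
    ring
  have hTt : T ≤ t := by
    rw [hτ, div_le_div_iff_of_pos_right (by positivity), sub_le_sub_iff_right, Real.exp_le_exp]
      at hτT
    exact le_of_mul_le_mul_left hτT (by positivity)
  obtain ⟨ht0, ht1, ht2⟩ : T₀ ≤ t ∧ T₁ ≤ t ∧ T₂ ≤ t := by
    rw [hT, max_le_iff, max_le_iff] at hTt
    exact hTt
  have hpow : ∀ a : ℝ, (1 + 2 * pPar n m * τ) ^ a = Real.exp (2 * pPar n m * t * a) := fun a => by
    rw [h1, ← Real.exp_mul]
  have hpow' : ∀ a : ℝ, (1 + 2 * pPar n m * τ) ^ (a / (2 * pPar n m)) = Real.exp (a * t) := by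
    intro a
    rw [hpow]
    congr 1
    field_simp
  obtain ⟨x, hx⟩ : ∃ x, x = (1 + 2 * pPar n m * τ) ^ (-betaPar n m) • y := ⟨_, rfl⟩
  have hy : y = Real.exp ((pPar n m + n) * t) • x := by
    rw [hx, hpow, smul_smul, ← Real.exp_add, betaPar]
    rw [show (pPar n m + n) * t + 2 * pPar n m * t * -((1 + n / pPar n m) / 2) = 0 by
      field_simp
      ring, Real.exp_zero, one_smul]
  rw [← hx]
  have hw := wt_pos hB x
  have hsb : 0 < √B := Real.sqrt_pos.2 hB
  have hratio : ρ τ y / rhoB n m B τ y = (1 + q t x / wt B x ^ 2) ^ (-κ) := by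
    have e := rescaled_eq_mul (ρ := ρ) hm1 hp0 hB t x
    rw [(hq t ht0 x).2, ← hτ, ← hy, ← hκ_def] at e
    exact (mul_right_cancel₀ (wt_rpow_pos hB x _).ne' e).symm
  have hquot : ∀ a : ℝ, (rhoB n m B τ 0 / rhoB n m B τ y) ^ (a / (pPar n m + n)) =
      (wt B x / √B) ^ a := fun a => by
    rw [hy, rhoB_quotient hm1 hp0 hB hτ, ← Real.rpow_mul (by positivity),
      mul_div_cancel₀ _ hpn.ne']
  have hfin := hsum (fun lam => (1 + 2 * pPar n m * τ) ^ (lam / (2 * pPar n m)) / B) t x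
  simp only [← mul_div_assoc] at hfin
  rw [hfin, hquot, ← hs_def,
    show (pPar n m + 2 - s) / (2 * pPar n m + 2 * n) = γ / (pPar n m + n) by
      rw [hγ_def, div_div, mul_add], hquot, Real.rpow_two, div_pow, Real.sq_sqrt hB.le, hratio]
  rw [show ∑ i, -κ * A i * (1 + 2 * pPar n m * τ) ^ (μ i / (2 * pPar n m)) / B * b i t x =
      -κ * (∑ i, A i * Real.exp (μ i * t) * b i t x) / B by
    rw [Finset.mul_sum, Finset.sum_div]
    refine Finset.sum_congr rfl fun i _ => ?_
    rw [hpow']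
    ring]
  refine abs_relative_error_le hB (sqrt_le_wt x) (hκ_def ▸ by positivity) hK hC₁ (Real.exp_pos (Λ * t)) hγ2
    ?_ (hq2 t ht1 x) (hS t ht2 x) ?_
  · exact hexp _ (hq t ht0 x).1
  · rw [← hpow']
    refine Real.rpow_le_rpow_of_nonpos hτ0 ?_ (div_nonpos_of_nonpos_of_nonneg hΛ0.le (by positivity))
    nlinarith only [hp, hτ0]
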